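/- Let n be an odd prime and let H be a finitely generated subgroup of SL(n,ℤ). The following are equivalent: (a) φ_p(H) = SL(n,ℤ/pℤ) for some prime p; (b) φ_p(H) = SL(n,ℤ/pℤ) for all but finitely many primes p; (c) H is infinite, non-solvable, primitive, and not an isometry group; (d) H is irreducible, not solvable-by-finite, and not an isometry group. -/

import Mathlib

open Matrix

/-- `SL n R` : the special linear group of `n × n` matrices over `R`. -/
abbrev SL (n : ℕ) (R : Type*) [CommRing R] := Matrix.SpecialLinearGroup (Fin n) R

/-- The reduction-mod-`p` homomorphism `φ_p : SL(n,ℤ) → SL(n,ℤ/pℤ)`. -/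
def redMod (n p : ℕ) : SL n ℤ →* SL n (ZMod p) :=
  Matrix.SpecialLinearGroup.map (Int.castRingHom (ZMod p))

/-- The rational matrix underlying an element of `SL(n,ℤ)`. -/
def matQ {n : ℕ} (g : SL n ℤ) : Matrix (Fin n) (Fin n) ℚ :=
  (g : Matrix (Fin n) (Fin n) ℤ).map ((↑) : ℤ → ℚ)

/-- A subgroup of `SL(n,ℤ)` is absolutely irreducible over `ℚ` if its elements generate the
full matrix algebra over `ℚ`. -/
def AbsIrredQ {n : ℕ} (H : Subgroup (SL n ℤ)) : Prop :=
  Algebra.adjoin ℚ (matQ '' (H : Set (SL n ℤ))) = ⊤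

/-- A subgroup of `SL(n, ℤ/pℤ)` is absolutely irreducible if its elements generate the
full matrix algebra over `ℤ/pℤ`. -/
def AbsIrredMod {n p : ℕ} (G : Subgroup (SL n (ZMod p))) : Prop :=
  Algebra.adjoin (ZMod p)
    ((fun g : SL n (ZMod p) => (g : Matrix (Fin n) (Fin n) (ZMod p))) '' (G : Set _)) = ⊤

/-- Irreducibility of the natural action of a subgroup of `SL(n,R)` on `R^n`. -/
def IrreducibleSub (R : Type*) [CommRing R] {n : ℕ} (G : Subgroup (SL n R)) : Prop :=
  ∀ W : Submodule R (Fin n → R),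
    (∀ g ∈ G, W.map (Matrix.toLin' (g : Matrix (Fin n) (Fin n) R)) ≤ W) → W = ⊥ ∨ W = ⊤

/-- Imprimitivity: a nontrivial direct-sum decomposition whose summands are permuted by `G`. -/
def ImprimitiveSub (R : Type*) [CommRing R] {n : ℕ} (G : Subgroup (SL n R)) : Prop :=
  ∃ m : ℕ, 2 ≤ m ∧ ∃ W : Fin m → Submodule R (Fin n → R),
    (∀ i, W i ≠ ⊥) ∧ DirectSum.IsInternal W ∧
    ∀ g ∈ G, ∀ i, ∃ j, (W i).map (Matrix.toLin' (g : Matrix (Fin n) (Fin n) R)) = W j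

/-- Primitivity: irreducible and not imprimitive. -/
def PrimitiveSub (R : Type*) [CommRing R] {n : ℕ} (G : Subgroup (SL n R)) : Prop :=
  IrreducibleSub R G ∧ ¬ ImprimitiveSub R G

/-- Monomiality: a direct sum of `n` one-dimensional subspaces permuted by `G`. -/
def MonomialSub (R : Type*) [CommRing R] {n : ℕ} (G : Subgroup (SL n R)) : Prop :=
  ∃ L : Fin n → Submodule R (Fin n → R),
    (∀ i, Module.finrank R (L i) = 1) ∧ DirectSum.IsInternal L ∧
    ∀ g ∈ G, ∀ i, ∃ j, (L i).map (Matrix.toLin' (g : Matrix (Fin n) (Fin n) R)) = L j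

/-- Irreducibility of a subgroup of `SL(n,ℤ)` acting on `ℚ^n`. -/
def IrreducibleQ {n : ℕ} (H : Subgroup (SL n ℤ)) : Prop :=
  ∀ W : Submodule ℚ (Fin n → ℚ),
    (∀ g ∈ H, W.map (Matrix.toLin' (matQ g)) ≤ W) → W = ⊥ ∨ W = ⊤

/-- Imprimitivity of a subgroup of `SL(n,ℤ)` acting on `ℚ^n`. -/
def ImprimitiveQ {n : ℕ} (H : Subgroup (SL n ℤ)) : Prop :=
  ∃ m : ℕ, 2 ≤ m ∧ ∃ W : Fin m → Submodule ℚ (Fin n → ℚ),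
    (∀ i, W i ≠ ⊥) ∧ DirectSum.IsInternal W ∧
    ∀ g ∈ H, ∀ i, ∃ j, (W i).map (Matrix.toLin' (matQ g)) = W j

/-- Primitivity of a subgroup of `SL(n,ℤ)` acting on `ℚ^n`. -/
def PrimitiveQ {n : ℕ} (H : Subgroup (SL n ℤ)) : Prop :=
  IrreducibleQ H ∧ ¬ ImprimitiveQ H

/-- A group is solvable-by-finite if it has a solvable subgroup of finite index. -/
def SolvableByFinite (G : Type*) [Group G] : Prop :=
  ∃ K : Subgroup G, IsSolvable K ∧ K.FiniteIndex

/-- A subgroup of `SL(n,ℤ)` is an isometry group if it preserves a nondegenerate bilinear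
form on `ℚ^n`. -/
def IsometryGroupQ {n : ℕ} (H : Subgroup (SL n ℤ)) : Prop :=
  ∃ Φ : Matrix (Fin n) (Fin n) ℚ, IsUnit Φ ∧ ∀ h ∈ H, matQ h * Φ * (matQ h)ᵀ = Φ

local notation "Mt(" n ")" => Matrix (Fin n) (Fin n)

section
/-- Combinatorial data of a thin chain of weights. -/
structure ChainData {ι : Type*} (A : ι → ι → ℤ) (N : ℕ) (w : ℕ → ι) (μ : ℕ → ι → ℤ) : Prop where
  step : ∀ k, k < N → ∀ i, μ (k+1) i = μ k i - A i (w (k+1))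
  T : ∀ k, k ≤ N → ∀ i, (k = 0 ∨ w k ≠ i) → ∃ m : ℕ, μ k i = m ∧ k + m ≤ N ∧
    (∀ j, k < j → j ≤ k + m → w j = i) ∧ (k + m < N → w (k+m+1) ≠ i)
  T' : ∀ k, k ≤ N → ∀ i, (k = N ∨ w (k+1) ≠ i) → ∃ m : ℕ, μ k i = -m ∧ m ≤ k ∧
    (∀ j, k < j + m → j ≤ k → w j = i) ∧ (m < k → w (k-m) ≠ i)

structure CartanLike {ι : Type*} (A : ι → ι → ℤ) : Prop where
  diag : ∀ i, A i i = 2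
  off : ∀ i j, i ≠ j → A i j ≤ 0
  symz : ∀ i j, A i j = 0 → A j i = 0
  prod : ∀ i j, i ≠ j → A i j * A j i ≤ 3

namespace ChainData
variable {ι : Type*} {A : ι → ι → ℤ} {N : ℕ} {w : ℕ → ι} {μ : ℕ → ι → ℤ}

theorem reverse (h : ChainData A N w μ) :
    ChainData A N (fun k => w (N+1-k)) (fun k i => - μ (N-k) i) := by
  refine ⟨?_, ?_, ?_⟩
  · intro k hk i
    have := h.step (N-(k+1)) (by omega) i
    rw [show N - (k+1) + 1 = N - k by omega] at this
    simp only [show N + 1 - (k+1) = N - k by omega]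
    omega
  · intro k hk i hi
    obtain ⟨m, h1, h2, h3, h4⟩ := h.T' (N-k) (by omega) i (by
      rcases hi with hi | hi
      · left; omega
      · by_cases hk0 : k = 0
        · left; omega
        · right
          rwa [show N - k + 1 = N + 1 - k by omega])
    refine ⟨m, by simp [h1], by omega, ?_, ?_⟩
    · intro j hj hj2
      exact h3 _ (by omega) (by omega)
    · intro hm
      have := h4 (by omega)
      simpa [show N + 1 - (k+m+1) = N - k - m by omega] using this
  · intro k hk i hi
    obtain ⟨m, h1, h2, h3, h4⟩ := h.T (N-k) (by omega) i (by
      rcases hi with hi | hi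
      · left; omega
      · right
        simpa [show N + 1 - (k+1) = N - k by omega] using hi)
    refine ⟨m, by simp [h1], by omega, ?_, ?_⟩
    · intro j hj hj2
      exact h3 _ (by omega) (by omega)
    · intro hm
      have := h4 (by omega)
      simpa [show N + 1 - (k-m) = N - k + m + 1 by omega] using this

theorem determ {w' : ℕ → ι} {μ' : ℕ → ι → ℤ} (h : ChainData A N w μ) (h' : ChainData A N w' μ')
    (h0 : ∀ k, 1 ≤ k → k ≤ N → μ 0 (w k) = μ' 0 (w k)) :
    ∀ k, 1 ≤ k → k ≤ N → w k = w' k := by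
  classical
  intro k
  induction k using Nat.strong_induction_on with
  | _ k ih =>
  intro hk1 hkN
  obtain ⟨k, rfl⟩ : ∃ l, k = l + 1 := ⟨k-1, by omega⟩
  set i := w (k+1) with hi
  -- weights agree
  have hmu : ∀ l, l ≤ k → μ l i = μ' l i := by
    intro l
    induction l with
    | zero => intro _; exact h0 _ hk1 hkN
    | succ l ihl =>
      intro hl
      rw [h.step l (by omega), h'.step l (by omega), ihl (by omega),
        ih (l+1) (by omega) (by omega) (by omega)]
  -- start of run
  have hex : ∃ k0, k0 ≤ k ∧ (k0 = 0 ∨ w k0 ≠ i) ∧ ∀ j, k0 < j → j ≤ k → w j = i := by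
    have : ∀ d, d ≤ k → (∃ k0, k0 ≤ k ∧ (k0 = 0 ∨ w k0 ≠ i) ∧ ∀ j, k0 < j → j ≤ k → w j = i) ∨
        (∀ j, k - d < j → j ≤ k → w j = i) := by
      intro d
      induction d with
      | zero => intro _; right; intro j h1 h2; omega
      | succ d ihd =>
        intro hd
        rcases ihd (by omega) with h1 | h1
        · left; exact h1
        · by_cases hw : w (k-d) = i
          · right
            intro j hj1 hj2
            by_cases hj : j = k - d
            · rw [hj, hw]
            · exact h1 j (by omega) hj2
          · left
            exact ⟨k-d, by omega, Or.inr hw, h1⟩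
    rcases this k le_rfl with h1 | h1
    · exact h1
    · exact ⟨0, by omega, Or.inl rfl, by simpa using h1⟩
  obtain ⟨k0, hk0, hst, hrun⟩ := hex
  obtain ⟨m, m1, m2, m3, m4⟩ := h.T k0 (by omega) i hst
  have hm : k + 1 ≤ k0 + m := by
    by_contra hcon
    have h5 := m4 (by omega)
    apply h5
    by_cases hh : k0 + m + 1 = k + 1
    · rw [hh]
    · exact hrun _ (by omega) (by omega)
  have hst' : k0 = 0 ∨ w' k0 ≠ i := by
    rcases hst with h1 | h1
    · left; exact h1
    · by_cases hh : k0 = 0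
      · left; exact hh
      · right; rwa [← ih k0 (by omega) (by omega) (by omega)]
  obtain ⟨m', m1', m2', m3', m4'⟩ := h'.T k0 (by omega) i hst'
  have : m = m' := by
    have := hmu k0 hk0
    rw [m1, m1'] at this
    exact_mod_cast this
  subst this
  exact (m3' (k+1) (by omega) hm).symm

theorem mu_fresh (h : ChainData A N w μ) {i : ι} (hN : 1 ≤ N) (k : ℕ) (hk : k ≤ N) (hk1 : 1 ≤ k)
    (hi : ∀ j, 1 ≤ j → j ≤ k → w j ≠ i) : μ 0 i = 0 ∧
    μ k i = - ∑ j ∈ Finset.range k, A i (w (j+1)) := by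
  have h0 : μ 0 i = 0 := by
    obtain ⟨m, m1, m2, m3, m4⟩ := h.T 0 (by omega) i (Or.inl rfl)
    by_cases hm : m = 0
    · rw [m1, hm]; rfl
    · exact absurd (m3 1 (by omega) (by omega)) (hi 1 le_rfl hk1)
  refine ⟨h0, ?_⟩
  have : ∀ l, l ≤ N → μ l i = - ∑ j ∈ Finset.range l, A i (w (j+1)) := by
    intro l
    induction l with
    | zero => intro _; simp [h0]
    | succ l ih =>
      intro hl
      rw [h.step l (by omega), ih (by omega), Finset.sum_range_succ]; ring
  exact this k hk

theorem mu_zero_of_next_ne (h : ChainData A N w μ) {i : ι} (k : ℕ) (hk : k < N)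
    (hi : k = 0 ∨ w k ≠ i) (hn : w (k+1) ≠ i) : μ k i = 0 := by
  obtain ⟨m, m1, m2, m3, m4⟩ := h.T k (by omega) i hi
  by_cases hm : m = 0
  · rw [m1, hm]; rfl
  · exact absurd (m3 (k+1) (by omega) (by omega)) hn

theorem next_ne_of_mu_zero (h : ChainData A N w μ) {i : ι} (k : ℕ) (hk : k < N)
    (hi : k = 0 ∨ w k ≠ i) (hn : μ k i = 0) : w (k+1) ≠ i := by
  obtain ⟨m, m1, m2, m3, m4⟩ := h.T k (by omega) i hi
  have : m = 0 := by rw [hn] at m1; exact_mod_cast m1.symm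
  subst this
  exact m4 (by omega)

structure Pre (A : ι → ι → ℤ) (N : ℕ) (w : ℕ → ι) (μ : ℕ → ι → ℤ) (r : ℕ) : Prop where
  pos : 1 ≤ r
  le : r ≤ N
  inj : ∀ j k, 1 ≤ j → j < k → k ≤ r → w j ≠ w k
  surj : ∀ k, 1 ≤ k → k ≤ N → ∃ j, 1 ≤ j ∧ j ≤ r ∧ w k = w j
  far : ∀ j k, 1 ≤ j → j + 1 < k → k ≤ r → A (w k) (w j) = 0
  near : ∀ k, 1 ≤ k → k + 1 ≤ r → A (w (k+1)) (w k) < 0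
  near1 : ∀ k, 1 ≤ k → k + 1 < r → A (w (k+1)) (w k) = -1
  near2 : ∀ k, 1 ≤ k → k + 2 ≤ r → A (w k) (w (k+1)) = -1
  fst : 2 ≤ r → μ 0 (w 1) = 1
  mu0 : ∀ k, 2 ≤ k → k ≤ r → μ 0 (w k) = 0

theorem exists_pre (h : ChainData A N w μ) (hA : CartanLike A) (hN : 1 ≤ N) :
    ∃ r, Pre A N w μ r := by
  classical
  let P : ℕ → Prop := fun r => 1 ≤ r ∧ ∀ j k, 1 ≤ j → j < k → k ≤ r → w j ≠ w k
  have hP1 : P 1 := ⟨le_rfl, fun j k _ _ _ => by omega⟩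
  let r := Nat.findGreatest P N
  have hr : P r := Nat.findGreatest_spec hN hP1
  have hrN : r ≤ N := Nat.findGreatest_le N
  have hmax : r < N → ∃ j, 1 ≤ j ∧ j ≤ r ∧ w (r+1) = w j := by
    intro hlt
    have hn : ¬ P (r+1) := Nat.findGreatest_is_greatest (Nat.lt_succ_self _) (by omega)
    by_contra hcon
    push Not at hcon
    apply hn
    refine ⟨by omega, fun j k h1 h2 h3 => ?_⟩
    by_cases hk : k = r + 1
    · subst hk
      exact (hcon j h1 (by omega)).symm
    · exact hr.2 j k h1 h2 (by omega)
  obtain ⟨hr1, hinj⟩ := hr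
  clear_value r
  -- fresh letters in the start
  have hfz : ∀ j k, 1 ≤ j → j + 1 < k → k ≤ r → μ j (w k) = 0 := by
    intro j k h1 h2 h3
    exact h.mu_zero_of_next_ne j (by omega) (Or.inr (hinj j k h1 (by omega) h3))
      (hinj (j+1) k (by omega) h2 h3)
  have hmu0 : ∀ k, 2 ≤ k → k ≤ r → μ 0 (w k) = 0 := by
    intro k h1 h2
    exact (h.mu_fresh (i := w k) hN 1 (by omega) le_rfl
      (fun j hj hj' => hinj j k hj (by omega) h2)).1
  have hfz' : ∀ j k, j + 1 < k → k ≤ r → μ j (w k) = 0 := by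
    intro j k h2 h3
    rcases Nat.eq_zero_or_pos j with rfl | hj
    · exact hmu0 k (by omega) h3
    · exact hfz j k hj h2 h3
  have hfar : ∀ j k, 1 ≤ j → j + 1 < k → k ≤ r → A (w k) (w j) = 0 := by
    intro j k h1 h2 h3
    obtain ⟨j, rfl⟩ : ∃ l, j = l + 1 := ⟨j-1, by omega⟩
    have := h.step j (by omega) (w k)
    rw [hfz' _ k h2 h3, hfz' _ k (by omega) h3] at this
    omega
  have hprev : ∀ k, 1 ≤ k → k + 1 ≤ r → μ k (w (k+1)) = - A (w (k+1)) (w k) := by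
    intro k h1 h2
    obtain ⟨j, rfl⟩ : ∃ l, k = l + 1 := ⟨k-1, by omega⟩
    have := h.step j (by omega) (w (j+1+1))
    rw [hfz' j (j+1+1) (by omega) h2] at this
    omega
  have hnear : ∀ k, 1 ≤ k → k + 1 ≤ r → A (w (k+1)) (w k) < 0 := by
    intro k h1 h2
    obtain ⟨m, m1, m2, m3, m4⟩ := h.T k (by omega) (w (k+1)) (Or.inr (hinj _ _ h1 (by omega) h2))
    have hm : m ≠ 0 := by
      rintro rfl
      exact m4 (by omega) rfl
    rw [hprev k h1 h2] at m1
    omega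
  have hone : ∀ k, k + 2 ≤ r → μ k (w (k+1)) = 1 := by
    intro k h1
    obtain ⟨m, m1, m2, m3, m4⟩ := h.T k (by omega) (w (k+1)) (by
      rcases Nat.eq_zero_or_pos k with hk | hk
      · left; exact hk
      · right; exact hinj _ _ hk (by omega) (by omega))
    have hm : m ≠ 0 := by
      rintro rfl
      exact m4 (by omega) rfl
    have hm2 : ¬ 2 ≤ m := by
      intro h2
      exact hinj (k+1) (k+2) (by omega) (by omega) h1 (m3 (k+2) (by omega) (by omega)).symm
    rw [m1]; have : m = 1 := by omega
    rw [this]; rfl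
  have hnear1 : ∀ k, 1 ≤ k → k + 1 < r → A (w (k+1)) (w k) = -1 := by
    intro k h1 h2
    have := hprev k h1 (by omega)
    rw [hone k (by omega)] at this
    omega
  refine ⟨r, hr1, hrN, hinj, ?_, hfar, hnear, hnear1, ?_, fun h2 => hone 0 (by omega), hmu0⟩
  · -- surj
    have key : ∀ k, k ≤ N → ∀ l, 1 ≤ l → l ≤ k → ∃ j, 1 ≤ j ∧ j ≤ r ∧ w l = w j := by
      intro k
      induction k with
      | zero => intro _ l h1 h2; omega
      | succ k ih =>
        intro hk l h1 h2
        by_cases hl : l ≤ k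
        · exact ih (by omega) l h1 hl
        have : l = k + 1 := by omega
        subst this
        by_cases hkr : k + 1 ≤ r
        · exact ⟨k+1, h1, hkr, rfl⟩
        by_contra hcon
        push Not at hcon
        have hfr : ∀ j, 1 ≤ j → j ≤ k → w j ≠ w (k+1) := by
          intro j hj1 hj2 he
          obtain ⟨j', a, b, c⟩ := ih (by omega) j hj1 hj2
          exact hcon j' a b (he ▸ c)
        obtain ⟨h0, hk'⟩ := h.mu_fresh hN k (by omega) (by omega) hfr
        obtain ⟨_, hrm⟩ := h.mu_fresh (i := w (k+1)) hN r hrN hr1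
          (fun j a b => (hcon j a b).symm)
        have hrz : μ r (w (k+1)) = 0 := by
          refine h.mu_zero_of_next_ne r (by omega) (Or.inr (hcon r hr1 le_rfl).symm) ?_
          obtain ⟨j, a, b, c⟩ := hmax (by omega)
          rw [c]; exact (hcon j a b).symm
        rw [hrz] at hrm
        have hAz : ∀ j, 1 ≤ j → j ≤ r → A (w (k+1)) (w j) = 0 := by
          have hs : ∑ j ∈ Finset.range r, A (w (k+1)) (w (j+1)) = 0 := by omega
          rw [Finset.sum_eq_zero_iff_of_nonpos] at hs
          · intro j a b
            have := hs (j-1) (by simp; omega)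
            rwa [show j - 1 + 1 = j by omega] at this
          · intro j hj
            refine hA.off _ _ (hcon _ (by omega) ?_)
            simp at hj; omega
        have hkz : μ k (w (k+1)) = 0 := by
          rw [hk', neg_eq_zero]
          apply Finset.sum_eq_zero
          intro j hj
          obtain ⟨j', a, b, c⟩ := ih (by omega) (j+1) (by omega) (by simp at hj; omega)
          rw [c]; exact hAz j' a b
        exact h.next_ne_of_mu_zero k (by omega) (Or.inr (hfr k (by omega) le_rfl)) hkz rfl
    intro k h1 h2
    exact key k h2 k h1 le_rfl
  · intro k h1 h2
    have e1 : μ (k+1) (w k) = 0 := by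
      refine h.mu_zero_of_next_ne (k+1) (by omega) (Or.inr ?_) ?_
      · exact (hinj k (k+1) h1 (by omega) (by omega)).symm
      · exact (hinj k (k+2) h1 (by omega) (by omega)).symm
    obtain ⟨j, rfl⟩ : ∃ l, k = l + 1 := ⟨k-1, by omega⟩
    have e2 := h.step j (by omega) (w (j+1))
    have e3 := h.step (j+1) (by omega) (w (j+1))
    rw [hone j (by omega), hA.diag] at e2
    rw [e1] at e3
    omega

theorem Pre.card_eq {w' : ℕ → ι} {μ' : ℕ → ι → ℤ} {r r' : ℕ} (p : Pre A N w μ r)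
    (p' : Pre A N w' μ' r') (hs : ∀ k, 1 ≤ k → k ≤ N → ∃ l, 1 ≤ l ∧ l ≤ N ∧ w k = w' l) :
    r ≤ r' := by
  classical
  have h1 : ((Finset.Icc 1 r).image w).card = r := by
    rw [Finset.card_image_of_injOn]
    · simp
    · intro a ha b hb hab
      simp at ha hb
      rcases lt_trichotomy a b with h | h | h
      · exact absurd hab (p.inj a b ha.1 h hb.2)
      · exact h
      · exact absurd hab.symm (p.inj b a hb.1 h ha.2)
  have h2 : ((Finset.Icc 1 r).image w) ⊆ ((Finset.Icc 1 r').image w') := by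
    intro x hx
    simp only [Finset.mem_image, Finset.mem_Icc] at hx ⊢
    obtain ⟨a, ha, rfl⟩ := hx
    obtain ⟨l, l1, l2, l3⟩ := hs a ha.1 (ha.2.trans p.le)
    obtain ⟨j, j1, j2, j3⟩ := p'.surj l l1 l2
    exact ⟨j, ⟨j1, j2⟩, by rw [l3, j3]⟩
  calc r = _ := h1.symm
    _ ≤ _ := Finset.card_le_card h2
    _ ≤ _ := Finset.card_image_le
    _ = r' := by simp

/-- a walk with steps `±1` which never repeats stays in one direction -/
theorem path_aux {r : ℕ} (hr : 2 ≤ r) (s : ℕ → ℕ) (hs : ∀ k, 1 ≤ k → k ≤ r → 1 ≤ s k ∧ s k ≤ r)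
    (hinj : ∀ j k, 1 ≤ j → j < k → k ≤ r → s j ≠ s k)
    (hstep : ∀ k, 1 ≤ k → k + 1 ≤ r → s (k+1) = s k + 1 ∨ s k = s (k+1) + 1) :
    (∀ k, 1 ≤ k → k ≤ r → s k = k) ∨ (∀ k, 1 ≤ k → k ≤ r → s k = r + 1 - k) := by
  rcases hstep 1 le_rfl hr with h | h
  · left
    have key : ∀ k, 1 ≤ k → k + 1 ≤ r → s (k+1) = s k + 1 := by
      intro k hk
      induction k, hk using Nat.le_induction with
      | base => intro _; exact h
      | succ k hk ih =>
        intro h2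
        rcases hstep (k+1) (by omega) h2 with h3 | h3
        · exact h3
        · exact absurd (by have := ih (by omega); omega) (hinj k (k+1+1) hk (by omega) h2)
    have key2 : ∀ k, 1 ≤ k → k ≤ r → s k + 1 = s 1 + k := by
      intro k hk
      induction k, hk using Nat.le_induction with
      | base => intro _; rfl
      | succ k hk ih =>
        intro h2
        have := key k hk h2
        have := ih (by omega)
        omega
    intro k h1 h2
    have := key2 r (by omega) le_rfl
    have := hs r (by omega) le_rfl
    have := hs 1 (by omega) (by omega)
    have := key2 k h1 h2
    omega
  · right
    have key : ∀ k, 1 ≤ k → k + 1 ≤ r → s k = s (k+1) + 1 := by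
      intro k hk
      induction k, hk using Nat.le_induction with
      | base => intro _; exact h
      | succ k hk ih =>
        intro h2
        rcases hstep (k+1) (by omega) h2 with h3 | h3
        · exact absurd (by have := ih (by omega); omega) (hinj k (k+1+1) hk (by omega) h2)
        · exact h3
    have key2 : ∀ k, 1 ≤ k → k ≤ r → s k + k = s 1 + 1 := by
      intro k hk
      induction k, hk using Nat.le_induction with
      | base => intro _; rfl
      | succ k hk ih =>
        intro h2
        have := key k hk h2
        have := ih (by omega)
        omega
    intro k h1 h2
    have := key2 r (by omega) le_rfl
    have := hs r (by omega) le_rfl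
    have := hs 1 (by omega) (by omega)
    have := key2 k h1 h2
    omega

theorem pal_or_inj (h : ChainData A N w μ) (hA : CartanLike A) (hN : (N+1).Prime) (hN2 : 2 ≤ N) :
    (∀ k, 1 ≤ k → k ≤ N → w k = w (N+1-k)) ∨ (∀ j k, 1 ≤ j → j < k → k ≤ N → w j ≠ w k) := by
  obtain ⟨r, p⟩ := h.exists_pre hA (by omega)
  obtain ⟨r', p'⟩ := h.reverse.exists_pre hA (by omega)
  obtain rfl : r = r' := by
    apply le_antisymm
    · refine p.card_eq p' (fun k h1 h2 => ⟨N+1-k, by omega, by omega, ?_⟩)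
      simp [show N + 1 - (N + 1 - k) = k by omega]
    · exact p'.card_eq p (fun k h1 h2 => ⟨N+1-k, by omega, by omega, rfl⟩)
  by_cases hr1 : r = 1
  · left
    subst hr1
    have : ∀ k, 1 ≤ k → k ≤ N → w k = w 1 := by
      intro k h1 h2
      obtain ⟨j, a, b, c⟩ := p.surj k h1 h2
      rw [c]; congr 1; omega
    intro k h1 h2
    rw [this k h1 h2, this (N+1-k) (by omega) (by omega)]
  have hr : 2 ≤ r := by have := p.pos; omega
  have hex : ∀ k, ∃ s, 1 ≤ k → k ≤ r → 1 ≤ s ∧ s ≤ r ∧ w (N+1-k) = w s := by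
    intro k
    by_cases hk : 1 ≤ k ∧ k ≤ r
    · have := p.le
      obtain ⟨j, a, b, c⟩ := p.surj (N+1-k) (by omega) (by omega)
      exact ⟨j, fun _ _ => ⟨a, b, c⟩⟩
    · exact ⟨0, fun h1 h2 => absurd ⟨h1, h2⟩ hk⟩
  choose s hs using hex
  have hsinj : ∀ j k, 1 ≤ j → j < k → k ≤ r → s j ≠ s k := by
    intro j k h1 h2 h3 he
    apply p'.inj j k h1 h2 h3
    show w (N+1-j) = w (N+1-k)
    rw [(hs j h1 (by omega)).2.2, (hs k (by omega) h3).2.2, he]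
  have hstep : ∀ k, 1 ≤ k → k + 1 ≤ r → s (k+1) = s k + 1 ∨ s k = s (k+1) + 1 := by
    intro k h1 h2
    have hn := p'.near k h1 h2
    change A (w (N+1-(k+1))) (w (N+1-k)) < 0 at hn
    obtain ⟨a1, a2, a3⟩ := hs k h1 (by omega)
    obtain ⟨b1, b2, b3⟩ := hs (k+1) (by omega) h2
    rw [a3, b3] at hn
    have hne := hsinj k (k+1) h1 (by omega) h2
    by_contra hcon
    rcases lt_or_gt_of_ne hne with hlt | hlt
    · have := p.far (s k) (s (k+1)) a1 (by omega) b2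
      omega
    · have := hA.symz _ _ (p.far (s (k+1)) (s k) b1 (by omega) a2)
      omega
  rcases path_aux hr s (fun k h1 h2 => ⟨(hs k h1 h2).1, (hs k h1 h2).2.1⟩) hsinj hstep with hp | hp
  · left
    refine h.determ h.reverse ?_
    have key : ∀ k, 1 ≤ k → k ≤ r → w (N+1-k) = w k := by
      intro k h1 h2
      rw [(hs k h1 h2).2.2, hp k h1 h2]
    intro k h1 h2
    obtain ⟨j, a, b, c⟩ := p.surj k h1 h2
    rw [c]
    by_cases hj : j = 1
    · subst hj
      rw [p.fst hr]
      have := p'.fst hr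
      rw [← this]
      show - μ _ (w (N+1-1)) = _
      rw [key 1 le_rfl (by omega)]
    · rw [p.mu0 j (by omega) b]
      have := p'.mu0 j (by omega) b
      rw [← this]
      show - μ _ (w (N+1-j)) = _
      rw [key j a b]
  · have key : ∀ k, 1 ≤ k → k ≤ r → w (N+1-k) = w (r+1-k) := by
      intro k h1 h2
      rw [(hs k h1 h2).2.2, hp k h1 h2]
    by_cases hNr : N = r
    · right
      subst hNr
      exact p.inj
    have hlt : r < N := by have := p.le; omega
    exfalso
    -- the last run
    by_cases hr3 : 3 ≤ r
    · have hbond : ∀ j, 1 ≤ j → j + 1 ≤ r → A (w j) (w (j+1)) = -1 ∧ A (w (j+1)) (w j) = -1 := by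
        intro j h1 h2
        by_cases hj : j + 2 ≤ r
        · exact ⟨p.near2 j h1 hj, p.near1 j h1 (by omega)⟩
        · have q1 := p'.near1 1 le_rfl (by omega)
          have q2 := p'.near2 1 le_rfl (by omega)
          change A (w (N+1-(1+1))) (w (N+1-1)) = -1 at q1
          change A (w (N+1-1)) (w (N+1-(1+1))) = -1 at q2
          rw [key 1 le_rfl (by omega), key (1+1) (by omega) (by omega)] at q1 q2
          have e1 : r + 1 - 1 = j + 1 := by omega
          have e2 : r + 1 - (1+1) = j := by omega
          rw [e1, e2] at q1 q2
          exact ⟨q1, q2⟩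
      -- compute μ
      have hmu : ∀ j, 1 ≤ j → j ≤ r → ∀ k, k ≤ r → μ k (w j) =
          if k + 1 = j then 1 else if k = j then -1 else 0 := by
        intro j hj1 hj2 k
        induction k with
        | zero =>
          intro _
          by_cases hj : j = 1
          · subst hj; simp [p.fst hr]
          · rw [p.mu0 j (by omega) hj2]; rw [if_neg (by omega), if_neg (by omega)]
        | succ k ih =>
          intro hk
          rw [h.step k (by omega), ih (by omega)]
          rcases lt_trichotomy (k+1) j with hc | hc | hc
          · by_cases hc2 : k + 2 = j
            · subst hc2
              rw [(hbond (k+1) (by omega) (by omega)).2]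
              simp
            · rw [p.far (k+1) j (by omega) (by omega) hj2]
              rw [if_neg (by omega), if_neg (by omega), if_neg (by omega), if_neg (by omega)]
              rfl
          · subst hc
            rw [hA.diag]; simp
          · by_cases hc2 : k = j
            · subst hc2
              rw [(hbond k (by omega) (by omega)).1]
              rw [if_neg (by omega), if_pos rfl, if_neg (by omega), if_neg (by omega)]
              rfl
            · rw [hA.symz _ _ (p.far j (k+1) hj1 (by omega) hk)]
              rw [if_neg (by omega), if_neg (by omega), if_neg (by omega), if_neg (by omega)]
              rfl
      obtain ⟨j, a, b, c⟩ := p.surj (r+1) (by omega) (by omega)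
      by_cases hj : j = r
      · subst hj
        obtain ⟨m, m1, m2, m3, m4⟩ := h.T (j-1) (by omega) (w j)
          (Or.inr (p.inj _ _ (by omega) (by omega) le_rfl))
        rw [hmu j a b (j-1) (by omega), if_pos (by omega)] at m1
        have : m = 1 := by exact_mod_cast m1.symm
        subst this
        have := m4 (by omega)
        rw [show j - 1 + 1 + 1 = j + 1 by omega] at this
        exact this c
      · refine h.next_ne_of_mu_zero r hlt (Or.inr (p.inj j r a (by omega) le_rfl).symm) ?_ c
        rw [hmu j a b r le_rfl, if_neg (by omega), if_neg (by omega)]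
    · obtain rfl : r = 2 := by omega
      have hA12 : A (w 2) (w 1) < 0 := p.near 1 le_rfl le_rfl
      have hne : w 1 ≠ w 2 := p.inj 1 2 le_rfl (by omega) le_rfl
      have hA21 : A (w 1) (w 2) < 0 := by
        rcases lt_or_eq_of_le (hA.off _ _ hne) with h1 | h1
        · exact h1
        · have := hA.symz _ _ h1; omega
      have hprod := hA.prod _ _ hne
      have hmuN1 : μ N (w 1) = 0 := by
        have := p'.mu0 2 le_rfl le_rfl
        change - μ (N-0) (w (N+1-2)) = 0 at this
        rw [key 2 (by omega) le_rfl] at this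
        simpa using this
      have hmuN2 : μ N (w 2) = -1 := by
        have := p'.fst hr
        change - μ (N-0) (w (N+1-1)) = 1 at this
        rw [key 1 (by omega) (by omega)] at this
        simp at this
        omega
      have hmu01 : μ 0 (w 1) = 1 := p.fst hr
      have hmu02 : μ 0 (w 2) = 0 := p.mu0 2 le_rfl le_rfl
      have hcnt : ∀ k, k ≤ N → ∃ n1 n2 : ℕ, n1 + n2 = k ∧
          μ k (w 1) = 1 - 2 * n1 - n2 * A (w 1) (w 2) ∧
          μ k (w 2) = - n1 * A (w 2) (w 1) - 2 * n2 := by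
        intro k
        induction k with
        | zero => intro _; exact ⟨0, 0, rfl, by simp [hmu01], by simp [hmu02]⟩
        | succ k ih =>
          intro hk
          obtain ⟨n1, n2, e1, e2, e3⟩ := ih (by omega)
          obtain ⟨j, a, b, c⟩ := p.surj (k+1) (by omega) hk
          have : j = 1 ∨ j = 2 := by omega
          rcases this with rfl | rfl
          · refine ⟨n1+1, n2, by omega, ?_, ?_⟩
            · rw [h.step k (by omega), c, e2, hA.diag]; push_cast; ring
            · rw [h.step k (by omega), c, e3]; push_cast; ring
          · refine ⟨n1, n2+1, by omega, ?_, ?_⟩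
            · rw [h.step k (by omega), c, e2]; push_cast; ring
            · rw [h.step k (by omega), c, e3, hA.diag]; push_cast; ring
      obtain ⟨n1, n2, e1, e2, e3⟩ := hcnt N le_rfl
      rw [hmuN1] at e2
      rw [hmuN2] at e3
      generalize A (w 1) (w 2) = a at *
      generalize A (w 2) (w 1) = b at *
      have ha : -3 ≤ a := by nlinarith
      have hb : -3 ≤ b := by nlinarith
      have hN9 : N ≠ 8 := by
        rintro rfl; revert hN; decide
      interval_cases a <;> interval_cases b <;> omega

end ChainData

end

section
/-- Combinatorial root data in fundamental-weight coordinates. -/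
structure WData (ι : Type*) [Fintype ι] where
  Pos : Finset (ι → ℤ)
  co : (ι → ℤ) → (ι → ℤ) →+ ℤ
  a : ι → ι → ℤ
  B : (ι → ℤ) →+ (ι → ℤ) →+ ℚ
  cc : (ι → ℤ) → ℚ
  ha : ∀ i, a i ∈ Pos
  aii : ∀ i, a i i = 2
  nz : (0 : ι → ℤ) ∉ Pos
  coa : ∀ i μ, co (a i) μ = μ i
  refl_mem : ∀ β ∈ Pos, ∀ i, β ≠ a i → β - β i • a i ∈ Pos
  refl_co : ∀ β ∈ Pos, ∀ i, β ≠ a i → ∀ μ, co (β - β i • a i) μ = co β (μ - μ i • a i)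
  pos : ∀ β ∈ Pos, ∃ n : ι → ℕ, β = ∑ j, n j • a j
  Bsymm : ∀ μ ν, B μ ν = B ν μ
  Bco : ∀ β ∈ Pos, ∀ μ, B μ β = cc β * co β μ
  ccpos : ∀ β ∈ Pos, 0 < cc β
  Bpos : ∀ μ, μ ≠ 0 → 0 < B μ μ

namespace WData
variable {ι : Type*} [Fintype ι] (W : WData ι)

/-- simple reflections -/
def s (i : ι) (μ : ι → ℤ) : ι → ℤ := μ - μ i • W.a i

theorem s_s (i : ι) (μ : ι → ℤ) : W.s i (W.s i μ) = μ := by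
  ext j; simp [s, W.aii]; ring

theorem s_apply_self (i : ι) (μ : ι → ℤ) : W.s i μ i = - μ i := by
  simp [s, W.aii]; ring

theorem s_add (i : ι) (μ ν : ι → ℤ) : W.s i (μ + ν) = W.s i μ + W.s i ν := by
  ext j; simp [s]; ring

theorem s_neg (i : ι) (μ : ι → ℤ) : W.s i (-μ) = - W.s i μ := by
  ext j; simp [s]; ring

theorem s_a (i : ι) : W.s i (W.a i) = - W.a i := by
  ext j; simp [s, W.aii]; ring

/-- `W.s i` as an additive homomorphism -/
def sHom (i : ι) : (ι → ℤ) →+ (ι → ℤ) where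
  toFun := W.s i
  map_zero' := by ext; simp [s]
  map_add' := W.s_add i

theorem Ba (i : ι) (μ : ι → ℤ) : W.B μ (W.a i) = W.cc (W.a i) * μ i := by
  rw [W.Bco _ (W.ha i), W.coa]

theorem B_s (i : ι) (μ ν : ι → ℤ) : W.B (W.s i μ) (W.s i ν) = W.B μ ν := by
  simp only [s, map_sub, map_zsmul, AddMonoidHom.sub_apply, AddMonoidHom.smul_apply]
  rw [W.Ba, W.Ba, W.Bsymm (W.a i) ν, W.Ba, W.aii]
  simp; ring

/-- Nonnegative cone of roots -/
def Qp (γ : ι → ℤ) : Prop := ∃ n : ι → ℕ, γ = ∑ j, n j • W.a j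

theorem Qp_zero : W.Qp 0 := ⟨0, by simp⟩
theorem Qp_add {γ δ : ι → ℤ} (h : W.Qp γ) (h' : W.Qp δ) : W.Qp (γ + δ) := by
  obtain ⟨n, rfl⟩ := h
  obtain ⟨m, rfl⟩ := h'
  exact ⟨n + m, by simp [add_smul, Finset.sum_add_distrib]⟩

theorem B_nonneg {γ ν : ι → ℤ} (h : W.Qp γ) (hν : ∀ i, 0 ≤ ν i) : 0 ≤ W.B ν γ := by
  obtain ⟨n, rfl⟩ := h
  simp only [map_sum, map_nsmul, W.Ba]
  refine Finset.sum_nonneg fun j _ => ?_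
  have := W.ccpos _ (W.ha j)
  have := hν j
  positivity

theorem B_posi {γ ν : ι → ℤ} (h : W.Qp γ) (hν : ∀ i, 0 < ν i) (h0 : γ ≠ 0) : 0 < W.B ν γ := by
  obtain ⟨n, rfl⟩ := h
  simp only [map_sum, map_nsmul, W.Ba]
  have h1 : ∀ j, 0 < W.cc (W.a j) * (ν j : ℚ) := fun j =>
    mul_pos (W.ccpos _ (W.ha j)) (by exact_mod_cast hν j)
  obtain ⟨j, hj⟩ : ∃ j, n j ≠ 0 := by
    by_contra hcon
    push Not at hcon
    exact h0 (by simp [hcon])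
  refine Finset.sum_pos' (fun j _ => nsmul_nonneg (h1 j).le _) ⟨j, Finset.mem_univ _, ?_⟩
  exact nsmul_pos (h1 j) hj

/-- the vector ρ -/
def ρ : ι → ℤ := fun _ => 1

theorem Bρ_pos {β : ι → ℤ} (hβ : β ∈ W.Pos) : 0 < W.B ρ β :=
  W.B_posi (W.pos β hβ) (fun _ => by simp [ρ]) (fun h => W.nz (h ▸ hβ))

theorem neg_not_mem {β : ι → ℤ} (hβ : β ∈ W.Pos) : -β ∉ W.Pos := by
  intro h
  have h1 := W.Bρ_pos hβ
  have h2 := W.Bρ_pos h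
  simp at h2
  linarith

theorem co_pos {β ν : ι → ℤ} (hβ : β ∈ W.Pos) (hν : ∀ i, 0 < ν i) : 0 < W.co β ν := by
  have h1 := W.B_posi (W.pos β hβ) hν (fun h => W.nz (h ▸ hβ))
  rw [W.Bco β hβ] at h1
  have := (pos_iff_pos_of_mul_pos h1).1 (W.ccpos β hβ)
  exact_mod_cast this

theorem s_mem {β : ι → ℤ} (hβ : β ∈ W.Pos) {i : ι} (h : β ≠ W.a i) :
    W.s i β ∈ W.Pos ∧ W.s i β ≠ W.a i := by
  refine ⟨W.refl_mem β hβ i h, fun h' => ?_⟩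
  have := W.s_s i β
  rw [h', W.s_a] at this
  exact W.neg_not_mem (W.ha i) (this ▸ hβ)

theorem s_injective (i : ι) : Function.Injective (W.s i) := fun x y h => by
  rw [← W.s_s i x, h, W.s_s]

theorem prod_erase_s {M : Type*} [CommMonoid M] [DecidableEq ι] (i : ι) (f : (ι → ℤ) → M) :
    ∏ β ∈ W.Pos.erase (W.a i), f (W.s i β) = ∏ β ∈ W.Pos.erase (W.a i), f β := by
  refine Finset.prod_nbij' (W.s i) (W.s i) ?_ ?_ ?_ ?_ ?_
  · intro β hβ
    simp only [Finset.mem_erase] at hβ ⊢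
    exact (W.s_mem hβ.2 hβ.1).symm
  · intro β hβ
    simp only [Finset.mem_erase] at hβ ⊢
    exact (W.s_mem hβ.2 hβ.1).symm
  · intro β _; exact W.s_s i β
  · intro β _; exact W.s_s i β
  · intro β _; rfl

theorem sum_erase_s {M : Type*} [AddCommMonoid M] [DecidableEq ι] (i : ι) (f : (ι → ℤ) → M) :
    ∑ β ∈ W.Pos.erase (W.a i), f (W.s i β) = ∑ β ∈ W.Pos.erase (W.a i), f β := by
  exact W.prod_erase_s (M := Multiplicative M) i f

theorem sum_pos : ∑ β ∈ W.Pos, β = 2 • ρ := by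
  classical
  ext i
  have h1 : W.s i (∑ β ∈ W.Pos, β) = (∑ β ∈ W.Pos, β) - 2 • W.a i := by
    rw [← Finset.add_sum_erase _ _ (W.ha i)]
    change W.sHom i (W.a i + _) = _
    rw [map_add, map_sum]
    change W.s i (W.a i) + ∑ x ∈ W.Pos.erase (W.a i), W.s i x = _
    rw [W.s_a, W.sum_erase_s i (fun β => β)]
    abel
  have h2 := congrFun h1 i
  rw [W.s_apply_self] at h2
  simp only [Pi.sub_apply, Pi.smul_apply, W.aii] at h2
  simp only [Pi.smul_apply, ρ]
  simp at h2 ⊢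
  omega

/-- product of coroots -/
def π (ν : ι → ℤ) : ℤ := ∏ β ∈ W.Pos, W.co β ν

theorem π_s (i : ι) (ν : ι → ℤ) : W.π (W.s i ν) = - W.π ν := by
  classical
  unfold π
  rw [← Finset.mul_prod_erase _ _ (W.ha i), ← Finset.mul_prod_erase _ _ (W.ha i), W.coa, W.coa,
    W.s_apply_self]
  rw [← W.prod_erase_s i (fun β => W.co β ν), neg_mul]
  congr 2
  refine Finset.prod_congr rfl fun β hβ => ?_
  simp only [Finset.mem_erase] at hβ
  exact (W.refl_co β hβ.2 i hβ.1 ν).symm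

theorem conj_induction (S : Finset (ι → ℤ)) (hS : ∀ ν ∈ S, ∀ i, W.s i ν ∈ S)
    (Q : (ι → ℤ) → Prop) (hQ : ∀ i, ∀ ν ∈ S, Q (W.s i ν) → Q ν)
    (hd : ∀ ν ∈ S, (∀ i, 0 ≤ ν i) → Q ν) : ∀ ν ∈ S, Q ν := by
  classical
  by_contra hcon
  push Not at hcon
  obtain ⟨ν, hν, hQν⟩ := hcon
  obtain ⟨κ, hκ, hmax⟩ := Finset.exists_max_image (S.filter fun ν => ¬ Q ν) (fun ν => W.B ρ ν)
    ⟨ν, by simp [hν, hQν]⟩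
  simp only [Finset.mem_filter] at hκ hmax
  have : ∃ i, κ i < 0 := by
    by_contra h
    push Not at h
    exact hκ.2 (hd κ hκ.1 h)
  obtain ⟨i, hi⟩ := this
  have h1 : ¬ Q (W.s i κ) := fun h => hκ.2 (hQ i κ hκ.1 h)
  have h2 := hmax _ ⟨hS κ hκ.1 i, h1⟩
  simp only [s, map_sub, map_zsmul, W.Ba] at h2
  have h3 := W.ccpos _ (W.ha i)
  have h4 : (κ i : ℚ) < 0 := by exact_mod_cast hi
  simp [ρ] at h2
  nlinarith

/-- the Weyl group as permutations -/
def sPerm (i : ι) : Equiv.Perm (ι → ℤ) := ⟨W.s i, W.s i, W.s_s i, W.s_s i⟩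

def Wgp : Subgroup (Equiv.Perm (ι → ℤ)) := Subgroup.closure (Set.range W.sPerm)

theorem Wgp_co {w : Equiv.Perm (ι → ℤ)} (hw : w ∈ W.Wgp) : ∀ β ∈ W.Pos, ∃ β' ∈ W.Pos,
    (∀ ν, W.co β (w ν) = W.co β' ν) ∨ (∀ ν, W.co β (w ν) = - W.co β' ν) := by
  classical
  have hs : ∀ i, ∀ β ∈ W.Pos, ∃ β' ∈ W.Pos,
    (∀ ν, W.co β (W.s i ν) = W.co β' ν) ∨ (∀ ν, W.co β (W.s i ν) = - W.co β' ν) := by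
    intro i β hβ
    by_cases h : β = W.a i
    · exact ⟨β, hβ, Or.inr fun ν => by rw [h, W.coa, W.coa, W.s_apply_self]⟩
    · exact ⟨W.s i β, (W.s_mem hβ h).1, Or.inl fun ν => (W.refl_co β hβ i h ν).symm⟩
  have hmul : ∀ x y : Equiv.Perm (ι → ℤ), (∀ β ∈ W.Pos, ∃ β' ∈ W.Pos,
    (∀ ν, W.co β (x ν) = W.co β' ν) ∨ (∀ ν, W.co β (x ν) = - W.co β' ν)) → (∀ β ∈ W.Pos, ∃ β' ∈ W.Pos,
    (∀ ν, W.co β (y ν) = W.co β' ν) ∨ (∀ ν, W.co β (y ν) = - W.co β' ν)) →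
    (∀ β ∈ W.Pos, ∃ β' ∈ W.Pos,
    (∀ ν, W.co β ((x * y) ν) = W.co β' ν) ∨ (∀ ν, W.co β ((x * y) ν) = - W.co β' ν)) := by
    intro x y hx hy β hβ
    obtain ⟨β', hβ', h1⟩ := hx β hβ
    obtain ⟨β'', hβ'', h2⟩ := hy β' hβ'
    refine ⟨β'', hβ'', ?_⟩
    rcases h1 with h1 | h1 <;> rcases h2 with h2 | h2
    · left; intro ν; rw [Equiv.Perm.mul_apply, h1, h2]
    · right; intro ν; rw [Equiv.Perm.mul_apply, h1, h2]
    · right; intro ν; rw [Equiv.Perm.mul_apply, h1, h2]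
    · left; intro ν; rw [Equiv.Perm.mul_apply, h1, h2, neg_neg]
  induction hw using Subgroup.closure_induction_left with
  | one => intro β hβ; exact ⟨β, hβ, Or.inl fun ν => rfl⟩
  | mul_left x hx y hy ih =>
    obtain ⟨i, rfl⟩ := hx
    exact hmul _ _ (hs i) ih
  | inv_mul_cancel x hx y hy ih =>
    obtain ⟨i, rfl⟩ := hx
    exact hmul _ _ (hs i) ih

/-- consequences of being alternating with unique dominant support element -/
structure AltSupp (S : Finset (ι → ℤ)) (κ : ι → ℤ) : Prop where
  stable : ∀ ν ∈ S, ∀ i, W.s i ν ∈ S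
  mem : κ ∈ S
  reg : ∀ i, 0 < κ i
  dom : ∀ ν ∈ S, (∀ i, 0 ≤ ν i) → ν = κ

variable {W}

theorem AltSupp.orbit {S : Finset (ι → ℤ)} {κ : ι → ℤ} (h : W.AltSupp S κ) :
    MulAction.orbit W.Wgp κ = (S : Set (ι → ℤ)) := by
  ext ν
  constructor
  · rintro ⟨⟨w, hw⟩, rfl⟩
    change w κ ∈ S
    unfold Wgp at hw
    induction hw using Subgroup.closure_induction_left with
    | one => exact h.mem
    | mul_left x hx y hy ih =>
      obtain ⟨i, rfl⟩ := hx
      exact h.stable _ ih i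
    | inv_mul_cancel x hx y hy ih =>
      obtain ⟨i, rfl⟩ := hx
      exact h.stable _ ih i
  · intro hν
    refine W.conj_induction S h.stable (fun ν => ν ∈ MulAction.orbit W.Wgp κ) ?_ ?_ ν hν
    · rintro i ν hν ⟨⟨w, hw⟩, hwe⟩
      change w κ = W.s i ν at hwe
      refine ⟨⟨W.sPerm i * w, W.Wgp.mul_mem (Subgroup.subset_closure ⟨i, rfl⟩) hw⟩, ?_⟩
      change W.s i (w κ) = ν
      rw [hwe, W.s_s]
    · intro ν hν hd
      rw [h.dom ν hν hd]
      exact MulAction.mem_orbit_self κ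

theorem AltSupp.stab_le {S T : Finset (ι → ℤ)} {κ τ : ι → ℤ} (h : W.AltSupp S κ)
    (h' : W.AltSupp T τ) : MulAction.stabilizer W.Wgp κ ≤ MulAction.stabilizer W.Wgp τ := by
  rintro ⟨w, hw⟩ hst
  rw [MulAction.mem_stabilizer_iff] at hst ⊢
  change w κ = κ at hst
  change w τ = τ
  refine h'.dom _ ?_ ?_
  · have : w τ ∈ MulAction.orbit W.Wgp τ := ⟨⟨w, hw⟩, rfl⟩
    rw [h'.orbit] at this
    exact this
  · intro i
    obtain ⟨β', hβ', h1⟩ := W.Wgp_co hw (W.a i) (W.ha i)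
    have hτ := W.co_pos hβ' h'.reg
    have hκ := W.co_pos hβ' h.reg
    rcases h1 with h1 | h1
    · have := h1 τ
      rw [W.coa] at this
      omega
    · have := h1 κ
      rw [W.coa, hst] at this
      have := h.reg i
      omega

theorem AltSupp.card_eq {S T : Finset (ι → ℤ)} {κ τ : ι → ℤ} (h : W.AltSupp S κ)
    (h' : W.AltSupp T τ) : S.card = T.card := by
  have e : MulAction.stabilizer W.Wgp κ = MulAction.stabilizer W.Wgp τ :=
    le_antisymm (h.stab_le h') (h'.stab_le h)
  have h1 := Nat.card_congr (MulAction.orbitEquivQuotientStabilizer W.Wgp κ)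
  have h2 := Nat.card_congr (MulAction.orbitEquivQuotientStabilizer W.Wgp τ)
  rw [← e, ← h1, h.orbit, h'.orbit] at h2
  simpa using h2.symm

theorem AltSupp.sum_eq {𝕜 : Type*} [Field 𝕜] {κ : ι → ℤ} (F : (ι → ℤ) →₀ 𝕜)
    (h : W.AltSupp F.support κ) (hF : ∀ i ν, F (W.s i ν) = - F ν) :
    F.sum (fun ν c => c * (W.π ν : 𝕜)) = F.support.card * (F κ * W.π κ) := by
  have : ∀ ν ∈ F.support, F ν * (W.π ν : 𝕜) = F κ * W.π κ := by
    refine W.conj_induction _ h.stable _ ?_ ?_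
    · intro i ν _ hν
      rw [← hν, hF, W.π_s]; push_cast; ring
    · intro ν hν hd
      rw [h.dom ν hν hd]
  rw [Finsupp.sum, Finset.sum_congr rfl this]
  simp

end WData

end

section
namespace WData
section alg
variable {X 𝕜 : Type*} [AddCommGroup X] [Field 𝕜]

/-- Fourier multiplier on the group algebra -/
noncomputable def opM (f : X → 𝕜) : AddMonoidAlgebra 𝕜 X →ₗ[𝕜] AddMonoidAlgebra 𝕜 X where
  toFun p := AddMonoidAlgebra.ofCoeff
    (Finsupp.onFinset p.coeff.support (fun ν => f ν * p.coeff ν)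
      (fun ν h => by simp at h ⊢; tauto))
  map_add' p q := by ext ν; simp [mul_add]
  map_smul' c p := by ext ν; simp; ring

@[simp] theorem opM_coeff (f : X → 𝕜) (p : AddMonoidAlgebra 𝕜 X) (ν : X) :
    (opM f p).coeff ν = f ν * p.coeff ν := rfl

@[simp] theorem opM_single (f : X → 𝕜) (ν : X) (c : 𝕜) :
    opM f (AddMonoidAlgebra.single ν c) = AddMonoidAlgebra.single ν (f ν * c) := by
  classical
  ext κ
  rw [opM_coeff, AddMonoidAlgebra.coeff_single, AddMonoidAlgebra.coeff_single, Finsupp.single_apply,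
    Finsupp.single_apply]
  split_ifs with h
  · subst h; rfl
  · simp

theorem opM_comp (f g : X → 𝕜) (p : AddMonoidAlgebra 𝕜 X) :
    opM f (opM g p) = opM (fun ν => f ν * g ν) p := by
  ext ν; simp [mul_assoc]

theorem opM_deriv (f : X → 𝕜) (hf : ∀ μ ν, f (μ + ν) = f μ + f ν) (p q : AddMonoidAlgebra 𝕜 X) :
    opM f (p * q) = p * opM f q + q * opM f p := by
  induction p using AddMonoidAlgebra.induction_linear with
  | zero => simp
  | add p p' h h' => rw [add_mul, map_add, map_add, h, h']; ring
  | single μ c =>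
    induction q using AddMonoidAlgebra.induction_linear with
    | zero => simp
    | add p p' h h' => rw [mul_add, map_add, map_add, h, h']; ring
    | single ν d =>
      simp only [AddMonoidAlgebra.single_mul_single, opM_single, hf]
      rw [add_comm ν μ, ← AddMonoidAlgebra.single_add]
      congr 1; ring

/-- augmentation -/
noncomputable def aug : AddMonoidAlgebra 𝕜 X →ₐ[𝕜] 𝕜 := AddMonoidAlgebra.lift 𝕜 𝕜 X 1

@[simp] theorem aug_single (ν : X) (c : 𝕜) : aug (AddMonoidAlgebra.single ν c) = c := by
  simp [aug]

theorem aug_eq (p : AddMonoidAlgebra 𝕜 X) : aug p = p.coeff.sum fun _ c => c := by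
  induction p using AddMonoidAlgebra.induction_linear with
  | zero => simp
  | add p p' h h' => rw [map_add, h, h', AddMonoidAlgebra.coeff_add, Finsupp.sum_add_index'] <;> simp
  | single ν c => simp

theorem opM_pow (f : X → 𝕜) (hf : ∀ μ ν, f (μ + ν) = f μ + f ν) (I : Ideal (AddMonoidAlgebra 𝕜 X))
    (j : ℕ) (p : AddMonoidAlgebra 𝕜 X) (hp : p ∈ I ^ (j+1)) : opM f p ∈ I ^ j := by
  induction j generalizing p with
  | zero => simp
  | succ j ih =>
    rw [pow_succ] at hp
    refine Submodule.mul_induction_on hp ?_ ?_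
    · intro x hx y hy
      rw [opM_deriv f hf]
      refine add_mem (Ideal.mul_mem_right _ _ hx) ?_
      rw [mul_comm, pow_succ]
      exact Ideal.mul_mem_mul (ih x hx) hy
    · intro x y hx hy
      rw [map_add]; exact add_mem hx hy

theorem opM_prod_pow {κ : Type*} (T : Finset κ) (f : κ → X → 𝕜)
    (hf : ∀ b, ∀ μ ν, f b (μ + ν) = f b μ + f b ν) (I : Ideal (AddMonoidAlgebra 𝕜 X))
    (j : ℕ) (p : AddMonoidAlgebra 𝕜 X) (hp : p ∈ I ^ (j + T.card)) :
    opM (fun ν => ∏ b ∈ T, f b ν) p ∈ I ^ j := by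
  classical
  induction T using Finset.induction_on generalizing j with
  | empty =>
    have : opM (fun ν => ∏ b ∈ (∅ : Finset κ), f b ν) p = p := by ext; simp
    rw [this]; simpa using hp
  | insert b T hb ih =>
    have : opM (fun ν => ∏ b ∈ insert b T, f b ν) p = opM (f b) (opM (fun ν => ∏ b ∈ T, f b ν) p) := by
      rw [opM_comp]; congr 2; funext ν; rw [Finset.prod_insert hb]
    rw [this]
    apply opM_pow _ (hf b)
    apply ih
    rw [Finset.card_insert_of_notMem hb] at hp
    rwa [add_assoc, add_comm 1]

end alg

variable {ι : Type*} [Fintype ι] (W : WData ι) {𝕜 : Type*} [Field 𝕜] [CharZero 𝕜]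

local notation "RR" => AddMonoidAlgebra 𝕜 (ι → ℤ)
local notation "ee" => fun ν : ι → ℤ => (AddMonoidAlgebra.single ν (1:𝕜) : AddMonoidAlgebra 𝕜 (ι → ℤ))

/-- support bounded above by `κ` with leading coefficient one -/
structure Lead (κ : ι → ℤ) (p : RR) : Prop where
  le : ∀ ν, p.coeff ν ≠ 0 → W.Qp (κ - ν)
  one : p.coeff κ = 1

variable {W}

theorem Qp_antisymm {γ : ι → ℤ} (h : W.Qp γ) (h' : W.Qp (-γ)) : γ = 0 := by
  by_contra h0
  have h1 := W.B_posi h (ν := ρ) (fun _ => by simp [ρ]) h0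
  have h2 := W.B_posi h' (ν := ρ) (fun _ => by simp [ρ]) (by simpa using h0)
  simp at h2; linarith

theorem Lead.mul {κ τ : ι → ℤ} {p q : RR} (hp : W.Lead κ p) (hq : W.Lead τ q) :
    W.Lead (κ + τ) (p * q) := by
  classical
  constructor
  · intro ν hν
    have := AddMonoidAlgebra.support_coeff_mul_subset p q (Finsupp.mem_support_iff.2 hν)
    obtain ⟨x, hx, y, hy, rfl⟩ := Finset.mem_add.1 this
    have := W.Qp_add (hp.le x (Finsupp.mem_support_iff.1 hx)) (hq.le y (Finsupp.mem_support_iff.1 hy))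
    convert this using 1; abel
  · rw [AddMonoidAlgebra.coeff_mul_add_of_uniqueAdd, hp.one, hq.one, one_mul]
    intro x y hx hy hxy
    have h1 := hp.le x (Finsupp.mem_support_iff.1 hx)
    have h2 := hq.le y (Finsupp.mem_support_iff.1 hy)
    have h3 : τ - y = - (κ - x) := by
      have : τ - y + (κ - x) = (κ + τ) - (x + y) := by abel
      rw [eq_neg_iff_add_eq_zero, this, hxy, sub_self]
    rw [h3] at h2
    have := sub_eq_zero.1 (Qp_antisymm h1 h2)
    refine ⟨this.symm, ?_⟩
    have : τ - y = 0 := by rw [h3, sub_eq_zero.2 this, neg_zero]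
    exact (sub_eq_zero.1 this).symm

variable (W) in
/-- Weyl denominator -/
noncomputable def Den (𝕜 : Type*) [Field 𝕜] : AddMonoidAlgebra 𝕜 (ι → ℤ) :=
  AddMonoidAlgebra.single ρ 1 * ∏ β ∈ W.Pos, (1 - AddMonoidAlgebra.single (-β) 1)

theorem lead_single (κ : ι → ℤ) : W.Lead κ (ee κ) := by
  classical
  constructor
  · intro ν hν
    have : κ = ν := by
      by_contra h
      apply hν
      simp [AddMonoidAlgebra.coeff_single, Finsupp.single_apply, h]
    subst this; rw [sub_self]; exact W.Qp_zero
  · simp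

theorem lead_den : W.Lead ρ (W.Den 𝕜) := by
  classical
  have : ∀ T ⊆ W.Pos, W.Lead 0 (∏ β ∈ T, (1 - ee (-β))) := by
    intro T
    induction T using Finset.induction_on with
    | empty => intro _; exact lead_single 0
    | insert b T hb ih =>
      intro hT
      rw [Finset.prod_insert hb, ← add_zero (0 : ι → ℤ)]
      refine Lead.mul ?_ (ih fun x hx => hT (Finset.mem_insert_of_mem hx))
      have hb' : b ∈ W.Pos := hT (Finset.mem_insert_self _ _)
      have hb0 : b ≠ 0 := fun h => W.nz (h ▸ hb')
      constructor
      · intro ν hν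
        rw [AddMonoidAlgebra.one_def] at hν
        simp only [AddMonoidAlgebra.coeff_sub, Finsupp.sub_apply,
          AddMonoidAlgebra.coeff_single, Finsupp.single_apply] at hν
        by_cases h1 : 0 = ν
        · subst h1; simpa using W.Qp_zero
        by_cases h2 : -b = ν
        · subst h2; rw [zero_sub, neg_neg]; exact W.pos b hb'
        simp [h1, h2] at hν
      · rw [AddMonoidAlgebra.one_def]
        simp [AddMonoidAlgebra.coeff_single, Finsupp.single_apply, hb0]
  have h2 := (lead_single (W := W) (𝕜 := 𝕜) ρ).mul (this W.Pos subset_rfl)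
  rw [add_zero] at h2
  exact h2

variable (W) in
noncomputable def σ (𝕜 : Type*) [Field 𝕜] (i : ι) :
    AddMonoidAlgebra 𝕜 (ι → ℤ) →+* AddMonoidAlgebra 𝕜 (ι → ℤ) :=
  AddMonoidAlgebra.mapDomainRingHom 𝕜 (W.sHom i)

theorem σ_single (i : ι) (ν : ι → ℤ) (c : 𝕜) : W.σ 𝕜 i (AddMonoidAlgebra.single ν c) =
    AddMonoidAlgebra.single (W.s i ν) c := by
  simp [σ]; rfl

theorem σ_coeff (i : ι) (ν : ι → ℤ) (p : RR) : (W.σ 𝕜 i p).coeff (W.s i ν) = p.coeff ν := by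
  classical
  induction p using AddMonoidAlgebra.induction_linear with
  | zero => simp
  | add p p' h h' => rw [map_add, AddMonoidAlgebra.coeff_add, AddMonoidAlgebra.coeff_add,
      Finsupp.add_apply, Finsupp.add_apply, h, h']
  | single μ c =>
    rw [σ_single]
    simp only [AddMonoidAlgebra.coeff_single, Finsupp.single_apply, (W.s_injective i).eq_iff]

theorem s_rho (i : ι) : W.s i ρ = ρ - W.a i := by simp [s, ρ]

theorem σ_den (i : ι) : W.σ 𝕜 i (W.Den 𝕜) = - W.Den 𝕜 := by
  classical
  unfold Den
  rw [← Finset.mul_prod_erase _ _ (W.ha i), map_mul, map_mul, map_prod]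
  simp only [map_sub, map_one, σ_single, W.s_neg, W.s_a, neg_neg]
  rw [W.prod_erase_s i (fun β => (1 - AddMonoidAlgebra.single (-β) 1 : RR)), s_rho,
    ← mul_assoc, ← mul_assoc, ← neg_mul]
  congr 1
  rw [mul_sub, mul_sub, AddMonoidAlgebra.single_mul_single, AddMonoidAlgebra.single_mul_single,
    mul_one, mul_one, neg_sub, sub_add_cancel, mul_one, sub_eq_add_neg (ρ : ι → ℤ)]

end WData

end

section
namespace WData
variable {ι : Type*} [Fintype ι] {W : WData ι} {𝕜 : Type*} [Field 𝕜] [CharZero 𝕜]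

local notation "RR" => AddMonoidAlgebra 𝕜 (ι → ℤ)

theorem alt_coeff {p : RR} (hp : ∀ i, W.σ 𝕜 i p = -p) (i : ι) (ν : ι → ℤ) :
    p.coeff (W.s i ν) = - p.coeff ν := by
  have h := σ_coeff (W := W) i ν p
  rw [hp i] at h
  rw [← h]; simp

theorem alt_ne {p : RR} (hp : ∀ i, W.σ 𝕜 i p = -p) {ν : ι → ℤ} (hν : p.coeff ν ≠ 0) (i : ι) :
    ν i ≠ 0 := by
  intro h
  have h1 := alt_coeff hp i ν
  have h2 : W.s i ν = ν := by simp [s, h]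
  rw [h2] at h1
  apply hν
  have : 2 * p.coeff ν = 0 := by linear_combination h1
  simpa using this

theorem altSupp_of {p : RR} {κ : ι → ℤ} (hp : ∀ i, W.σ 𝕜 i p = -p) (hl : W.Lead κ p)
    (hκ : ∀ i, 0 < κ i) (hd : ∀ ν, p.coeff ν ≠ 0 → (∀ i, 0 < ν i) → ν = κ) :
    W.AltSupp p.coeff.support κ := by
  refine ⟨?_, ?_, hκ, ?_⟩
  · intro ν hν i
    rw [Finsupp.mem_support_iff] at hν ⊢
    rw [alt_coeff hp]; simpa using hν
  · rw [Finsupp.mem_support_iff, hl.one]; exact one_ne_zero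
  · intro ν hν h
    rw [Finsupp.mem_support_iff] at hν
    exact hd ν hν fun i => lt_of_le_of_ne (h i) (alt_ne hp hν i).symm

theorem altSupp_den : W.AltSupp (W.Den 𝕜).coeff.support ρ := by
  refine altSupp_of σ_den lead_den (fun _ => by simp [ρ]) ?_
  intro ν hν hd
  have h1 := (lead_den (W := W) (𝕜 := 𝕜)).le ν hν
  by_contra hne
  have h2 := W.Bpos (ρ - ν) (fun h => hne (sub_eq_zero.1 h).symm)
  have h3 := W.B_nonneg h1 (ν := ν - ρ) (fun i => by have := hd i; simp [ρ]; omega)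
  rw [← neg_sub, map_neg] at h3
  simp only [AddMonoidHom.neg_apply] at h3
  linarith

theorem AltSupp.norm {S : Finset (ι → ℤ)} {κ : ι → ℤ} (h : W.AltSupp S κ) :
    ∀ ν ∈ S, W.B ν ν = W.B κ κ := by
  refine W.conj_induction S h.stable _ ?_ ?_
  · intro i ν _ h1
    rw [W.B_s] at h1; exact h1
  · intro ν hν hd
    rw [h.dom ν hν hd]

variable (W) in
/-- partial derivative -/
noncomputable def dB (𝕜 : Type*) [Field 𝕜] [CharZero 𝕜] (ν : ι → ℤ) :
    AddMonoidAlgebra 𝕜 (ι → ℤ) →ₗ[𝕜] AddMonoidAlgebra 𝕜 (ι → ℤ) := opM fun μ => (W.B μ ν : 𝕜)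

variable (W) in
/-- Laplacian -/
noncomputable def lap (𝕜 : Type*) [Field 𝕜] [CharZero 𝕜] :
    AddMonoidAlgebra 𝕜 (ι → ℤ) →ₗ[𝕜] AddMonoidAlgebra 𝕜 (ι → ℤ) := opM fun μ => (W.B μ μ : 𝕜)

variable (W) in
/-- gradient pairing -/
noncomputable def G (χ p : RR) : RR :=
  p.coeff.sum fun ν c => AddMonoidAlgebra.single ν c * W.dB 𝕜 ν χ

theorem G_single (χ : RR) (ν : ι → ℤ) (c : 𝕜) :
    W.G χ (AddMonoidAlgebra.single ν c) = AddMonoidAlgebra.single ν c * W.dB 𝕜 ν χ := by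
  unfold G
  rw [AddMonoidAlgebra.coeff_single, Finsupp.sum_single_index]; simp

theorem G_zero (χ : RR) : W.G χ 0 = 0 := by simp [G]

theorem G_add (χ p q : RR) : W.G χ (p + q) = W.G χ p + W.G χ q := by
  unfold G
  rw [AddMonoidAlgebra.coeff_add, Finsupp.sum_add_index']
  · simp
  · intro a b c; rw [AddMonoidAlgebra.single_add, add_mul]

theorem dB_add (μ ν : ι → ℤ) (χ : RR) : W.dB 𝕜 (μ + ν) χ = W.dB 𝕜 μ χ + W.dB 𝕜 ν χ := by
  ext κ; simp [dB, add_mul]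

theorem dB_zero (χ : RR) : W.dB 𝕜 0 χ = 0 := by ext κ; simp [dB]

theorem dB_neg (μ : ι → ℤ) (χ : RR) : W.dB 𝕜 (-μ) χ = - W.dB 𝕜 μ χ := by
  ext κ; simp [dB]

theorem dB_sum (T : Finset (ι → ℤ)) (χ : RR) :
    W.dB 𝕜 (∑ β ∈ T, β) χ = ∑ β ∈ T, W.dB 𝕜 β χ := by
  classical
  induction T using Finset.induction_on with
  | empty => simp [dB_zero]
  | insert b T hb ih => rw [Finset.sum_insert hb, Finset.sum_insert hb, dB_add, ih]

theorem G_mul (χ p q : RR) : W.G χ (p * q) = p * W.G χ q + q * W.G χ p := by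
  induction p using AddMonoidAlgebra.induction_linear with
  | zero => simp [G_zero]
  | add p p' h h' => rw [add_mul, G_add, G_add, h, h']; ring
  | single μ c =>
    induction q using AddMonoidAlgebra.induction_linear with
    | zero => simp [G_zero]
    | add p p' h h' => rw [mul_add, G_add, G_add, h, h']; ring
    | single ν d =>
      rw [AddMonoidAlgebra.single_mul_single, G_single, G_single, G_single, dB_add,
        ← AddMonoidAlgebra.single_mul_single]
      ring

theorem lap_mul (χ p : RR) :
    W.lap 𝕜 (p * χ) = W.lap 𝕜 p * χ + p * W.lap 𝕜 χ + 2 * W.G χ p := by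
  induction p using AddMonoidAlgebra.induction_linear with
  | zero => simp [G_zero]
  | add p p' h h' => rw [add_mul, G_add, map_add, map_add, h, h']; ring
  | single μ c =>
    rw [G_single]
    induction χ using AddMonoidAlgebra.induction_linear with
    | zero => simp
    | add p p' h h' => rw [mul_add, map_add, map_add, map_add, h, h']; ring
    | single ν d =>
      simp only [AddMonoidAlgebra.single_mul_single, lap, dB, opM_single]
      rw [two_mul]
      simp only [← AddMonoidAlgebra.single_add]
      congr 1
      rw [map_add, map_add, AddMonoidHom.add_apply, AddMonoidHom.add_apply, W.Bsymm μ ν]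
      push_cast; ring

theorem G_den (χ : RR) (T : (ι → ℤ) → RR)
    (h1 : ∀ β ∈ W.Pos, (1 - AddMonoidAlgebra.single (-β) 1) * T β = W.dB 𝕜 β χ) :
    2 * W.G χ (W.Den 𝕜) = W.Den 𝕜 * ∑ β ∈ W.Pos, (1 + AddMonoidAlgebra.single (-β) 1) * T β := by
  classical
  have key : ∀ S ⊆ W.Pos, W.G χ (∏ β ∈ S, (1 - AddMonoidAlgebra.single (-β) 1 : RR)) =
      (∏ β ∈ S, (1 - AddMonoidAlgebra.single (-β) 1 : RR)) *
        ∑ β ∈ S, AddMonoidAlgebra.single (-β) 1 * T β := by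
    intro S
    induction S using Finset.induction_on with
    | empty =>
      intro _
      simp only [Finset.prod_empty, Finset.sum_empty, mul_zero]
      rw [AddMonoidAlgebra.one_def, G_single, dB_zero, mul_zero]
    | insert b S hb ih =>
      intro hS
      have hb' := hS (Finset.mem_insert_self _ _)
      have hg : W.G χ (1 - AddMonoidAlgebra.single (-b) 1 : RR) =
          AddMonoidAlgebra.single (-b) 1 * ((1 - AddMonoidAlgebra.single (-b) 1) * T b) := by
        rw [h1 b hb', sub_eq_add_neg, ← AddMonoidAlgebra.single_neg, G_add, G_single, dB_neg,
          AddMonoidAlgebra.one_def, G_single, dB_zero, mul_zero, zero_add,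
          AddMonoidAlgebra.single_neg]
        ring
      rw [Finset.prod_insert hb, Finset.sum_insert hb, G_mul, hg,
        ih fun x hx => hS (Finset.mem_insert_of_mem hx)]
      ring
  have hρ : (2 : RR) * W.dB 𝕜 ρ χ = ∑ β ∈ W.Pos, (1 - AddMonoidAlgebra.single (-β) 1) * T β := by
    rw [Finset.sum_congr rfl h1, ← dB_sum, W.sum_pos, two_smul, dB_add, two_mul]
  unfold Den
  rw [G_mul, key _ subset_rfl, G_single]
  have : ∑ β ∈ W.Pos, (1 + AddMonoidAlgebra.single (-β) 1) * T β =
      ∑ β ∈ W.Pos, (1 - AddMonoidAlgebra.single (-β) 1) * T β +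
      2 * ∑ β ∈ W.Pos, AddMonoidAlgebra.single (-β) 1 * T β := by
    rw [Finset.mul_sum, ← Finset.sum_add_distrib]
    refine Finset.sum_congr rfl fun β _ => ?_
    ring
  rw [this, ← hρ]
  ring

theorem den_mem_pow : W.Den 𝕜 ∈ (RingHom.ker (aug (X := ι → ℤ) (𝕜 := 𝕜))) ^ W.Pos.card := by
  unfold Den
  apply Ideal.mul_mem_left
  rw [← Finset.prod_const]
  refine Ideal.prod_mem_prod fun β _ => ?_
  rw [RingHom.mem_ker]
  simp

theorem aug_opM (p : RR) : aug (opM (fun ν => (W.π ν : 𝕜)) p) =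
    p.coeff.sum fun ν c => c * (W.π ν : 𝕜) := by
  induction p using AddMonoidAlgebra.induction_linear with
  | zero => simp
  | add p p' h h' =>
    rw [map_add, map_add, h, h', AddMonoidAlgebra.coeff_add, Finsupp.sum_add_index']
    · simp
    · intros; ring
  | single ν c => simp [mul_comm]

theorem aug_den_mul (χ : RR) : aug (opM (fun ν => (W.π ν : 𝕜)) (W.Den 𝕜 * χ)) =
    aug χ * aug (opM (fun ν => (W.π ν : 𝕜)) (W.Den 𝕜)) := by
  set I := RingHom.ker (aug (X := ι → ℤ) (𝕜 := 𝕜)) with hI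
  have h1 : W.Den 𝕜 * (χ - algebraMap 𝕜 RR (aug χ)) ∈ I ^ (1 + W.Pos.card) := by
    rw [pow_add, pow_one, mul_comm (W.Den 𝕜)]
    refine Ideal.mul_mem_mul ?_ den_mem_pow
    rw [hI, RingHom.mem_ker, map_sub, AlgHom.commutes]; simp
  have h2 := opM_prod_pow W.Pos (fun β ν => (W.co β ν : 𝕜)) (fun b μ ν => by simp) I 1 _ h1
  rw [pow_one, hI, RingHom.mem_ker, mul_sub, map_sub, map_sub, sub_eq_zero] at h2
  have h3 : (fun ν => (W.π ν : 𝕜)) = (fun ν => ∏ b ∈ W.Pos, (W.co b ν : 𝕜)) := by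
    funext ν; simp [π]
  rw [h3, h2, mul_comm (W.Den 𝕜), ← Algebra.smul_def, map_smul, map_smul, smul_eq_mul]

/-- Weyl dimension formula, combinatorial form. -/
theorem weyl_dim (m : (ι → ℤ) →₀ ℕ) (t : (ι → ℤ) → (ι → ℤ) →₀ 𝕜) (c : 𝕜) (lam : ι → ℤ)
    (hms : ∀ i μ, m (W.s i μ) = m μ) (hlam : ∀ i, 0 ≤ lam i) (hm1 : m lam = 1)
    (hle : ∀ μ, m μ ≠ 0 → W.Qp (lam - μ)) (ht0 : ∀ β ∈ W.Pos, ∀ μ, m μ = 0 → t β μ = 0)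
    (h1 : ∀ β ∈ W.Pos, ∀ μ, t β μ - t β (μ + β) = W.B μ β * m μ)
    (h2 : ∀ μ, c * m μ = W.B μ μ * m μ + ∑ β ∈ W.Pos, (t β μ + t β (μ + β))) :
    ((m.sum fun _ k => k : ℕ) : ℤ) * W.π ρ = W.π (lam + ρ) := by
  classical
  set χ : RR := AddMonoidAlgebra.ofCoeff (m.mapRange (Nat.cast : ℕ → 𝕜) (by simp)) with hχ
  set T : (ι → ℤ) → RR := fun β => AddMonoidAlgebra.ofCoeff (t β) with hT
  have hχc : ∀ ν, χ.coeff ν = (m ν : 𝕜) := fun ν => by simp [hχ]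
  have hTc : ∀ β ν, (T β).coeff ν = t β ν := fun β ν => rfl
  have hshift : ∀ β ν, (AddMonoidAlgebra.single (-β) 1 * T β).coeff ν = t β (ν + β) := by
    intro β ν
    rw [AddMonoidAlgebra.coeff_single_mul_apply, one_mul, hTc]; congr 1; abel
  have e1 : ∀ β ∈ W.Pos, (1 - AddMonoidAlgebra.single (-β) 1) * T β = W.dB 𝕜 β χ := by
    intro β hβ
    ext ν
    rw [sub_mul, one_mul, AddMonoidAlgebra.coeff_sub, Finsupp.sub_apply, hshift, hTc, h1 β hβ]
    simp [dB, hχc]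
  have e2 : c • χ = W.lap 𝕜 χ + ∑ β ∈ W.Pos, (1 + AddMonoidAlgebra.single (-β) 1) * T β := by
    ext ν
    rw [AddMonoidAlgebra.coeff_smul, Finsupp.smul_apply, smul_eq_mul, hχc, h2,
      AddMonoidAlgebra.coeff_add, Finsupp.add_apply, AddMonoidAlgebra.coeff_sum,
      Finsupp.finset_sum_apply]
    refine congrArg₂ (· + ·) ?_ ?_
    · simp [lap, hχc]
    · refine Finset.sum_congr rfl fun β _ => ?_
      rw [add_mul, one_mul, AddMonoidAlgebra.coeff_add, Finsupp.add_apply, hshift, hTc]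
  have hσχ : ∀ i, W.σ 𝕜 i χ = χ := by
    intro i
    ext ν
    have := σ_coeff (W := W) i (W.s i ν) χ
    rw [W.s_s] at this
    rw [this, hχc, hχc, hms]
  have hσ : ∀ i, W.σ 𝕜 i (W.Den 𝕜 * χ) = - (W.Den 𝕜 * χ) := by
    intro i; rw [map_mul, σ_den, hσχ, neg_mul]
  have hleadχ : W.Lead lam χ := by
    constructor
    · intro ν hν
      refine hle ν ?_
      rintro h; apply hν; rw [hχc, h]; simp
    · rw [hχc, hm1]; simp
  have hlead : W.Lead (lam + ρ) (W.Den 𝕜 * χ) := by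
    rw [add_comm]; exact lead_den.mul hleadχ
  have hlapD : W.lap 𝕜 (W.Den 𝕜) = ((W.B ρ ρ : ℚ) : 𝕜) • W.Den 𝕜 := by
    ext ν
    simp only [lap, opM_coeff, AddMonoidAlgebra.coeff_smul, Finsupp.smul_apply, smul_eq_mul]
    by_cases h : (W.Den 𝕜).coeff ν = 0
    · simp [h]
    · rw [(altSupp_den (W := W) (𝕜 := 𝕜)).norm ν (Finsupp.mem_support_iff.2 h)]
  have hlap : W.lap 𝕜 (W.Den 𝕜 * χ) = (c + (W.B ρ ρ : ℚ)) • (W.Den 𝕜 * χ) := by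
    rw [lap_mul, G_den χ T e1, hlapD, add_assoc, ← mul_add, ← e2, add_smul, smul_mul_assoc,
      mul_smul_comm, add_comm]
  have hnorm : ∀ ν, (W.Den 𝕜 * χ).coeff ν ≠ 0 → (W.B ν ν : 𝕜) = c + (W.B ρ ρ : ℚ) := by
    intro ν hν
    have := congrArg (fun p : RR => p.coeff ν) hlap
    simp only [lap, opM_coeff, AddMonoidAlgebra.coeff_smul, Finsupp.smul_apply, smul_eq_mul] at this
    exact mul_right_cancel₀ hν this
  have hreg : ∀ i, 0 < ((lam + ρ : ι → ℤ) i) := fun i => by have := hlam i; simp [ρ]; omega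
  have halt : W.AltSupp (W.Den 𝕜 * χ).coeff.support (lam + ρ) := by
    refine altSupp_of hσ hlead hreg ?_
    intro ν hν hd
    have hh1 := hnorm ν hν
    have hh2 := hnorm (lam + ρ) (by rw [hlead.one]; exact one_ne_zero)
    rw [← hh2] at hh1
    have hh : W.B ν ν = W.B (lam + ρ) (lam + ρ) := by exact_mod_cast hh1
    by_contra hne
    have hq := hlead.le ν hν
    have hpos := W.B_posi hq (ν := (lam + ρ) + ν) (fun i => add_pos (hreg i) (hd i))
      (fun h => hne (sub_eq_zero.1 h).symm)
    generalize hκ : lam + ρ = κ at hpos hh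
    rw [map_sub, map_add, AddMonoidHom.add_apply, AddMonoidHom.add_apply, W.Bsymm ν κ] at hpos
    linarith
  have s1 := halt.sum_eq (𝕜 := 𝕜) (F := (W.Den 𝕜 * χ).coeff) (alt_coeff hσ)
  have s2 := (altSupp_den (W := W) (𝕜 := 𝕜)).sum_eq (𝕜 := 𝕜) (F := (W.Den 𝕜).coeff) (alt_coeff σ_den)
  rw [← aug_opM, hlead.one, one_mul] at s1
  rw [← aug_opM, lead_den.one, one_mul] at s2
  have hcard := halt.card_eq (altSupp_den (W := W) (𝕜 := 𝕜))
  rw [aug_den_mul, s2, hcard] at s1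
  have hcne : ((W.Den 𝕜).coeff.support.card : 𝕜) ≠ 0 := by
    have : 0 < (W.Den 𝕜).coeff.support.card :=
      Finset.card_pos.2 ⟨_, (altSupp_den (W := W) (𝕜 := 𝕜)).mem⟩
    exact_mod_cast this.ne'
  have hfin : aug χ * (W.π ρ : 𝕜) = W.π (lam + ρ) := by
    apply mul_left_cancel₀ hcne
    rw [← s1]; ring
  have haug : aug χ = ((m.sum fun _ k => k : ℕ) : 𝕜) := by
    rw [aug_eq, hχ, Finsupp.sum_mapRange_index (by simp), Finsupp.sum, Finsupp.sum]
    push_cast; rfl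
  rw [haug] at hfin
  exact_mod_cast hfin

end WData

end

section
/-- sl2 triple of operators (light version). -/
structure SlTriple {K V : Type*} [Field K] [AddCommGroup V] [Module K V]
    (h e f : Module.End K V) : Prop where
  ef : e * f - f * e = h
  he : h * e - e * h = (2 : K) • e
  hf : h * f - f * h = -(2 : K) • f

namespace SlTriple
variable {K V : Type*} [Field K] [CharZero K] [AddCommGroup V] [Module K V]
  {h e f : Module.End K V}

theorem swap (T : SlTriple h e f) : SlTriple (-h) f e where
  ef := by rw [← T.ef]; abel
  he := by
    have := T.hf
    rw [neg_mul, mul_neg, sub_neg_eq_add, neg_add_eq_sub, ← neg_sub, this]; simp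
  hf := by
    have := T.he
    rw [neg_mul, mul_neg, sub_neg_eq_add, neg_add_eq_sub, ← neg_sub, this]; simp

theorem h_e (T : SlTriple h e f) {v : V} {q : K} (hv : h v = q • v) :
    h (e v) = (q + 2) • e v := by
  have := congrArg (fun x : Module.End K V => x v) T.he
  simp only [LinearMap.sub_apply, Module.End.mul_apply, hv, map_smul, LinearMap.smul_apply,
    sub_eq_iff_eq_add] at this
  rw [this, ← add_smul, add_comm]

theorem h_f (T : SlTriple h e f) {v : V} {q : K} (hv : h v = q • v) :
    h (f v) = (q - 2) • f v := by
  have := T.swap.h_e (v := v) (q := -q) (by simp [hv])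
  rw [LinearMap.neg_apply, neg_eq_iff_eq_neg, ← neg_smul] at this
  rw [this]; congr 1; ring

theorem h_f_pow (T : SlTriple h e f) {v : V} {q : K} (hv : h v = q • v) (n : ℕ) :
    h ((f ^ n) v) = (q - 2 * n) • (f ^ n) v := by
  induction n with
  | zero => simp [hv]
  | succ n ih =>
    rw [pow_succ', Module.End.mul_apply, T.h_f ih]; congr 1; push_cast; ring

theorem e_f (T : SlTriple h e f) (v : V) : e (f v) = f (e v) + h v := by
  have := congrArg (fun x : Module.End K V => x v) T.ef
  simp only [LinearMap.sub_apply, Module.End.mul_apply, sub_eq_iff_eq_add] at this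
  rw [this, add_comm]

theorem e_f_pow (T : SlTriple h e f) {v : V} {q : K} (hv : h v = q • v) (n : ℕ) :
    e ((f ^ (n + 1)) v) = (f ^ (n + 1)) (e v) + ((n + 1) * (q - n)) • (f ^ n) v := by
  induction n with
  | zero => simp [T.e_f, hv]
  | succ n ih =>
    rw [pow_succ' f (n + 1), Module.End.mul_apply, T.e_f, ih, map_add, map_smul, T.h_f_pow hv,
      Module.End.mul_apply, add_assoc, ← Module.End.mul_apply f (f ^ n), ← pow_succ', ← add_smul]
    congr 2; push_cast; ring

theorem inj_prim (T : SlTriple h e f) {v : V} {q : ℕ} (hv : h v = (q : K) • v) (hev : e v = 0)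
    (n : ℕ) (hn : n ≤ q) (hf : (f ^ n) v = 0) : v = 0 := by
  induction n with
  | zero => simpa using hf
  | succ n ih =>
    refine ih (by omega) ?_
    have := T.e_f_pow hv n
    rw [hf, hev, map_zero, map_zero, zero_add] at this
    rcases smul_eq_zero.1 this.symm with h0 | h0
    · exfalso
      rcases mul_eq_zero.1 h0 with h1 | h1
      · exact Nat.cast_add_one_ne_zero n h1
      · rw [sub_eq_zero] at h1
        have : q = n := by exact_mod_cast h1
        omega
    · exact h0

theorem inj (T : SlTriple h e f) (k : ℕ) {v : V} {q : ℕ} (hv : h v = (q : K) • v)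
    (hev : (e ^ k) v = 0) (hf : (f ^ q) v = 0) : v = 0 := by
  induction k generalizing v q with
  | zero => simpa using hev
  | succ k ih =>
    refine T.inj_prim hv ?_ q le_rfl hf
    refine ih (v := e v) (q := q + 2) ?_ ?_ ?_
    · rw [T.h_e hv]; push_cast; rfl
    · rw [← Module.End.mul_apply, ← pow_succ]; exact hev
    · have h1 := T.e_f_pow hv (q + 1)
      have h2 : (f ^ (q + 1)) v = 0 := by rw [pow_succ', Module.End.mul_apply, hf, map_zero]
      have h3 : (f ^ (q + 1 + 1)) v = 0 := by rw [pow_succ', Module.End.mul_apply, h2, map_zero]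
      rw [h2, h3, map_zero, smul_zero, add_zero] at h1
      exact h1.symm

/-- A primitive vector with integral weight has nonnegative weight. -/
theorem prim_nonneg (T : SlTriple h e f) {k : ℕ} (hfk : f ^ k = 0) {v : V} (hv0 : v ≠ 0) {q : ℤ}
    (hv : h v = (q : K) • v) (hev : e v = 0) : 0 ≤ q := by
  by_contra hq
  push Not at hq
  apply hv0
  obtain ⟨m, hm⟩ : ∃ m : ℕ, q = -((m + 1 : ℕ) : ℤ) := ⟨(-q - 1).toNat, by omega⟩
  refine T.swap.inj k (v := v) (q := m + 1) ?_ ?_ ?_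
  · rw [LinearMap.neg_apply, hv, hm, ← neg_smul]; congr 1; push_cast; ring
  · rw [hfk]; simp
  · rw [pow_succ, Module.End.mul_apply, hev, map_zero]

theorem prim_f_succ (T : SlTriple h e f) {k : ℕ} (hfk : f ^ k = 0) {v : V} {q : ℕ}
    (hv : h v = (q : K) • v) (hev : e v = 0) : (f ^ (q + 1)) v = 0 := by
  by_contra h0
  have h1 := T.e_f_pow hv q
  rw [hev, map_zero, sub_self, mul_zero, zero_smul, add_zero] at h1
  have h2 := T.prim_nonneg hfk h0 (q := (q : ℤ) - 2 * (q + 1 : ℕ)) (by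
    rw [T.h_f_pow hv]; push_cast; rfl) h1
  push_cast at h2; omega

end SlTriple

end

section
open Module

/-- Representation data. -/
structure VData (K V ι : Type*) [Field K] [AddCommGroup V] [Module K V] [Fintype ι] where
  W : WData ι
  wt : (ι → ℤ) → Submodule K V
  E : (ι → ℤ) → Module.End K V
  G : (ι → ℤ) → Module.End K V
  ind : iSupIndep wt
  top : ⨆ μ, wt μ = ⊤
  Ewt : ∀ β ∈ W.Pos, ∀ μ, ∀ v ∈ wt μ, E β v ∈ wt (μ + β)
  Gwt : ∀ β ∈ W.Pos, ∀ μ, ∀ v ∈ wt μ, G β v ∈ wt (μ - β)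
  EG : ∀ β ∈ W.Pos, ∀ μ, ∀ v ∈ wt μ, E β (G β v) - G β (E β v) = (W.B μ β : K) • v
  comm : ∀ i j, i ≠ j → ∀ v, E (W.a i) (G (W.a j) v) = G (W.a j) (E (W.a i) v)
  c : K
  cas : ∀ μ, ∀ v ∈ wt μ, (W.B μ μ : K) • v + ∑ β ∈ W.Pos, (E β (G β v) + G β (E β v)) = c • v
  irr : ∀ Y : Submodule K V, (∀ i, ∀ v ∈ Y, E (W.a i) v ∈ Y) → (∀ i, ∀ v ∈ Y, G (W.a i) v ∈ Y) →
    Y = ⊥ ∨ Y = ⊤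

namespace VData
variable {K V ι : Type*} [Field K] [CharZero K] [AddCommGroup V] [Module K V] [Fintype ι]
  [DecidableEq ι]
  (D : VData K V ι)

/-- raising operator -/
def e (i : ι) : Module.End K V := D.E (D.W.a i)
/-- lowering operator -/
def f (i : ι) : Module.End K V := ((D.W.cc (D.W.a i) : ℚ) : K)⁻¹ • D.G (D.W.a i)
/-- Cartan operator -/
def h (i : ι) : Module.End K V := D.e i * D.f i - D.f i * D.e i

theorem ccK (i : ι) : ((D.W.cc (D.W.a i) : ℚ) : K) ≠ 0 := by
  have := (D.W.ccpos _ (D.W.ha i)).ne'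
  exact_mod_cast this

theorem e_wt (i : ι) {μ v} (hv : v ∈ D.wt μ) : D.e i v ∈ D.wt (μ + D.W.a i) :=
  D.Ewt _ (D.W.ha i) _ _ hv

theorem f_wt (i : ι) {μ v} (hv : v ∈ D.wt μ) : D.f i v ∈ D.wt (μ - D.W.a i) :=
  Submodule.smul_mem _ _ (D.Gwt _ (D.W.ha i) _ _ hv)

theorem h_wt (i : ι) {μ v} (hv : v ∈ D.wt μ) : D.h i v = ((μ i : ℤ) : K) • v := by
  have := D.EG _ (D.W.ha i) _ _ hv
  rw [D.W.Ba] at this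
  simp only [h, e, f, LinearMap.sub_apply, Module.End.mul_apply, LinearMap.smul_apply, map_smul]
  rw [← smul_sub, this, smul_smul]
  congr 1
  push_cast
  rw [inv_mul_cancel_left₀ (D.ccK i)]

theorem ext_wt {A B : Module.End K V} (hAB : ∀ μ, ∀ v ∈ D.wt μ, A v = B v) : A = B := by
  have : ⊤ ≤ LinearMap.eqLocus A B := by
    rw [← D.top]; exact iSup_le fun μ v hv => hAB μ v hv
  ext v; exact this Submodule.mem_top

theorem slT (i : ι) : SlTriple (D.h i) (D.e i) (D.f i) where
  ef := rfl
  he := by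
    refine D.ext_wt fun μ v hv => ?_
    simp only [LinearMap.sub_apply, Module.End.mul_apply, LinearMap.smul_apply]
    rw [D.h_wt i (D.e_wt i hv), D.h_wt i hv, map_smul, ← sub_smul]
    congr 1; simp [D.W.aii]
  hf := by
    refine D.ext_wt fun μ v hv => ?_
    simp only [LinearMap.sub_apply, Module.End.mul_apply, LinearMap.smul_apply]
    rw [D.h_wt i (D.f_wt i hv), D.h_wt i hv, map_smul, ← sub_smul]
    congr 1; simp [D.W.aii]

theorem ef_comm {i j : ι} (hij : i ≠ j) (v : V) : D.e i (D.f j v) = D.f j (D.e i v) := by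
  simp only [e, f, LinearMap.smul_apply, map_smul, D.comm i j hij]

theorem e_f (i j : ι) {μ v} (hv : v ∈ D.wt μ) :
    D.e i (D.f j v) = D.f j (D.e i v) + (if i = j then ((μ i : ℤ) : K) else 0) • v := by
  split_ifs with hij
  · subst hij; rw [(D.slT i).e_f, D.h_wt i hv]
  · rw [D.ef_comm hij]; simp

theorem a_inj : Function.Injective D.W.a := by
  intro i j hij
  by_contra hne
  have h1 := D.W.coa i (Pi.single i 1)
  rw [hij, D.W.coa j] at h1
  simp [Pi.single_apply, Ne.symm hne] at h1

/-- multiplicity -/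
noncomputable def m (μ : ι → ℤ) : ℕ := finrank K (D.wt μ)

variable [FiniteDimensional K V]

theorem m_ne {μ} : D.m μ ≠ 0 ↔ D.wt μ ≠ ⊥ := by
  rw [m, Ne, Submodule.finrank_eq_zero]

theorem fin : {μ | D.wt μ ≠ ⊥}.Finite := 
  WellFoundedGT.finite_ne_bot_of_iSupIndep D.ind

theorem eq_of_mem {μ ν v} (h1 : v ∈ D.wt μ) (h2 : v ∈ D.wt ν) (h0 : v ≠ 0) : μ = ν := by
  by_contra hne
  exact h0 ((Submodule.disjoint_def.1 (D.ind.pairwiseDisjoint hne)) v h1 h2)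

theorem nilp (i : ι) : ∃ k, D.e i ^ k = 0 ∧ D.f i ^ k = 0 := by
  obtain ⟨M, hM⟩ : ∃ M : ℕ, ∀ μ, D.wt μ ≠ ⊥ → |μ i| ≤ M := by
    obtain ⟨M, hM⟩ := (D.fin.image fun μ => (|μ i|).toNat).bddAbove
    refine ⟨M, fun μ hμ => ?_⟩
    have := hM ⟨μ, hμ, rfl⟩
    simp only at this
    omega
  have he : ∀ k : ℕ, ∀ μ v, v ∈ D.wt μ → (D.e i ^ k) v ∈ D.wt (μ + k • D.W.a i) := by
    intro k
    induction k with
    | zero => intro μ v hv; simpa using hv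
    | succ k ih =>
      intro μ v hv
      rw [pow_succ', Module.End.mul_apply, add_smul, one_smul, ← add_assoc]
      exact D.e_wt i (ih μ v hv)
  have hf : ∀ k : ℕ, ∀ μ v, v ∈ D.wt μ → (D.f i ^ k) v ∈ D.wt (μ - k • D.W.a i) := by
    intro k
    induction k with
    | zero => intro μ v hv; simpa using hv
    | succ k ih =>
      intro μ v hv
      rw [pow_succ', Module.End.mul_apply, add_smul, one_smul, ← sub_sub]
      exact D.f_wt i (ih μ v hv)
  refine ⟨M + 1, D.ext_wt fun μ v hv => ?_, D.ext_wt fun μ v hv => ?_⟩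
  · by_contra h0
    rw [LinearMap.zero_apply] at h0
    have h1 := hM _ ((Submodule.ne_bot_iff _).2 ⟨_, he (M+1) μ v hv, h0⟩)
    have h2 := hM μ ((Submodule.ne_bot_iff _).2 ⟨v, hv, fun h => h0 (by simp [h])⟩)
    simp [D.W.aii] at h1
    rw [abs_le] at h1 h2
    omega
  · by_contra h0
    rw [LinearMap.zero_apply] at h0
    have h1 := hM _ ((Submodule.ne_bot_iff _).2 ⟨_, hf (M+1) μ v hv, h0⟩)
    have h2 := hM μ ((Submodule.ne_bot_iff _).2 ⟨v, hv, fun h => h0 (by simp [h])⟩)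
    simp [D.W.aii] at h1
    rw [abs_le] at h1 h2
    omega

theorem e_pow_wt (i : ι) (k : ℕ) {μ v} (hv : v ∈ D.wt μ) : (D.e i ^ k) v ∈ D.wt (μ + k • D.W.a i) := by
  induction k with
  | zero => simpa using hv
  | succ k ih =>
    rw [pow_succ', Module.End.mul_apply, add_smul, one_smul, ← add_assoc]
    exact D.e_wt i ih

theorem f_pow_wt (i : ι) (k : ℕ) {μ v} (hv : v ∈ D.wt μ) : (D.f i ^ k) v ∈ D.wt (μ - k • D.W.a i) := by
  induction k with
  | zero => simpa using hv
  | succ k ih =>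
    rw [pow_succ', Module.End.mul_apply, add_smul, one_smul, ← sub_sub]
    exact D.f_wt i ih

theorem m_le (i : ι) (μ) : D.m μ ≤ D.m (D.W.s i μ) := by
  obtain ⟨k, hk1, hk2⟩ := D.nilp i
  rcases le_total 0 (μ i) with hq | hq
  · obtain ⟨q, hq⟩ := Int.eq_ofNat_of_zero_le hq
    have hs : D.W.s i μ = μ - q • D.W.a i := by rw [WData.s, hq]; simp
    rw [hs]
    refine LinearMap.finrank_le_finrank_of_injective
      (f := LinearMap.restrict (D.f i ^ q) (fun v hv => D.f_pow_wt i q hv)) ?_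
    rw [← LinearMap.ker_eq_bot, LinearMap.ker_eq_bot']
    intro v hv
    have hv' := congrArg Subtype.val hv
    simp only [LinearMap.restrict_coe_apply, ZeroMemClass.coe_zero] at hv'
    refine Subtype.ext ((D.slT i).inj k (q := q) ?_ (by simp [hk1]) hv')
    rw [D.h_wt i v.2, hq]; simp
  · obtain ⟨q, hq⟩ := Int.exists_eq_neg_ofNat hq
    have hs : D.W.s i μ = μ + q • D.W.a i := by rw [WData.s, hq]; simp
    rw [hs]
    refine LinearMap.finrank_le_finrank_of_injective
      (f := LinearMap.restrict (D.e i ^ q) (fun v hv => D.e_pow_wt i q hv)) ?_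
    rw [← LinearMap.ker_eq_bot, LinearMap.ker_eq_bot']
    intro v hv
    have hv' := congrArg Subtype.val hv
    simp only [LinearMap.restrict_coe_apply, ZeroMemClass.coe_zero] at hv'
    refine Subtype.ext ((D.slT i).swap.inj k (q := q) ?_ (by simp [hk2]) hv')
    rw [LinearMap.neg_apply, D.h_wt i v.2, hq]; simp

theorem m_s (i : ι) (μ) : D.m (D.W.s i μ) = D.m μ := by
  refine le_antisymm ?_ (D.m_le i μ)
  have := D.m_le i (D.W.s i μ)
  rwa [D.W.s_s] at this

end VData

end

section
open Module

namespace WData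
variable {ι : Type*} [Fintype ι] [DecidableEq ι] (W : WData ι)

theorem co_nonneg {β ν : ι → ℤ} (hβ : β ∈ W.Pos) (hν : ∀ i, 0 ≤ ν i) : 0 ≤ W.co β ν := by
  have h1 := W.B_nonneg (W.pos β hβ) hν
  rw [W.Bco β hβ] at h1
  have := nonneg_of_mul_nonneg_right h1 (W.ccpos β hβ)
  exact_mod_cast this

/-- twice the half sum of positive coroots -/
def hr : (ι → ℤ) →+ ℤ := ∑ β ∈ W.Pos, W.co β

theorem hr_apply (ν) : W.hr ν = ∑ β ∈ W.Pos, W.co β ν := by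
  simp [hr, AddMonoidHom.finset_sum_apply]

theorem hr_a (i : ι) : W.hr (W.a i) = 2 := by
  rw [hr_apply, ← Finset.add_sum_erase _ _ (W.ha i), W.coa, W.aii]
  have h1 := W.sum_erase_s i (fun β => W.co β (W.a i))
  have h2 : ∑ β ∈ W.Pos.erase (W.a i), W.co (W.s i β) (W.a i) =
      ∑ β ∈ W.Pos.erase (W.a i), - W.co β (W.a i) := by
    refine Finset.sum_congr rfl fun β hβ => ?_
    rw [Finset.mem_erase] at hβ
    have := W.refl_co β hβ.2 i hβ.1 (W.a i)
    rw [WData.s, this, W.aii, map_sub, map_zsmul]; simp; ring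
  rw [h2, Finset.sum_neg_distrib] at h1
  linarith

theorem hr_ne (i : ι) (l : List ι) : (((i :: l).map W.a).sum) ≠ 0 := by
  intro h
  have h1 : ∀ l : List ι, W.hr ((l.map W.a).sum) = 2 * l.length := by
    intro l
    induction l with
    | nil => simp
    | cons i l ih => simp [ih, hr_a]; ring
  have := h1 (i :: l)
  rw [h] at this
  simp at this; omega

/-- coefficients of `2ρ^∨` -/
def cf (i : ι) : ℤ := W.hr (Pi.single i 1)

theorem cf_pos (i : ι) : 0 < W.cf i := by
  rw [cf, hr_apply]
  refine Finset.sum_pos' (fun β hβ => W.co_nonneg hβ fun j => ?_) ⟨W.a i, W.ha i, ?_⟩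
  · by_cases h : j = i
    · subst h; simp
    · simp [h]
  · rw [W.coa]; simp

theorem map_eq (φ : (ι → ℤ) →+ ℤ) (μ : ι → ℤ) : φ μ = ∑ i, μ i * φ (Pi.single i 1) := by
  conv_lhs => rw [← Finset.univ_sum_single μ, map_sum]
  refine Finset.sum_congr rfl fun i _ => ?_
  have : (Pi.single i (μ i) : ι → ℤ) = μ i • Pi.single i 1 := by
    ext j; by_cases h : j = i
    · subst h; simp
    · simp [h]
  rw [this, map_zsmul]; simp

end WData

namespace VData
variable {K V ι : Type*} [Field K] [CharZero K] [AddCommGroup V] [Module K V] [Fintype ι]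
  [DecidableEq ι] (D : VData K V ι)

/-- vectors obtained by lowering along a word -/
def wv (v0 : V) : List ι → V
  | [] => v0
  | i :: l => D.f i (wv v0 l)

theorem wv_wt {v0 lam} (h0 : v0 ∈ D.wt lam) (l : List ι) :
    D.wv v0 l ∈ D.wt (lam - (l.map D.W.a).sum) := by
  induction l with
  | nil => simpa [wv] using h0
  | cons i l ih =>
    have := D.f_wt i ih
    rw [sub_sub, add_comm] at this
    simpa [wv] using this

theorem span_wv {v0 lam} (h0 : v0 ∈ D.wt lam) (hne : v0 ≠ 0) (he : ∀ i, D.e i v0 = 0) :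
    Submodule.span K (Set.range (D.wv v0)) = ⊤ := by
  have hv : v0 ∈ Submodule.span K (Set.range (D.wv v0)) := Submodule.subset_span ⟨[], rfl⟩
  have hf : ∀ i, ∀ v ∈ Submodule.span K (Set.range (D.wv v0)),
      D.f i v ∈ Submodule.span K (Set.range (D.wv v0)) := by
    intro i v hv
    induction hv using Submodule.span_induction with
    | mem x hx => obtain ⟨l, rfl⟩ := hx; exact Submodule.subset_span ⟨i :: l, rfl⟩
    | zero => simp
    | add x y _ _ hx hy => rw [map_add]; exact add_mem hx hy
    | smul c x _ hx => rw [map_smul]; exact Submodule.smul_mem _ _ hx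
  suffices key : Submodule.span K (Set.range (D.wv v0)) = ⊥ ∨
      Submodule.span K (Set.range (D.wv v0)) = ⊤ by
    rcases key with h | h
    · rw [h] at hv; exact absurd (by simpa using hv) hne
    · exact h
  refine D.irr (Submodule.span K (Set.range (D.wv v0))) ?_ ?_
  · intro i v hv
    induction hv using Submodule.span_induction with
    | mem x hx =>
      obtain ⟨l, rfl⟩ := hx
      induction l with
      | nil => have := he i; rw [e] at this; simp [wv, this]
      | cons j l ih =>
        have := D.e_f i j (D.wv_wt h0 l)
        rw [e] at this
        rw [wv, this]
        exact add_mem (hf j _ ih) (Submodule.smul_mem _ _ (Submodule.subset_span ⟨l, rfl⟩))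
    | zero => simp
    | add x y _ _ hx hy => rw [map_add]; exact add_mem hx hy
    | smul c x _ hx => rw [map_smul]; exact Submodule.smul_mem _ _ hx
  · intro i v hv
    have := Submodule.smul_mem _ ((D.W.cc (D.W.a i) : ℚ) : K) (hf i v hv)
    rwa [f, LinearMap.smul_apply, smul_inv_smul₀ (D.ccK i)] at this

/-- A family of homogeneous vectors spanning `V` spans each weight space. -/
theorem span_homog {κ : Type*} (x : κ → V) (d : κ → ι → ℤ) (hx : ∀ k, x k ∈ D.wt (d k))
    (hs : Submodule.span K (Set.range x) = ⊤) (μ) :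
    D.wt μ ≤ Submodule.span K (x '' {k | d k = μ}) := by
  classical
  set P : Submodule K V := Submodule.span K (x '' {k | d k = μ}) with hP
  have hPle : P ≤ D.wt μ := Submodule.span_le.2 (by rintro _ ⟨k, hk, rfl⟩; rw [← hk]; exact hx k)
  have htop : P ⊔ ⨆ ν, ⨆ (_ : ν ≠ μ), D.wt ν = ⊤ := by
    rw [eq_top_iff, ← hs, Submodule.span_le]
    rintro _ ⟨k, rfl⟩
    by_cases hk : d k = μ
    · exact Submodule.mem_sup_left (Submodule.subset_span ⟨k, hk, rfl⟩)
    · refine Submodule.mem_sup_right ?_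
      exact Submodule.mem_iSup_of_mem (d k) (Submodule.mem_iSup_of_mem hk (hx k))
  intro v hv
  have hv' : v ∈ P ⊔ ⨆ ν, ⨆ (_ : ν ≠ μ), D.wt ν := by rw [htop]; trivial
  obtain ⟨p, hp, q, hq, hpq⟩ := Submodule.mem_sup.1 hv'
  have hqm : q ∈ D.wt μ := by
    have : q = v - p := by rw [← hpq]; abel
    rw [this]; exact sub_mem hv (hPle hp)
  have : q = 0 := Submodule.disjoint_def.1 (D.ind μ) q hqm hq
  rw [← hpq, this, add_zero]; exact hp

variable [FiniteDimensional K V]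

theorem exists_hw [Nontrivial V] : ∃ lam, ∃ v0 ∈ D.wt lam, v0 ≠ 0 ∧ ∀ i, D.e i v0 = 0 := by
  have hne : {μ | D.wt μ ≠ ⊥}.Nonempty := by
    by_contra h
    rw [Set.not_nonempty_iff_eq_empty, Set.eq_empty_iff_forall_notMem] at h
    have : (⊤ : Submodule K V) = ⊥ := by
      rw [← D.top, iSup_eq_bot]; intro μ; simpa using h μ
    exact top_ne_bot this
  obtain ⟨lam, hlam, hmax⟩ := Set.exists_max_image _ (fun μ => D.W.hr μ) D.fin hne
  obtain ⟨v0, hv0, hne0⟩ := (Submodule.ne_bot_iff _).1 hlam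
  refine ⟨lam, v0, hv0, hne0, fun i => ?_⟩
  by_contra h
  have := hmax (lam + D.W.a i) ((Submodule.ne_bot_iff _).2 ⟨_, D.e_wt i hv0, h⟩)
  simp only [map_add, D.W.hr_a] at this
  omega

theorem hw_nonneg {v0 lam} (h0 : v0 ∈ D.wt lam) (hne : v0 ≠ 0) (he : ∀ i, D.e i v0 = 0) (i) :
    0 ≤ lam i := by
  obtain ⟨k, hk1, hk2⟩ := D.nilp i
  exact (D.slT i).prim_nonneg hk2 hne (D.h_wt i h0) (he i)

theorem hw_one {v0 lam} (h0 : v0 ∈ D.wt lam) (hne : v0 ≠ 0) (he : ∀ i, D.e i v0 = 0) :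
    D.m lam = 1 := by
  have h1 := D.span_homog _ _ (D.wv_wt h0) (D.span_wv h0 hne he) lam
  have h2 : D.wv v0 '' {l | lam - (l.map D.W.a).sum = lam} = {v0} := by
    ext v
    constructor
    · rintro ⟨l, hl, rfl⟩
      rcases l with _ | ⟨i, l⟩
      · rfl
      · exact absurd (by simpa using hl) (D.W.hr_ne i l)
    · rintro rfl; exact ⟨[], by simp, rfl⟩
  rw [h2] at h1
  have h3 : D.wt lam = K ∙ v0 := le_antisymm h1 (by simpa using h0)
  rw [m, h3, finrank_span_singleton hne]

theorem hw_le {v0 lam} (h0 : v0 ∈ D.wt lam) (hne : v0 ≠ 0) (he : ∀ i, D.e i v0 = 0) (μ)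
    (hμ : D.m μ ≠ 0) : D.W.Qp (lam - μ) := by
  rw [D.m_ne] at hμ
  have h1 := D.span_homog _ _ (D.wv_wt h0) (D.span_wv h0 hne he) μ
  have h2 : ∃ l, lam - ((l : List ι).map D.W.a).sum = μ := by
    by_contra hcon
    push Not at hcon
    have : {l : List ι | lam - (l.map D.W.a).sum = μ} = ∅ := by
      ext l; simpa using hcon l
    rw [this] at h1
    exact hμ (by simpa using h1)
  obtain ⟨l, rfl⟩ := h2
  rw [sub_sub_cancel]
  clear h1 hμ
  induction l with
  | nil => simpa using D.W.Qp_zero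
  | cons i l ih =>
    simp only [List.map_cons, List.sum_cons]
    exact D.W.Qp_add ⟨Pi.single i 1, by simp [Pi.single_apply]⟩ ih

/-- multiplicity as a finsupp -/
noncomputable def mf : (ι → ℤ) →₀ ℕ := Finsupp.onFinset D.fin.toFinset D.m (fun μ hμ => by
  simpa using D.m_ne.1 hμ)

theorem EG_wt {β} (hβ : β ∈ D.W.Pos) (μ) : ∀ v ∈ D.wt μ, (D.E β * D.G β) v ∈ D.wt μ := by
  intro v hv
  have := D.Ewt β hβ _ _ (D.Gwt β hβ _ _ hv)
  simpa using this

theorem GE_wt {β} (hβ : β ∈ D.W.Pos) (μ) : ∀ v ∈ D.wt μ, (D.G β * D.E β) v ∈ D.wt μ := by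
  intro v hv
  have := D.Gwt β hβ _ _ (D.Ewt β hβ _ _ hv)
  simpa using this

open Classical in
/-- partial traces -/
noncomputable def t (β μ : ι → ℤ) : K :=
  if hβ : β ∈ D.W.Pos then
    LinearMap.trace K _ (LinearMap.restrict (D.E β * D.G β) (D.EG_wt hβ μ)) else 0

theorem t_zero {β μ} (h : D.m μ = 0) : D.t β μ = 0 := by
  unfold t
  split_ifs with hβ
  · have : Subsingleton (D.wt μ) := by
      rw [m] at h; exact finrank_zero_iff.1 h
    rw [Subsingleton.elim (LinearMap.restrict (D.E β * D.G β) (D.EG_wt hβ μ)) 0, map_zero]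
  · rfl

theorem trace_GE {β μ} (hβ : β ∈ D.W.Pos) :
    LinearMap.trace K _ (LinearMap.restrict (D.G β * D.E β) (D.GE_wt hβ μ)) = D.t β (μ + β) := by
  have hG : ∀ v ∈ D.wt (μ + β), D.G β v ∈ D.wt μ := fun v hv => by
    simpa using D.Gwt β hβ _ _ hv
  have e1 : LinearMap.restrict (D.G β * D.E β) (D.GE_wt hβ μ) =
      LinearMap.restrict (D.G β) hG ∘ₗ LinearMap.restrict (D.E β) (D.Ewt β hβ μ) := by
    ext v; simp
  have e2 : LinearMap.restrict (D.E β * D.G β) (D.EG_wt hβ (μ + β)) =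
      LinearMap.restrict (D.E β) (D.Ewt β hβ μ) ∘ₗ LinearMap.restrict (D.G β) hG := by
    ext v; simp
  rw [e1, LinearMap.trace_comp_comm', ← e2, t, dif_pos hβ]

theorem t_sub {β μ} (hβ : β ∈ D.W.Pos) :
    D.t β μ - D.t β (μ + β) = (D.W.B μ β : K) * (D.m μ : K) := by
  rw [← D.trace_GE hβ, t, dif_pos hβ, ← map_sub]
  have : LinearMap.restrict (D.E β * D.G β) (D.EG_wt hβ μ) -
      LinearMap.restrict (D.G β * D.E β) (D.GE_wt hβ μ) = (D.W.B μ β : K) • LinearMap.id := by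
    ext v; simpa using D.EG β hβ μ v v.2
  rw [this, map_smul, LinearMap.trace_id, smul_eq_mul, m]

theorem t_cas (μ) : D.c * (D.m μ : K) = (D.W.B μ μ : K) * (D.m μ : K) +
    ∑ β ∈ D.W.Pos, (D.t β μ + D.t β (μ + β)) := by
  have : D.c • (LinearMap.id : D.wt μ →ₗ[K] D.wt μ) = (D.W.B μ μ : K) • LinearMap.id +
      ∑ β : D.W.Pos, (LinearMap.restrict (D.E β * D.G β) (D.EG_wt β.2 μ) +
        LinearMap.restrict (D.G β * D.E β) (D.GE_wt β.2 μ)) := by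
    ext v
    have := D.cas μ v v.2
    rw [← Finset.sum_coe_sort] at this
    simpa using this.symm
  have h2 := congrArg (LinearMap.trace K _) this
  rw [map_add, map_smul, map_smul, map_sum, LinearMap.trace_id, smul_eq_mul, smul_eq_mul] at h2
  rw [m, h2, ← Finset.sum_coe_sort D.W.Pos]
  congr 1
  refine Finset.sum_congr rfl fun β _ => ?_
  rw [map_add, D.trace_GE β.2]
  congr 1
  rw [t, dif_pos β.2]

theorem finrank_eq : (D.mf.sum fun _ k => k) = finrank K V := by
  classical
  have h1 : DirectSum.IsInternal D.wt := by
    rw [DirectSum.isInternal_submodule_iff_iSupIndep_and_iSup_eq_top]; exact ⟨D.ind, D.top⟩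
  have h2 := LinearMap.trace_eq_sum_trace_restrict' h1 D.fin (f := (LinearMap.id : V →ₗ[K] V))
    (fun μ v hv => hv)
  rw [LinearMap.trace_id] at h2
  have h3 : ∀ (μ) (hh : ∀ v ∈ D.wt μ, (LinearMap.id : V →ₗ[K] V) v ∈ D.wt μ),
      LinearMap.trace K (D.wt μ) (LinearMap.restrict (LinearMap.id : V →ₗ[K] V) hh) =
      (D.m μ : K) := by
    intro μ hh
    have : LinearMap.restrict (LinearMap.id : V →ₗ[K] V) hh = LinearMap.id := by ext; simp
    rw [this, LinearMap.trace_id, m]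
  rw [Finset.sum_congr rfl fun μ _ => h3 μ _] at h2
  have h4 : (D.mf.sum fun _ k => k) = ∑ μ ∈ D.fin.toFinset, D.m μ :=
    Finsupp.onFinset_sum _ (fun _ => rfl)
  rw [h4]
  exact_mod_cast h2.symm

theorem wdf {v0 lam} (h0 : v0 ∈ D.wt lam) (hne : v0 ≠ 0) (he : ∀ i, D.e i v0 = 0) :
    (finrank K V : ℤ) * D.W.π WData.ρ = D.W.π (lam + WData.ρ) := by
  rw [← D.finrank_eq]
  refine D.W.weyl_dim (𝕜 := K) D.mf
    (fun β => Finsupp.onFinset D.fin.toFinset (D.t β) (fun μ hμ => by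
      rw [Set.Finite.mem_toFinset]; exact D.m_ne.1 (fun h => hμ (D.t_zero h))))
    D.c lam (fun i μ => D.m_s i μ) (D.hw_nonneg h0 hne he) (D.hw_one h0 hne he)
    (D.hw_le h0 hne he) (fun β _ μ h => D.t_zero h) (fun β hβ μ => D.t_sub hβ) (fun μ => D.t_cas μ)

end VData

end

section
open Module

namespace WData
variable {ι : Type*} [Fintype ι] [DecidableEq ι] (W : WData ι)

/-- Lemma D hypothesis -/
def LemD : Prop := ∀ γ ∈ W.Pos, ∀ i, W.co γ (Pi.single i 1) ≠ 0 →
  W.co γ ρ ≤ ((W.Pos.filter fun δ => W.co δ (Pi.single i 1) ≠ 0).card : ℤ)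

theorem single_nonneg (i : ι) : ∀ j, (0 : ℤ) ≤ (Pi.single i 1 : ι → ℤ) j := by
  intro j
  by_cases h : j = i
  · subst h; simp
  · simp [h]

theorem le_hr (hD : W.LemD) {n : ℕ} (hn : n.Prime) {lam : ι → ℤ} (hl : ∀ i, 0 ≤ lam i)
    (hw : (n : ℤ) * W.π ρ = W.π (lam + ρ)) : (n : ℤ) ≤ W.hr lam + 1 := by
  have hρ : ∀ β ∈ W.Pos, 0 < W.co β ρ := fun β hβ => W.co_pos hβ (fun i => by simp [ρ])
  have e1 : W.π ρ = (∏ β ∈ W.Pos.filter (fun β => W.co β lam = 0), W.co β ρ) *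
      ∏ β ∈ W.Pos.filter (fun β => ¬ W.co β lam = 0), W.co β ρ :=
    (Finset.prod_filter_mul_prod_filter_not _ _ _).symm
  have e2 : W.π (lam + ρ) = (∏ β ∈ W.Pos.filter (fun β => W.co β lam = 0), W.co β ρ) *
      ∏ β ∈ W.Pos.filter (fun β => ¬ W.co β lam = 0), W.co β (lam + ρ) := by
    rw [π, ← Finset.prod_filter_mul_prod_filter_not _ (fun β => W.co β lam = 0)]
    congr 1
    refine Finset.prod_congr rfl fun β hβ => ?_
    rw [map_add, (Finset.mem_filter.1 hβ).2, zero_add]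
  have h0 : (∏ β ∈ W.Pos.filter (fun β => W.co β lam = 0), W.co β ρ) ≠ 0 :=
    (Finset.prod_pos fun β hβ => hρ β (Finset.mem_filter.1 hβ).1).ne'
  rw [e1, e2, mul_left_comm] at hw
  have hw := mul_left_cancel₀ h0 hw
  have hdvd : (n : ℤ) ∣ ∏ β ∈ W.Pos.filter (fun β => ¬ W.co β lam = 0), W.co β (lam + ρ) :=
    ⟨_, hw.symm⟩
  rw [(Nat.prime_iff_prime_int.1 hn).dvd_finset_prod_iff] at hdvd
  obtain ⟨β, hβ, hd⟩ := hdvd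
  rw [Finset.mem_filter] at hβ
  have hpos : 0 < W.co β lam := lt_of_le_of_ne (W.co_nonneg hβ.1 hl) (Ne.symm hβ.2)
  have hle := Int.le_of_dvd (by rw [map_add]; have := hρ β hβ.1; omega) hd
  rw [map_add] at hle
  obtain ⟨i, hi1, hi2⟩ : ∃ i, lam i ≠ 0 ∧ W.co β (Pi.single i 1) ≠ 0 := by
    by_contra hcon
    push Not at hcon
    apply hβ.2
    rw [map_eq]
    refine Finset.sum_eq_zero fun i _ => ?_
    by_cases h : lam i = 0
    · simp [h]
    · simp [hcon i h]
  have hD1 := hD β hβ.1 i hi2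
  set S := W.Pos.filter fun δ => W.co δ (Pi.single i 1) ≠ 0 with hS
  have hβS : β ∈ S := Finset.mem_filter.2 ⟨hβ.1, hi2⟩
  have hge : ∀ δ ∈ S, 1 ≤ W.co δ lam := by
    intro δ hδ
    rw [hS, Finset.mem_filter] at hδ
    rw [map_eq]
    have h1 : ∀ j ∈ Finset.univ, 0 ≤ lam j * W.co δ (Pi.single j 1) := fun j _ =>
      mul_nonneg (hl j) (W.co_nonneg hδ.1 (single_nonneg j))
    refine le_trans ?_ (Finset.single_le_sum h1 (Finset.mem_univ i))
    have h2 := W.co_nonneg hδ.1 (single_nonneg i)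
    have h3 := hl i
    have := mul_pos (lt_of_le_of_ne h3 (Ne.symm hi1)) (lt_of_le_of_ne h2 (Ne.symm hδ.2))
    omega
  have h2 : W.hr lam ≥ ∑ δ ∈ S, W.co δ lam := by
    rw [hr_apply]
    exact Finset.sum_le_sum_of_subset_of_nonneg (Finset.filter_subset _ _)
      (fun δ hδ _ => W.co_nonneg hδ hl)
  rw [← Finset.add_sum_erase _ _ hβS] at h2
  have h3 : ∑ δ ∈ S.erase β, W.co δ lam ≥ ((S.erase β).card : ℤ) := by
    have := Finset.card_nsmul_le_sum (S.erase β) (fun δ => W.co δ lam) 1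
      (fun δ hδ => hge δ (Finset.mem_of_mem_erase hδ))
    simpa using this
  have h4 := Finset.card_erase_add_one hβS
  have h5 : ((S.erase β).card : ℤ) + 1 = S.card := by exact_mod_cast h4
  omega

end WData

namespace VData
variable {K V ι : Type*} [Field K] [CharZero K] [AddCommGroup V] [Module K V] [Fintype ι]
  [DecidableEq ι] (D : VData K V ι)

/-- principal raising operator -/
def EE : Module.End K V := ∑ i, D.e i
/-- principal lowering operator -/
def FF : Module.End K V := ∑ i, (D.W.cf i : K) • D.f i
/-- principal Cartan operator -/
def HH : Module.End K V := D.EE * D.FF - D.FF * D.EE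

theorem HH_wt {μ v} (hv : v ∈ D.wt μ) : D.HH v = ((D.W.hr μ : ℤ) : K) • v := by
  simp only [HH, EE, FF, LinearMap.sub_apply, Module.End.mul_apply, LinearMap.sum_apply,
    LinearMap.smul_apply, map_sum, map_smul]
  have : ∀ i j, D.e i (D.f j v) = D.f j (D.e i v) + (if i = j then ((μ i : ℤ) : K) else 0) • v :=
    fun i j => D.e_f i j hv
  simp only [this, smul_add, Finset.sum_add_distrib, ite_smul, zero_smul, smul_ite, smul_zero,
    Finset.sum_ite_eq', Finset.sum_ite_eq, Finset.mem_univ, if_true]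
  rw [Finset.sum_comm, WData.map_eq]
  simp only [Finset.smul_sum]
  rw [add_sub_cancel_left]
  push_cast
  rw [Finset.sum_smul]
  refine Finset.sum_congr rfl fun i _ => ?_
  rw [smul_smul, WData.cf, mul_comm]

theorem slTT : SlTriple D.HH D.EE D.FF where
  ef := rfl
  he := by
    refine D.ext_wt fun μ v hv => ?_
    simp only [LinearMap.sub_apply, Module.End.mul_apply, LinearMap.smul_apply]
    rw [D.HH_wt hv, map_smul]
    simp only [EE, LinearMap.sum_apply, map_sum, Finset.smul_sum]
    rw [← Finset.sum_sub_distrib]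
    refine Finset.sum_congr rfl fun i _ => ?_
    rw [D.HH_wt (D.e_wt i hv), ← sub_smul]
    congr 1; simp [D.W.hr_a]
  hf := by
    refine D.ext_wt fun μ v hv => ?_
    simp only [LinearMap.sub_apply, Module.End.mul_apply, LinearMap.smul_apply]
    rw [D.HH_wt hv, map_smul]
    simp only [FF, LinearMap.sum_apply, map_sum, Finset.smul_sum, LinearMap.smul_apply, map_smul]
    rw [← Finset.sum_sub_distrib]
    refine Finset.sum_congr rfl fun i _ => ?_
    rw [D.HH_wt (D.f_wt i hv), smul_comm, smul_comm _ (D.W.cf i : K) (D.f i v),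
      smul_comm _ (D.W.cf i : K) (D.f i v), ← smul_sub, ← sub_smul,
      smul_comm (-2 : K)]
    congr 2; simp [D.W.hr_a]

variable [FiniteDimensional K V]

/-- Thin chain. -/
theorem exists_thin (hD : D.W.LemD) (hp : (finrank K V).Prime) :
    ∃ (N : ℕ) (lam : ι → ℤ) (v0 : V), finrank K V = N + 1 ∧ v0 ∈ D.wt lam ∧ v0 ≠ 0 ∧
      (∀ i, D.e i v0 = 0) ∧ D.W.hr lam = N ∧ ∀ k ≤ N, (D.FF ^ k) v0 ≠ 0 := by
  have : Nontrivial V := by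
    apply Module.nontrivial_of_finrank_pos (R := K); exact hp.pos
  obtain ⟨lam, v0, h0, hne, he⟩ := D.exists_hw
  have hl := D.hw_nonneg h0 hne he
  have h1 := D.W.le_hr hD hp hl (D.wdf h0 hne he)
  obtain ⟨N, hN⟩ : ∃ N : ℕ, D.W.hr lam = N :=
    ⟨(D.W.hr lam).toNat, by have := hp.pos; omega⟩
  have hh : D.HH v0 = (N : K) • v0 := by rw [D.HH_wt h0, hN]; simp
  have hE : D.EE v0 = 0 := by simp [EE, he]
  have hF : ∀ k ≤ N, (D.FF ^ k) v0 ≠ 0 := fun k hk h => hne (D.slTT.inj_prim hh hE k hk h)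
  refine ⟨N, lam, v0, le_antisymm (by omega) ?_, h0, hne, he, hN, hF⟩
  have := End.eigenvectors_linearIndependent' D.HH (fun k : Fin (N+1) => (N : K) - 2 * (k : ℕ))
    (by
      intro j k hjk
      simp only [sub_right_inj, mul_eq_mul_left_iff, Nat.cast_inj, OfNat.ofNat_ne_zero,
        or_false] at hjk
      exact Fin.ext hjk) (fun k => (D.FF ^ (k : ℕ)) v0)
    (fun k => ⟨by rw [End.mem_eigenspace_iff]; exact D.slTT.h_f_pow hh k, hF k (by omega)⟩)
  have := this.fintype_card_le_finrank
  simpa using this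

end VData

end

section
open Module

/-- A thin chain of weight vectors for `VData`. -/
structure VChain {K V ι : Type*} [Field K] [AddCommGroup V] [Module K V] [Fintype ι]
    [DecidableEq ι] (D : VData K V ι) (N : ℕ) (x : ℕ → V) (w : ℕ → ι) (μ : ℕ → ι → ℤ) : Prop where
  mem : ∀ k ≤ N, x k ∈ D.wt (μ k)
  ne : ∀ k ≤ N, x k ≠ 0
  step : ∀ k < N, μ (k+1) = μ k - D.W.a (w (k+1))
  fw : ∀ k < N, ((D.W.cf (w (k+1)) : ℤ) : K) • D.f (w (k+1)) (x k) = x (k+1)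
  fo : ∀ k < N, ∀ i, w (k+1) ≠ i → D.f i (x k) = 0
  fN : ∀ i, D.f i (x N) = 0
  ew : ∀ k < N, D.e (w (k+1)) (x (k+1)) = (((k : K) + 1) * ((N : K) - k)) • x k
  eo : ∀ k < N, ∀ i, w (k+1) ≠ i → D.e i (x (k+1)) = 0
  e0 : ∀ i, D.e i (x 0) = 0
  li : LinearIndependent K (fun k : Fin (N+1) => x k)

namespace VData
variable {K V ι : Type*} [Field K] [CharZero K] [AddCommGroup V] [Module K V] [Fintype ι]
  [DecidableEq ι] (D : VData K V ι) [FiniteDimensional K V]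

theorem exists_chain (hD : D.W.LemD) (hp : (finrank K V).Prime) :
    ∃ (N : ℕ) (x : ℕ → V) (w : ℕ → ι) (μ : ℕ → ι → ℤ), finrank K V = N + 1 ∧
      VChain D N x w μ := by
  classical
  obtain ⟨N, lam, v0, hfin, h0, hne, he, hN, hF⟩ := D.exists_thin hD hp
  set x : ℕ → V := fun k => (D.FF ^ k) v0 with hx
  have hh : D.HH v0 = (N : K) • v0 := by rw [D.HH_wt h0, hN]; simp
  have hE : D.EE v0 = 0 := by simp [EE, he]
  have hxh : ∀ k, D.HH (x k) = ((N : K) - 2 * k) • x k := fun k => D.slTT.h_f_pow hh k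
  have hli : LinearIndependent K (fun k : Fin (N+1) => x k) := 
    End.eigenvectors_linearIndependent' D.HH (fun k : Fin (N+1) => (N : K) - 2 * (k : ℕ))
    (by
      intro j k hjk
      simp only [sub_right_inj, mul_eq_mul_left_iff, Nat.cast_inj, OfNat.ofNat_ne_zero,
        or_false] at hjk
      exact Fin.ext hjk) (fun k => x k)
    (fun k => ⟨by rw [End.mem_eigenspace_iff]; exact hxh k, hF k (by omega)⟩)
  let bs : Basis (Fin (N+1)) K V := basisOfLinearIndependentOfCardEqFinrank hli (by simp [hfin])
  have hbs : ∀ k, bs k = x k := fun k => by simp [bs]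
  -- eigenvectors
  have heig : ∀ (q : K) (v : V), D.HH v = q • v → ∀ j : Fin (N+1), (N : K) - 2 * (j : ℕ) ≠ q →
      bs.repr v j = 0 := by
    intro q v hv j hj
    have e1 : D.HH v = ∑ k, (bs.repr v k * ((N : K) - 2 * (k : ℕ))) • bs k := by
      conv_lhs => rw [← bs.sum_repr v, map_sum]
      refine Finset.sum_congr rfl fun k _ => ?_
      rw [map_smul, hbs, hxh, smul_smul]
    have e2 := congrArg (fun y => bs.repr y j) e1
    simp only [bs.repr_sum_self] at e2
    rw [hv, map_smul] at e2
    simp only [Finsupp.smul_apply, smul_eq_mul] at e2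
    have : ((N : K) - 2 * (j : ℕ) - q) * bs.repr v j = 0 := by linear_combination -e2
    rcases mul_eq_zero.1 this with h | h
    · exact absurd (sub_eq_zero.1 h) hj
    · exact h
  have heigk : ∀ (k : ℕ) (hk : k ≤ N) (v : V), D.HH v = ((N : K) - 2 * k) • v →
      ∃ c : K, v = c • x k := by
    intro k hk v hv
    refine ⟨bs.repr v ⟨k, by omega⟩, ?_⟩
    conv_lhs => rw [← bs.sum_repr v]
    rw [Finset.sum_eq_single ⟨k, by omega⟩]
    · rw [hbs]
    · intro j _ hj
      rw [heig _ v hv j, zero_smul]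
      intro h
      apply hj
      simp only [sub_right_inj, mul_eq_mul_left_iff, Nat.cast_inj, OfNat.ofNat_ne_zero,
        or_false] at h
      exact Fin.ext h
    · simp
  have heig0 : ∀ (v : V), D.HH v = ((N : K) - 2 * (N + 1)) • v → v = 0 := by
    intro v hv
    rw [← bs.sum_repr v]
    refine Finset.sum_eq_zero fun j _ => ?_
    rw [heig _ v hv j, zero_smul]
    intro h
    simp only [sub_right_inj, mul_eq_mul_left_iff, OfNat.ofNat_ne_zero, or_false] at h
    have : (j : ℕ) = N + 1 := by exact_mod_cast h
    omega
  have hFs : ∀ k, x (k+1) = ∑ i, (D.W.cf i : K) • D.f i (x k) := by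
    intro k
    simp only [hx]
    rw [pow_succ', Module.End.mul_apply]
    simp [FF]
  have hfe : ∀ k (ν : ι → ℤ), x k ∈ D.wt ν → ∀ i, D.HH (D.f i (x k)) =
      ((N : K) - 2 * ((k+1 : ℕ))) • D.f i (x k) := by
    intro k ν hν i
    by_cases hz : D.f i (x k) = 0
    · simp [hz]
    have hz' : x k ≠ 0 := fun h => hz (by simp [h])
    have h1 := D.HH_wt hν
    rw [hxh] at h1
    have h2 := smul_left_injective K hz' h1
    rw [D.HH_wt (D.f_wt i hν), map_sub, D.W.hr_a]
    congr 1; push_cast; rw [← h2]; ring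
  have key : ∀ k < N, ∀ ν, x k ∈ D.wt ν → ∃ i, x (k+1) ∈ D.wt (ν - D.W.a i) ∧
      (D.W.cf i : K) • D.f i (x k) = x (k+1) ∧ ∀ j, i ≠ j → D.f j (x k) = 0 := by
    intro k hk ν hν
    have hc : ∀ i, ∃ c : K, D.f i (x k) = c • x (k+1) := fun i =>
      heigk (k+1) (by omega) _ (hfe k ν hν i)
    obtain ⟨i, hi⟩ : ∃ i, D.f i (x k) ≠ 0 := by
      by_contra hcon
      push Not at hcon
      exact hF (k+1) (by omega) (by have := hFs k; simpa [hcon] using this)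
    have hm : ∀ i, D.f i (x k) ≠ 0 → x (k+1) ∈ D.wt (ν - D.W.a i) := by
      intro i hi
      obtain ⟨c, hc⟩ := hc i
      have h1 := D.f_wt i hν
      rw [hc] at h1 hi
      have hc0 : c ≠ 0 := fun h => hi (by simp [h])
      exact (Submodule.smul_mem_iff _ hc0).1 h1
    have ho : ∀ j, i ≠ j → D.f j (x k) = 0 := by
      intro j hij
      by_contra hj
      have := D.eq_of_mem (hm i hi) (hm j hj) (hF (k+1) (by omega))
      exact hij (D.a_inj (sub_right_injective this))
    refine ⟨i, hm i hi, ?_, ho⟩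
    rw [hFs k, Finset.sum_eq_single i]
    · intro j _ hj; rw [ho j (Ne.symm hj), smul_zero]
    · simp
  have : Nonempty ι := by
    by_contra hcon
    rw [not_nonempty_iff] at hcon
    have h1 : D.FF = 0 := by simp [FF]
    have h2 : N = 0 := by
      by_contra h
      exact hF 1 (by omega) (by simp [h1])
    rw [h2] at hfin
    rw [hfin] at hp
    exact absurd hp (by norm_num)
  choose! nx hnx1 hnx2 hnx3 using key
  let μ : ℕ → ι → ℤ := fun k => Nat.rec lam (fun k ν => ν - D.W.a (nx k ν)) k
  let w : ℕ → ι := fun k => nx (k-1) (μ (k-1))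
  have hμ : ∀ k, μ (k+1) = μ k - D.W.a (w (k+1)) := fun k => rfl
  have hmem : ∀ k ≤ N, x k ∈ D.wt (μ k) := by
    intro k
    induction k with
    | zero => intro _; simpa [hx, μ] using h0
    | succ k ih => intro hk; exact hnx1 k (by omega) _ (ih (by omega))
  have hEx : ∀ k, D.EE (x (k+1)) = (((k : K) + 1) * ((N : K) - k)) • x k := by
    intro k
    have := D.slTT.e_f_pow hh k
    rw [hE, map_zero, zero_add] at this
    exact this
  have hhr : ∀ k ≤ N, ((D.W.hr (μ k) : ℤ) : K) = (N : K) - 2 * k := by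
    intro k hk
    have h1 := D.HH_wt (hmem k hk)
    rw [hxh] at h1
    exact (smul_left_injective K (hF k hk) h1).symm
  have heo : ∀ k < N, ∀ i, w (k+1) ≠ i → D.e i (x (k+1)) = 0 := by
    intro k hk i hi
    by_contra hz
    have h1 := D.e_wt i (hmem (k+1) (by omega))
    have h2 := D.HH_wt h1
    rw [map_add, D.W.hr_a] at h2
    push_cast at h2
    rw [hhr (k+1) (by omega)] at h2
    obtain ⟨c, hc⟩ := heigk k hk.le (D.e i (x (k+1))) (by rw [h2]; congr 1; push_cast; ring)
    rw [hc] at h1 hz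
    have hc0 : c ≠ 0 := fun h => hz (by simp [h])
    have h3 := D.eq_of_mem ((Submodule.smul_mem_iff _ hc0).1 h1) (hmem k hk.le) (hF k hk.le)
    rw [hμ, sub_add, sub_eq_self, sub_eq_zero] at h3
    exact hi (D.a_inj h3)
  refine ⟨N, x, w, μ, hfin, ⟨hmem, hF, fun k _ => hμ k, ?_, ?_, ?_, ?_, heo, ?_, hli⟩⟩
  · intro k hk; exact hnx2 k hk _ (hmem k hk.le)
  · intro k hk i hi; exact hnx3 k hk _ (hmem k hk.le) i hi
  · intro i
    apply heig0
    have := hfe N _ (hmem N le_rfl) i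
    push_cast at this; exact this
  · intro k hk
    rw [← hEx k, EE, LinearMap.sum_apply, Finset.sum_eq_single (w (k+1))]
    · intro i _ hi; exact heo k hk i (Ne.symm hi)
    · simp
  · intro i; simpa [hx] using he i

end VData

end

section
open Module

namespace VChain
variable {K V ι : Type*} [Field K] [CharZero K] [AddCommGroup V] [Module K V] [Fintype ι]
  [DecidableEq ι] {D : VData K V ι} {N : ℕ} {x : ℕ → V} {w : ℕ → ι} {μ : ℕ → ι → ℤ}

theorem cfK (D : VData K V ι) (i : ι) : ((D.W.cf i : ℤ) : K) ≠ 0 := by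
  have := (D.W.cf_pos i).ne'
  exact_mod_cast this

theorem f_run (C : VChain D N x w μ) {k : ℕ} (hk : k ≤ N) (i : ι) (j : ℕ)
    (hj : (D.f i ^ j) (x k) ≠ 0) : k + j ≤ N ∧ (∀ l, k < l → l ≤ k + j → w l = i) ∧
      ∃ c : K, c ≠ 0 ∧ (D.f i ^ j) (x k) = c • x (k + j) := by
  induction j with
  | zero => exact ⟨by omega, fun l h1 h2 => by omega, 1, one_ne_zero, by simp⟩
  | succ j ih =>
    rw [pow_succ', Module.End.mul_apply] at hj
    obtain ⟨h1, h2, c, hc, h3⟩ := ih (fun h => hj (by simp [h]))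
    rw [h3, map_smul] at hj
    have hlt : k + j < N := by
      rcases h1.lt_or_eq with h | h
      · exact h
      · rw [h, C.fN, smul_zero] at hj; exact absurd rfl hj
    have hw : w (k + j + 1) = i := by
      by_contra hw
      rw [C.fo _ hlt i hw, smul_zero] at hj; exact hj rfl
    refine ⟨by omega, ?_, c * ((D.W.cf i : ℤ) : K)⁻¹, mul_ne_zero hc (inv_ne_zero (cfK D i)), ?_⟩
    · intro l h4 h5
      rcases Nat.lt_or_ge (k + j) l with h | h
      · rw [show l = k + j + 1 by omega]; exact hw
      · exact h2 l h4 h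
    · rw [pow_succ', Module.End.mul_apply, h3, map_smul, ← add_assoc, ← C.fw _ hlt, hw,
        mul_smul, inv_smul_smul₀ (cfK D i)]

theorem e_run (C : VChain D N x w μ) {k : ℕ} (hk : k ≤ N) (i : ι) (j : ℕ)
    (hj : (D.e i ^ j) (x k) ≠ 0) : j ≤ k ∧ (∀ l, k < l + j → l ≤ k → w l = i) ∧
      ∃ c : K, c ≠ 0 ∧ (D.e i ^ j) (x k) = c • x (k - j) := by
  induction j with
  | zero => exact ⟨by omega, fun l h1 h2 => by omega, 1, one_ne_zero, by simp⟩
  | succ j ih =>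
    rw [pow_succ', Module.End.mul_apply] at hj
    obtain ⟨h1, h2, c, hc, h3⟩ := ih (fun h => hj (by simp [h]))
    rw [h3, map_smul] at hj
    have hlt : j < k := by
      rcases h1.lt_or_eq with h | h
      · exact h
      · rw [h, Nat.sub_self, C.e0, smul_zero] at hj; exact absurd rfl hj
    obtain ⟨l, hl⟩ : ∃ l, k - j = l + 1 := ⟨k - j - 1, by omega⟩
    rw [hl] at h3 hj
    have hw : w (l + 1) = i := by
      by_contra hw
      rw [C.eo l (by omega) i hw, smul_zero] at hj; exact hj rfl
    refine ⟨by omega, ?_, c * (((l : K) + 1) * ((N : K) - l)), ?_, ?_⟩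
    · intro l' h4 h5
      rcases Nat.lt_or_ge k (l' + j) with h | h
      · exact h2 l' h h5
      · rw [show l' = l + 1 by omega]; exact hw
    · refine mul_ne_zero hc (mul_ne_zero (Nat.cast_add_one_ne_zero l) ?_)
      rw [sub_ne_zero]
      have : N ≠ l := by omega
      exact_mod_cast this
    · rw [pow_succ', Module.End.mul_apply, h3, map_smul, ← hw, C.ew l (by omega), smul_smul,
        show k - (j + 1) = l by omega]

variable [FiniteDimensional K V]

theorem chainData (C : VChain D N x w μ) : ChainData (fun i j => D.W.a j i) N w μ where
  step k hk i := by rw [C.step k hk]; rfl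
  T k hk i hi := by
    obtain ⟨M, hM1, hM2⟩ := D.nilp i
    have he : D.e i (x k) = 0 := by
      rcases k with _ | k
      · exact C.e0 i
      · rcases hi with h | h
        · omega
        · exact C.eo k (by omega) i h
    have hh := D.h_wt i (C.mem k hk)
    have hnn := (D.slT i).prim_nonneg hM2 (C.ne k hk) hh he
    obtain ⟨m, hm⟩ := Int.eq_ofNat_of_zero_le hnn
    rw [hm] at hh
    have hh' : D.h i (x k) = (m : K) • x k := by simpa using hh
    have hnz : (D.f i ^ m) (x k) ≠ 0 := fun h =>
      C.ne k hk ((D.slT i).inj_prim hh' he m le_rfl h)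
    obtain ⟨h1, h2, c, hc, h3⟩ := C.f_run hk i m hnz
    refine ⟨m, hm, h1, h2, fun hlt hw => ?_⟩
    have h4 := (D.slT i).prim_f_succ hM2 hh' he
    rw [pow_succ', Module.End.mul_apply, h3, map_smul] at h4
    have h5 := C.fw _ hlt
    rw [hw, (smul_eq_zero.1 h4).resolve_left hc, smul_zero] at h5
    exact C.ne _ (by omega) h5.symm
  T' k hk i hi := by
    obtain ⟨M, hM1, hM2⟩ := D.nilp i
    have he : D.f i (x k) = 0 := by
      rcases hi with h | h
      · rw [h]; exact C.fN i
      · rcases hk.lt_or_eq with h' | h'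
        · exact C.fo k h' i h
        · rw [h']; exact C.fN i
    have hh := D.h_wt i (C.mem k hk)
    have hh1 : (-D.h i) (x k) = ((-(μ k i) : ℤ) : K) • x k := by
      rw [LinearMap.neg_apply, hh]; simp
    have hnn := (D.slT i).swap.prim_nonneg hM1 (C.ne k hk) hh1 he
    obtain ⟨m, hm⟩ := Int.eq_ofNat_of_zero_le hnn
    rw [hm] at hh1
    have hh' : (-D.h i) (x k) = (m : K) • x k := by simpa using hh1
    have hnz : (D.e i ^ m) (x k) ≠ 0 := fun h =>
      C.ne k hk ((D.slT i).swap.inj_prim hh' he m le_rfl h)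
    obtain ⟨h1, h2, c, hc, h3⟩ := C.e_run hk i m hnz
    refine ⟨m, by omega, h1, h2, fun hlt hw => ?_⟩
    have h4 := (D.slT i).swap.prim_f_succ hM1 hh' he
    rw [pow_succ', Module.End.mul_apply, h3, map_smul] at h4
    obtain ⟨l, hl⟩ : ∃ l, k - m = l + 1 := ⟨k - m - 1, by omega⟩
    rw [hl] at hw h4
    have h5 := C.ew l (by omega)
    rw [hw, (smul_eq_zero.1 h4).resolve_left hc] at h5
    rcases smul_eq_zero.1 h5.symm with h6 | h6
    · rcases mul_eq_zero.1 h6 with h7 | h7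
      · have : ((l + 1 : ℕ) : K) = 0 := by push_cast; exact h7
        have : l + 1 = 0 := by exact_mod_cast this
        omega
      · rw [sub_eq_zero] at h7
        have : N = l := by exact_mod_cast h7
        omega
    · exact C.ne l (by omega) h6

end VChain

/-- A subspace of matrices closed under commutators containing the simple root vectors contains
all trace zero matrices. -/
theorem mem_of_simple {K : Type*} [Field K] {N : ℕ}
    (S : Submodule K (Matrix (Fin (N+1)) (Fin (N+1)) K))
    (hS : ∀ X ∈ S, ∀ Y ∈ S, X * Y - Y * X ∈ S)
    (h1 : ∀ k : Fin N, Matrix.single k.succ k.castSucc 1 ∈ S)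
    (h2 : ∀ k : Fin N, Matrix.single k.castSucc k.succ 1 ∈ S) :
    ∀ X : Matrix (Fin (N+1)) (Fin (N+1)) K, X.trace = 0 → X ∈ S := by
  have key : ∀ d : ℕ, ∀ i j : Fin (N+1), (i : ℕ) + d + 1 = j →
      Matrix.single i j 1 ∈ S ∧ Matrix.single j i 1 ∈ S := by
    intro d
    induction d with
    | zero =>
      intro i j hij
      have hi : (i : ℕ) < N := by omega
      have e2 : j = (⟨i, hi⟩ : Fin N).succ := by ext; simp; omega
      rw [e2]
      exact ⟨h2 ⟨i, hi⟩, h1 ⟨i, hi⟩⟩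
    | succ d ih =>
      intro i j hij
      obtain ⟨a1, a2⟩ := ih i ⟨j - 1, by omega⟩ (by simp; omega)
      have hl : (j : ℕ) - 1 < N := by omega
      have e1 : (⟨j - 1, by omega⟩ : Fin (N+1)) = (⟨j - 1, hl⟩ : Fin N).castSucc := rfl
      have e2 : j = (⟨j - 1, hl⟩ : Fin N).succ := by ext; simp; omega
      have b1 := h2 ⟨j - 1, hl⟩
      have b2 := h1 ⟨j - 1, hl⟩
      rw [← e2, ← e1] at b1 b2
      have hij' : i ≠ j := by intro h; rw [h] at hij; omega
      have c1 := hS _ a1 _ b1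
      have c2 := hS _ b2 _ a2
      rw [Matrix.single_mul_single_same, Matrix.single_mul_single_of_ne _ _ _ _ hij'.symm] at c1
      rw [Matrix.single_mul_single_same, Matrix.single_mul_single_of_ne _ _ _ _ hij'] at c2
      rw [mul_one, sub_zero] at c1 c2
      exact ⟨c1, c2⟩
  have hoff : ∀ i j : Fin (N+1), i ≠ j → Matrix.single i j 1 ∈ S := by
    intro i j hij
    rcases lt_or_gt_of_ne hij with h | h
    · exact (key (j - i - 1) i j (by have : (i:ℕ) < j := h; omega)).1
    · exact (key (i - j - 1) j i (by have : (j:ℕ) < i := h; omega)).2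
  have hdiag : ∀ i j : Fin (N+1), Matrix.single i i 1 - Matrix.single j j 1 ∈ S := by
    intro i j
    by_cases hij : i = j
    · subst hij; simp
    · have := hS _ (hoff i j hij) _ (hoff j i (Ne.symm hij))
      simpa using this
  intro X hX
  have e : X = ∑ i, ∑ j, (if i = j then X i i • (Matrix.single i i (1 : K) - Matrix.single 0 0 1)
      else X i j • Matrix.single i j (1 : K)) := by
    have e3 : ∀ i, ∑ j, (if i = j then X i i • (Matrix.single i i (1 : K) - Matrix.single 0 0 1)
      else X i j • Matrix.single i j (1 : K)) = ∑ j, Matrix.single i j (X i j) -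
        X i i • Matrix.single 0 0 1 := by
      intro i
      have : X i i • Matrix.single 0 0 (1 : K) =
        ∑ j, if i = j then X i i • Matrix.single (0 : Fin (N+1)) (0 : Fin (N+1)) (1:K) else 0 := by
        simp
      rw [this, ← Finset.sum_sub_distrib]
      refine Finset.sum_congr rfl fun j _ => ?_
      split_ifs with h
      · subst h; rw [smul_sub]; simp
      · simp
    rw [Finset.sum_congr rfl fun i _ => e3 i, Finset.sum_sub_distrib, ← Matrix.matrix_eq_sum_single,
      ← Finset.sum_smul]
    have : ∑ i, X i i = 0 := hX
    rw [this, zero_smul, sub_zero]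
  rw [e]
  refine Submodule.sum_mem _ fun i _ => Submodule.sum_mem _ fun j _ => ?_
  split_ifs with h
  · exact S.smul_mem _ (hdiag i 0)
  · exact S.smul_mem _ (hoff i j h)

namespace VData
variable {K V ι : Type*} [Field K] [CharZero K] [AddCommGroup V] [Module K V] [Fintype ι]
  [DecidableEq ι] (D : VData K V ι) [FiniteDimensional K V]

theorem main (hD : D.W.LemD) (hA : CartanLike (fun i j => D.W.a j i))
    (hp : (finrank K V).Prime) (hp2 : finrank K V ≠ 2) :
    (∀ LL : Submodule K (Module.End K V), (∀ X ∈ LL, ∀ Y ∈ LL, X * Y - Y * X ∈ LL) →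
      (∀ i, D.E (D.W.a i) ∈ LL) → (∀ i, D.G (D.W.a i) ∈ LL) →
      ∀ X, LinearMap.trace K V X = 0 → X ∈ LL) ∨
    ∃ Bf : V →ₗ[K] V →ₗ[K] K, Bf ≠ 0 ∧
      (∀ i u v, Bf (D.E (D.W.a i) u) v + Bf u (D.E (D.W.a i) v) = 0) ∧
      (∀ i u v, Bf (D.G (D.W.a i) u) v + Bf u (D.G (D.W.a i) v) = 0) := by
  classical
  obtain ⟨N, x, w, μ, hfin, C⟩ := D.exists_chain hD hp
  have hN2 : 2 ≤ N := by have := hp.two_le; omega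
  let bs : Basis (Fin (N+1)) K V := basisOfLinearIndependentOfCardEqFinrank C.li (by simp [hfin])
  have hbs : ∀ k, bs k = x k := fun k => by simp [bs]
  have hG : ∀ i, D.G (D.W.a i) = ((D.W.cc (D.W.a i) : ℚ) : K) • D.f i := by
    intro i; rw [f, smul_inv_smul₀ (D.ccK i)]
  -- uniform formulas
  have hf : ∀ i (k : ℕ), k < N → D.f i (x k) =
      (if w (k+1) = i then ((D.W.cf i : ℤ) : K)⁻¹ else 0) • x (k+1) := by
    intro i k hk
    split_ifs with h
    · rw [← C.fw k hk, h, inv_smul_smul₀ (VChain.cfK D i)]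
    · rw [C.fo k hk i h, zero_smul]
  have he : ∀ i (k : ℕ), k < N → D.e i (x (k+1)) =
      (if w (k+1) = i then ((k : K) + 1) * ((N : K) - k) else 0) • x k := by
    intro i k hk
    split_ifs with h
    · rw [← C.ew k hk, h]
    · rw [C.eo k hk i h, zero_smul]
  rcases C.chainData.pal_or_inj hA (hfin ▸ hp) hN2 with hpal | hinj
  · right
    let M : Matrix (Fin (N+1)) (Fin (N+1)) K := fun i j =>
      if (i : ℕ) + j = N then (-1) ^ (i : ℕ) else 0
    let Bf : V →ₗ[K] V →ₗ[K] K := Matrix.toLinearMap₂ bs bs M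
    have hB : ∀ i j : ℕ, i ≤ N → j ≤ N → Bf (x i) (x j) = if i + j = N then (-1) ^ i else 0 := by
      intro i j hi hj
      have : Bf (bs ⟨i, by omega⟩) (bs ⟨j, by omega⟩) = M ⟨i, by omega⟩ ⟨j, by omega⟩ :=
        Matrix.toLinearMap₂_apply_basis bs bs M _ _
      rw [hbs, hbs] at this
      exact this
    have hB1 : ∀ i j : ℕ, i ≤ N → j ≤ N → i + j = N → Bf (x i) (x j) = (-1) ^ i :=
      fun i j hi hj h => by rw [hB i j hi hj, if_pos h]
    have hB0 : ∀ i j : ℕ, i ≤ N → j ≤ N → i + j ≠ N → Bf (x i) (x j) = 0 :=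
      fun i j hi hj h => by rw [hB i j hi hj, if_neg h]
    have ext2 : ∀ (X : Module.End K V), (∀ i j : ℕ, i ≤ N → j ≤ N →
        Bf (X (x i)) (x j) + Bf (x i) (X (x j)) = 0) → ∀ u v, Bf (X u) v + Bf u (X v) = 0 := by
      intro X hX u v
      have : Bf.comp X + Bf.compl₂ X = 0 := by
        refine bs.ext fun i => bs.ext fun j => ?_
        rw [hbs, hbs]
        simpa using hX i j (by omega) (by omega)
      have := congrArg (fun T => T u v) this
      simpa using this
    have hBe : ∀ i u v, Bf (D.e i u) v + Bf u (D.e i v) = 0 := by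
      intro i
      refine ext2 _ fun a b ha hb => ?_
      rcases a with _ | a <;> rcases b with _ | b
      · simp [C.e0]
      · rw [C.e0, he i b (by omega), map_smul, hB0 _ _ (by omega) (by omega) (by omega)]
        simp
      · rw [C.e0, he i a (by omega), map_smul, LinearMap.smul_apply, hB0 _ _ (by omega) (by omega) (by omega)]
        simp
      · rw [he i a (by omega), he i b (by omega), map_smul, map_smul, LinearMap.smul_apply]
        by_cases hab : a + (b + 1) = N
        · have e1 := hpal (a+1) (by omega) (by omega)
          rw [show N + 1 - (a+1) = b + 1 by omega] at e1
          rw [hB1 _ _ (by omega) (by omega) (by omega), hB1 _ _ (by omega) (by omega) (by omega), e1]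
          have : (N : K) = a + (b + 1) := by exact_mod_cast hab.symm
          rw [this]
          split_ifs
          · simp only [smul_eq_mul, pow_succ]; ring
          · simp
        · rw [hB0 _ _ (by omega) (by omega) (by omega), hB0 _ _ (by omega) (by omega) (by omega)]; simp
    have hBf : ∀ i u v, Bf (D.f i u) v + Bf u (D.f i v) = 0 := by
      intro i
      refine ext2 _ fun a b ha hb => ?_
      rcases ha.lt_or_eq with ha | ha <;> rcases hb.lt_or_eq with hb | hb
      · rw [hf i a (by omega), hf i b (by omega), map_smul, map_smul, LinearMap.smul_apply]
        by_cases hab : a + (b + 1) = N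
        · have e1 := hpal (a+1) (by omega) (by omega)
          rw [show N + 1 - (a+1) = b + 1 by omega] at e1
          rw [hB1 _ _ (by omega) (by omega) (by omega), hB1 _ _ (by omega) (by omega) (by omega), e1]
          split_ifs
          · simp only [smul_eq_mul, pow_succ]; ring
          · simp
        · rw [hB0 _ _ (by omega) (by omega) (by omega), hB0 _ _ (by omega) (by omega) (by omega)]; simp
      · rw [hb, C.fN, hf i a (by omega), map_smul, LinearMap.smul_apply,
          hB0 _ _ (by omega) (by omega) (by omega)]
        simp
      · rw [ha, C.fN, hf i b (by omega), map_smul,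
          hB0 _ _ (by omega) (by omega) (by omega)]
        simp
      · rw [ha, hb, C.fN]; simp
    refine ⟨Bf, ?_, hBe, ?_⟩
    · intro h
      have := hB 0 N (by omega) le_rfl
      rw [h] at this
      simp at this
    · intro i u v
      have := hBf i u v
      rw [hG]
      simp only [LinearMap.smul_apply, map_smul]
      rw [← smul_add, this, smul_zero]
  · left
    intro LL hLL hE hGm X hX
    let T : Module.End K V ≃ₐ[K] Matrix (Fin (N+1)) (Fin (N+1)) K := LinearMap.toMatrixAlgEquiv bs
    have hfm : ∀ i, D.f i ∈ LL := fun i => LL.smul_mem _ (hGm i)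
    have hT : ∀ (k l : Fin (N+1)) (Y : Module.End K V), (∀ j : Fin (N+1), Y (bs j) =
        if l = j then bs k else 0) → T Y = Matrix.single k l 1 := by
      intro k l Y hY
      ext a b
      simp only [T]
      rw [LinearMap.toMatrixAlgEquiv_apply, hY, Matrix.single_apply]
      by_cases h : l = b
      · subst h; simp [Finsupp.single_apply]
      · simp [h]
    have := mem_of_simple (LL.map T.toLinearMap) ?_ ?_ ?_ (T X) ?_
    · obtain ⟨Y, hY, hXY⟩ := this
      rwa [← T.injective hXY]
    · rintro _ ⟨A, hA, rfl⟩ _ ⟨B, hB, rfl⟩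
      exact ⟨_, hLL A hA B hB, by simp⟩
    · intro k
      refine ⟨((D.W.cf (w (k+1)) : ℤ) : K) • D.f (w (k+1)), LL.smul_mem _ (hfm _), ?_⟩
      refine hT _ _ _ fun j => ?_
      rw [hbs, hbs, LinearMap.smul_apply]
      by_cases hj : (j : ℕ) < N
      · rw [hf _ _ hj]
        split_ifs with h1 h2 h2
        · rw [smul_inv_smul₀ (VChain.cfK D _), ← h2]; rfl
        · exfalso
          have h3 : (k : ℕ) ≠ j := fun h => h2 (Fin.ext h)
          rcases lt_or_gt_of_ne h3 with h4 | h4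
          · exact hinj _ _ (by omega) (by omega) (by omega) h1.symm
          · exact hinj _ _ (by omega) (by omega) (by omega) h1
        · exfalso; apply h1; rw [← h2]; rfl
        · simp
      · rw [show (j : ℕ) = N by omega, C.fN, if_neg, smul_zero]
        intro h; rw [← h] at hj; exact hj k.2
    · intro k
      refine ⟨((((k:ℕ) : K) + 1) * ((N : K) - (k:ℕ)))⁻¹ • D.e (w (k+1)), LL.smul_mem _ (hE _), ?_⟩
      refine hT _ _ _ fun j => ?_
      rw [hbs, hbs, LinearMap.smul_apply]
      have hnz : (((k:ℕ) : K) + 1) * ((N : K) - (k:ℕ)) ≠ 0 := by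
        refine mul_ne_zero (Nat.cast_add_one_ne_zero _) ?_
        rw [sub_ne_zero]
        have : N ≠ k := by omega
        exact_mod_cast this
      rcases hj : (j : ℕ) with _ | l
      · rw [C.e0, if_neg, smul_zero]
        intro h; rw [← h] at hj; simp at hj
      · rw [he _ _ (by omega)]
        split_ifs with h1 h2 h2
        · have : l = k := by rw [← h2] at hj; simpa using hj.symm
          rw [this, inv_smul_smul₀ hnz]; rfl
        · exfalso
          have h3 : (k : ℕ) ≠ l := fun h => h2 (Fin.ext (by rw [hj, ← h]; simp))
          rcases lt_or_gt_of_ne h3 with h4 | h4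
          · exact hinj _ _ (by omega) (by omega) (by omega) h1.symm
          · exact hinj _ _ (by omega) (by omega) (by omega) h1
        · exfalso; apply h1
          have : l = k := by rw [← h2] at hj; simpa using hj.symm
          rw [this]
        · simp
    · rw [← hX, LinearMap.trace_eq_matrix_trace K bs]; rfl

end VData

end

section
open Module

namespace RB
variable {I K M N : Type*} [Field K] [CharZero K] [AddCommGroup M] [Module K M]
  [AddCommGroup N] [Module K N] {P : RootPairing I K M N} (b : P.Base)

/-- coefficients of a root in a base -/
noncomputable def cf (k j : I) : ℤ := (b.exists_root_eq_sum_int k).choose j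

theorem cf_supp (k : I) {j : I} (h : j ∉ b.support) : cf b k j = 0 := by
  by_contra h'
  exact h ((b.exists_root_eq_sum_int k).choose_spec.1 h')

theorem cf_sign (k : I) : 0 < cf b k ∨ cf b k < 0 := (b.exists_root_eq_sum_int k).choose_spec.2.1

theorem cf_sum (k : I) : P.root k = ∑ j ∈ b.support, cf b k j • P.root j :=
  (b.exists_root_eq_sum_int k).choose_spec.2.2

theorem cf_uniq (k : I) (f : I → ℤ) (hf : P.root k = ∑ j ∈ b.support, f j • P.root j) {j : I}
    (hj : j ∈ b.support) : cf b k j = f j := by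
  have h1 : ∑ j ∈ b.support, ((cf b k j - f j : ℤ) : K) • P.root j = 0 := by
    have : ∑ j ∈ b.support, ((cf b k j - f j : ℤ) : K) • P.root j
        = ∑ j ∈ b.support, cf b k j • P.root j - ∑ j ∈ b.support, f j • P.root j := by
      rw [← Finset.sum_sub_distrib]
      refine Finset.sum_congr rfl fun x _ => ?_
      rw [Int.cast_smul_eq_zsmul, sub_smul]
    rw [this, ← cf_sum, ← hf, sub_self]
  have := linearIndepOn_iff'.mp b.linearIndepOn_root b.support _ (by simp) h1 j hj
  have h2 : cf b k j - f j = 0 := by exact_mod_cast this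
  omega

theorem ht_eq (k : I) : b.height k = ∑ j ∈ b.support, cf b k j := rfl

theorem cf_nonneg {k : I} (h : b.IsPos k) (j : I) : 0 ≤ cf b k j := by
  rcases cf_sign b k with h1 | h1
  · exact h1.le j
  · exfalso
    rw [RootPairing.Base.isPos_iff, ht_eq] at h
    have : ∑ j ∈ b.support, cf b k j ≤ 0 := Finset.sum_nonpos fun j _ => h1.le j
    omega

theorem isPos_of_cf {k : I} (h : ∀ j ∈ b.support, 0 ≤ cf b k j) : b.IsPos k := by
  rw [RootPairing.Base.isPos_iff', ht_eq]
  exact Finset.sum_nonneg h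

theorem cf_add {i j k : I} (hk : P.root k = P.root i + P.root j) (l : I) :
    cf b k l = cf b i l + cf b j l := by
  by_cases hl : l ∈ b.support
  · apply cf_uniq b k (fun l => cf b i l + cf b j l) _ hl
    simp only [add_smul, Finset.sum_add_distrib, ← cf_sum, hk]
  · simp [cf_supp b _ hl]

theorem cf_simple [DecidableEq I] {i : I} (hi : i ∈ b.support) (l : I) :
    cf b i l = if l = i then 1 else 0 := by
  by_cases hl : l ∈ b.support
  · apply cf_uniq b i (fun l => if l = i then 1 else 0) _ hl
    simp [hi]
  · rw [cf_supp b _ hl, if_neg]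
    rintro rfl; exact hl hi

variable [Finite I] [P.IsCrystallographic] [P.IsReduced]

theorem pr_add {i j k : I} (hk : P.root k = P.root i + P.root j) (l : I) :
    P.pairingIn ℤ k l = P.pairingIn ℤ i l + P.pairingIn ℤ j l := by
  apply FaithfulSMul.algebraMap_injective ℤ K
  simp only [map_add, RootPairing.algebraMap_pairingIn, ← RootPairing.root_coroot_eq_pairing, hk,
    LinearMap.add_apply]

theorem pr_pos {i j : I} : 0 < P.pairingIn ℤ i j ↔ 0 < P.pairingIn ℤ j i :=
  RootPairing.zero_lt_pairingIn_iff' P ℤ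

theorem pr_neg {i j : I} : P.pairingIn ℤ i j < 0 ↔ P.pairingIn ℤ j i < 0 := by
  have h1 := pr_pos (P := P) (i := i) (j := j)
  have h2 : P.pairingIn ℤ i j = 0 ↔ P.pairingIn ℤ j i = 0 :=
    RootPairing.pairingIn_eq_zero_iff P
  omega

theorem down_lemma {γ x δ : I} (hx : b.IsPos x) (hδ : b.IsPos δ)
    (h : P.root γ = P.root x + P.root δ) :
    ∃ j ∈ b.support, cf b δ j ≠ 0 ∧ ∃ k, P.root γ = P.root k + P.root j := by
  classical
  have main : ∀ N : ℕ, ∀ x δ : I, b.IsPos x → b.IsPos δ → b.height δ = N →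
      P.root γ = P.root x + P.root δ →
      ∃ j ∈ b.support, cf b δ j ≠ 0 ∧ ∃ k, P.root γ = P.root k + P.root j := by
    intro N
    induction N with
    | zero =>
      intro x δ hx hδ hN
      rw [RootPairing.Base.isPos_iff] at hδ
      omega
    | succ N ih =>
      intro x δ hx hδ hN h
      obtain ⟨j, hj, hj'⟩ := hδ.exists_mem_support_pos_pairingIn
      rw [pr_pos] at hj'
      rcases eq_or_ne δ j with rfl | hij
      · exact ⟨δ, hj, by rw [cf_simple b hj]; simp, x, h⟩
      obtain ⟨d, hd⟩ := P.root_sub_root_mem_of_pairingIn_pos hj' hij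
      have hd' : P.root δ = P.root d + P.root j := by rw [hd]; abel
      have hjp := b.isPos_of_mem_support hj
      have hdp : b.IsPos d := hδ.sub hj hd
      have hdN : b.height d = N := by
        rw [b.height_sub hd, hN, RootPairing.Base.height_one_of_mem_support hj]; push_cast; ring
      have hcf : cf b δ j ≠ 0 := by
        rw [cf_add b hd', cf_simple b hj]
        have := cf_nonneg b hdp j
        simp; omega
      have finish : (∃ y, P.root y = P.root x + P.root j) →
        ∃ j ∈ b.support, cf b δ j ≠ 0 ∧ ∃ k, P.root γ = P.root k + P.root j := by
        rintro ⟨y, hy⟩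
        obtain ⟨l, hl, hl', k, hk⟩ := ih y d (hx.add hjp hy) hdp hdN
          (by rw [h, hy, hd']; abel)
        refine ⟨l, hl, ?_, k, hk⟩
        rw [cf_add b hd']
        have := cf_nonneg b hdp l
        have := cf_nonneg b hjp l
        omega
      have finish2 : (∃ y, P.root y = P.root x + P.root d) →
        ∃ j ∈ b.support, cf b δ j ≠ 0 ∧ ∃ k, P.root γ = P.root k + P.root j := by
        rintro ⟨y, hy⟩
        exact ⟨j, hj, hcf, y, by rw [h, hy, hd']; abel⟩
      have hneg : ∀ u v : I, b.IsPos u → b.IsPos v → P.root u ≠ - P.root v := by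
        intro u v hu hv huv
        have : ∑ j ∈ b.support, cf b u j • P.root j = ∑ j ∈ b.support, (- cf b v j) • P.root j := by
          simp only [neg_smul, Finset.sum_neg_distrib, ← cf_sum, huv]
        rw [← cf_sum] at this
        have h1 : ∀ j ∈ b.support, cf b u j = 0 := by
          intro j hj
          have := cf_uniq b u (fun j => - cf b v j) this hj
          have := cf_nonneg b hu j
          have := cf_nonneg b hv j
          omega
        have h2 := b.height_ne_zero u
        rw [ht_eq] at h2
        exact h2 (Finset.sum_eq_zero h1)
      have hγ1 : P.root γ - P.root d = P.root x + P.root j := by rw [h, hd']; abel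
      have hγ2 : P.root γ - P.root j = P.root x + P.root d := by rw [h, hd']; abel
      have hne1 : γ ≠ d := by
        rintro rfl
        rw [sub_self] at hγ1
        exact hneg x j hx hjp (by rw [eq_neg_iff_add_eq_zero, ← hγ1])
      have hne2 : γ ≠ j := by
        rintro rfl
        rw [sub_self] at hγ2
        exact hneg x d hx hdp (by rw [eq_neg_iff_add_eq_zero, ← hγ2])
      by_cases c1 : 0 < P.pairingIn ℤ γ d
      · obtain ⟨y, hy⟩ := P.root_sub_root_mem_of_pairingIn_pos c1 hne1
        exact finish ⟨y, by rw [hy, hγ1]⟩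
      by_cases c2 : 0 < P.pairingIn ℤ γ j
      · obtain ⟨y, hy⟩ := P.root_sub_root_mem_of_pairingIn_pos c2 hne2
        exact finish2 ⟨y, by rw [hy, hγ2]⟩
      by_cases c3 : P.pairingIn ℤ x d < 0
      · obtain ⟨y, hy⟩ := P.root_add_root_mem_of_pairingIn_neg c3 (hneg x d hx hdp)
        exact finish2 ⟨y, by rw [hy]⟩
      by_cases c4 : P.pairingIn ℤ x j < 0
      · obtain ⟨y, hy⟩ := P.root_add_root_mem_of_pairingIn_neg c4 (hneg x j hx hjp)
        exact finish ⟨y, by rw [hy]⟩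
      exfalso
      rw [pr_pos] at c1 c2
      rw [pr_neg] at c3 c4
      have e1 := pr_add hd' x
      have e2 := pr_add hd' γ
      have e3 := pr_add h δ
      have e4 : P.pairingIn ℤ δ δ = 2 := by simp
      have e5 := pr_neg (P := P) (i := δ) (j := x)
      have e6 := pr_pos (P := P) (i := δ) (j := γ)
      omega
  have h1 : 0 < b.height δ := hδ
  exact main (b.height δ).toNat x δ hx hδ (by omega) h

theorem chain_down [DecidableEq I] {γ i : I} (hγ : b.IsPos γ) (hi : i ∈ b.support)
    (hc : cf b γ i ≠ 0) (hh : 1 < b.height γ) :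
    ∃ k, b.IsPos k ∧ cf b k i ≠ 0 ∧ b.height k = b.height γ - 1 := by
  have fin : ∀ j ∈ b.support, ∀ k, P.root γ = P.root k + P.root j → (j ≠ i ∨ 2 ≤ cf b γ i) →
      ∃ k, b.IsPos k ∧ cf b k i ≠ 0 ∧ b.height k = b.height γ - 1 := by
    intro j hj k hk hor
    have hh1 := b.height_add hk
    rw [RootPairing.Base.height_one_of_mem_support hj] at hh1
    refine ⟨k, ?_, ?_, by omega⟩
    · rw [RootPairing.Base.isPos_iff]; omega
    · have := cf_add b hk i
      rw [cf_simple b hj] at this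
      split_ifs at this with h
      · subst h; simp at hor; omega
      · omega
  obtain ⟨j, hj, hj'⟩ := hγ.exists_mem_support_pos_pairingIn
  rw [pr_pos] at hj'
  have hne : γ ≠ j := by
    rintro rfl
    rw [RootPairing.Base.height_one_of_mem_support hj] at hh; omega
  obtain ⟨d, hd⟩ := P.root_sub_root_mem_of_pairingIn_pos hj' hne
  have hd' : P.root γ = P.root d + P.root j := by rw [hd]; abel
  by_cases hor : j ≠ i ∨ 2 ≤ cf b γ i
  · exact fin j hj d hd' hor
  · push Not at hor
    obtain ⟨rfl, h2⟩ := hor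
    have hdp : b.IsPos d := hγ.sub hj hd
    obtain ⟨l, hl, hl', k, hk⟩ := down_lemma b (b.isPos_of_mem_support hj) hdp
      (by rw [hd', add_comm])
    apply fin l hl k hk
    left
    rintro rfl
    have := cf_add b hd' l
    rw [cf_simple b hj] at this
    have := cf_nonneg b hdp l
    simp at *
    omega

theorem count [Fintype I] [DecidableEq I] {γ i : I} (hγ : b.IsPos γ) (hi : i ∈ b.support)
    (hc : cf b γ i ≠ 0) : b.height γ ≤
      (((Finset.univ.filter fun k => 0 < b.height k ∧ cf b k i ≠ 0).card : ℕ) : ℤ) := by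
  have main : ∀ N : ℕ, ∀ γ : I, b.IsPos γ → cf b γ i ≠ 0 → b.height γ = N →
    N ≤ (Finset.univ.filter fun k => (0 < b.height k ∧ cf b k i ≠ 0) ∧ b.height k ≤ N).card := by
    intro N
    induction N with
    | zero => intros; omega
    | succ N ih =>
      intro γ hγ hc hN
      rcases Nat.eq_zero_or_pos N with rfl | hpos
      · refine Finset.card_pos.mpr ⟨γ, ?_⟩
        simp [hc, hN]
      · obtain ⟨k, hk, hk', hkN⟩ := chain_down b hγ hi hc (by omega)
        have h1 := ih k hk hk' (by omega)
        refine lt_of_le_of_lt h1 (Finset.card_lt_card ?_)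
        rw [Finset.ssubset_iff_of_subset]
        · exact ⟨γ, by simp [hc, hN], by simp [hN]⟩
        · intro k; simp; intro h1 h2 h3; push_cast; exact ⟨⟨h1, h2⟩, by omega⟩
  have h1 : 0 < b.height γ := hγ
  have h2 := main (b.height γ).toNat γ hγ hc (by omega)
  have h3 : (Finset.univ.filter fun k => (0 < b.height k ∧ cf b k i ≠ 0) ∧
    b.height k ≤ (b.height γ).toNat).card ≤
    (Finset.univ.filter fun k => 0 < b.height k ∧ cf b k i ≠ 0).card := by
    apply Finset.card_le_card
    intro k; simp; intro h1 h2 h3; exact ⟨h1, h2⟩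
  omega
end RB

end

section
open Module

namespace RB
variable {I K M N : Type*} [Field K] [CharZero K] [AddCommGroup M] [Module K M]
  [AddCommGroup N] [Module K N] {P : RootPairing I K M N} (b : P.Base)
  [Fintype I] [P.IsCrystallographic] [P.IsReduced] [P.IsRootSystem]

/-- coroot coefficients -/
noncomputable def cof (k j : I) : ℤ := cf b.flip k j

/-- coordinates of a root -/
noncomputable def rr (k : I) : b.support → ℤ := fun i => P.pairingIn ℤ k i

/-- normalisation hypotheses -/
structure Nrm (P : RootPairing I K M N) [P.IsCrystallographic] (c : I → ℚ) : Prop where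
  pos : ∀ k, 0 < c k
  sym : ∀ k l, c l * P.pairingIn ℤ k l = c k * P.pairingIn ℤ l k
  rep : ∀ k, P.coroot k = ∑ l, ((P.pairingIn ℤ l k : ℚ) * c l : K) • P.coroot l

theorem pairK (k l : I) : P.root' k (P.coroot l) = (P.pairingIn ℤ k l : K) := by
  rw [RootPairing.root'_coroot_eq_pairing, ← P.algebraMap_pairingIn ℤ]; simp

theorem cof_sum (k : I) : P.coroot k = ∑ j ∈ b.support, cof b k j • P.coroot j := cf_sum b.flip k

theorem coroot_indep (f g : I → K)
    (h : ∑ j ∈ b.support, f j • P.coroot j = ∑ j ∈ b.support, g j • P.coroot j) {j : I}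
    (hj : j ∈ b.support) : f j = g j := by
  have h1 : ∑ j ∈ b.support, (f j - g j) • P.coroot j = 0 := by
    simp [sub_smul, Finset.sum_sub_distrib, h]
  exact sub_eq_zero.mp <| linearIndepOn_iff'.mp b.linearIndepOn_coroot b.support _ (by simp) h1 j hj

theorem rep2 {c : I → ℚ} (hc : Nrm P c) (k : I) : (c k : K) • P.coroot k =
    ∑ l, ((c l : K) * c l * P.root' k (P.coroot l)) • P.coroot l := by
  conv_lhs => rw [hc.rep k]
  rw [Finset.smul_sum]
  refine Finset.sum_congr rfl fun l _ => ?_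
  rw [smul_smul, pairK]
  congr 1
  have : ((c l * P.pairingIn ℤ k l : ℚ) : K) = ((c k * P.pairingIn ℤ l k : ℚ) : K) := by
    rw [hc.sym]
  push_cast at this ⊢
  linear_combination -(c l : K) * this

theorem cof_rel {c : I → ℚ} (hc : Nrm P c) (k j : I) : c k * cof b k j = c j * cf b k j := by
  by_cases hj : j ∈ b.support
  swap
  · rw [cof, cf_supp b _ hj, cf_supp b.flip _ hj]; simp
  have h := rep2 hc k
  have h2 : ∀ l, P.root' k (P.coroot l) = ∑ j ∈ b.support, (cf b k j : K) * P.root' j (P.coroot l) := by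
    intro l
    have := congrArg (fun x => P.toLinearMap x (P.coroot l)) (cf_sum b k)
    simp only [map_sum, map_zsmul, LinearMap.coe_sum, Finset.sum_apply, LinearMap.smul_apply,
      zsmul_eq_mul] at this
    exact this
  have h3 : (c k : K) • P.coroot k = ∑ j ∈ b.support, ((cf b k j : K) * c j) • P.coroot j := by
    rw [h]
    simp_rw [h2, Finset.mul_sum, Finset.sum_smul]
    rw [Finset.sum_comm]
    refine Finset.sum_congr rfl fun i _ => ?_
    rw [mul_smul, rep2 hc i, Finset.smul_sum]
    refine Finset.sum_congr rfl fun l _ => ?_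
    rw [smul_smul]; congr 1; ring
  rw [cof_sum b k, Finset.smul_sum] at h3
  have h4 := coroot_indep b (fun j => (c k : K) * cof b k j) (fun j => (cf b k j : K) * c j)
    (by rw [← h3]
        refine Finset.sum_congr rfl fun l _ => ?_
        rw [mul_smul, Int.cast_smul_eq_zsmul]) hj
  have h5 : ((c k * cof b k j : ℚ) : K) = ((c j * cf b k j : ℚ) : K) := by
    push_cast; rw [h4]; ring
  exact_mod_cast h5

theorem flip_pos {c : I → ℚ} (hc : Nrm P c) (k : I) : b.flip.IsPos k ↔ b.IsPos k := by
  have key : ∀ j, 0 ≤ cof b k j ↔ 0 ≤ cf b k j := by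
    intro j
    have h1 := cof_rel b hc k j
    have h2 := hc.pos k
    have h3 := hc.pos j
    rw [← Int.cast_nonneg_iff (R := ℚ), ← Int.cast_nonneg_iff (R := ℚ) (n := cf b k j),
      ← mul_nonneg_iff_of_pos_left h2, h1, mul_nonneg_iff_of_pos_left h3]
  constructor
  · intro h
    exact isPos_of_cf b fun j _ => (key j).1 (cf_nonneg b.flip h j)
  · intro h
    exact isPos_of_cf b.flip fun j _ => (key j).2 (cf_nonneg b h j)

/-- coroot as functional on coordinates -/
noncomputable def coK (k : I) : (b.support → ℤ) →+ ℤ :=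
  AddMonoidHom.mk' (fun μ => ∑ j : b.support, cof b k j * μ j) (by
    intro x y; simp [mul_add, Finset.sum_add_distrib])

theorem coK_apply (k : I) (μ) : coK b k μ = ∑ j : b.support, cof b k j * μ j := rfl

theorem coK_rr (k l : I) : coK b k (rr b l) = P.pairingIn ℤ l k := by
  apply FaithfulSMul.algebraMap_injective ℤ K
  rw [RootPairing.algebraMap_pairingIn, ← RootPairing.root'_coroot_eq_pairing, cof_sum b k, map_sum,
    coK_apply, map_sum, ← Finset.sum_coe_sort b.support]
  refine Finset.sum_congr rfl fun j _ => ?_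
  rw [map_mul, rr, RootPairing.algebraMap_pairingIn, ← RootPairing.root'_coroot_eq_pairing, map_zsmul]
  simp

theorem coK_simple (i : b.support) (μ) : coK b i μ = μ i := by
  classical
  rw [coK_apply]
  have : ∀ j : b.support, cof b i j = if j = i then 1 else 0 := by
    intro j
    rw [cof, cf_simple b.flip i.2]; simp only [← Subtype.ext_iff]
  simp [this]

theorem rr_inj : Function.Injective (rr b) := by
  intro k l h
  apply P.root.injective
  apply (LinearMap.IsPerfPair.bijective_left P.toLinearMap).injective
  have hs : Submodule.span K (P.coroot '' b.support) = ⊤ := by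
    rw [b.span_coroot_support]
    exact RootPairing.IsRootSystem.span_coroot_eq_top
  apply LinearMap.ext_on hs
  rintro _ ⟨i, hi, rfl⟩
  have := congrFun h ⟨i, hi⟩
  have h2 : algebraMap ℤ K (P.pairingIn ℤ k i) = algebraMap ℤ K (P.pairingIn ℤ l i) :=
    congrArg _ this
  rw [RootPairing.algebraMap_pairingIn, RootPairing.algebraMap_pairingIn] at h2
  exact h2

open Classical in
/-- co on coordinates -/
noncomputable def coB (β : b.support → ℤ) : (b.support → ℤ) →+ ℤ :=
  if h : ∃ k, rr b k = β then coK b h.choose else 0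

theorem coB_rr (k : I) : coB b (rr b k) = coK b k := by
  have h : ∃ l, rr b l = rr b k := ⟨k, rfl⟩
  rw [coB, dif_pos h, rr_inj b h.choose_spec]

open Classical in
/-- cc on coordinates -/
noncomputable def ccB (c : I → ℚ) (β : b.support → ℤ) : ℚ :=
  if h : ∃ k, rr b k = β then c h.choose else 0

theorem ccB_rr (c : I → ℚ) (k : I) : ccB b c (rr b k) = c k := by
  have h : ∃ l, rr b l = rr b k := ⟨k, rfl⟩
  rw [ccB, dif_pos h, rr_inj b h.choose_spec]

/-- form on coordinates -/
noncomputable def BB (c : I → ℚ) : (b.support → ℤ) →+ (b.support → ℤ) →+ ℚ :=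
  AddMonoidHom.mk' (fun μ => AddMonoidHom.mk'
    (fun ν => ∑ k, c k * c k * (coK b k μ * coK b k ν)) (by
      intro x y; simp [mul_add, Finset.sum_add_distrib])) (by
      intro x y; ext ν; simp [mul_add, add_mul, Finset.sum_add_distrib])

theorem BB_apply (c : I → ℚ) (μ ν) : BB b c μ ν = ∑ k, c k * c k * (coK b k μ * coK b k ν) := rfl

theorem rep_cof {c : I → ℚ} (hc : Nrm P c) (k j : I) (hj : j ∈ b.support) :
    ∑ l, c l * c l * P.pairingIn ℤ k l * cof b l j = c k * cof b k j := by
  have h := rep2 hc k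
  rw [cof_sum b k, Finset.smul_sum] at h
  have e : ∀ l, ((c l : K) * c l * P.root' k (P.coroot l)) • P.coroot l =
      ∑ j ∈ b.support, ((c l : K) * c l * P.root' k (P.coroot l) * cof b l j) • P.coroot j := by
    intro l
    conv_lhs => enter [2]; rw [cof_sum b l]
    rw [Finset.smul_sum]
    refine Finset.sum_congr rfl fun j _ => ?_
    rw [mul_smul _ (cof b l j : K), Int.cast_smul_eq_zsmul]
  rw [Finset.sum_congr rfl fun l _ => e l, Finset.sum_comm] at h
  simp_rw [← Finset.sum_smul] at h
  have h4 := coroot_indep b (fun j => (c k : K) * cof b k j)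
    (fun j => ∑ l, (c l : K) * c l * P.root' k (P.coroot l) * cof b l j) (by
      rw [← h]
      refine Finset.sum_congr rfl fun l _ => ?_
      rw [mul_smul, Int.cast_smul_eq_zsmul]) hj
  simp only [pairK] at h4
  have h5 : ((∑ l, c l * c l * P.pairingIn ℤ k l * cof b l j : ℚ) : K)
    = ((c k * cof b k j : ℚ) : K) := by push_cast; exact h4.symm
  exact_mod_cast h5

theorem BB_rr {c : I → ℚ} (hc : Nrm P c) (μ) (k : I) : BB b c μ (rr b k) = c k * coK b k μ := by
  rw [BB_apply]
  simp_rw [coK_rr, coK_apply]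
  push_cast
  simp_rw [Finset.mul_sum, Finset.sum_mul, Finset.mul_sum]
  rw [Finset.sum_comm]
  refine Finset.sum_congr rfl fun j _ => ?_
  have := rep_cof b hc k j j.2
  rw [← mul_assoc, ← this, Finset.sum_mul]
  refine Finset.sum_congr rfl fun l _ => ?_
  ring

theorem rr_refl (i : b.support) (k : I) :
    rr b (P.reflectionPerm i k) = rr b k - rr b k i • rr b i := by
  ext j
  apply FaithfulSMul.algebraMap_injective ℤ K
  simp only [rr, Pi.sub_apply, Pi.smul_apply, smul_eq_mul, map_sub, map_mul,
    RootPairing.algebraMap_pairingIn, ← RootPairing.root'_coroot_eq_pairing]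
  have := P.root_reflectionPerm i k
  rw [RootPairing.reflection_apply] at this
  simp only [RootPairing.root', this, map_sub, map_smul]
  simp [RootPairing.coroot']

theorem cof_refl (i : b.support) (k : I) (μ) :
    coK b (P.reflectionPerm i k) μ = coK b k (μ - μ i • rr b i) := by
  classical
  have h : ∀ j : b.support, cof b (P.reflectionPerm i k) j =
      cof b k j - P.pairingIn ℤ i k * if (j : I) = i then 1 else 0 := by
    intro j
    refine cf_uniq b.flip (P.reflectionPerm i k)
      (fun j => cof b k j - P.pairingIn ℤ i k * if j = (i : I) then 1 else 0) ?_ j.2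
    have := P.coroot_reflectionPerm i k
    rw [RootPairing.coreflection_apply] at this
    change P.coroot _ = ∑ j ∈ b.support, _ • P.coroot j
    rw [this]
    simp only [sub_smul, Finset.sum_sub_distrib, ← cof_sum]
    congr 1
    simp only [mul_ite, mul_one, mul_zero, ite_smul, zero_smul, Finset.sum_ite_eq', i.2, if_true]
    rw [pairK, Int.cast_smul_eq_zsmul]
  rw [map_sub, map_zsmul, coK_rr, coK_apply]
  simp_rw [h, sub_mul, Finset.sum_sub_distrib]
  rw [coK_apply]
  congr 1
  rw [Finset.sum_eq_single i]
  · simp [mul_comm]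
  · intro j _ hj; rw [if_neg (Subtype.coe_injective.ne hj)]; simp
  · simp

open Classical in
/-- the WData of a root system -/
noncomputable def wdata {c : I → ℚ} (hc : Nrm P c) : WData b.support where
  Pos := (Finset.univ.filter fun k => b.IsPos k).image (rr b)
  co := coB b
  a := fun i => rr b i
  B := BB b c
  cc := ccB b c
  ha := fun i => Finset.mem_image_of_mem _ (by simp [b.isPos_of_mem_support i.2])
  aii := fun i => by simp [rr]
  nz := by
    intro h
    obtain ⟨k, hk, h0⟩ := Finset.mem_image.mp h
    have := coK_rr b k k
    rw [h0] at this; simp at this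
  coa := fun i μ => by rw [coB_rr, coK_simple]
  refl_mem := by
    intro β hβ i hi
    obtain ⟨k, hk, rfl⟩ := Finset.mem_image.mp hβ
    rw [← rr_refl]
    apply Finset.mem_image_of_mem
    simp only [Finset.mem_filter, Finset.mem_univ, true_and] at hk ⊢
    exact hk.reflectionPerm i.2 (by rintro rfl; exact hi rfl)
  refl_co := by
    intro β hβ i hi μ
    obtain ⟨k, hk, rfl⟩ := Finset.mem_image.mp hβ
    rw [← rr_refl, coB_rr, coB_rr, cof_refl]
  pos := by
    intro β hβ
    obtain ⟨k, hk, rfl⟩ := Finset.mem_image.mp hβ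
    simp only [Finset.mem_filter, Finset.mem_univ, true_and] at hk
    refine ⟨fun j => (cf b k j).toNat, ?_⟩
    ext i
    apply FaithfulSMul.algebraMap_injective ℤ K
    simp only [Finset.sum_apply, Pi.smul_apply, rr, map_sum, map_nsmul,
      RootPairing.algebraMap_pairingIn, ← RootPairing.root'_coroot_eq_pairing]
    have := congrArg (fun x => P.toLinearMap x (P.coroot i)) (cf_sum b k)
    simp only [map_sum, map_zsmul, LinearMap.coe_sum, Finset.sum_apply, LinearMap.smul_apply] at this
    refine this.trans ?_
    rw [← Finset.sum_coe_sort]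
    refine Finset.sum_congr rfl fun j _ => ?_
    rw [← natCast_zsmul, Int.toNat_of_nonneg (cf_nonneg b hk j)]
  Bsymm := fun μ ν => by
    rw [BB_apply, BB_apply]
    refine Finset.sum_congr rfl fun l _ => ?_
    ring
  Bco := by
    intro β hβ μ
    obtain ⟨k, hk, rfl⟩ := Finset.mem_image.mp hβ
    rw [BB_rr b hc, ccB_rr, coB_rr]
  ccpos := by
    intro β hβ
    obtain ⟨k, hk, rfl⟩ := Finset.mem_image.mp hβ
    rw [ccB_rr]; exact hc.pos k
  Bpos := by
    intro μ hμ
    obtain ⟨i, hi⟩ := Function.ne_iff.mp hμ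
    rw [BB_apply]
    apply Finset.sum_pos'
    · intro k _
      have := mul_self_nonneg (c k * coK b k μ)
      nlinarith
    · refine ⟨i, Finset.mem_univ _, ?_⟩
      rw [coK_simple]
      have h1 := hc.pos i
      have : (μ i : ℚ) ≠ 0 := by exact_mod_cast hi
      have h2 := mul_self_pos.mpr this
      positivity

theorem wdata_cartan {c : I → ℚ} (hc : Nrm P c) :
    CartanLike (fun i j => (wdata b hc).a j i) where
  diag := fun i => (wdata b hc).aii i
  off := fun i j hij => b.pairingIn_le_zero_of_ne (Subtype.coe_injective.ne hij.symm) j.2 i.2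
  symz := fun i j h => by
    change P.pairingIn ℤ j i = 0 at h
    change P.pairingIn ℤ i j = 0
    exact (RootPairing.pairingIn_eq_zero_iff P).mp h
  prod := fun i j hij => by
    change P.pairingIn ℤ j i * P.pairingIn ℤ i j ≤ 3
    have h1 := P.pairingIn_pairingIn_mem_set_of_isCrystal_of_isRed (i := j) (j := i)
    have h2 : P.pairingIn ℤ j i ≤ 0 :=
      b.pairingIn_le_zero_of_ne (Subtype.coe_injective.ne hij.symm) j.2 i.2
    have h3 : ¬ (P.pairingIn ℤ j i = -2 ∧ P.pairingIn ℤ i j = -2) := by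
      rintro ⟨h4, h5⟩
      have h6 := (RootPairing.pairingIn_neg_two_neg_two_iff (P := P) (R := K) ℤ (i := j) (j := i)).mp ⟨h4, h5⟩
      exact b.root_ne_neg_of_ne j.2 i.2 (Subtype.coe_injective.ne hij.symm) h6
    simp only [Set.mem_insert_iff, Set.mem_singleton_iff, Prod.mk.injEq] at h1
    rcases h1 with h|h|h|h|h|h|h|h|h|h|h|h|h <;> rw [h.1, h.2] <;> rw [h.1, h.2] at h3 <;> simp_all

theorem wdata_LemD [DecidableEq b.support] {c : I → ℚ} (hc : Nrm P c) : (wdata b hc).LemD := by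
  classical
  intro γ hγ i hi
  obtain ⟨k, hk, rfl⟩ := Finset.mem_image.mp hγ
  simp only [Finset.mem_filter, Finset.mem_univ, true_and] at hk
  have e0 : ∀ k, (wdata b hc).co (rr b k) (Pi.single i 1) = cof b k i := by
    intro k
    change coB b (rr b k) _ = _
    rw [coB_rr, coK_apply, Finset.sum_eq_single i]
    · simp
    · intro j _ hj; simp [hj]
    · simp
  have e1 : (wdata b hc).co (rr b k) WData.ρ = b.flip.height k := by
    change coB b (rr b k) _ = _
    rw [coB_rr, coK_apply, ht_eq, RootPairing.Base.flip_support, ← Finset.sum_coe_sort b.support]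
    refine Finset.sum_congr rfl fun j _ => ?_
    simp [WData.ρ, cof]
  rw [e0] at hi
  rw [e1]
  refine (count b.flip ((flip_pos b hc k).mpr hk) i.2 hi).trans ?_
  norm_cast
  refine Finset.card_le_card_of_injOn (rr b) ?_ (rr_inj b).injOn
  intro l hl
  simp only [Finset.coe_filter, Finset.mem_univ, true_and, Set.mem_setOf_eq] at hl ⊢
  rw [e0]
  exact ⟨Finset.mem_image_of_mem _ (by simpa using (flip_pos b hc l).mp hl.1), hl.2⟩
end RB

end

section
open Module LieAlgebra LieModule LieAlgebra.IsKilling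

namespace LB
variable {K L : Type*} [Field K] [CharZero K] [LieRing L] [LieAlgebra K L] [FiniteDimensional K L]
  [IsKilling K L] {H : LieSubalgebra K L} [H.IsCartanSubalgebra] [IsTriangularizable K H L]

theorem exists_lie_ne {α β : Weight K H L} (hα : α.IsNonZero)
    (h : rootSpace H (α + β : H → K) ≠ ⊥) :
    ∃ e ∈ rootSpace H α, ∃ y ∈ rootSpace H β, ⁅e, y⁆ ≠ 0 := by
  obtain ⟨x, hx, x_ne0⟩ := (chainTop α β).exists_ne_zero
  obtain ⟨h', e, f, isSl2, he, hf⟩ := exists_isSl2Triple_of_weight_isNonZero hα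
  obtain rfl := isSl2.h_eq_coroot hα he hf
  have prim : isSl2.HasPrimitiveVectorWith x (chainLength α β : K) :=
    have := lie_mem_genWeightSpace_of_mem_genWeightSpace he hx
    ⟨x_ne0, (chainLength_smul _ _ hx).symm, by rwa [genWeightSpace_add_chainTop _ _ hα] at this⟩
  obtain ⟨q, hq⟩ : ∃ q, chainTopCoeff α β = q + 1 := by
    refine Nat.exists_eq_succ_of_ne_zero fun h0 => h ?_
    have := genWeightSpace_chainTopCoeff_add_one_nsmul_add (R := K) (M := L) α β hα
    rwa [h0, zero_add, one_smul] at this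
  have hle := chainTopCoeff_le_chainLength α β
  refine ⟨e, he, ((toEnd K L L f) ^ (q + 1)) x, ?_, ?_⟩
  · have := toEnd_pow_apply_mem hf hx (q + 1)
    have e1 : ((q + 1) • (-(α : H → K)) + chainTop α β : H → K) = β := by
      rw [coe_chainTop', hq]; simp
    rwa [e1] at this
  · rw [prim.lie_e_pow_succ_toEnd_f]
    refine smul_ne_zero ?_ (prim.pow_toEnd_f_ne_zero_of_eq_nat rfl (by omega))
    apply mul_ne_zero
    · exact_mod_cast Nat.succ_ne_zero q
    · rw [sub_ne_zero]; exact_mod_cast (by omega : chainLength α β ≠ q)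

theorem rootSpace_span {α : Weight K H L} (hα : α.IsNonZero) {x : L} (hx : x ∈ rootSpace H α)
    (hx0 : x ≠ 0) {y : L} (hy : y ∈ rootSpace H α) : ∃ k : K, y = k • x := by
  obtain ⟨k, hk⟩ : ∃ k : K, k • x = y := by
    simpa using (finrank_eq_one_iff_of_nonzero' ⟨x, hx⟩ (by simpa using hx0)).mp
      (finrank_rootSpace_eq_one _ hα) ⟨_, hy⟩
  exact ⟨k, hk.symm⟩

/-- the dual vector of a root -/
noncomputable def tt (α : Weight K H L) : H := (cartanEquivDual H).symm (Weight.toLinear K H L α)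

theorem kappa_tt (α : Weight K H L) (x : H) :
    traceForm K H L (tt α) x = α x := by
  have := congrArg (fun φ : Dual K H => φ x)
    ((cartanEquivDual H).apply_symm_apply (Weight.toLinear K H L α))
  exact this

theorem kappa_sum (x y : H) : traceForm K H L x y = ∑ γ : H.root, γ.1 x * γ.1 y := by
  have h1 := restrict_killingForm_eq_sum (K := K) (L := L) (H := H)
  have h2 := LinearMap.congr_fun₂ h1 x y
  rw [Finset.sum_coe_sort H.root (fun γ => γ x * γ y)]
  have h3 : traceForm K H L x y = killingForm K L x y := by
    rfl
  rw [h3]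
  simp at h2
  exact h2.trans rfl

theorem rep_t (x : H) : x = ∑ γ : H.root, γ.1 x • tt γ.1 := by
  have hnd := (traceForm_cartan_nondegenerate K L H)
  rw [← sub_eq_zero]
  apply hnd.1
  intro y
  rw [map_sub, LinearMap.sub_apply, kappa_sum, map_sum, LinearMap.sum_apply]
  simp [kappa_tt]

theorem tt_coroot {α : Weight K H L} (hα : α.IsNonZero) :
    tt α = (α (tt α) / 2) • coroot α := by
  have h0 := root_apply_cartanEquivDual_symm_ne_zero hα
  change α (tt α) ≠ 0 at h0
  change _ = (α (tt α) / 2) • (2 • (α (tt α))⁻¹ • tt α)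
  rw [← Nat.cast_smul_eq_nsmul K, smul_smul, smul_smul]
  rw [show α (tt α) / 2 * ((2 : ℕ) : K) * (α (tt α))⁻¹ = 1 by push_cast; field_simp]; simp

/-- normalisation -/
noncomputable def cN (k : H.root) : ℚ := 2 / ∑ γ : H.root, ((rootSystem H).pairingIn ℤ γ k : ℚ) ^ 2

theorem prK (k l : H.root) : ((rootSystem H).pairingIn ℤ k l : K) = k.1 (coroot l.1) := by
  rw [← rootSystem_pairing_apply, ← (rootSystem H).algebraMap_pairingIn ℤ]; simp

theorem root_nz (k : H.root) : k.1.IsNonZero := (Finset.mem_filter.mp k.2).2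

theorem cN_sum_pos (k : H.root) : 0 < ∑ γ : H.root, ((rootSystem H).pairingIn ℤ γ k : ℚ) ^ 2 := by
  apply Finset.sum_pos'
  · intros; positivity
  · exact ⟨k, Finset.mem_univ _, by simp⟩

theorem cN_eq (k : H.root) : (cN k : K) = k.1 (tt k.1) / 2 := by
  have h0 := root_apply_cartanEquivDual_symm_ne_zero (root_nz k)
  change k.1 (tt k.1) ≠ 0 at h0
  have h1 := kappa_sum (coroot k.1) (coroot k.1)
  rw [traceForm_coroot, root_apply_coroot (root_nz k)] at h1
  change 2 • (k.1 (tt k.1))⁻¹ • (2 : K) = _ at h1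
  have h2 : (((∑ γ : H.root, ((rootSystem H).pairingIn ℤ γ k : ℚ) ^ 2) : ℚ) : K) =
      2 • (k.1 (tt k.1))⁻¹ • (2 : K) := by
    rw [h1]; push_cast; refine Finset.sum_congr rfl fun γ _ => ?_
    rw [prK]; ring
  rw [cN, Rat.cast_div, h2]
  simp
  field_simp

theorem tt_eq (k : H.root) : tt k.1 = (cN k : K) • coroot k.1 := by
  rw [cN_eq]; exact tt_coroot (root_nz k)

theorem nrm : RB.Nrm (rootSystem H) cN where
  pos := fun k => div_pos two_pos (cN_sum_pos k)
  sym := by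
    intro k l
    have h1 : k.1 (tt l.1) = l.1 (tt k.1) := by
      rw [← kappa_tt, ← kappa_tt, traceForm_comm]
    rw [tt_eq, tt_eq] at h1
    have h2 : ∀ (α : Weight K H L) (c : K) (x : H), α (c • x) = c * α x := fun α c x =>
      (Weight.toLinear K H L α).map_smul c x
    rw [h2, h2, ← prK, ← prK] at h1
    exact_mod_cast h1
  rep := by
    intro k
    have := rep_t (coroot k.1)
    rw [rootSystem_coroot_apply]
    conv_lhs => rw [this]
    refine Finset.sum_congr rfl fun l _ => ?_
    rw [tt_eq, smul_smul, rootSystem_coroot_apply, ← prK]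
    simp
theorem span_coroots : Submodule.span K (Set.range fun k : H.root => coroot k.1) = ⊤ := by
  have h : (fun k : H.root => coroot k.1) = (rootSystem H).coroot := by
    funext k; rw [rootSystem_coroot_apply]
  rw [h]; exact RootPairing.IsRootSystem.span_coroot_eq_top

theorem rootSpace_add_le (S : LieSubalgebra K L) {α β γ : Weight K H L} (hα : α.IsNonZero)
    (hγ : γ.IsNonZero) (h : (γ : H → K) = α + β)
    (h1 : ∀ x ∈ rootSpace H α, x ∈ S) (h2 : ∀ x ∈ rootSpace H β, x ∈ S) :
    ∀ x ∈ rootSpace H γ, x ∈ S := by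
  have hne : rootSpace H (α + β : H → K) ≠ ⊥ := by
    rw [← h]; exact γ.2
  obtain ⟨e, he, y, hy, hey⟩ := exists_lie_ne hα hne
  intro x hx
  have hm : ⁅e, y⁆ ∈ rootSpace H γ := by
    rw [h]; exact lie_mem_genWeightSpace_of_mem_genWeightSpace he hy
  obtain ⟨k, rfl⟩ := rootSpace_span hγ hm hey hx
  exact S.smul_mem _ (S.lie_mem (h1 _ he) (h2 _ hy))

theorem gen_top (b : (rootSystem H).Base) (S : LieSubalgebra K L)
    (h1 : ∀ i ∈ b.support, ∀ x ∈ rootSpace H i.1, x ∈ S)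
    (h2 : ∀ i ∈ b.support, ∀ x ∈ rootSpace H (-i.1), x ∈ S) : S = ⊤ := by
  have key : ∀ k : H.root, b.IsPos k → (∀ x ∈ rootSpace H k.1, x ∈ S) ∧
      (∀ x ∈ rootSpace H (-k.1), x ∈ S) := by
    intro k hk
    refine hk.induction_on_add (p := fun k => (∀ x ∈ rootSpace H k.1, x ∈ S) ∧
      (∀ x ∈ rootSpace H (-k.1), x ∈ S)) (fun i hi => ⟨h1 i hi, h2 i hi⟩) ?_
    intro i j k hk hi hj
    have hk' : (k.1 : H → K) = i.1 + j.1 := by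
      have := congrArg (fun φ : Dual K H => (φ : H → K)) hk
      exact this
    have e2 : ((-k.1 : Weight K H L) : H → K) = (-i.1 : Weight K H L) + (-j.1 : Weight K H L) := by
      rw [Weight.coe_neg, Weight.coe_neg, Weight.coe_neg, hk', neg_add]
    refine ⟨rootSpace_add_le S (root_nz i) (root_nz k) hk' hi.1 (h1 j hj), ?_⟩
    have := rootSpace_add_le S (α := -i.1) (β := -j.1) (γ := -k.1)
      ((Weight.IsNonZero.neg (root_nz i))) ((Weight.IsNonZero.neg (root_nz k))) e2
    exact this hi.2 (h2 j hj)
  have hall : ∀ k : H.root, (∀ x ∈ rootSpace H k.1, x ∈ S) ∧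
      (∀ x ∈ rootSpace H (-k.1), x ∈ S) := by
    intro k
    letI := (rootSystem H).indexNeg
    rcases RootPairing.Base.IsPos.or_neg b k with h | h
    · exact key k h
    · have := key _ h
      have e1 : (-k).1 = -k.1 := by
        apply DFunLike.coe_injective
        have := congrArg (fun φ : Dual K H => (φ : H → K)) (show (rootSystem H).root (-k) = -(rootSystem H).root k by
            rw [RootPairing.indexNeg_neg, RootPairing.root_reflectionPerm, RootPairing.reflection_apply_self])
        exact this
      rw [e1] at this
      refine ⟨by simpa using this.2, this.1⟩
  have hH : ∀ x : H, (x : L) ∈ S := by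
    intro x
    have hx : x ∈ Submodule.span K (Set.range fun k : H.root => coroot k.1) := by
      rw [span_coroots]; trivial
    induction hx using Submodule.span_induction with
    | mem x hx =>
      obtain ⟨k, rfl⟩ := hx
      obtain ⟨h', e, f, isSl2, he, hf⟩ := exists_isSl2Triple_of_weight_isNonZero (root_nz k)
      have := isSl2.h_eq_coroot (root_nz k) he hf
      change ((coroot k.1 : H) : L) ∈ S
      rw [← this, ← isSl2.lie_e_f]
      refine S.lie_mem ((hall k).1 _ he) ((hall k).2 _ ?_)
      exact hf
    | zero => exact S.zero_mem
    | add x y _ _ hx hy => exact S.add_mem hx hy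
    | smul a x _ hx => exact S.smul_mem a hx
  rw [eq_top_iff]
  intro x _
  have htop := iSup_genWeightSpace_eq_top' K H L
  have hx : x ∈ (⨆ χ : Weight K H L, (genWeightSpace L χ)) := by rw [htop]; trivial
  refine LieSubmodule.iSup_induction' (motive := fun x _ => x ∈ S) _ ?_ S.zero_mem
    (fun x y _ _ => S.add_mem) hx
  intro χ y hy
  by_cases hχ : χ.IsZero
  · rw [hχ.eq] at hy
    have : y ∈ H := by
      have h0 := rootSpace_zero_eq K L H
      change y ∈ rootSpace H (0 : H → K) at hy
      rw [h0] at hy; exact hy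
    exact hH ⟨y, this⟩
  · exact (hall ⟨χ, Finset.mem_filter.mpr ⟨Finset.mem_univ _, hχ⟩⟩).1 y hy
theorem exists_eg (α : Weight K H L) : ∃ e ∈ rootSpace H α, ∃ g ∈ rootSpace H (-α),
    killingForm K L e g = 1 := by
  obtain ⟨e, he, he0⟩ := α.exists_ne_zero
  obtain ⟨f, hf, hef⟩ : ∃ f ∈ rootSpace H (-α), killingForm K L e f ≠ 0 := by
    by_contra! h
    have := mem_ker_killingForm_of_mem_rootSpace_of_forall_rootSpace_neg K L H he h
    rw [ker_killingForm_eq_bot] at this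
    exact he0 this
  exact ⟨e, he, (killingForm K L e f)⁻¹ • f, Submodule.smul_mem _ _ hf, by
    rw [map_smul, smul_eq_mul, inv_mul_cancel₀ hef]⟩

/-- root vector -/
noncomputable def ee (k : H.root) : L := (exists_eg k.1).choose
theorem ee_mem (k : H.root) : ee k ∈ rootSpace H k.1 := (exists_eg k.1).choose_spec.1
/-- opposite root vector -/
noncomputable def gg (k : H.root) : L := (exists_eg k.1).choose_spec.2.choose
theorem gg_mem (k : H.root) : gg k ∈ rootSpace H (-k.1) := (exists_eg k.1).choose_spec.2.choose_spec.1
theorem kappa_eg (k : H.root) : killingForm K L (ee k) (gg k) = 1 :=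
  (exists_eg k.1).choose_spec.2.choose_spec.2

theorem lie_eg (k : H.root) : ⁅ee k, gg k⁆ = ((tt k.1 : H) : L) := by
  have := lie_eq_killingForm_smul_of_mem_rootSpace_of_mem_rootSpace_neg (ee_mem k) (gg_mem k)
  rw [kappa_eg, one_smul] at this
  exact this

theorem ee_ne (k : H.root) : ee k ≠ 0 := by
  intro h
  have := kappa_eg k
  rw [h] at this; simp at this

theorem gg_ne (k : H.root) : gg k ≠ 0 := by
  intro h
  have := kappa_eg k
  rw [h] at this; simp at this

theorem kappa_orth {α β : H → K} {x y : L} (hx : x ∈ rootSpace H α) (hy : y ∈ rootSpace H β)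
    (h : α + β ≠ 0) : killingForm K L x y = 0 :=
  killingForm_apply_eq_zero_of_mem_rootSpace_of_add_ne_zero K L H hx hy h

theorem mem_zero (x : H) : (x : L) ∈ rootSpace H (0 : H → K) := by
  have h0 := rootSpace_zero_eq K L H
  rw [h0]; exact x.2

theorem root_coe_ne (k : H.root) : (k.1 : H → K) ≠ 0 := root_nz k

/-- first dual family -/
noncomputable def xx : H.root ⊕ H.root → L := Sum.elim (fun k => ((tt k.1 : H) : L)) ee
/-- second dual family -/
noncomputable def yy : H.root ⊕ H.root → L := Sum.elim (fun k => ((tt k.1 : H) : L)) gg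

theorem root_ext {k l : H.root} (h : (k.1 : H → K) = l.1) : k = l :=
  Subtype.ext (DFunLike.coe_injective h)

theorem rep_H (z : H) : ∑ j, killingForm K L (z : L) (yy (H := H) j) • xx (H := H) j = z := by
  rw [Fintype.sum_sum_type]
  have h1 : ∀ k : H.root, killingForm K L (z : L) (yy (H := H) (Sum.inr k)) = 0 := fun k =>
    kappa_orth (mem_zero z) (gg_mem k) (by simpa using root_coe_ne k)
  have h2 : ∀ k : H.root, killingForm K L (z : L) (yy (H := H) (Sum.inl k)) = k.1 z := fun k => by
    rw [← kappa_tt k.1 z, traceForm_comm]; rfl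
  simp only [h1, h2, zero_smul, Finset.sum_const_zero, add_zero]
  conv_rhs => rw [rep_t z]
  simp [xx]

theorem rep_e (l : H.root) : ∑ j, killingForm K L (ee l) (yy (H := H) j) • xx (H := H) j = ee l := by
  rw [Fintype.sum_sum_type]
  have h1 : ∀ k : H.root, killingForm K L (ee l) (yy (H := H) (Sum.inl k)) = 0 := fun k =>
    kappa_orth (ee_mem l) (mem_zero _) (by simpa using root_coe_ne l)
  simp only [h1, zero_smul, Finset.sum_const_zero, zero_add]
  rw [Finset.sum_eq_single l]
  · change killingForm K L (ee l) (gg l) • ee l = ee l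
    rw [kappa_eg, one_smul]
  · intro k _ hk
    have : killingForm K L (ee l) (yy (H := H) (Sum.inr k)) = 0 :=
      kappa_orth (ee_mem l) (gg_mem k) (by
        rw [← sub_eq_add_neg, sub_ne_zero]; exact fun h => hk (root_ext h).symm)
    rw [this, zero_smul]
  · simp

theorem L_induct {p : L → Prop} (h0 : p 0) (ha : ∀ x y, p x → p y → p (x + y))
    (hs : ∀ (c : K) x, p x → p (c • x)) (hH : ∀ z : H, p z) (he : ∀ k : H.root, p (ee k)) (x : L) :
    p x := by
  have htop := iSup_genWeightSpace_eq_top' K H L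
  have hx : x ∈ (⨆ χ : Weight K H L, (genWeightSpace L χ)) := by rw [htop]; trivial
  refine LieSubmodule.iSup_induction' (motive := fun x _ => p x) _ ?_ h0
    (fun x y _ _ => ha x y) hx
  intro χ y hy
  by_cases hχ : χ.IsZero
  · rw [hχ.eq] at hy
    have : y ∈ H := by
      have h0 := rootSpace_zero_eq K L H
      change y ∈ rootSpace H (0 : H → K) at hy
      rw [h0] at hy; exact hy
    exact hH ⟨y, this⟩
  · let k : H.root := ⟨χ, Finset.mem_filter.mpr ⟨Finset.mem_univ _, hχ⟩⟩
    obtain ⟨c, rfl⟩ := rootSpace_span (root_nz k) (ee_mem k) (ee_ne k) hy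
    exact hs _ _ (he k)

theorem rep_x (z : L) : ∑ j, killingForm K L z (yy (H := H) j) • xx (H := H) j = z := by
  refine L_induct (H := H) (p := fun z => ∑ j, killingForm K L z (yy (H := H) j) • xx (H := H) j = z)
    ?_ ?_ ?_ rep_H rep_e z
  · simp
  · intro x y hx hy
    conv_rhs => rw [← hx, ← hy]
    simp [add_smul, Finset.sum_add_distrib]
  · intro c x hx
    conv_rhs => rw [← hx]
    simp [Finset.smul_sum, smul_smul]

theorem rep_y (z : L) : ∑ j, killingForm K L (xx (H := H) j) z • yy (H := H) j = z := by
  rw [← sub_eq_zero, ← Submodule.mem_bot (R := K), ← ker_killingForm_eq_bot, LinearMap.mem_ker]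
  ext w
  rw [map_sub, LinearMap.sub_apply, map_sum, LinearMap.sum_apply, LinearMap.zero_apply, sub_eq_zero]
  have := rep_x (H := H) w
  conv_rhs => rw [← this]
  simp only [map_sum, map_smul, LinearMap.smul_apply, smul_eq_mul]
  refine Finset.sum_congr rfl fun j _ => ?_
  rw [LieModule.traceForm_comm K L L (xx j) z, LieModule.traceForm_comm K L L (yy j) w, mul_comm]

section module
variable {V : Type*} [AddCommGroup V] [Module K V] [LieRingModule L V] [LieModule K L V]

variable (H V) in
/-- the Casimir operator -/
noncomputable def casimir : Module.End K V := ∑ j, toEnd K L V (xx (H := H) j) * toEnd K L V (yy (H := H) j)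

theorem casimir_comm (z : L) : toEnd K L V z * casimir H V = casimir H V * toEnd K L V z := by
  have br : ∀ a c : L, toEnd K L V a * toEnd K L V c =
      toEnd K L V c * toEnd K L V a + toEnd K L V ⁅a, c⁆ := by
    intro a c; ext v; simp [lie_lie]
  have hx : ∀ j, toEnd K L V ⁅z, xx (H := H) j⁆ = ∑ i, killingForm K L ⁅z, xx (H := H) j⁆ (yy (H := H) i) • toEnd K L V (xx (H := H) i) := by
    intro j
    conv_lhs => rw [← rep_x (H := H) ⁅z, xx (H := H) j⁆]
    simp only [map_sum, map_smul]
  have hy : ∀ j, toEnd K L V ⁅z, yy (H := H) j⁆ = ∑ i, killingForm K L (xx (H := H) i) ⁅z, yy (H := H) j⁆ • toEnd K L V (yy (H := H) i) := by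
    intro j
    conv_lhs => rw [← rep_y (H := H) ⁅z, yy (H := H) j⁆]
    simp only [map_sum, map_smul]
  rw [casimir, Finset.mul_sum, Finset.sum_mul, ← sub_eq_zero, ← Finset.sum_sub_distrib]
  have : ∀ j, toEnd K L V z * (toEnd K L V (xx (H := H) j) * toEnd K L V (yy (H := H) j)) -
      toEnd K L V (xx (H := H) j) * toEnd K L V (yy (H := H) j) * toEnd K L V z =
      toEnd K L V ⁅z, xx (H := H) j⁆ * toEnd K L V (yy (H := H) j) +
      toEnd K L V (xx (H := H) j) * toEnd K L V ⁅z, yy (H := H) j⁆ := by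
    intro j
    rw [← mul_assoc, br z (xx j), add_mul, mul_assoc, br z (yy j), mul_add, mul_assoc]; abel
  simp_rw [this, hx, hy, Finset.sum_add_distrib, Finset.sum_mul, Finset.mul_sum]
  conv_lhs => arg 2; rw [Finset.sum_comm]
  rw [← Finset.sum_add_distrib]
  refine Finset.sum_eq_zero fun j _ => ?_
  rw [← Finset.sum_add_distrib]
  refine Finset.sum_eq_zero fun i _ => ?_
  rw [smul_mul_assoc, mul_smul_comm, ← add_smul]
  have : killingForm K L ⁅z, xx (H := H) j⁆ (yy (H := H) i) + killingForm K L (xx (H := H) j) ⁅z, yy (H := H) i⁆ = 0 := by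
    rw [← lie_skew, map_neg, LinearMap.neg_apply, LieModule.traceForm_apply_lie_apply]; simp
  rw [this, zero_smul]
end module
end LB

end

section
open Module LieAlgebra LieModule LieAlgebra.IsKilling

namespace LB
variable {K L : Type*} [Field K] [CharZero K] [LieRing L] [LieAlgebra K L] [FiniteDimensional K L]
  [IsKilling K L] {H : LieSubalgebra K L} [H.IsCartanSubalgebra] [IsTriangularizable K H L]
variable {V : Type*} [AddCommGroup V] [Module K V] [LieRingModule L V] [LieModule K L V]
variable (b : (rootSystem H).Base)

variable (V) in
/-- weight spaces -/
noncomputable def wts (μ : b.support → ℤ) : Submodule K V :=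
  ⨅ i : b.support, (toEnd K L V ((coroot i.1.1 : H) : L)).eigenspace (μ i : K)

theorem mem_wts {μ : b.support → ℤ} {v : V} : v ∈ wts V b μ ↔
    ∀ i : b.support, ⁅((coroot i.1.1 : H) : L), v⁆ = (μ i : K) • v := by
  simp [wts, Submodule.mem_iInf]

theorem wts_coroot {μ : b.support → ℤ} {v : V} (hv : v ∈ wts V b μ) (k : H.root) :
    ⁅((coroot k.1 : H) : L), v⁆ = (RB.coK b k μ : K) • v := by
  have h := RB.cof_sum b k
  rw [rootSystem_coroot_apply] at h
  rw [h, RB.coK_apply, ← Finset.sum_coe_sort b.support]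
  rw [mem_wts] at hv
  rw [Int.cast_sum, Finset.sum_smul]
  have e : ((∑ i : b.support, RB.cof b k i • (rootSystem H).coroot i : H) : L) =
      ∑ i : b.support, (RB.cof b k i : K) • ((coroot i.1.1 : H) : L) := by
    rw [AddSubmonoidClass.coe_finset_sum]
    refine Finset.sum_congr rfl fun i _ => ?_
    rw [rootSystem_coroot_apply]
    rw [Int.cast_smul_eq_zsmul]; rfl
  rw [e, sum_lie]
  refine Finset.sum_congr rfl fun i _ => ?_
  rw [smul_lie, hv i, smul_smul]; push_cast; rfl

theorem wts_tt {μ : b.support → ℤ} {v : V} (hv : v ∈ wts V b μ) (k : H.root) :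
    ⁅((tt k.1 : H) : L), v⁆ = ((RB.BB b cN μ (RB.rr b k) : ℚ) : K) • v := by
  rw [tt_eq, RB.BB_rr b nrm]
  have : (((cN k : K) • coroot k.1 : H) : L) = (cN k : K) • ((coroot k.1 : H) : L) := rfl
  rw [this, smul_lie, wts_coroot b hv, smul_smul]; push_cast; rfl

theorem wts_shift {μ : b.support → ℤ} {v : V} (hv : v ∈ wts V b μ) {x : L} (ν : b.support → ℤ)
    {α : H → K} (hx : x ∈ rootSpace H α) (hα : ∀ i : b.support, α (coroot i.1.1) = ν i) :
    ⁅x, v⁆ ∈ wts V b (μ + ν) := by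
  rw [mem_wts] at hv ⊢
  intro i
  have h1 : ⁅((coroot i.1.1 : H) : L), x⁆ = α (coroot i.1.1) • x := lie_eq_smul_of_mem_rootSpace hx _
  rw [leibniz_lie, h1, hv i, hα, smul_lie, lie_smul, ← add_smul]
  push_cast; rw [Pi.add_apply]; push_cast; rw [add_comm]

theorem rr_K (k : H.root) (i : b.support) : k.1 (coroot i.1.1) = (RB.rr b k i : K) := (prK k i.1).symm

theorem wts_e {μ : b.support → ℤ} {v : V} (hv : v ∈ wts V b μ) (k : H.root) :
    ⁅ee k, v⁆ ∈ wts V b (μ + RB.rr b k) :=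
  wts_shift b hv _ (ee_mem k) (rr_K b k)

theorem wts_g {μ : b.support → ℤ} {v : V} (hv : v ∈ wts V b μ) (k : H.root) :
    ⁅gg k, v⁆ ∈ wts V b (μ - RB.rr b k) := by
  rw [sub_eq_add_neg]
  exact wts_shift b hv _ (gg_mem k) (fun i => by simp [rr_K b k])

theorem wts_ind : iSupIndep (wts V b) := by
  have h := Module.End.independent_iInf_maxGenEigenspace_of_forall_mapsTo
    (fun i : b.support => toEnd K L V ((coroot i.1.1 : H) : L)) (by
      intro i j φ
      apply Module.End.mapsTo_maxGenEigenspace_of_comm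
      have : ⁅((coroot i.1.1 : H) : L), ((coroot j.1.1 : H) : L)⁆ = 0 := by
        have h0 : ⁅(coroot i.1.1 : H), (coroot j.1.1 : H)⁆ = 0 := trivial_lie_zero _ _ _ _
        exact congrArg (fun x : H => (x : L)) h0
      refine LinearMap.ext fun v => ?_
      have h3 := lie_lie ((coroot i.1.1 : H) : L) ((coroot j.1.1 : H) : L) v
      rw [this, zero_lie] at h3
      exact (sub_eq_zero.mp h3.symm).symm)
  have h2 := h.comp (f := fun μ : b.support → ℤ => fun i => (μ i : K)) (by
    intro μ ν h; funext i
    have : (μ i : K) = ν i := congrFun h i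
    exact_mod_cast this)
  refine h2.mono fun μ => ?_
  refine iInf_mono fun i => ?_
  exact Module.End.eigenspace_le_maxGenEigenspace

theorem integral [FiniteDimensional K V] [IsTriangularizable K H V] {v : V} (hv : v ≠ 0) (k : H.root) {c : K}
    (h : ⁅((coroot k.1 : H) : L), v⁆ = c • v) : ∃ m : ℤ, c = m := by
  obtain ⟨h', e, f, isSl2, he, hf⟩ := exists_isSl2Triple_of_weight_isNonZero (root_nz k)
  obtain rfl := isSl2.h_eq_coroot (root_nz k) he hf
  have hnil := isNilpotent_toEnd_of_mem_rootSpace (M := V) H (root_coe_ne k) he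
  obtain ⟨N, hN⟩ := hnil
  have hw : ∀ m : ℕ, ⁅((coroot k.1 : H) : L), ((toEnd K L V e) ^ m) v⁆ =
      (c + 2 * m) • ((toEnd K L V e) ^ m) v := by
    intro m
    induction m with
    | zero => simpa using h
    | succ m ih =>
      rw [pow_succ', Module.End.mul_apply, toEnd_apply_apply, leibniz_lie, ih, isSl2.lie_h_e_smul K,
        smul_lie, lie_smul, ← add_smul]
      push_cast; congr 1; ring
  obtain ⟨m, hm1, hm2⟩ : ∃ m : ℕ, ((toEnd K L V e) ^ m) v ≠ 0 ∧ ((toEnd K L V e) ^ (m+1)) v = 0 := by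
    classical
    have hex : ∃ m, ((toEnd K L V e) ^ m) v = 0 := ⟨N, by rw [hN]; simp⟩
    have hpos : Nat.find hex ≠ 0 := by
      intro h0; have := Nat.find_spec hex; rw [h0] at this; simp at this; exact hv this
    obtain ⟨m, hm⟩ := Nat.exists_eq_succ_of_ne_zero hpos
    refine ⟨m, Nat.find_min hex (by omega), ?_⟩
    have := Nat.find_spec hex; rwa [hm] at this
  have prim : isSl2.HasPrimitiveVectorWith (((toEnd K L V e) ^ m) v) (c + 2 * m) :=
    ⟨hm1, hw m, by rw [pow_succ', Module.End.mul_apply] at hm2; exact hm2⟩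
  obtain ⟨q, hq⟩ := prim.exists_nat
  exact ⟨q - 2 * m, by push_cast; linear_combination hq⟩
/-- if simple root vectors preserve `Y` then so does `L` -/
theorem stable_of_simple (Y : Submodule K V) (h1 : ∀ i : b.support, ∀ v ∈ Y, ⁅ee i.1, v⁆ ∈ Y)
    (h2 : ∀ i : b.support, ∀ v ∈ Y, ⁅gg i.1, v⁆ ∈ Y) : ∀ x : L, ∀ v ∈ Y, ⁅x, v⁆ ∈ Y := by
  let S : LieSubalgebra K L :=
    { carrier := {x | ∀ v ∈ Y, ⁅x, v⁆ ∈ Y}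
      add_mem' := fun ha hb v hv => by rw [add_lie]; exact Y.add_mem (ha v hv) (hb v hv)
      zero_mem' := fun v _ => by rw [zero_lie]; exact Y.zero_mem
      smul_mem' := fun c x hx v hv => by rw [smul_lie]; exact Y.smul_mem _ (hx v hv)
      lie_mem' := fun {x y} hx hy v hv => by
        rw [lie_lie]; exact Y.sub_mem (hx _ (hy v hv)) (hy _ (hx v hv)) }
  have hS : S = ⊤ := by
    refine gen_top b S ?_ ?_
    · intro i hi x hx
      obtain ⟨c, rfl⟩ := rootSpace_span (root_nz i) (ee_mem i) (ee_ne i) hx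
      exact S.smul_mem _ (h1 ⟨i, hi⟩)
    · intro i hi x hx
      obtain ⟨c, rfl⟩ := rootSpace_span (α := -i.1) (Weight.IsNonZero.neg (root_nz i))
        (gg_mem i) (gg_ne i) hx
      exact S.smul_mem _ (h2 ⟨i, hi⟩)
  intro x
  have : x ∈ S := by rw [hS]; trivial
  exact this

theorem wts_top [FiniteDimensional K V] [IsTriangularizable K H V] [Nontrivial V]
    (hirr : ∀ Y : Submodule K V, (∀ x : L, ∀ v ∈ Y, ⁅x, v⁆ ∈ Y) → Y = ⊥ ∨ Y = ⊤) :
    ⨆ μ, wts V b μ = ⊤ := by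
  refine (hirr (⨆ μ, wts V b μ) (stable_of_simple b _ ?_ ?_)).resolve_left ?_
  · intro i v hv
    induction hv using Submodule.iSup_induction' with
    | mem μ v hv => exact Submodule.mem_iSup_of_mem _ (wts_e b hv i.1)
    | zero => rw [lie_zero]; exact Submodule.zero_mem _
    | add x y _ _ hx hy => rw [lie_add]; exact Submodule.add_mem _ hx hy
  · intro i v hv
    induction hv using Submodule.iSup_induction' with
    | mem μ v hv => exact Submodule.mem_iSup_of_mem _ (wts_g b hv i.1)
    | zero => rw [lie_zero]; exact Submodule.zero_mem _
    | add x y _ _ hx hy => rw [lie_add]; exact Submodule.add_mem _ hx hy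
  · intro h0
    obtain ⟨χ, hχ⟩ := exists_nontrivial_weightSpace_of_isNilpotent (k := K) (L := H) (M := V)
    obtain ⟨⟨v, hv⟩, hv0⟩ := exists_ne (0 : weightSpace V χ)
    have hv0' : v ≠ 0 := fun h => hv0 (Subtype.ext h)
    rw [mem_weightSpace] at hv
    have hc : ∀ i : b.support, ∃ m : ℤ, χ (coroot i.1.1) = m := fun i =>
      integral hv0' i.1 (hv (coroot i.1.1))
    choose μ hμ using hc
    have : v ∈ wts V b μ := by
      rw [mem_wts]; intro i; rw [← hμ i]; exact hv _
    have h2 := Submodule.mem_iSup_of_mem μ this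
    rw [h0] at h2
    exact hv0' h2

theorem casimir_scalar [FiniteDimensional K V] [IsAlgClosed K] [Nontrivial V]
    (hirr : ∀ Y : Submodule K V, (∀ x : L, ∀ v ∈ Y, ⁅x, v⁆ ∈ Y) → Y = ⊥ ∨ Y = ⊤) :
    ∃ c : K, ∀ v, casimir H V v = c • v := by
  obtain ⟨c, hc⟩ := Module.End.exists_eigenvalue (casimir H V)
  refine ⟨c, fun v => ?_⟩
  have := (hirr ((casimir H V).eigenspace c) (fun x v hv => ?_)).resolve_left hc
  · have hv : v ∈ (casimir H V).eigenspace c := by rw [this]; trivial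
    exact Module.End.mem_eigenspace_iff.mp hv
  · rw [Module.End.mem_eigenspace_iff] at hv ⊢
    have := LinearMap.congr_fun (casimir_comm (H := H) (V := V) x) v
    simp only [Module.End.mul_apply, toEnd_apply_apply] at this
    rw [← this, hv, lie_smul]

theorem neg_root (k : H.root) : ∃ l : H.root, l.1 = -k.1 :=
  ⟨⟨-k.1, Finset.mem_filter.mpr ⟨Finset.mem_univ _, Weight.IsNonZero.neg (root_nz k)⟩⟩, rfl⟩

/-- negation of roots -/
noncomputable def ng (k : H.root) : H.root := (neg_root k).choose
theorem ng_val (k : H.root) : (ng k).1 = -k.1 := (neg_root k).choose_spec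
theorem ng_ng (k : H.root) : ng (ng k) = k := Subtype.ext (by rw [ng_val, ng_val, neg_neg])

theorem eg_neg (k : H.root) (v : V) : ⁅ee (ng k), ⁅gg (ng k), v⁆⁆ = ⁅gg k, ⁅ee k, v⁆⁆ := by
  have h1 : ee (ng k) ∈ rootSpace H (-k.1 : Weight K H L) := by
    have := ee_mem (ng k); rwa [ng_val] at this
  have h2 : gg (ng k) ∈ rootSpace H k.1 := by
    have := gg_mem (ng k); rw [ng_val] at this; simpa using this
  obtain ⟨c, hc⟩ := rootSpace_span (α := -k.1) (Weight.IsNonZero.neg (root_nz k))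
        (gg_mem k) (gg_ne k) h1
  obtain ⟨d, hd⟩ := rootSpace_span (root_nz k) (ee_mem k) (ee_ne k) h2
  have h3 := kappa_eg (ng k)
  rw [hc, hd, map_smul, map_smul, LinearMap.smul_apply, LieModule.traceForm_comm, kappa_eg] at h3
  simp at h3
  rw [hc, hd, smul_lie, smul_lie, lie_smul, smul_smul, mul_comm, h3, one_smul]

theorem pos_ng (k : H.root) : b.IsPos (ng k) ↔ ¬ b.IsPos k := by
  letI := (rootSystem H).indexNeg
  have e : ng k = -k := by
    apply root_ext
    have := congrArg (fun φ : Dual K H => (φ : H → K)) (show (rootSystem H).root (-k) = -(rootSystem H).root k by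
            rw [RootPairing.indexNeg_neg, RootPairing.root_reflectionPerm, RootPairing.reflection_apply_self])
    rw [ng_val]; exact this.symm
  rw [e]
  constructor
  · intro h1 h2
    rw [RootPairing.Base.isPos_iff] at h1 h2
    rw [RootPairing.Base.height_reflectionPerm_self] at h1
    omega
  · intro h
    exact (RootPairing.Base.IsPos.or_neg b k).resolve_left h

open Classical in
theorem casimir_wt {μ : b.support → ℤ} {v : V} (hv : v ∈ wts V b μ) :
    casimir H V v = ((RB.BB b cN μ μ : ℚ) : K) • v +
      ∑ k ∈ Finset.univ.filter (fun k => b.IsPos k), (⁅ee k, ⁅gg k, v⁆⁆ + ⁅gg k, ⁅ee k, v⁆⁆) := by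
  rw [casimir, LinearMap.sum_apply, Fintype.sum_sum_type]
  congr 1
  · have : ∀ k : H.root, (toEnd K L V (xx (H := H) (Sum.inl k)) * toEnd K L V (yy (H := H) (Sum.inl k))) v
        = ((cN k * cN k * (RB.coK b k μ * RB.coK b k μ) : ℚ) : K) • v := by
      intro k
      change ⁅((tt k.1 : H) : L), ⁅((tt k.1 : H) : L), v⁆⁆ = _
      rw [wts_tt b hv, lie_smul, wts_tt b hv, smul_smul, RB.BB_rr b nrm]
      congr 1; push_cast; ring
    rw [Finset.sum_congr rfl fun k _ => this k, ← Finset.sum_smul, RB.BB_apply]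
    push_cast; rfl
  · change ∑ k : H.root, ⁅ee k, ⁅gg k, v⁆⁆ = _
    rw [← Finset.sum_filter_add_sum_filter_not Finset.univ (fun k => b.IsPos k),
      Finset.sum_add_distrib]
    congr 1
    refine Finset.sum_bij' (fun k _ => ng k) (fun k _ => ng k) ?_ ?_ ?_ ?_ ?_
    · intro k hk; simpa [pos_ng] using hk
    · intro k hk; simpa [pos_ng] using hk
    · intro k _; exact ng_ng k
    · intro k _; exact ng_ng k
    · intro k _; rw [← eg_neg, ng_ng]
end LB

end

section
open Module LieAlgebra LieModule LieAlgebra.IsKilling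

namespace LB
variable {K L : Type*} [Field K] [CharZero K] [LieRing L] [LieAlgebra K L] [FiniteDimensional K L]
  [IsKilling K L] {H : LieSubalgebra K L} [H.IsCartanSubalgebra] [IsTriangularizable K H L]
variable {V : Type*} [AddCommGroup V] [Module K V] [LieRingModule L V] [LieModule K L V]

open Classical in
/-- raising operators indexed by coordinates -/
noncomputable def EE (b : (rootSystem H).Base) (V : Type*) [AddCommGroup V] [Module K V]
    [LieRingModule L V] [LieModule K L V] (β : b.support → ℤ) : Module.End K V :=
  if h : ∃ k, RB.rr b k = β then toEnd K L V (ee h.choose) else 0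

open Classical in
/-- lowering operators indexed by coordinates -/
noncomputable def GG (b : (rootSystem H).Base) (V : Type*) [AddCommGroup V] [Module K V]
    [LieRingModule L V] [LieModule K L V] (β : b.support → ℤ) : Module.End K V :=
  if h : ∃ k, RB.rr b k = β then toEnd K L V (gg h.choose) else 0

theorem EE_rr (b : (rootSystem H).Base) (k : H.root) : EE b V (RB.rr b k) = toEnd K L V (ee k) := by
  have h : ∃ l, RB.rr b l = RB.rr b k := ⟨k, rfl⟩
  rw [EE, dif_pos h, RB.rr_inj b h.choose_spec]

theorem GG_rr (b : (rootSystem H).Base) (k : H.root) : GG b V (RB.rr b k) = toEnd K L V (gg k) := by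
  have h : ∃ l, RB.rr b l = RB.rr b k := ⟨k, rfl⟩
  rw [GG, dif_pos h, RB.rr_inj b h.choose_spec]

theorem simple_comm (b : (rootSystem H).Base) {i j : H.root} (hi : i ∈ b.support)
    (hj : j ∈ b.support) (hij : i ≠ j) : ⁅ee i, gg j⁆ = 0 := by
  have hm : ⁅ee i, gg j⁆ ∈ rootSpace H ((i.1 : H → K) + -(j.1 : H → K)) :=
    lie_mem_genWeightSpace_of_mem_genWeightSpace (ee_mem i) (gg_mem j)
  by_contra h0
  have hne : rootSpace H ((i.1 : H → K) + -(j.1 : H → K)) ≠ ⊥ := by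
    intro h; rw [h] at hm; exact h0 hm
  let χ : Weight K H L := ⟨_, hne⟩
  have hχ : χ.IsNonZero := by
    intro hz
    have : (i.1 : H → K) + -(j.1 : H → K) = 0 := hz
    rw [← sub_eq_add_neg, sub_eq_zero] at this
    exact hij (root_ext this)
  refine b.sub_notMem_range_root hi hj ⟨⟨χ, Finset.mem_filter.mpr ⟨Finset.mem_univ _, hχ⟩⟩, ?_⟩
  ext h
  change i.1 h + - j.1 h = i.1 h - j.1 h
  ring

/-- the data attached to an irreducible module -/
noncomputable def vdata (b : (rootSystem H).Base) [FiniteDimensional K V] [IsAlgClosed K]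
    [IsTriangularizable K H V] [Nontrivial V]
    (hirr : ∀ Y : Submodule K V, (∀ x : L, ∀ v ∈ Y, ⁅x, v⁆ ∈ Y) → Y = ⊥ ∨ Y = ⊤) :
    VData K V b.support where
  W := RB.wdata b nrm
  wt := wts V b
  E := EE b V
  G := GG b V
  ind := wts_ind b
  top := wts_top b hirr
  Ewt := by
    intro β hβ μ v hv
    obtain ⟨k, _, rfl⟩ := Finset.mem_image.mp hβ
    rw [EE_rr]; exact wts_e b hv k
  Gwt := by
    intro β hβ μ v hv
    obtain ⟨k, _, rfl⟩ := Finset.mem_image.mp hβ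
    rw [GG_rr]; exact wts_g b hv k
  EG := by
    intro β hβ μ v hv
    obtain ⟨k, _, rfl⟩ := Finset.mem_image.mp hβ
    rw [EE_rr, GG_rr]
    have := wts_tt b hv k
    rw [← lie_eg, lie_lie] at this
    exact this
  comm := by
    intro i j hij v
    change EE b V (RB.rr b i) (GG b V (RB.rr b j) v) = GG b V (RB.rr b j) (EE b V (RB.rr b i) v)
    rw [EE_rr, GG_rr]
    have := lie_lie (ee i.1) (gg j.1) v
    rw [simple_comm b i.2 j.2 (fun h => hij (Subtype.ext h)), zero_lie] at this
    exact (sub_eq_zero.mp this.symm)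
  c := (casimir_scalar (H := H) hirr).choose
  cas := by
    intro μ v hv
    rw [← (casimir_scalar (H := H) hirr).choose_spec v, casimir_wt b hv]
    congr 1
    change ∑ β ∈ Finset.image _ _, _ = _
    rw [Finset.sum_image (RB.rr_inj b).injOn]
    refine Finset.sum_congr rfl fun k _ => ?_
    rw [EE_rr, GG_rr]; rfl
  irr := by
    intro Y h1 h2
    refine hirr Y (stable_of_simple b Y ?_ ?_)
    · intro i v hv
      have := h1 i v hv
      change EE b V (RB.rr b i) v ∈ Y at this
      rwa [EE_rr] at this
    · intro i v hv
      have := h2 i v hv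
      change GG b V (RB.rr b i) v ∈ Y at this
      rwa [GG_rr] at this

variable (H) in
theorem lie_main0 [FiniteDimensional K V] [IsAlgClosed K]
    [IsTriangularizable K H V]
    (hirr : ∀ Y : Submodule K V, (∀ x : L, ∀ v ∈ Y, ⁅x, v⁆ ∈ Y) → Y = ⊥ ∨ Y = ⊤)
    (hp : (finrank K V).Prime) (hp2 : finrank K V ≠ 2) :
    (∀ X : Module.End K V, LinearMap.trace K V X = 0 → ∃ x : L, toEnd K L V x = X) ∨
    ∃ Bf : V →ₗ[K] V →ₗ[K] K, Bf ≠ 0 ∧ ∀ (x : L) (u v : V), Bf ⁅x, u⁆ v + Bf u ⁅x, v⁆ = 0 := by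
  classical
  haveI : Nontrivial V := Module.nontrivial_of_finrank_pos (R := K) hp.pos
  obtain ⟨b⟩ : Nonempty (rootSystem H).Base := RootPairing.nonempty_base _
  have hE : ∀ i : b.support, (vdata (V := V) b hirr).E ((vdata (V := V) b hirr).W.a i) = toEnd K L V (ee i.1) := fun i =>
    EE_rr b i.1
  have hG : ∀ i : b.support, (vdata (V := V) b hirr).G ((vdata (V := V) b hirr).W.a i) = toEnd K L V (gg i.1) := fun i =>
    GG_rr b i.1
  rcases VData.main (vdata (V := V) b hirr) (RB.wdata_LemD b nrm) (RB.wdata_cartan b nrm) hp hp2 with h | ⟨Bf, h0, h1, h2⟩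
  · left
    intro X hX
    have := h (LinearMap.range (toEnd K L V : L →ₗ[K] Module.End K V)) ?_ ?_ ?_ X hX
    · exact this
    · rintro _ ⟨x, rfl⟩ _ ⟨y, rfl⟩
      refine ⟨⁅x, y⁆, ?_⟩
      ext v
      exact lie_lie x y v
    · intro i; rw [hE]; exact ⟨_, rfl⟩
    · intro i; rw [hG]; exact ⟨_, rfl⟩
  · right
    refine ⟨Bf, h0, ?_⟩
    let S : LieSubalgebra K L :=
      { carrier := {x | ∀ u v, Bf ⁅x, u⁆ v + Bf u ⁅x, v⁆ = 0}
        add_mem' := fun {x y} ha hb u v => by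
          have h1 := ha u v; have h2 := hb u v
          simp only [add_lie, map_add, LinearMap.add_apply]
          linear_combination h1 + h2
        zero_mem' := fun u v => by simp
        smul_mem' := fun c x hx u v => by
          have h1 := hx u v
          simp only [smul_lie, map_smul, LinearMap.smul_apply, smul_eq_mul]
          linear_combination c * h1
        lie_mem' := fun {x y} hx hy u v => by
          have h1 := hx ⁅y, u⁆ v; have h2 := hy ⁅x, u⁆ v
          have h3 := hx u ⁅y, v⁆; have h4 := hy u ⁅x, v⁆
          simp only [lie_lie, map_sub, LinearMap.sub_apply]
          linear_combination h1 - h2 + h3 - h4 - (hx ⁅y, u⁆ v) + hx ⁅y, u⁆ v }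
    have hS : S = ⊤ := by
      refine gen_top b S ?_ ?_
      · intro i hi x hx
        obtain ⟨c, rfl⟩ := rootSpace_span (root_nz i) (ee_mem i) (ee_ne i) hx
        refine S.smul_mem _ (fun u v => ?_)
        have := h1 ⟨i, hi⟩ u v
        rwa [hE] at this
      · intro i hi x hx
        obtain ⟨c, rfl⟩ := rootSpace_span (α := -i.1) (Weight.IsNonZero.neg (root_nz i))
          (gg_mem i) (gg_ne i) hx
        refine S.smul_mem _ (fun u v => ?_)
        have := h2 ⟨i, hi⟩ u v
        rwa [hG] at this
    intro x
    have : x ∈ S := by rw [hS]; trivial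
    exact this
end LB

section
attribute [local instance] LieRing.ofAssociativeRing

/-- Theorem G -/
theorem theoremG {K : Type*} [Field K] [CharZero K] [IsAlgClosed K] {V : Type*} [AddCommGroup V]
    [Module K V] [FiniteDimensional K V] (L0 : Submodule K (Module.End K V))
    (hbr : ∀ X ∈ L0, ∀ Y ∈ L0, X * Y - Y * X ∈ L0)
    (htr : ∀ X ∈ L0, LinearMap.trace K V X = 0)
    (hirr : ∀ Y : Submodule K V, (∀ X ∈ L0, ∀ v ∈ Y, X v ∈ Y) → Y = ⊥ ∨ Y = ⊤)
    (hp : (finrank K V).Prime) (hp2 : finrank K V ≠ 2) :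
    (∀ X : Module.End K V, LinearMap.trace K V X = 0 → X ∈ L0) ∨
    ∃ Bf : V →ₗ[K] V →ₗ[K] K, Bf ≠ 0 ∧ ∀ X ∈ L0, ∀ (u v : V), Bf (X u) v + Bf u (X v) = 0 := by
  haveI : Nontrivial V := Module.nontrivial_of_finrank_pos (R := K) hp.pos
  let LL : LieSubalgebra K (Module.End K V) := { L0 with lie_mem' := fun {X Y} hX hY => hbr X hX Y hY }
  have hirr' : ∀ Y : Submodule K V, (∀ x : LL, ∀ v ∈ Y, ⁅x, v⁆ ∈ Y) → Y = ⊥ ∨ Y = ⊤ :=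
    fun Y hY => hirr Y (fun X hX v hv => hY ⟨X, hX⟩ v hv)
  haveI : LieModule.IsIrreducible K LL V := by
    refine LieModule.IsIrreducible.mk fun N hN => ?_
    have := (hirr' N.toSubmodule (fun x v hv => N.lie_mem hv)).resolve_left
      (fun h => hN (by simpa using h))
    simpa using this
  haveI : LieModule.IsFaithful K LL V := by
    refine ⟨?_⟩
    intro x y h
    apply Subtype.ext
    ext v
    exact LinearMap.congr_fun h v
  haveI := LieAlgebra.hasTrivialRadical_of_isIrreducible_of_isFaithful K LL V (fun x => htr _ x.2)
  haveI : LieAlgebra.IsKilling K LL := inferInstance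
  obtain ⟨x0, hH⟩ := LieAlgebra.exists_isCartanSubalgebra_engel K LL
  rcases LB.lie_main0 (K := K) (L := LL) (LieSubalgebra.engel K x0) (V := V) hirr' hp hp2 with h | ⟨Bf, h0, h1⟩
  · left
    intro X hX
    obtain ⟨x, hx⟩ := h X hX
    rw [← hx]; exact x.2
  · right
    exact ⟨Bf, h0, fun X hX u v => h1 ⟨X, hX⟩ u v⟩
end

end

section
open Module

/-- dimension version of Clifford's theorem -/
theorem clifford_dim {K G V : Type*} [Field K] [Group G] [AddCommGroup V] [Module K V]
    [FiniteDimensional K V] (ρ : G →* Module.End K V) (X : Set (Module.End K V))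
    (hX : ∀ g : G, ∀ x ∈ X, ∃ y ∈ X, x * ρ g = ρ g * y)
    (S : Set G) (hS : ∀ g ∈ S, ∀ h ∈ S, g * h ∈ S) (h1 : (1:G) ∈ S)
    (hirr : ∀ Y : Submodule K V, (∀ g ∈ S, ∀ v ∈ Y, ρ g v ∈ Y) → Y = ⊥ ∨ Y = ⊤)
    (W : Submodule K V) (hW0 : W ≠ ⊥) (hWX : ∀ x ∈ X, ∀ v ∈ W, x v ∈ W)
    (hmin : ∀ Y : Submodule K V, Y ≤ W → (∀ x ∈ X, ∀ v ∈ Y, x v ∈ Y) → Y = ⊥ ∨ Y = W) :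
    finrank K W ∣ finrank K V := by
  classical
  have hinv : ∀ g : G, ∀ v, ρ g⁻¹ (ρ g v) = v := by
    intro g v
    rw [← Module.End.mul_apply, ← map_mul]; simp
  have hinv' : ∀ g : G, ∀ v, ρ g (ρ g⁻¹ v) = v := by
    intro g v
    rw [← Module.End.mul_apply, ← map_mul]; simp
  have hinj : ∀ g : G, Function.Injective (ρ g) := fun g => Function.LeftInverse.injective (hinv g)
  -- translate stable
  have htr : ∀ g : G, ∀ Y : Submodule K V, (∀ x ∈ X, ∀ v ∈ Y, x v ∈ Y) →
      ∀ x ∈ X, ∀ v ∈ Y.map (ρ g), x v ∈ Y.map (ρ g) := by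
    rintro g Y hY x hx _ ⟨v, hv, rfl⟩
    obtain ⟨y, hy, hxy⟩ := hX g x hx
    refine ⟨y v, hY y hy v hv, ?_⟩
    exact (congrArg (fun f => f v) hxy).symm
  have hmin' : ∀ g : G, ∀ Y : Submodule K V, Y ≤ W.map (ρ g) → (∀ x ∈ X, ∀ v ∈ Y, x v ∈ Y) →
      Y = ⊥ ∨ Y = W.map (ρ g) := by
    intro g Y hY hYX
    have e : (Y.map (ρ g⁻¹)).map (ρ g) = Y := by
      ext v; constructor
      · rintro ⟨_, ⟨w, hw, rfl⟩, rfl⟩; rw [hinv']; exact hw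
      · intro hv; exact ⟨_, ⟨v, hv, rfl⟩, hinv' g v⟩
    rcases hmin (Y.map (ρ g⁻¹)) (by
      rintro _ ⟨v, hv, rfl⟩
      obtain ⟨w, hw, rfl⟩ := hY hv
      rw [hinv]; exact hw) (htr _ _ hYX) with h | h
    · left; rw [← e, h]; simp
    · right; rw [← e, h]
  let P : ℕ → Prop := fun d => ∃ Y : Submodule K V, finrank K Y = d ∧ (∀ x ∈ X, ∀ v ∈ Y, x v ∈ Y)
    ∧ finrank K W ∣ finrank K Y
  have hP0 : P 0 := ⟨⊥, by simp, by simp, by simp⟩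
  obtain ⟨Y, hYd, hYX, hYdv⟩ := Nat.findGreatest_spec (P := P) (Nat.zero_le (finrank K V)) hP0
  suffices Y = ⊤ by rw [this, finrank_top] at hYdv; exact hYdv
  have hle : ∀ g ∈ S, W.map (ρ g) ≤ Y := by
    intro g hg
    rcases hmin' g (W.map (ρ g) ⊓ Y) inf_le_left (fun x hx v hv =>
      ⟨htr g W hWX x hx v hv.1, hYX x hx v hv.2⟩) with h | h
    · exfalso
      have hd := Submodule.finrank_sup_add_finrank_inf_eq (W.map (ρ g)) Y
      rw [h, finrank_bot, add_zero, LinearEquiv.finrank_eq (Submodule.equivMapOfInjective (ρ g) (hinj g) W).symm] at hd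
      have hPn : P (finrank K W + finrank K Y) := by
        refine ⟨W.map (ρ g) ⊔ Y, hd, ?_, ?_⟩
        · intro x hx v hv
          obtain ⟨a, ha, b, hb, rfl⟩ := Submodule.mem_sup.1 hv
          rw [map_add]
          exact Submodule.add_mem_sup (htr g W hWX x hx a ha) (hYX x hx b hb)
        · rw [hd]; exact (dvd_refl _).add hYdv
      have := Nat.le_findGreatest (P := P) (n := finrank K V)
        (by rw [← hd]; exact Submodule.finrank_le _) hPn
      have hWp : 0 < finrank K W := by
        rw [Nat.pos_iff_ne_zero]; intro h; exact hW0 (Submodule.finrank_eq_zero.1 h)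
      omega
    · exact inf_eq_left.1 h
  have hsup : (⨆ g ∈ S, W.map (ρ g)) ≤ Y := iSup₂_le hle
  rcases hirr (⨆ g ∈ S, W.map (ρ g)) (by
    intro g hg v hv
    have : (⨆ h ∈ S, W.map (ρ h)) ≤ (⨆ h ∈ S, W.map (ρ h)).comap (ρ g) := by
      refine iSup₂_le fun h hh => ?_
      rintro _ ⟨w, hw, rfl⟩
      refine Submodule.mem_iSup_of_mem (g * h) (Submodule.mem_iSup_of_mem (hS g hg h hh) ⟨w, hw, ?_⟩)
      rw [map_mul]; rfl
    exact this hv) with h | h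
  · exfalso
    apply hW0
    rw [eq_bot_iff, ← h]
    refine le_trans ?_ (le_iSup₂_of_le 1 h1 le_rfl)
    rw [map_one]; exact fun v hv => ⟨v, hv, rfl⟩
  · rw [h] at hsup; exact top_le_iff.1 hsup

theorem exists_min_stable {K V : Type*} [Field K] [AddCommGroup V] [Module K V]
    [FiniteDimensional K V] [Nontrivial V] (X : Set (Module.End K V)) :
    ∃ W : Submodule K V, W ≠ ⊥ ∧ (∀ x ∈ X, ∀ v ∈ W, x v ∈ W) ∧
    ∀ Y : Submodule K V, Y ≤ W → (∀ x ∈ X, ∀ v ∈ Y, x v ∈ Y) → Y = ⊥ ∨ Y = W := by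
  let s : Set (Submodule K V) := {W | W ≠ ⊥ ∧ (∀ x ∈ X, ∀ v ∈ W, x v ∈ W)}
  obtain ⟨W, hW, hm⟩ := (wellFounded_lt (α := Submodule K V)).has_min s
    ⟨⊤, by simp, by simp⟩
  refine ⟨W, hW.1, hW.2, fun Y hY hYX => ?_⟩
  by_cases h : Y = ⊥
  · exact Or.inl h
  · right
    by_contra hne
    exact hm Y ⟨h, hYX⟩ (lt_of_le_of_ne hY hne)

/-- prime dimension: irreducible group, normal-ish operators: either a common eigenline or irreducible. -/
theorem clifford_prime {K G V : Type*} [Field K] [Group G] [AddCommGroup V] [Module K V]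
    [FiniteDimensional K V] (ρ : G →* Module.End K V) (X : Set (Module.End K V))
    (hX : ∀ g : G, ∀ x ∈ X, ∃ y ∈ X, x * ρ g = ρ g * y)
    (hirr : ∀ Y : Submodule K V, (∀ g, ∀ v ∈ Y, ρ g v ∈ Y) → Y = ⊥ ∨ Y = ⊤)
    (hp : (finrank K V).Prime) :
    (∃ v : V, v ≠ 0 ∧ ∀ x ∈ X, ∃ c : K, x v = c • v) ∨
    ∀ Y : Submodule K V, (∀ x ∈ X, ∀ v ∈ Y, x v ∈ Y) → Y = ⊥ ∨ Y = ⊤ := by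
  have : Nontrivial V := Module.nontrivial_of_finrank_pos hp.pos
  obtain ⟨W, hW0, hWX, hmin⟩ := exists_min_stable X
  have hd := clifford_dim ρ X hX Set.univ (by simp) (by simp)
    (fun Y hY => hirr Y fun g => hY g (by simp)) W hW0 hWX hmin
  rcases (Nat.dvd_prime hp).1 hd with h | h
  · left
    obtain ⟨v, hv0, hv⟩ := finrank_eq_one_iff'.1 h
    refine ⟨v, by simpa using hv0, fun x hx => ?_⟩
    obtain ⟨c, hc⟩ := hv ⟨x v, hWX x hx v v.2⟩
    exact ⟨c, (congrArg Subtype.val hc).symm⟩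
  · right
    have : W = ⊤ := Submodule.eq_top_of_finrank_eq h
    subst this
    exact fun Y hY => hmin Y le_top hY

end

section
open Module

theorem abelian_normal_trichotomy {K G V : Type*} [Field K] [Group G] [AddCommGroup V] [Module K V]
    [FiniteDimensional K V] (ρ : G →* Module.End K V)
    (hirr : ∀ Y : Submodule K V, (∀ g, ∀ v ∈ Y, ρ g v ∈ Y) → Y = ⊥ ∨ Y = ⊤)
    (hp : (finrank K V).Prime) (A : Subgroup G) [hA : A.Normal]
    (hcomm : ∀ a ∈ A, ∀ b ∈ A, a * b = b * a) :
    (∀ Y : Submodule K V, (∀ a ∈ A, ∀ v ∈ Y, ρ a v ∈ Y) → Y = ⊥ ∨ Y = ⊤) ∨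
    (∃ m : ℕ, 2 ≤ m ∧ ∃ W : Fin m → Submodule K V, (∀ i, W i ≠ ⊥) ∧ DirectSum.IsInternal W ∧
      ∀ g, ∀ i, ∃ j, (W i).map (ρ g) = W j) ∨
    ∀ a ∈ A, ∃ c : K, ∀ v, ρ a v = c • v := by
  classical
  have hinv' : ∀ g : G, ∀ v, ρ g (ρ g⁻¹ v) = v := by
    intro g v
    rw [← Module.End.mul_apply, ← map_mul]; simp
  rcases clifford_prime ρ (ρ '' (A : Set G)) (by
    rintro g _ ⟨a, ha, rfl⟩
    refine ⟨ρ (g⁻¹ * a * g), ⟨_, by simpa using hA.conj_mem a ha g⁻¹, rfl⟩, ?_⟩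
    rw [← map_mul, ← map_mul]; congr 1; group) hirr hp with ⟨v, hv0, hv⟩ | h
  swap
  · left
    intro Y hY
    exact h Y (by rintro _ ⟨a, ha, rfl⟩; exact hY a ha)
  right
  let W : (A → K) → Submodule K V := fun χ => ⨅ a : A, (ρ a).eigenspace (χ a)
  have hmemW : ∀ χ u, u ∈ W χ ↔ ∀ a : A, ρ a u = χ a • u := by
    intro χ u; simp [W, Submodule.mem_iInf, Module.End.mem_eigenspace_iff]
  have hind : iSupIndep W := by
    refine (Module.End.independent_iInf_maxGenEigenspace_of_forall_mapsTo (fun a : A => ρ a) ?_).mono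
      (fun χ => ?_)
    · intro a b φ
      apply Module.End.mapsTo_maxGenEigenspace_of_comm
      rw [Commute, SemiconjBy, ← map_mul, ← map_mul, hcomm _ b.2 _ a.2]
    · exact iInf_mono fun a => (Module.End.genEigenspace (ρ a) (χ a)).monotone le_top
  let tw : G → (A → K) → (A → K) := fun g χ a => χ ⟨g⁻¹ * a * g, by simpa using hA.conj_mem a a.2 g⁻¹⟩
  have htw : ∀ g χ u, u ∈ W χ → ρ g u ∈ W (tw g χ) := by
    intro g χ u hu
    rw [hmemW] at hu ⊢
    intro a
    have := hu ⟨g⁻¹ * a * g, by simpa using hA.conj_mem a a.2 g⁻¹⟩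
    rw [← map_smul]
    simp only [tw]
    rw [← this, ← Module.End.mul_apply, ← Module.End.mul_apply, ← map_mul, ← map_mul]
    congr 2; group
  have htw2 : ∀ g χ, tw g (tw g⁻¹ χ) = χ := by
    intro g χ; funext a; simp only [tw]; congr 1; ext; simp [mul_assoc]
  have htw3 : ∀ g χ, tw g⁻¹ (tw g χ) = χ := by
    intro g χ; funext a; simp only [tw]; congr 1; ext; simp [mul_assoc]
  have hmap : ∀ g χ, (W χ).map (ρ g) = W (tw g χ) := by
    intro g χ
    apply le_antisymm
    · rintro _ ⟨u, hu, rfl⟩; exact htw g χ u hu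
    · intro u hu
      refine ⟨ρ g⁻¹ u, ?_, hinv' g u⟩
      have := htw g⁻¹ _ u hu
      rwa [htw3] at this
  have htop : (⨆ χ, W χ) = ⊤ := by
    refine (hirr (⨆ χ, W χ) ?_).resolve_left ?_
    · intro g u hu
      have : (⨆ χ, W χ) ≤ (⨆ χ, W χ).comap (ρ g) := by
        refine iSup_le fun χ u hu => ?_
        exact Submodule.mem_iSup_of_mem _ (htw g χ u hu)
      exact this hu
    · intro h
      choose c hc using fun a : A => hv (ρ a) ⟨a, a.2, rfl⟩
      have : v ∈ ⨆ χ, W χ := Submodule.mem_iSup_of_mem c ((hmemW c v).2 hc)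
      rw [h] at this; exact hv0 (by simpa using this)
  have hfin : Finite {χ // W χ ≠ ⊥} := WellFoundedGT.finite_ne_bot_of_iSupIndep hind
  obtain ⟨m, ⟨e⟩⟩ := Finite.exists_equiv_fin {χ // W χ ≠ ⊥}
  have hind' : iSupIndep fun χ : {χ // W χ ≠ ⊥} => W χ := hind.comp Subtype.coe_injective
  have htop' : (⨆ χ : {χ // W χ ≠ ⊥}, W χ) = ⊤ := by rw [iSup_ne_bot_subtype, htop]
  by_cases hm : 2 ≤ m
  · left
    refine ⟨m, hm, fun i => W (e.symm i), fun i => (e.symm i).2, ?_, ?_⟩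
    · rw [DirectSum.isInternal_submodule_iff_iSupIndep_and_iSup_eq_top]
      exact ⟨hind'.comp e.symm.injective, by rw [← htop']; exact e.symm.iSup_comp (g := fun χ : {χ // W χ ≠ ⊥} => W χ)⟩
    · intro g i
      refine ⟨e ⟨tw g (e.symm i), ?_⟩, ?_⟩
      · rw [← hmap]
        intro h
        rw [Submodule.eq_bot_iff] at h
        apply (e.symm i).2
        rw [Submodule.eq_bot_iff]
        intro x hx
        have := h _ ⟨x, hx, rfl⟩
        have h2 := hinv' g⁻¹ x
        rw [inv_inv, this, map_zero] at h2
        exact h2.symm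
      · simp [hmap]
  · right
    have hsub : Subsingleton {χ // W χ ≠ ⊥} := by
      refine ⟨fun x y => e.injective (Fin.ext ?_)⟩
      have := (e x).2; have := (e y).2; omega
    have hne : Nonempty {χ // W χ ≠ ⊥} := by
      by_contra hne
      rw [not_nonempty_iff] at hne
      rw [iSup_of_empty] at htop'
      have : v ∈ (⊤ : Submodule K V) := trivial
      rw [← htop'] at this; exact hv0 (by simpa using this)
    obtain ⟨χ⟩ := hne
    have : W χ = ⊤ := by
      rw [← htop']
      have : Unique {χ // W χ ≠ ⊥} := ⟨⟨χ⟩, fun y => Subsingleton.elim _ _⟩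
      rw [iSup_unique]
      congr 2; exact Subsingleton.elim _ _
    intro a ha
    refine ⟨χ.1 ⟨a, ha⟩, fun u => (hmemW χ u).1 (this ▸ trivial) ⟨a, ha⟩⟩

end

section
open Module

theorem aut_solvable_aux {K E : Type*} [Field K] [CommRing E] [IsDomain E] [Algebra K E]
    [FiniteDimensional K E] (hp : (finrank K E).Prime) : Group.IsSolvable (E ≃ₐ[K] E) := by
  letI : Field E := fieldOfFiniteDimensional K E
  have h : finrank (IntermediateField.fixedField (⊤ : Subgroup (E ≃ₐ[K] E))) E ∣ finrank K E :=
    Dvd.intro_left _ (Module.finrank_mul_finrank K _ E)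
  rw [IntermediateField.finrank_fixedField_eq_card, Subgroup.card_top] at h
  rcases (Nat.dvd_prime hp).1 h with h | h
  · have := (Nat.card_eq_one_iff_unique.1 h).1
    infer_instance
  · have := Fact.mk hp
    have hc : IsCyclic (E ≃ₐ[K] E) := isCyclic_of_prime_card h
    exact Group.isSolvable_of_comm fun a b => mul_comm' a b

theorem aut_solvable {K E : Type*} [Field K] [Ring E] [IsDomain E] [Algebra K E]
    [FiniteDimensional K E] (hcomm : ∀ x y : E, x * y = y * x)
    (hp : (finrank K E).Prime) : Group.IsSolvable (E ≃ₐ[K] E) := by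
  letI : CommRing E := { ‹Ring E› with mul_comm := hcomm }
  exact aut_solvable_aux hp

theorem irr_abelian_solvable {K G V : Type*} [Field K] [Group G] [AddCommGroup V] [Module K V]
    [FiniteDimensional K V] (ρ : G →* Module.End K V) (hinj : Function.Injective ρ)
    (hp : (finrank K V).Prime) (A : Subgroup G) [hA : A.Normal]
    (hcomm : ∀ a ∈ A, ∀ b ∈ A, a * b = b * a)
    (hirr : ∀ Y : Submodule K V, (∀ a ∈ A, ∀ v ∈ Y, ρ a v ∈ Y) → Y = ⊥ ∨ Y = ⊤) :
    Group.IsSolvable G := by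
  classical
  have hnt : Nontrivial V := Module.nontrivial_of_finrank_pos hp.pos
  obtain ⟨v, hv0⟩ := exists_ne (0 : V)
  let E : Subalgebra K (Module.End K V) := Algebra.adjoin K (ρ '' (A : Set G))
  have hAE : ∀ a ∈ A, ρ a ∈ E := fun a ha => Algebra.subset_adjoin ⟨a, ha, rfl⟩
  have hcent : ∀ u : Module.End K V, (∀ a ∈ A, u * ρ a = ρ a * u) → ∀ x ∈ E, u * x = x * u := by
    intro u hu x hx
    have : E ≤ Subalgebra.centralizer K {u} := by
      refine Algebra.adjoin_le ?_
      rintro _ ⟨a, ha, rfl⟩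
      rw [SetLike.mem_coe, Subalgebra.mem_centralizer_iff]
      rintro _ rfl
      exact hu a ha
    have := this hx
    rw [Subalgebra.mem_centralizer_iff] at this
    exact this u rfl
  have hEcomm : ∀ x ∈ E, ∀ y ∈ E, x * y = y * x := by
    intro x hx y hy
    refine hcent x (fun a ha => (hcent (ρ a) (fun b hb => ?_) x hx).symm) y hy
    rw [← map_mul, ← map_mul, hcomm a ha b hb]
  have hker : ∀ x ∈ E, x ≠ 0 → Function.Injective x := by
    intro x hx hx0
    rw [← LinearMap.ker_eq_bot]
    refine (hirr (LinearMap.ker x) ?_).resolve_right ?_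
    · intro a ha w hw
      rw [LinearMap.mem_ker] at hw ⊢
      rw [← Module.End.mul_apply, hEcomm x hx _ (hAE a ha), Module.End.mul_apply, hw, map_zero]
    · intro h; exact hx0 (LinearMap.ker_eq_top.1 h)
  haveI hdom : IsDomain E := by
    have : NoZeroDivisors E := by
      refine ⟨fun {x y} h => ?_⟩
      by_contra hne
      push Not at hne
      have hx : (x : Module.End K V) ≠ 0 := fun h => hne.1 (Subtype.ext h)
      have hy : (y : Module.End K V) ≠ 0 := fun h => hne.2 (Subtype.ext h)
      apply hv0
      apply hker y y.2 hy
      apply hker x x.2 hx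
      rw [← Module.End.mul_apply]
      have : (x : Module.End K V) * y = 0 := congrArg Subtype.val h
      rw [this]; simp
    exact NoZeroDivisors.to_isDomain E
  let ev : E →ₗ[K] V := (LinearMap.applyₗ v).comp E.val.toLinearMap
  have hev : ∀ x : E, ev x = (x : Module.End K V) v := fun x => rfl
  have hevinj : Function.Injective ev := by
    rw [injective_iff_map_eq_zero]
    intro x hx
    by_contra hne
    have hx0 : (x : Module.End K V) ≠ 0 := fun h => hne (Subtype.ext h)
    apply hv0; apply hker x x.2 hx0
    rw [← hev, hx, map_zero]
  have hevsurj : Function.Surjective ev := by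
    rw [← LinearMap.range_eq_top]
    refine (hirr _ ?_).resolve_left ?_
    · rintro a ha _ ⟨x, rfl⟩
      exact ⟨⟨ρ a * x, E.mul_mem (hAE a ha) x.2⟩, rfl⟩
    · intro h
      have : v ∈ LinearMap.range ev := ⟨1, rfl⟩
      rw [h] at this; exact hv0 (by simpa using this)
  have hfr : finrank K E = finrank K V := LinearEquiv.finrank_eq (LinearEquiv.ofBijective ev ⟨hevinj, hevsurj⟩)
  have hsolv : Group.IsSolvable (E ≃ₐ[K] E) := aut_solvable
    (fun x y => Subtype.ext (hEcomm x x.2 y y.2)) (by rw [hfr]; exact hp)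
  have hgg : ∀ g : G, ρ g * ρ g⁻¹ = 1 := fun g => by rw [← map_mul]; simp
  have hgg' : ∀ g : G, ρ g⁻¹ * ρ g = 1 := fun g => by rw [← map_mul]; simp
  have hconjE : ∀ g : G, ∀ x ∈ E, ρ g * x * ρ g⁻¹ ∈ E := by
    intro g x hx
    induction hx using Algebra.adjoin_induction with
    | mem x hx =>
      obtain ⟨a, ha, rfl⟩ := hx
      rw [← map_mul, ← map_mul]
      exact hAE _ (hA.conj_mem a ha g)
    | algebraMap r =>
      rw [← Algebra.commutes, mul_assoc, hgg, mul_one]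
      exact E.algebraMap_mem r
    | add x y _ _ hx hy => rw [mul_add, add_mul]; exact E.add_mem hx hy
    | mul x y _ _ hx hy =>
      have : ρ g * (x * y) * ρ g⁻¹ = (ρ g * x * ρ g⁻¹) * (ρ g * y * ρ g⁻¹) := by
        simp only [mul_assoc]; rw [← mul_assoc (ρ g⁻¹) (ρ g), hgg', one_mul]
      rw [this]; exact E.mul_mem hx hy
  let cj : G → E →ₐ[K] E := fun g => AlgHom.ofLinearMap
    { toFun := fun x => ⟨ρ g * x * ρ g⁻¹, hconjE g x x.2⟩
      map_add' := fun x y => Subtype.ext (by simp [mul_add, add_mul])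
      map_smul' := fun c x => Subtype.ext (by simp) }
    (Subtype.ext (by simp [hgg])) (fun x y => Subtype.ext (by
      show ρ g * ((x : Module.End K V) * y) * ρ g⁻¹ = (ρ g * x * ρ g⁻¹) * (ρ g * y * ρ g⁻¹)
      simp only [mul_assoc]; rw [← mul_assoc (ρ g⁻¹) (ρ g), hgg', one_mul]))
  have hcj : ∀ g x, (cj g x : Module.End K V) = ρ g * x * ρ g⁻¹ := fun g x => rfl
  have hcjmul : ∀ g h x, cj (g * h) x = cj g (cj h x) := by
    intro g h x; apply Subtype.ext; rw [hcj, hcj, hcj, _root_.mul_inv_rev, map_mul, map_mul]; simp only [mul_assoc]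
  have hcjone : ∀ x, cj 1 x = x := by
    intro x; apply Subtype.ext; rw [hcj]; simp
  let ψ : G →* (E ≃ₐ[K] E) :=
    { toFun := fun g => AlgEquiv.ofAlgHom (cj g) (cj g⁻¹)
        (AlgHom.ext fun x => by rw [AlgHom.comp_apply, ← hcjmul]; simp [hcjone])
        (AlgHom.ext fun x => by rw [AlgHom.comp_apply, ← hcjmul]; simp [hcjone])
      map_one' := AlgEquiv.ext hcjone
      map_mul' := fun g h => AlgEquiv.ext (hcjmul g h) }
  have hψ : ∀ g x, ψ g x = cj g x := fun g x => rfl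
  have hkE : ∀ g ∈ ψ.ker, ρ g ∈ E := by
    intro g hg
    have hc : ∀ x ∈ E, ρ g * x = x * ρ g := by
      intro x hx
      have h1 : (cj g ⟨x, hx⟩ : Module.End K V) = x := by
        rw [← hψ, MonoidHom.mem_ker.1 hg]; rfl
      rw [hcj] at h1
      have := congrArg (· * ρ g) h1
      simp only [mul_assoc, hgg', mul_one] at this
      exact this
    obtain ⟨x, hx⟩ := hevsurj (ρ g v)
    have : ρ g = x := by
      ext w
      obtain ⟨y, rfl⟩ := hevsurj w
      rw [hev, ← Module.End.mul_apply, hc y y.2, Module.End.mul_apply, ← hx, hev, ← Module.End.mul_apply,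
        hEcomm _ y.2 _ x.2, Module.End.mul_apply]
    rw [this]; exact x.2
  have hks : Group.IsSolvable ψ.ker := Group.isSolvable_of_comm fun a b => Subtype.ext (hinj (by
    simp only [Subgroup.coe_mul, map_mul]
    exact hEcomm _ (hkE a a.2) _ (hkE b b.2)))
  exact solvable_of_ker_le_range ψ.ker.subtype ψ (by simp)

end

section
open Module

def rhoQ (n : ℕ) : SL n ℤ →* Module.End ℚ (Fin n → ℚ) where
  toFun g := Matrix.toLin' (matQ g)
  map_one' := by
    have : matQ (1 : SL n ℤ) = 1 := by simp [matQ]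
    rw [this]; exact Matrix.toLin'_one
  map_mul' g h := by
    have : matQ (g * h) = matQ g * matQ h := by
      simp only [matQ, Matrix.SpecialLinearGroup.coe_mul]
      exact Matrix.map_mul (f := Int.castRingHom ℚ)
    rw [this]; exact Matrix.toLin'_mul _ _

theorem rhoQ_apply {n : ℕ} (g : SL n ℤ) : rhoQ n g = Matrix.toLin' (matQ g) := rfl

theorem matQ_one {n : ℕ} : matQ (1 : SL n ℤ) = 1 := by simp [matQ]

theorem matQ_inj {n : ℕ} : Function.Injective (matQ (n := n)) := by
  intro g h e
  apply Subtype.ext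
  ext i j
  have := congrFun (congrFun e i) j
  simpa [matQ] using this

theorem rhoQ_inj (n : ℕ) : Function.Injective (rhoQ n) := fun _ _ h =>
  matQ_inj (Matrix.toLin'.injective h)

theorem matQ_det {n : ℕ} (g : SL n ℤ) : (matQ g).det = 1 := by
  have : matQ g = (Int.castRingHom ℚ).mapMatrix (g : Mt(n) ℤ) := rfl
  rw [this, ← RingHom.map_det, g.2, map_one]

def rhoH {n : ℕ} (H : Subgroup (SL n ℤ)) : H →* Module.End ℚ (Fin n → ℚ) := (rhoQ n).comp H.subtype

theorem rhoH_apply {n : ℕ} (H : Subgroup (SL n ℤ)) (g : H) : rhoH H g = Matrix.toLin' (matQ g.1) := rfl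

theorem rhoH_inj {n : ℕ} (H : Subgroup (SL n ℤ)) : Function.Injective (rhoH H) :=
  (rhoQ_inj n).comp Subtype.coe_injective

theorem irrQ_iff {n : ℕ} (H : Subgroup (SL n ℤ)) : IrreducibleQ H ↔
    ∀ Y : Submodule ℚ (Fin n → ℚ), (∀ g : H, ∀ v ∈ Y, rhoH H g v ∈ Y) → Y = ⊥ ∨ Y = ⊤ := by
  constructor
  · intro h Y hY
    refine h Y fun g hg => ?_
    rintro _ ⟨v, hv, rfl⟩
    exact hY ⟨g, hg⟩ v hv
  · intro h Y hY
    exact h Y fun g v hv => hY g g.2 ⟨v, hv, rfl⟩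

theorem exists_abelian_normal {G : Type*} [Group G] (N : Subgroup G) [N.Normal]
    (hs : Group.IsSolvable N) (hN : N ≠ ⊥) :
    ∃ A : Subgroup G, A.Normal ∧ A ≠ ⊥ ∧ ∀ a ∈ A, ∀ b ∈ A, a * b = b * a := by
  classical
  obtain ⟨k, hk⟩ := hs
  have hex : ∃ k, derivedSeries N k = ⊥ := ⟨k, hk⟩
  have hspec := Nat.find_spec hex
  have hpos : Nat.find hex ≠ 0 := by
    intro h0
    rw [h0, derivedSeries_zero] at hspec
    apply hN
    rw [eq_bot_iff]
    intro x hx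
    have : (⟨x, hx⟩ : N) ∈ (⊤ : Subgroup N) := trivial
    rw [hspec, Subgroup.mem_bot] at this
    exact congrArg Subtype.val this
  obtain ⟨j, hj⟩ := Nat.exists_eq_succ_of_ne_zero hpos
  have hjne : derivedSeries N j ≠ ⊥ := Nat.find_min hex (by omega)
  rw [hj, Nat.succ_eq_add_one, derivedSeries_succ, Subgroup.commutator_eq_bot_iff_le_centralizer] at hspec
  refine ⟨(derivedSeries N j).map N.subtype, inferInstance, ?_, ?_⟩
  · intro h
    rw [Subgroup.map_eq_bot_iff_of_injective _ N.subtype_injective] at h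
    exact hjne h
  · rintro _ ⟨a, ha, rfl⟩ _ ⟨b, hb, rfl⟩
    have := hspec hb
    rw [Subgroup.mem_centralizer_iff] at this
    exact congrArg Subtype.val (this a ha)

theorem scalar_eq_one {n : ℕ} (hodd : Odd n) (g : SL n ℤ) (c : ℚ) (h : ∀ v, rhoQ n g v = c • v) : g = 1 := by
  have hm : matQ g = c • (1 : Mt(n) ℚ) := by
    apply Matrix.toLin'.injective
    ext1 v
    have := h
    apply LinearMap.ext
    intro w
    simp [← rhoQ_apply, this]
  have hd := matQ_det g
  rw [hm, Matrix.det_smul, Matrix.det_one, mul_one, Fintype.card_fin] at hd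
  have hc : c = 1 := by
    have := hodd.strictMono_pow (R := ℚ)
    exact this.injective (by simpa using hd)
  apply matQ_inj
  rw [hm, hc, one_smul, matQ_one]

theorem virt_solv_dich {n : ℕ} (hn : n.Prime) (hodd : Odd n) (H : Subgroup (SL n ℤ))
    (hirr : IrreducibleQ H) (hprim : ¬ ImprimitiveQ H) (hs : SolvableByFinite H) :
    Finite H ∨ Group.IsSolvable H := by
  obtain ⟨K, hK, hKf⟩ := hs
  have hK : Group.IsSolvable K := hK
  have hNs : Group.IsSolvable K.normalCore :=
    Group.isSolvable_of_isSolvable_injective (f := Subgroup.inclusion K.normalCore_le)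
      (Subgroup.inclusion_injective _)
  by_cases hN : K.normalCore = ⊥
  · left
    have : K.normalCore.FiniteIndex := inferInstance
    rw [hN] at this
    exact (Subgroup.finite_iff_finite_and_finiteIndex (⊥ : Subgroup H)).2 ⟨inferInstance, this⟩
  · obtain ⟨A, hA, hA0, hcomm⟩ := exists_abelian_normal K.normalCore hNs hN
    have hfr : (finrank ℚ (Fin n → ℚ)).Prime := by simpa using hn
    rcases abelian_normal_trichotomy (rhoH H) ((irrQ_iff H).1 hirr) hfr A hcomm with h | h | h
    · right
      exact irr_abelian_solvable (rhoH H) (rhoH_inj H) hfr A hcomm h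
    · exfalso
      apply hprim
      obtain ⟨m, hm, W, h1, h2, h3⟩ := h
      exact ⟨m, hm, W, h1, h2, fun g hg i => h3 ⟨g, hg⟩ i⟩
    · exfalso
      apply hA0
      rw [eq_bot_iff]
      intro a ha
      obtain ⟨c, hc⟩ := h a ha
      have := scalar_eq_one hodd a.1 c hc
      rw [Subgroup.mem_bot]
      exact Subtype.ext this

end

section
open Module

/-- a rational eigenvalue of an element of SL(n,ℤ) is ±1 -/
theorem rat_eigenvalue {n : ℕ} (g : SL n ℤ) (c : ℚ) (v : Fin n → ℚ) (hv : v ≠ 0)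
    (h : rhoQ n g v = c • v) : c = 1 ∨ c = -1 := by
  have key : ∀ (g : SL n ℤ) (c : ℚ), rhoQ n g v = c • v → ∃ z : ℤ, (z : ℚ) = c := by
    intro g c h
    have hroot : (matQ g).charpoly.IsRoot c := by
      have h1 : Module.End.HasEigenvalue (Matrix.toLin' (matQ g)) c :=
        Module.End.hasEigenvalue_of_hasEigenvector (x := v)
          ⟨Module.End.mem_eigenspace_iff.2 h, hv⟩
      have := (Module.End.hasEigenvalue_iff_isRoot_charpoly _ _).1 h1
      simpa [Matrix.charpoly_toLin'] using this
    have hm : (matQ g).charpoly = (g : Mt(n) ℤ).charpoly.map (Int.castRingHom ℚ) :=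
      (Matrix.charpoly_map _ (Int.castRingHom ℚ))
    have hItg : IsIntegral ℤ c := by
      refine ⟨_, Matrix.charpoly_monic (g : Mt(n) ℤ), ?_⟩
      rw [hm, Polynomial.IsRoot.def, Polynomial.eval_map] at hroot
      exact hroot
    obtain ⟨z, hz⟩ := IsIntegrallyClosed.isIntegral_iff.1 hItg
    exact ⟨z, by simpa using hz⟩
  have hc0 : c ≠ 0 := by
    rintro rfl
    rw [zero_smul] at h
    apply hv
    have : rhoQ n g⁻¹ (rhoQ n g v) = v := by rw [← Module.End.mul_apply, ← map_mul]; simp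
    rw [← this, h, map_zero]
  have h' : rhoQ n g⁻¹ v = c⁻¹ • v := by
    have : rhoQ n g⁻¹ (rhoQ n g v) = v := by rw [← Module.End.mul_apply, ← map_mul]; simp
    rw [h, map_smul] at this
    rw [← this, smul_smul, inv_mul_cancel₀ hc0, one_smul, this]
  obtain ⟨z, hz⟩ := key g c h
  obtain ⟨w, hw⟩ := key g⁻¹ c⁻¹ h'
  have : z * w = 1 := by
    have : (z : ℚ) * w = 1 := by rw [hz, hw, mul_inv_cancel₀ hc0]
    exact_mod_cast this
  rcases Int.eq_one_or_neg_one_of_mul_eq_one this with h | h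
  · left; rw [← hz, h]; simp
  · right; rw [← hz, h]; simp

theorem imprim_finite {n : ℕ} (hn : n.Prime) (H : Subgroup (SL n ℤ))
    (hirr : IrreducibleQ H) (him : ImprimitiveQ H) : Finite H := by
  classical
  obtain ⟨m, hm, W, hW0, hWi, hperm⟩ := him
  rw [irrQ_iff] at hirr
  have hperm' : ∀ g : H, ∀ i, ∃ j, (W i).map (rhoH H g) = W j := fun g i => hperm g g.2 i
  choose σ hσ using hperm'
  obtain ⟨hind, htop⟩ := (DirectSum.isInternal_submodule_iff_iSupIndep_and_iSup_eq_top W).1 hWi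
  have hWinj : Function.Injective W := hind.injective hW0
  have hinv : ∀ g : H, ∀ v, rhoH H g⁻¹ (rhoH H g v) = v := by
    intro g v
    rw [← Module.End.mul_apply, ← map_mul]; simp
  have hinj : ∀ g : H, Function.Injective (rhoH H g) := fun g => Function.LeftInverse.injective (hinv g)
  let i0 : Fin m := ⟨0, by omega⟩
  have hσmul : ∀ g h i, σ (g * h) i = σ g (σ h i) := by
    intro g h i
    apply hWinj
    rw [← hσ, ← hσ, ← hσ, map_mul, Module.End.mul_eq_comp, Submodule.map_comp]
  have hσ1 : ∀ i, σ 1 i = i := by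
    intro i; apply hWinj; rw [← hσ, map_one]; exact Submodule.map_id _
  -- transitivity
  have htrans : ∀ j, ∃ g, σ g i0 = j := by
    intro j
    by_contra hne
    push Not at hne
    let Y := ⨆ i : {i // ∃ g, σ g i0 = i}, W i
    have hY : Y = ⊤ := by
      refine (hirr Y ?_).resolve_left ?_
      · intro g v hv
        have : Y ≤ Y.comap (rhoH H g) := by
          refine iSup_le ?_
          rintro ⟨_, h, rfl⟩ v hv
          refine Submodule.mem_iSup_of_mem ⟨σ (g * h) i0, _, rfl⟩ ?_
          show rhoH H g v ∈ W (σ (g * h) i0)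
          rw [hσmul, ← hσ g]; exact ⟨v, hv, rfl⟩
        exact this hv
      · intro h
        apply hW0 i0
        rw [eq_bot_iff, ← h]
        exact le_iSup (fun i : {i // ∃ g, σ g i0 = i} => W i) ⟨i0, 1, hσ1 i0⟩
    have h2 := hind j
    have : (⊤ : Submodule ℚ (Fin n → ℚ)) ≤ ⨆ i, ⨆ (_ : i ≠ j), W i := by
      rw [← hY]
      refine iSup_le ?_
      rintro ⟨_, h, rfl⟩
      exact le_iSup₂_of_le _ (hne h) le_rfl
    rw [top_le_iff.1 this, disjoint_top] at h2
    exact hW0 j h2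
  have hdim : ∀ j, finrank ℚ (W j) = finrank ℚ (W i0) := by
    intro j
    obtain ⟨g, rfl⟩ := htrans j
    rw [← hσ]
    exact (LinearEquiv.finrank_eq (Submodule.equivMapOfInjective (rhoH H g) (hinj g) (W i0))).symm
  have hsum : n = m * finrank ℚ (W i0) := by
    have h1 := LinearEquiv.finrank_eq (LinearEquiv.ofBijective (DirectSum.coeLinearMap W) hWi)
    rw [Module.finrank_directSum] at h1
    simp only [hdim] at h1
    simp at h1
    exact h1.symm
  have hd1 : finrank ℚ (W i0) = 1 := by
    rcases (Nat.dvd_prime hn).1 (Dvd.intro_left _ hsum.symm) with h | h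
    · exact h
    · exfalso
      rw [h] at hsum
      nlinarith [hn.pos]
  let ψ : H →* Equiv.Perm (Fin m) :=
    { toFun := fun g => ⟨σ g, σ g⁻¹, fun i => by rw [← hσmul]; simp [hσ1],
        fun i => by rw [← hσmul]; simp [hσ1]⟩
      map_one' := Equiv.ext hσ1
      map_mul' := fun g h => Equiv.ext (hσmul g h) }
  have hb : ∀ i, ∃ v ∈ W i, v ≠ 0 ∧ ∀ w ∈ W i, ∃ c : ℚ, c • v = w := by
    intro i
    have := (hdim i).trans hd1
    obtain ⟨v, hv0, hv⟩ := finrank_eq_one_iff'.1 this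
    refine ⟨v, v.2, by simpa using hv0, fun w hw => ?_⟩
    obtain ⟨c, hc⟩ := hv ⟨w, hw⟩
    exact ⟨c, congrArg Subtype.val hc⟩
  choose b hbm hb0 hbs using hb
  have hker : ∀ g : ψ.ker, ∀ i, rhoH H g (b i) = b i ∨ rhoH H g (b i) = - b i := by
    intro g i
    have hmap : rhoH H g (b i) ∈ W i := by
      have : σ g i = i := congrArg (fun f : Equiv.Perm (Fin m) => f i) (MonoidHom.mem_ker.1 g.2)
      have h2 := hσ g i
      rw [this] at h2
      conv => enter [1]; rw [← h2]
      exact ⟨_, hbm i, rfl⟩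
    obtain ⟨c, hc⟩ := hbs i _ hmap
    rcases rat_eigenvalue g.1.1 c (b i) (hb0 i) hc.symm with h | h
    · left; rw [← hc, h, one_smul]
    · right; rw [← hc, h, neg_one_smul]
  have hext : ∀ f f' : Module.End ℚ (Fin n → ℚ), (∀ i, f (b i) = f' (b i)) → f = f' := by
    intro f f' h
    have : (⊤ : Submodule ℚ (Fin n → ℚ)) ≤ LinearMap.eqLocus f f' := by
      rw [← htop]
      refine iSup_le fun i w hw => ?_
      obtain ⟨c, rfl⟩ := hbs i w hw
      rw [LinearMap.mem_eqLocus, map_smul, map_smul, h]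
    ext1 
    apply LinearMap.ext
    intro x
    exact this trivial
  have hfk : Finite ψ.ker := by
    let F : ψ.ker → (Fin m → Prop) := fun g i => rhoH H g (b i) = b i
    refine Finite.of_injective F ?_
    intro g g' hgg
    apply Subtype.ext
    apply rhoH_inj
    apply hext
    intro i
    have hi : (rhoH H g (b i) = b i) = (rhoH H g' (b i) = b i) := congrFun hgg i
    by_cases h : rhoH H g (b i) = b i
    · rw [h]; rw [h] at hi; exact (hi.mp rfl).symm
    · have h' := (hker g i).resolve_left h
      have h'' := (hker g' i).resolve_left (hi ▸ h)
      rw [h', h'']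
  exact (Subgroup.finite_iff_finite_and_finiteIndex ψ.ker).2 ⟨hfk, inferInstance⟩

theorem d_iff_c {n : ℕ} (hn : n.Prime) (hodd : Odd n) (H : Subgroup (SL n ℤ)) :
    (Infinite H ∧ ¬ Group.IsSolvable H ∧ PrimitiveQ H ∧ ¬ IsometryGroupQ H) ↔
        (IrreducibleQ H ∧ ¬ SolvableByFinite H ∧ ¬ IsometryGroupQ H) := by
  constructor
  · rintro ⟨h1, h2, h3, h4⟩
    refine ⟨h3.1, fun h => ?_, h4⟩
    rcases virt_solv_dich hn hodd H h3.1 h3.2 h with h | h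
    · exact not_finite H
    · exact h2 h
  · rintro ⟨h1, h2, h3⟩
    have hinf : Infinite H := by
      rw [← not_finite_iff_infinite]
      intro hf
      exact h2 ⟨⊥, (inferInstance : Group.IsSolvable (⊥ : Subgroup H)), inferInstance⟩
    refine ⟨hinf, fun h => h2 ⟨⊤, (inferInstance : Group.IsSolvable (⊤ : Subgroup H)), inferInstance⟩,
      ⟨h1, fun h => ?_⟩, h3⟩
    have := imprim_finite hn H h1 h
    exact not_finite H

end

section
open Module

theorem primitive_scale {ι : Type*} [Fintype ι] (p : ℕ) (hp : p.Prime) (v : ι → ℚ) (hv : v ≠ 0) :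
    ∃ (c : ℚ) (w : ι → ℤ), c ≠ 0 ∧ (∀ i, (w i : ℚ) = c * v i) ∧ ∃ i, ((w i : ℤ) : ZMod p) ≠ 0 := by
  classical
  obtain ⟨b, hb⟩ := IsLocalization.exist_integer_multiples_of_finite (nonZeroDivisors ℤ) v
  choose u hu using hb
  have hu' : ∀ i, (u i : ℚ) = (b : ℤ) * v i := by
    intro i; have := hu i; simpa [Algebra.smul_def] using this
  have hb0 : ((b : ℤ) : ℚ) ≠ 0 := by
    have := nonZeroDivisors.coe_ne_zero b
    exact_mod_cast this
  obtain ⟨i0, hi0⟩ : ∃ i, v i ≠ 0 := by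
    by_contra h; push Not at h; exact hv (funext h)
  obtain ⟨g, hg, hg1⟩ := Finset.extract_gcd u (s := Finset.univ) ⟨i0, Finset.mem_univ _⟩
  set d := Finset.univ.gcd u
  have hd0 : (d : ℚ) ≠ 0 := by
    intro h
    have h0 : d = 0 := by exact_mod_cast h
    have := hu' i0
    rw [hg i0 (Finset.mem_univ _), h0] at this
    rw [zero_mul, Int.cast_zero] at this
    exact mul_ne_zero hb0 hi0 this.symm
  refine ⟨(b : ℤ) / d, g, div_ne_zero hb0 hd0, fun i => ?_, ?_⟩
  · have := hu' i
    rw [hg i (Finset.mem_univ _)] at this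
    push_cast at this
    field_simp
    linarith
  · by_contra h
    push Not at h
    have hdvd : (p : ℤ) ∣ Finset.univ.gcd g := Finset.dvd_gcd fun i _ => by
      rw [← ZMod.intCast_zmod_eq_zero_iff_dvd] 
      have := Fact.mk hp
      exact h i
    rw [hg1] at hdvd
    have := Int.isUnit_iff.1 (isUnit_of_dvd_one hdvd)
    have := hp.two_le
    omega

theorem surj_irreducible {n p : ℕ} (hp : p.Prime) (H : Subgroup (SL n ℤ))
    (hH : H.map (redMod n p) = ⊤) : IrreducibleQ H := by
  classical
  have := Fact.mk hp
  rw [irrQ_iff]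
  intro Y hY
  by_contra hne
  push Not at hne
  obtain ⟨y, hyY, hy0⟩ := Submodule.exists_mem_ne_zero_of_ne_bot hne.1
  obtain ⟨f, hf0, hf⟩ := Submodule.exists_le_ker_of_lt_top Y (lt_top_iff_ne_top.2 hne.2)
  let l : Fin n → ℚ := fun i => f (Pi.single i 1)
  have hfl : ∀ v, f v = ∑ i, l i * v i := by
    intro v
    conv_lhs => rw [← LinearMap.sum_single_apply (φ := fun _ : Fin n => ℚ) (v := v)]
    rw [map_sum]
    refine Finset.sum_congr rfl fun i _ => ?_
    have : (Pi.single i (v i) : Fin n → ℚ) = v i • Pi.single i 1 := by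
      rw [← Pi.single_smul]; simp
    rw [this, map_smul, smul_eq_mul, mul_comm]
  have hl0 : l ≠ 0 := by
    intro h; apply hf0
    ext1 
    apply LinearMap.ext
    intro v
    simp [hfl, h]
  obtain ⟨c, w, hc, hw, i1, hi1⟩ := primitive_scale p hp y hy0
  obtain ⟨d, m, hd, hm, i2, hi2⟩ := primitive_scale p hp l hl0
  have key : ∀ h ∈ H, ∑ i, m i * ∑ j, h.1 i j * w j = 0 := by
    intro h hh
    have h1 : f (rhoH H ⟨h, hh⟩ y) = 0 := hf (hY ⟨h, hh⟩ y hyY)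
    rw [hfl, rhoH_apply] at h1
    have h2 : ((∑ i, m i * ∑ j, h.1 i j * w j : ℤ) : ℚ) = 0 := by
      push_cast
      simp only [hm, hw]
      have : ∀ i, d * l i * ∑ j, (h.1 i j : ℚ) * (c * y j) = (d * c) * (l i * ∑ j, (h.1 i j : ℚ) * y j) := by
        intro i
        rw [Finset.mul_sum, Finset.mul_sum, Finset.mul_sum]
        exact Finset.sum_congr rfl fun j _ => by ring
      rw [Finset.sum_congr rfl fun i _ => this i, ← Finset.mul_sum]
      have h3 : ∑ i, l i * ∑ j, (h.1 i j : ℚ) * y j = 0 := by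
        rw [← h1]
        refine Finset.sum_congr rfl fun i _ => ?_
        simp [Matrix.toLin'_apply, Matrix.mulVec, dotProduct, matQ]
      rw [h3, mul_zero]
    exact_mod_cast h2
  have key2 : ∀ g : SL n (ZMod p), ∑ i, (m i : ZMod p) * ∑ j, g.1 i j * (w j : ZMod p) = 0 := by
    intro g
    have : g ∈ H.map (redMod n p) := by rw [hH]; trivial
    obtain ⟨h, hh, rfl⟩ := this
    have := congrArg (Int.cast : ℤ → ZMod p) (key h hh)
    push_cast at this
    exact this
  have e1 : ∑ i, (m i : ZMod p) * (w i : ZMod p) = 0 := by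
    have := key2 1
    simpa [Matrix.one_apply] using this
  have e2 : ∀ i j, i ≠ j → (m i : ZMod p) * (w j : ZMod p) = 0 := by
    intro i j hij
    have := key2 (Matrix.SpecialLinearGroup.transvection hij 1)
    simp only [Matrix.SpecialLinearGroup.transvection_coe, Matrix.add_apply, add_mul,
      Finset.sum_add_distrib, mul_add] at this
    have h1 : ∑ x, (m x : ZMod p) * ∑ x_1, (1 : Mt(n) (ZMod p)) x x_1 * (w x_1 : ZMod p) = 0 := by
      simpa [Matrix.one_apply] using e1
    rw [h1, zero_add] at this
    simpa [Matrix.single_apply, ite_and] using this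
  have hw0 : ∀ j, j ≠ i2 → (w j : ZMod p) = 0 := fun j hj =>
    (mul_eq_zero.1 (e2 i2 j hj.symm)).resolve_left hi2
  rw [Finset.sum_eq_single i2 (fun j _ hj => by rw [hw0 j hj, mul_zero]) (by simp)] at e1
  have hw2 := (mul_eq_zero.1 e1).resolve_left hi2
  by_cases h : i1 = i2
  · subst h; exact hi1 hw2
  · exact hi1 (hw0 i1 h)

theorem surj_not_isometry {n p : ℕ} (hn : 3 ≤ n) (hp : p.Prime) (H : Subgroup (SL n ℤ))
    (hH : H.map (redMod n p) = ⊤) : ¬ IsometryGroupQ H := by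
  classical
  have := Fact.mk hp
  rintro ⟨Φ, hΦ, hiso⟩
  have hΦ0 : (fun x : Fin n × Fin n => Φ x.1 x.2) ≠ 0 := by
    intro h
    have : Φ = 0 := by ext i j; exact congrFun h (i, j)
    rw [this] at hΦ
    haveI : Nonempty (Fin n) := ⟨⟨0, by omega⟩⟩
    exact not_isUnit_zero hΦ
  obtain ⟨c, w, hc, hw, ⟨j, k⟩, hjk⟩ := primitive_scale p hp _ hΦ0
  let Ψ : Mt(n) ℤ := Matrix.of fun i j => w (i, j)
  have hΨ : Ψ.map (Int.castRingHom ℚ) = c • Φ := by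
    ext i j; simp [Ψ, hw]
  have key : ∀ h ∈ H, h.1 * Ψ * h.1ᵀ = Ψ := by
    intro h hh
    have h1 : (h.1 * Ψ * h.1ᵀ).map (Int.castRingHom ℚ) = Ψ.map (Int.castRingHom ℚ) := by
      rw [Matrix.map_mul, Matrix.map_mul, Matrix.transpose_map, hΨ]
      have : h.1.map (Int.castRingHom ℚ) = matQ h := rfl
      rw [this, Matrix.mul_smul, Matrix.smul_mul, hiso h hh]
    ext a b
    have := congrFun (congrFun h1 a) b
    simpa using this
  let Θ : Mt(n) (ZMod p) := Ψ.map (Int.castRingHom (ZMod p))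
  have key2 : ∀ g : SL n (ZMod p), g.1 * Θ * g.1ᵀ = Θ := by
    intro g
    have : g ∈ H.map (redMod n p) := by rw [hH]; trivial
    obtain ⟨h, hh, rfl⟩ := this
    have := congrArg (fun M : Mt(n) ℤ => M.map (Int.castRingHom (ZMod p))) (key h hh)
    simp only [Matrix.map_mul, Matrix.transpose_map] at this
    exact this
  obtain ⟨i, hi⟩ : ∃ i : Fin n, i ∉ ({j, k} : Finset (Fin n)) := by
    by_contra hcon
    push Not at hcon
    have : (Finset.univ : Finset (Fin n)) ⊆ {j, k} := fun i _ => hcon i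
    have := Finset.card_le_card this
    have h2 := Finset.card_le_two (a := j) (b := k)
    simp at this
    omega
  simp only [Finset.mem_insert, Finset.mem_singleton, not_or] at hi
  have h3 := congrFun (congrFun (key2 (Matrix.SpecialLinearGroup.transvection hi.1 1)) i) k
  simp only [Matrix.SpecialLinearGroup.transvection_coe] at h3
  rw [Matrix.transpose_add, Matrix.transpose_one, Matrix.transpose_single, mul_add, mul_one, add_mul, one_mul,
    Matrix.add_apply, Matrix.add_apply, Matrix.single_mul_apply_same] at h3
  rw [Matrix.mul_single_apply_of_ne (hbj := Ne.symm hi.2)] at h3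
  apply hjk
  have : Θ j k = 0 := by simpa using h3
  simpa [Θ, Ψ] using this

end

section
open Module

open scoped commutatorElement in
theorem SL_not_solvable {n p : ℕ} (hn : 3 ≤ n) (hp : p.Prime) : ¬ Group.IsSolvable (SL n (ZMod p)) := by
  classical
  have := Fact.mk hp
  intro hs
  let T : Subgroup (SL n (ZMod p)) := Subgroup.closure
    {g | ∃ (i j : Fin n) (hij : i ≠ j) (b : ZMod p), g = Matrix.SpecialLinearGroup.transvection hij b}
  have hmem : ∀ (i j : Fin n) (hij : i ≠ j) (b : ZMod p),
      Matrix.SpecialLinearGroup.transvection hij b ∈ T :=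
    fun i j hij b => Subgroup.subset_closure ⟨i, j, hij, b, rfl⟩
  have hT : T ≠ ⊥ := by
    intro h
    have hij : (⟨0, by omega⟩ : Fin n) ≠ ⟨1, by omega⟩ := by simp
    have := hmem _ _ hij 1
    rw [h, Subgroup.mem_bot] at this
    have := congrArg (fun g : SL n (ZMod p) => g.1 ⟨0, by omega⟩ ⟨1, by omega⟩) this
    simp [Matrix.SpecialLinearGroup.transvection_coe, Matrix.one_apply, Matrix.SpecialLinearGroup.transvection, Matrix.transvection] at this
  have hlt := Group.IsSolvable.commutator_lt_of_ne_bot hT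
  refine absurd hlt (not_lt_of_ge ?_)
  rw [Subgroup.closure_le]
  rintro _ ⟨i, k, hik, b, rfl⟩
  obtain ⟨j, hj⟩ : ∃ j : Fin n, j ∉ ({i, k} : Finset (Fin n)) := by
    by_contra hcon
    push Not at hcon
    have : (Finset.univ : Finset (Fin n)) ⊆ {i, k} := fun i _ => hcon i
    have := Finset.card_le_card this
    have h2 := Finset.card_le_two (a := i) (b := k)
    simp at this
    omega
  simp only [Finset.mem_insert, Finset.mem_singleton, not_or] at hj
  have hij : i ≠ j := Ne.symm hj.1
  have hjk : j ≠ k := hj.2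
  have e : Matrix.SpecialLinearGroup.transvection hik b =
      ⁅Matrix.SpecialLinearGroup.transvection hij b, Matrix.SpecialLinearGroup.transvection hjk (1 : ZMod p)⁆ := by
    rw [commutatorElement_def, eq_mul_inv_iff_mul_eq, eq_mul_inv_iff_mul_eq]
    apply Subtype.ext
    show (1 + single i k b) * (1 + single j k 1) * (1 + single i j b) =
      (1 + single i j b) * (1 + single j k (1 : ZMod p))
    simp [mul_add, add_mul, hik, hij, hjk, hik.symm, hij.symm, hjk.symm]
    abel
  rw [SetLike.mem_coe, e]
  exact Subgroup.commutator_mem_commutator (hmem _ _ _ _) (hmem _ _ _ _)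

theorem exists_no_pm_one {n p : ℕ} (hn : 3 ≤ n) (hodd : Odd n) (hp : p.Prime) :
    ∃ g : SL n (ZMod p), (g.1 - 1).det ≠ 0 ∧ (g.1 + 1).det ≠ 0 := by
  classical
  have := Fact.mk hp
  let f : Polynomial (ZMod p) := Polynomial.X ^ n + (Polynomial.X ^ 2 - 1)
  have hdeg : (Polynomial.X ^ 2 - 1 : Polynomial (ZMod p)).degree < n := by
    refine lt_of_le_of_lt (b := ((2 : ℕ) : WithBot ℕ)) ?_ (by exact_mod_cast hn)
    compute_degree
    rfl
  have hf : f.Monic := Polynomial.monic_X_pow_add hdeg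
  have hfd : f.natDegree = n := by
    have : f.degree = n := by
      show (Polynomial.X ^ n + (Polynomial.X ^ 2 - 1) : Polynomial (ZMod p)).degree = n
      rw [Polynomial.degree_add_eq_left_of_degree_lt] <;> simp [hdeg]
    exact Polynomial.natDegree_eq_of_degree_eq_some this
  let pb := AdjoinRoot.powerBasis' hf
  let M0 := Algebra.leftMulMatrix pb.basis pb.gen
  have hdim : pb.dim = n := by simp [pb, AdjoinRoot.powerBasis'_dim, hfd]
  let e : Fin pb.dim ≃ Fin n := finCongr hdim
  let M : Mt(n) (ZMod p) := Matrix.reindex e e M0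
  have hM : M.charpoly = f := by
    rw [Matrix.charpoly_reindex, charpoly_leftMulMatrix]
    simp only [pb]
    rw [AdjoinRoot.powerBasis'_gen, AdjoinRoot.minpoly_root hf.ne_zero, hf.leadingCoeff]
    simp
  have hev : ∀ c, (Matrix.scalar (Fin n) c - M).det = c ^ n + (c ^ 2 - 1) := by
    intro c
    rw [← Matrix.eval_charpoly, hM]; simp [f]
  have hdet : M.det = 1 := by
    have := hev 0
    rw [map_zero, zero_sub, Matrix.det_neg, Fintype.card_fin, hodd.neg_one_pow, zero_pow (by omega)] at this
    simp at this
    exact this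
  refine ⟨⟨M, hdet⟩, ?_, ?_⟩
  · have := hev 1
    rw [map_one] at this
    show (M - 1).det ≠ 0
    rw [← neg_sub, Matrix.det_neg, this]
    simp
  · have := hev (-1)
    rw [hodd.neg_one_pow, map_neg, map_one] at this
    show (M + 1).det ≠ 0
    have e : M + 1 = - (-1 - M) := by abel
    rw [e, Matrix.det_neg, this]
    simp

theorem finite_order_pm_one {n : ℕ} (hodd : Odd n) (h : SL n ℤ) (k : ℕ) (hk : 0 < k) (hhk : h ^ k = 1) :
    (h.1 - 1).det = 0 ∨ (h.1 + 1).det = 0 := by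
  classical
  let M : Mt(n) ℝ := h.1.map (Int.castRingHom ℝ)
  have hMk : M ^ k = 1 := by
    have h1 := congrArg (fun g : SL n ℤ => (Int.castRingHom ℝ).mapMatrix g.1) hhk
    simp only [Matrix.SpecialLinearGroup.coe_pow, map_pow, Matrix.SpecialLinearGroup.coe_one, map_one] at h1
    exact h1
  obtain ⟨c, hc⟩ : ∃ c, M.charpoly.IsRoot c := by
    by_contra hno
    push Not at hno
    have hcont := M.charpoly.continuous
    have hlc : 0 < M.charpoly.leadingCoeff := by rw [M.charpoly_monic.leadingCoeff]; norm_num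
    have hdn : M.charpoly.natDegree = n := by simp
    have hn0 : 0 < n := hodd.pos
    have hdeg : 0 < M.charpoly.degree := by
      rw [← Polynomial.natDegree_pos_iff_degree_pos, hdn]; exact hn0
    have h1 := M.charpoly.tendsto_atTop_of_leadingCoeff_nonneg hdeg hlc.le
    have h2 : Filter.Tendsto (fun x => (M.charpoly.comp (-Polynomial.X)).eval x) Filter.atTop Filter.atBot := by
      apply Polynomial.tendsto_atBot_of_leadingCoeff_nonpos
      · rw [← Polynomial.natDegree_pos_iff_degree_pos, Polynomial.natDegree_comp, hdn]
        simpa using hn0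
      · rw [Polynomial.leadingCoeff_comp (by simp), hdn, M.charpoly_monic.leadingCoeff]
        simp [hodd.neg_one_pow]
    obtain ⟨a, ha⟩ := (h1.eventually_gt_atTop 0).exists
    obtain ⟨b, hb⟩ := (h2.eventually_lt_atBot 0).exists
    rw [Polynomial.eval_comp] at hb
    obtain ⟨x, hx⟩ := mem_range_of_exists_le_of_exists_ge hcont ⟨_, hb.le⟩ ⟨_, ha.le⟩
    exact hno x hx
  have hdet : (Matrix.scalar (Fin n) c - M).det = 0 := by
    rw [← Matrix.eval_charpoly]; exact hc
  obtain ⟨v, hv0, hv⟩ := Matrix.exists_mulVec_eq_zero_iff.2 hdet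
  have hMv : M *ᵥ v = c • v := by
    rw [Matrix.sub_mulVec, sub_eq_zero] at hv
    rw [← hv]; ext i; simp [Matrix.scalar_apply, Matrix.mulVec_diagonal]
  have hpow : ∀ j, (M ^ j) *ᵥ v = c ^ j • v := by
    intro j
    induction j with
    | zero => simp
    | succ j ih => rw [pow_succ, ← Matrix.mulVec_mulVec, hMv, Matrix.mulVec_smul, ih, smul_smul, pow_succ, mul_comm]
  have hck : c ^ k = 1 := by
    have := hpow k
    rw [hMk, Matrix.one_mulVec] at this
    obtain ⟨i, hi⟩ : ∃ i, v i ≠ 0 := by by_contra h; push Not at h; exact hv0 (funext h)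
    have := congrFun this i
    simp only [Pi.smul_apply, smul_eq_mul] at this
    exact (mul_right_cancel₀ hi (by rw [one_mul]; exact this)).symm
  have habs : |c| = 1 := by
    have : |c| ^ k = 1 := by rw [← abs_pow, hck, abs_one]
    exact (pow_eq_one_iff_of_nonneg (abs_nonneg c) hk.ne').1 this
  have hZ : ∀ N : Mt(n) ℤ, (N.map (Int.castRingHom ℝ)).det = 0 → N.det = 0 := by
    intro N hN
    have : ((Int.castRingHom ℝ) N.det) = 0 := by rw [RingHom.map_det]; exact hN
    simpa using this
  rcases eq_or_eq_neg_of_abs_eq habs with h1 | h1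
  · left
    rw [h1, map_one] at hdet
    apply hZ
    have : (h.1 - 1).map (Int.castRingHom ℝ) = -(1 - M) := by
      have := map_sub (Int.castRingHom ℝ).mapMatrix h.1 1
      rw [map_one] at this
      rw [neg_sub]; exact this
    rw [this, Matrix.det_neg, hdet, mul_zero]
  · right
    rw [h1, map_neg, map_one] at hdet
    apply hZ
    have : (h.1 + 1).map (Int.castRingHom ℝ) = -(-1 - M) := by
      have := map_add (Int.castRingHom ℝ).mapMatrix h.1 1
      rw [map_one] at this
      rw [neg_sub, sub_neg_eq_add]; exact this
    rw [this, Matrix.det_neg, hdet, mul_zero]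

theorem a_imp_d {n p : ℕ} (hn : n.Prime) (hodd : Odd n) (hp : p.Prime) (H : Subgroup (SL n ℤ))
    (hH : H.map (redMod n p) = ⊤) : IrreducibleQ H ∧ ¬ SolvableByFinite H ∧ ¬ IsometryGroupQ H := by
  have hn3 : 3 ≤ n := by
    have := hn.two_le
    obtain ⟨k, hk⟩ := hodd
    omega
  have := Fact.mk hp
  have hirr := surj_irreducible hp H hH
  refine ⟨hirr, fun hs => ?_, surj_not_isometry hn3 hp H hH⟩
  have hnf : ¬ Finite H := by
    intro hf
    obtain ⟨g, hg1, hg2⟩ := exists_no_pm_one hn3 hodd hp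
    have : g ∈ H.map (redMod n p) := by rw [hH]; trivial
    obtain ⟨h, hh, rfl⟩ := this
    have hfo := isOfFinOrder_of_finite (⟨h, hh⟩ : H)
    obtain ⟨k, hk, hhk⟩ := isOfFinOrder_iff_pow_eq_one.1 hfo
    have hhk' : h ^ k = 1 := congrArg Subtype.val hhk
    have hr : (redMod n p h).1 = (Int.castRingHom (ZMod p)).mapMatrix h.1 := rfl
    rcases finite_order_pm_one hodd h k hk hhk' with h0 | h0
    · apply hg1
      have := congrArg (Int.castRingHom (ZMod p)) h0
      rw [RingHom.map_det, map_sub, map_one, map_zero] at this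
      rw [hr]; exact this
    · apply hg2
      have := congrArg (Int.castRingHom (ZMod p)) h0
      rw [RingHom.map_det, map_add, map_one, map_zero] at this
      rw [hr]; exact this
  have hns : ¬ Group.IsSolvable H := by
    intro hs
    apply SL_not_solvable hn3 hp
    refine Group.isSolvable_of_surjective (f := (redMod n p).comp H.subtype) ?_
    intro g
    have : g ∈ H.map (redMod n p) := by rw [hH]; trivial
    obtain ⟨h, hh, rfl⟩ := this
    exact ⟨⟨h, hh⟩, rfl⟩
  by_cases him : ImprimitiveQ H
  · exact hnf (imprim_finite hn H hirr him)
  · rcases virt_solv_dich hn hodd H hirr him hs with h | h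
    · exact hnf h
    · exact hns h

end

section
namespace PN
open MvPolynomial

variable {d : ℕ} {F : Type*} [Field F]

lemma mono_approx (f : Fin d → MvPolynomial (Fin d) F)
    (hf : ∀ i, f i - X i ∈ idealOfVars (Fin d) F ^ 2) (s : Fin d →₀ ℕ) :
    aeval f (monomial s (1:F)) - monomial s 1 ∈ idealOfVars (Fin d) F ^ (s.degree + 1) ∧
    aeval f (monomial s (1:F)) ∈ idealOfVars (Fin d) F ^ s.degree ∧
    monomial s (1:F) ∈ idealOfVars (Fin d) F ^ s.degree := by
  set I := idealOfVars (Fin d) F with hI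
  have key : ∀ (a b : ℕ) (u u' v v' : MvPolynomial (Fin d) F), u - u' ∈ I ^ (a+1) ∧ u ∈ I ^ a ∧ u' ∈ I ^ a →
      v - v' ∈ I ^ (b+1) ∧ v ∈ I ^ b ∧ v' ∈ I ^ b →
      u * v - u' * v' ∈ I ^ (a + b + 1) ∧ u * v ∈ I ^ (a+b) ∧ u' * v' ∈ I ^ (a+b) := by
    rintro a b u u' v v' ⟨h1, h2, h3⟩ ⟨k1, k2, k3⟩
    refine ⟨?_, ?_, ?_⟩
    · have : u * v - u' * v' = u * (v - v') + (u - u') * v' := by ring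
      rw [this]
      refine Ideal.add_mem _ ?_ ?_
      · rw [add_assoc, pow_add]; exact Ideal.mul_mem_mul h2 k1
      · rw [show a + b + 1 = (a+1) + b by ring, pow_add]; exact Ideal.mul_mem_mul h1 k3
    · rw [pow_add]; exact Ideal.mul_mem_mul h2 k2
    · rw [pow_add]; exact Ideal.mul_mem_mul h3 k3
  have hX : ∀ i, (X i : MvPolynomial (Fin d) F) ∈ I := fun i => Ideal.subset_span ⟨i, rfl⟩
  induction s using Finsupp.induction_linear with
  | zero => simp
  | add s t hs ht =>
    have h1 : monomial (s+t) (1:F) = monomial s 1 * monomial t 1 := by simp [monomial_mul]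
    rw [h1, map_mul, map_add]
    exact key _ _ _ _ _ _ hs ht
  | single i k =>
    induction k with
    | zero => simp
    | succ k ih =>
      have h1 : monomial (Finsupp.single i (k+1)) (1:F) = monomial (Finsupp.single i k) 1 * X i := by
        rw [X, monomial_mul, Finsupp.single_add]; simp
      rw [h1, map_mul, Finsupp.single_add, map_add]
      have h2 : (Finsupp.single i 1 : Fin d →₀ ℕ).degree = 1 := by simp
      rw [h2]
      refine key _ 1 _ _ _ _ ih ⟨?_, ?_, ?_⟩
      · simpa using hf i
      · rw [aeval_X, pow_one]
        have := Ideal.add_mem I (Ideal.pow_le_self two_ne_zero (hf i)) (hX i)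
        simpa using this
      · simpa using hX i

lemma aeval_ne_zero (f : Fin d → MvPolynomial (Fin d) F)
    (hf : ∀ i, f i - X i ∈ idealOfVars (Fin d) F ^ 2) (Q : MvPolynomial (Fin d) F) (hQ : Q ≠ 0) :
    aeval f Q ≠ 0 := by
  classical
  set I := idealOfVars (Fin d) F with hI
  -- approximate
  have happ : ∀ m, Q ∈ I ^ m → aeval f Q - Q ∈ I ^ (m+1) := by
    intro m hm
    rw [hI, mem_pow_idealOfVars_iff] at hm
    have : aeval f Q - Q = ∑ s ∈ Q.support, C (Q.coeff s) * (aeval f (monomial s (1:F)) - monomial s 1) := by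
      conv_lhs => rw [Q.as_sum]
      rw [map_sum, ← Finset.sum_sub_distrib]
      refine Finset.sum_congr rfl fun s _ => ?_
      have : monomial s (Q.coeff s) = C (Q.coeff s) * monomial s 1 := by simp [C_mul_monomial]
      rw [this, map_mul, mul_sub, algHom_C]; rfl
    rw [this]
    refine Ideal.sum_mem _ fun s hs => Ideal.mul_mem_left _ _ ?_
    exact Ideal.pow_le_pow_right (by have := hm s hs; omega) (mono_approx f hf s).1
  have hnot : ∃ m, Q ∉ I ^ m := by
    obtain ⟨s, hs⟩ := MvPolynomial.support_nonempty.2 hQ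
    refine ⟨s.degree + 1, fun h => ?_⟩
    rw [hI, mem_pow_idealOfVars_iff] at h
    have := h s hs
    omega
  intro h0
  have hm := Nat.find_spec hnot
  have h1 : Nat.find hnot ≠ 0 := by
    intro h
    rw [h] at hm; simp at hm
  obtain ⟨k, hk⟩ := Nat.exists_eq_succ_of_ne_zero h1
  have h2 : Q ∈ I ^ k := by
    by_contra hc
    have := Nat.find_min' hnot hc
    omega
  have h3 := happ k h2
  rw [h0, zero_sub, neg_mem_iff] at h3
  rw [hk] at hm
  exact hm h3

/-- polynomial with box coefficients -/
noncomputable def boxPoly {m : ℕ} (c : (Fin d → Fin m) → F) : MvPolynomial (Fin d) F :=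
  ∑ a : Fin d → Fin m, monomial (Finsupp.equivFunOnFinite.symm fun i => (a i : ℕ)) (c a)

lemma boxPoly_coeff {m : ℕ} (c : (Fin d → Fin m) → F) (a : Fin d → Fin m) :
    (boxPoly c).coeff (Finsupp.equivFunOnFinite.symm fun i => (a i : ℕ)) = c a := by
  classical
  rw [boxPoly, coeff_sum, Finset.sum_eq_single a]
  · simp
  · intro b _ hb
    rw [coeff_monomial, if_neg]
    intro h
    apply hb
    have := Finsupp.equivFunOnFinite.symm.injective h
    funext i
    exact Fin.ext (congrFun this i)
  · simp

lemma boxPoly_aeval_deg {m e : ℕ} (c : (Fin d → Fin m) → F) (f : Fin d → MvPolynomial (Fin d) F)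
    (hf : ∀ i, (f i).totalDegree ≤ e) : (aeval f (boxPoly c)).totalDegree ≤ d * (m * e) := by
  rw [boxPoly, map_sum]
  refine totalDegree_finsetSum_le fun a _ => ?_
  rw [aeval_monomial]
  refine (totalDegree_mul _ _).trans ?_
  rw [Finsupp.prod_fintype _ _ (by simp)]
  have h1 : (algebraMap F (MvPolynomial (Fin d) F) (c a)).totalDegree = 0 := totalDegree_C _
  rw [h1, zero_add]
  refine (totalDegree_finset_prod _ _).trans ?_
  refine (Finset.sum_le_card_nsmul _ _ (m*e) ?_).trans (by simp)
  intro i _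
  refine (totalDegree_pow _ _).trans ?_
  exact Nat.mul_le_mul (a i).2.le (hf i)

lemma exists_relation (e : ℕ) (f : Fin d → MvPolynomial (Fin d) F)
    (hdeg : ∀ i, (f i).totalDegree ≤ e) (j : Fin d) {K m : ℕ} (hK : K = d * e + 2) (hm : m = K ^ d + 1) :
    ∃ c : Fin m → (Fin d → Fin m) → F, c ≠ 0 ∧
      ∑ b : Fin m, aeval f (boxPoly (c b)) * X j ^ (b : ℕ) = 0 := by
  classical
  let T : (Fin m → (Fin d → Fin m) → F) →ₗ[F] MvPolynomial (Fin d) F :=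
    { toFun := fun c => ∑ b : Fin m, aeval f (boxPoly (c b)) * X j ^ (b : ℕ)
      map_add' := by
        intro c c'
        rw [← Finset.sum_add_distrib]
        refine Finset.sum_congr rfl fun b _ => ?_
        rw [← add_mul, ← map_add]
        congr 2
        simp [boxPoly, Finset.sum_add_distrib]
      map_smul' := by
        intro r c
        rw [Finset.smul_sum]
        refine Finset.sum_congr rfl fun b _ => ?_
        rw [← smul_mul_assoc, RingHom.id_apply, ← map_smul]
        congr 2
        simp [boxPoly, Finset.smul_sum, smul_monomial] }
  let S : MvPolynomial (Fin d) F →ₗ[F] ((Fin d → Fin (K*m)) → F) :=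
    LinearMap.pi fun a => MvPolynomial.lcoeff F (Finsupp.equivFunOnFinite.symm fun i => (a i : ℕ))
  have hlt : Module.finrank F ((Fin d → Fin (K*m)) → F) < Module.finrank F (Fin m → (Fin d → Fin m) → F) := by
    simp only [Module.finrank_pi_fintype, Module.finrank_self, mul_one, Fintype.card_fun, Fintype.card_fin,
      Finset.sum_const, Finset.card_univ, smul_eq_mul]
    rw [mul_pow]
    have hmp : 0 < m := by omega
    have hmd : 0 < m ^ d := by positivity
    have hlt : K ^ d < m := by omega
    exact Nat.mul_lt_mul_of_pos_right hlt hmd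
  obtain ⟨c, hc, hc0⟩ := Submodule.exists_mem_ne_zero_of_ne_bot (LinearMap.ker_ne_bot_of_finrank_lt (f := S ∘ₗ T) hlt)
  refine ⟨c, hc0, ?_⟩
  rw [LinearMap.mem_ker, LinearMap.comp_apply] at hc
  change T c = 0
  have hTdeg : (T c).totalDegree < K * m := by
    have : (T c).totalDegree ≤ d * (m * e) + m := by
      refine totalDegree_finsetSum_le fun b _ => ?_
      refine (totalDegree_mul _ _).trans ?_
      refine Nat.add_le_add (boxPoly_aeval_deg _ _ hdeg) ?_
      rw [totalDegree_X_pow]; exact b.2.le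
    have hm0 : 0 < m := by omega
    have : K * m = d * (m*e) + 2 * m := by rw [hK]; ring
    omega
  ext s
  rw [coeff_zero]
  by_cases hs : ∀ i, s i < K * m
  · have := congrFun hc fun i => ⟨s i, hs i⟩
    simp only [S, LinearMap.pi_apply, lcoeff_apply, Pi.zero_apply] at this
    rw [← this]
    congr 1
    ext i; simp
  · push Not at hs
    obtain ⟨i, hi⟩ := hs
    refine coeff_eq_zero_of_totalDegree_lt ?_
    refine lt_of_lt_of_le hTdeg (hi.trans ?_)
    by_cases h : s i = 0
    · omega
    exact Finset.single_le_sum (f := fun i => s i) (fun _ _ => Nat.zero_le _) (Finsupp.mem_support_iff.2 h)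

lemma sz_card [Fintype F] [DecidableEq F] {P : MvPolynomial (Fin d) F} (hP : P ≠ 0) (D : ℕ) (hD : P.totalDegree ≤ D) :
    Fintype.card F * (Finset.univ.filter fun t : Fin d → F => eval t P = 0).card ≤ D * Fintype.card F ^ d := by
  have h := schwartz_zippel_totalDegree hP (Finset.univ : Finset F)
  have hq : (0:ℚ≥0) < Fintype.card F := by exact_mod_cast Fintype.card_pos
  rw [Fintype.piFinset_univ, Finset.card_univ, div_le_div_iff₀ (by positivity) hq] at h
  have h2 : Finset.card (Finset.univ.filter fun t : Fin d → F => eval t P = 0) * Fintype.card F ≤ P.totalDegree * Fintype.card F ^ d := by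
    exact_mod_cast h
  rw [mul_comm]
  exact h2.trans (Nat.mul_le_mul_right _ hD)

theorem poly_image (d e : ℕ) : ∃ C q0 : ℕ, ∀ (F : Type) [Field F] [Fintype F],
    q0 ≤ Fintype.card F → ∀ f : Fin d → MvPolynomial (Fin d) F, (∀ i, (f i).totalDegree ≤ e) →
    (∀ i, f i - X i ∈ idealOfVars (Fin d) F ^ 2) → 
    Fintype.card F ^ d ≤ C * Nat.card (Set.range fun t : Fin d → F => fun i => eval t (f i)) := by
  classical
  obtain ⟨K, hK⟩ : ∃ K, K = d * e + 2 := ⟨_, rfl⟩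
  obtain ⟨m, hm⟩ : ∃ m, m = K ^ d + 1 := ⟨_, rfl⟩
  refine ⟨2 * m ^ d, 2 * (d * (d * (m * e))) , ?_⟩
  intro F _ _ hq f hdeg hf
  choose c hc0 hc using fun j => exists_relation e f hdeg j hK hm
  have hb : ∀ j, ∃ b, boxPoly (c j b) ≠ 0 := by
    intro j
    by_contra hcon
    push Not at hcon
    apply hc0 j
    funext b a
    rw [← boxPoly_coeff (c j b) a, hcon b]; simp
  choose b hb using hb
  set ev : (Fin d → F) → (Fin d → F) := fun t => fun i => eval t (f i) with hev
  have heval : ∀ t (Q : MvPolynomial (Fin d) F), eval t (aeval f Q) = eval (ev t) Q := by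
    intro t Q
    rw [← MvPolynomial.coe_aeval_eq_eval, ← MvPolynomial.coe_aeval_eq_eval]
    change (aeval t) ((aeval f) Q) = aeval (ev t) Q
    rw [← AlgHom.comp_apply, MvPolynomial.comp_aeval]; rfl
  let bad : Fin d → Finset (Fin d → F) := fun j => Finset.univ.filter fun t => eval t (aeval f (boxPoly (c j (b j)))) = 0
  have hbad : ∀ j, Fintype.card F * (bad j).card ≤ (d * (m*e)) * Fintype.card F ^ d := fun j =>
    sz_card (aeval_ne_zero f hf _ (hb j)) _ (boxPoly_aeval_deg _ _ hdeg)
  let good : Finset (Fin d → F) := Finset.univ \ Finset.univ.biUnion bad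
  have hgood : Fintype.card F ^ d ≤ good.card + (Finset.univ.biUnion bad).card := by
    have := Finset.card_sdiff_add_card (Finset.univ : Finset (Fin d → F)) (Finset.univ.biUnion bad)
    rw [this]
    refine le_trans (by simp) (Finset.card_le_card Finset.subset_union_left)
  have hbadall : 2 * (Finset.univ.biUnion bad).card ≤ Fintype.card F ^ d := by
    have h1 : (Finset.univ.biUnion bad).card ≤ ∑ j, (bad j).card := Finset.card_biUnion_le
    have h2 : Fintype.card F * ∑ j, (bad j).card ≤ d * ((d * (m*e)) * Fintype.card F ^ d) := by
      rw [Finset.mul_sum]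
      refine (Finset.sum_le_card_nsmul _ _ _ fun j _ => hbad j).trans (by simp)
    have hq0 : 0 < Fintype.card F := Fintype.card_pos
    refine Nat.le_of_mul_le_mul_left (c := Fintype.card F) ?_ hq0
    calc Fintype.card F * (2 * (Finset.univ.biUnion bad).card) ≤ 2 * (Fintype.card F * ∑ j, (bad j).card) := by
          have := Nat.mul_le_mul_left (2 * Fintype.card F) h1
          linarith
      _ ≤ 2 * (d * ((d * (m*e)) * Fintype.card F ^ d)) := Nat.mul_le_mul_left _ h2
      _ = (2 * (d * (d * (m*e)))) * Fintype.card F ^ d := by ring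
      _ ≤ _ := Nat.mul_le_mul_right _ hq
  -- fibers
  let up : Fin d → (Fin d → F) → Polynomial F := fun j y => ∑ k : Fin m, Polynomial.monomial (k:ℕ) (eval y (boxPoly (c j k)))
  have hupne : ∀ t ∈ good, ∀ j, up j (ev t) ≠ 0 := by
    intro t ht j h0
    have hco : (up j (ev t)).coeff (b j : ℕ) = eval (ev t) (boxPoly (c j (b j))) := by
      simp only [up, Polynomial.finsetSum_coeff, Polynomial.coeff_monomial]
      rw [Finset.sum_eq_single (b j)]
      · simp
      · intro k _ hk
        rw [if_neg]
        exact fun h => hk (Fin.ext h)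
      · simp
    rw [h0, Polynomial.coeff_zero, ← heval] at hco
    simp only [good, Finset.mem_sdiff, Finset.mem_univ, true_and, Finset.mem_biUnion, not_exists] at ht
    exact ht j (Finset.mem_filter.2 ⟨Finset.mem_univ _, hco.symm⟩)
  have hroot : ∀ t j, (up j (ev t)).IsRoot (t j) := by
    intro t j
    have := congrArg (eval t) (hc j)
    rw [map_sum, map_zero] at this
    rw [Polynomial.IsRoot.def, ← this, Polynomial.eval_finsetSum]
    refine Finset.sum_congr rfl fun k _ => ?_
    rw [Polynomial.eval_monomial, map_mul, heval, map_pow, eval_X]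
  have hrootcard : ∀ j y, (up j y).roots.toFinset.card ≤ m := by
    intro j y
    refine (Multiset.toFinset_card_le _).trans ((Polynomial.card_roots' _).trans ?_)
    refine Polynomial.natDegree_sum_le_of_forall_le _ _ fun k _ => ?_
    exact (Polynomial.natDegree_monomial_le _).trans k.2.le
  have hfib : good.card ≤ m ^ d * (good.image ev).card := by
    refine Finset.card_le_mul_card_image _ _ fun y hy => ?_
    obtain ⟨t0, ht0, rfl⟩ := Finset.mem_image.1 hy
    have hsub : (good.filter fun t => ev t = ev t0) ⊆ Fintype.piFinset fun j => (up j (ev t0)).roots.toFinset := by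
      intro t ht
      rw [Finset.mem_filter] at ht
      rw [Fintype.mem_piFinset]
      intro j
      rw [Multiset.mem_toFinset, Polynomial.mem_roots (hupne t0 ht0 j), ← ht.2]
      exact hroot t j
    refine (Finset.card_le_card hsub).trans ?_
    rw [Fintype.card_piFinset]
    refine (Finset.prod_le_pow_card _ _ m fun j _ => hrootcard j _).trans (by simp)
  have himg : (good.image ev).card ≤ Nat.card (Set.range ev) := by
    rw [Nat.card_coe_set_eq, ← Set.ncard_coe_finset]
    refine Set.ncard_le_ncard ?_ (Set.toFinite _)
    intro y hy
    obtain ⟨t, _, rfl⟩ := Finset.mem_image.1 (Finset.mem_coe.1 hy)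
    exact ⟨t, rfl⟩
  have h5 := Nat.mul_le_mul_left (m^d) himg
  have h6 : Fintype.card F ^ d ≤ 2 * good.card := by omega
  calc Fintype.card F ^ d ≤ 2 * good.card := h6
    _ ≤ 2 * (m^d * Nat.card (Set.range ev)) := Nat.mul_le_mul_left _ (hfib.trans h5)
    _ = _ := by ring

end PN

end

section
namespace PN
open Matrix.SpecialLinearGroup

lemma diag2n_transv {n : ℕ} {F : Type*} [Field F] {i j : Fin n} (hij : i ≠ j) (a : F) (ha : a ≠ 0) :
    diag2n hij a ha = (transvection hij a * transvection hij.symm (-a⁻¹) * transvection hij a) *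
      (transvection hij (-1) * transvection hij.symm 1 * transvection hij (-1)) := by
  apply Subtype.ext
  set e : Mt(n) F := Matrix.single i j 1 with he
  set f : Mt(n) F := Matrix.single j i 1 with hf
  have hee : e * e = 0 := by simp [he, Matrix.single_mul_single_of_ne, hij.symm]
  have hff : f * f = 0 := by simp [hf, Matrix.single_mul_single_of_ne, hij]
  have hefe : e * f * e = e := by simp [he, hf]
  have hfef : f * e * f = f := by simp [he, hf]
  have ht : ∀ c : F, (transvection hij c : SpecialLinearGroup (Fin n) F).1 = 1 + c • e := by
    intro c; rw [transvection_coe]; simp [Matrix.transvection, he]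
  have ht' : ∀ c : F, (transvection hij.symm c : SpecialLinearGroup (Fin n) F).1 = 1 + c • f := by
    intro c; rw [transvection_coe]; simp [Matrix.transvection, hf]
  have hw : ∀ c : F, c ≠ 0 → (1 + c • e) * (1 + (-c⁻¹) • f) * (1 + c • e) = (1 - e * f - f * e) + c • e - c⁻¹ • f := by
    intro c hc
    simp only [mul_add, add_mul, mul_one, one_mul, smul_mul_assoc, mul_smul_comm, smul_smul, hee, hefe, smul_zero]
    match_scalars <;> field_simp <;> ring
  have hw1 := hw a ha
  have hw2 := hw (-1) (by simp)
  have hd : (diag2n hij a ha).1 = (1 - e * f - f * e) + a • (e * f) + a⁻¹ • (f * e) := by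
    rw [diag2n_coe]
    ext k l
    simp only [he, hf, Matrix.single_mul_single_same, mul_one, Matrix.diagonal_apply, Matrix.add_apply, Matrix.sub_apply,
      Matrix.smul_apply, Matrix.one_apply, Matrix.single_apply, smul_eq_mul]
    by_cases hkl : k = l
    · subst hkl
      by_cases h1 : k = i
      · subst h1; simp [hij.symm]
      · by_cases h2 : k = j
        · subst h2; simp [hij, h1]
        · simp [h1, h2, Ne.symm h1, Ne.symm h2]
    · have h1 : ¬ (i = k ∧ i = l) := fun h => hkl (h.1.symm.trans h.2)
      have h2 : ¬ (j = k ∧ j = l) := fun h => hkl (h.1.symm.trans h.2)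
      simp [hkl, h1, h2]
  have h3 : (-(-1:F)⁻¹) = 1 := by norm_num
  rw [h3] at hw2
  rw [hd, coe_mul, coe_mul, coe_mul, coe_mul, coe_mul, ht, ht, ht', ht', hw1, hw2]
  have z1 : (1 - e * f - f * e) * e = 0 := by
    simp only [sub_mul, one_mul, hefe, mul_assoc f, hee, mul_zero]; simp
  have z2 : (1 - e * f - f * e) * f = 0 := by
    simp only [sub_mul, one_mul, hfef, mul_assoc e, hff, mul_zero]; simp
  have z3 : e * (1 - e * f - f * e) = 0 := by
    simp only [mul_sub, mul_one, ← mul_assoc, hefe, hee, zero_mul]; simp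
  have z4 : f * (1 - e * f - f * e) = 0 := by
    simp only [mul_sub, mul_one, ← mul_assoc, hfef, hff, zero_mul]; simp
  have z5 : (1 - e * f - f * e) * (1 - e * f - f * e) = 1 - e * f - f * e := by
    conv_lhs => rw [mul_sub, mul_sub, mul_one, ← mul_assoc, z1, ← mul_assoc, z2]
    simp
  set z := 1 - e * f - f * e with hz
  simp only [mul_add, add_mul, mul_sub, sub_mul, smul_mul_assoc, mul_smul_comm, z1, z2, z3, z4, z5, hee, hff, smul_zero]
  have h4 : (-1:F)⁻¹ = -1 := by norm_num
  simp only [h4]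
  match_scalars <;> ring

lemma closure_transv {n : ℕ} (hn : 2 ≤ n) {F : Type*} [Field F] (G : Subgroup (SpecialLinearGroup (Fin n) F))
    (hG : ∀ (i j : Fin n) (hij : i ≠ j) (a : F), transvection hij a ∈ G) : G = ⊤ := by
  haveI : Nontrivial (Fin n) := Fin.nontrivial_iff_two_le.2 hn
  rw [eq_top_iff]
  intro g _
  refine diagonal_transvection_induction' (fun g => g ∈ G) g ?_ hG (fun _ _ => G.mul_mem)
  intro i j hij c hc
  rw [diag2n_transv hij c hc]
  exact G.mul_mem (G.mul_mem (G.mul_mem (hG _ _ _ _) (hG _ _ _ _)) (hG _ _ _ _))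
    (G.mul_mem (G.mul_mem (hG _ _ _ _) (hG _ _ _ _)) (hG _ _ _ _))

lemma transv_pow {n p : ℕ} [Fact p.Prime] {i j : Fin n} (hij : i ≠ j) (a : ZMod p) :
    (transvection hij a : SpecialLinearGroup (Fin n) (ZMod p)) ^ p = 1 := by
  have : ∀ k : ℕ, (transvection hij a : SpecialLinearGroup (Fin n) (ZMod p)) ^ k = transvection hij (k * a) := by
    intro k
    induction k with
    | zero =>
      apply Subtype.ext; rw [transvection_coe]; simp [Matrix.transvection]
    | succ k ih =>
      rw [pow_succ, ih]
      apply Subtype.ext; rw [coe_mul, transvection_coe, transvection_coe, transvection_coe]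
      have := Matrix.transvection_mul_transvection_same i j hij ((k:ZMod p) * a) a
      rw [Matrix.transvection, Matrix.transvection, Matrix.transvection] at this
      rw [this]; push_cast; ring_nf
  rw [this]
  apply Subtype.ext; rw [transvection_coe]; simp [Matrix.transvection]

lemma mem_of_index_lt {Γ : Type*} [Group Γ] [Finite Γ] (G : Subgroup Γ) {p : ℕ} (hp : p.Prime) (h : G.index < p)
    (u : Γ) (hu : u ^ p = 1) : u ∈ G := by
  have h1 : G.relIndex (Subgroup.zpowers u) ∣ p := by
    refine (Subgroup.relIndex_dvd_card _ _).trans ?_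
    rw [Nat.card_zpowers]
    exact orderOf_dvd_of_pow_eq_one hu
  have h2 : G.relIndex (Subgroup.zpowers u) ≤ G.index := by
    rw [← Subgroup.relIndex_top_right]
    exact Subgroup.relIndex_le_of_le_right le_top (by rw [Subgroup.relIndex_top_right]; exact Subgroup.index_ne_zero_of_finite)
  rcases (Nat.dvd_prime hp).1 h1 with h3 | h3
  · exact Subgroup.relIndex_eq_one.1 h3 (Subgroup.mem_zpowers u)
  · omega

lemma card_SL_le {n : ℕ} (hn : 0 < n) {F : Type} [Field F] [Fintype F] :
    Nat.card (SpecialLinearGroup (Fin n) F) * (Fintype.card F - 1) ≤ Fintype.card F ^ (n ^ 2) := by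
  classical
  have h1 : Nat.card (SpecialLinearGroup (Fin n) F × Fˣ) = Nat.card (SpecialLinearGroup (Fin n) F) * (Fintype.card F - 1) := by
    rw [Nat.card_prod, Nat.card_units, Nat.card_eq_fintype_card (α := F)]
  have h2 : Nat.card (Mt(n) F) = Fintype.card F ^ (n^2) := by
    rw [show Mt(n) F = (Fin n → Fin n → F) from rfl, Nat.card_fun, Nat.card_fun, Nat.card_fin, ← pow_mul, sq, Nat.card_eq_fintype_card]
  rw [← h1, ← h2]
  let D : Fˣ → Mt(n) F := fun c => Matrix.diagonal (Function.update 1 (⟨0, hn⟩ : Fin n) (c:F))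
  have hD : ∀ c, (D c).det = c := by
    intro c
    simp only [D, Matrix.det_diagonal]
    rw [Finset.prod_update_of_mem (Finset.mem_univ _)]; simp
  refine Nat.card_le_card_of_injective (fun x : SpecialLinearGroup (Fin n) F × Fˣ => D x.2 * (x.1 : Mt(n) F)) ?_
  rintro ⟨g, c⟩ ⟨g', c'⟩ h
  simp only at h
  have h3 : c = c' := by
    have := congrArg Matrix.det h
    rw [Matrix.det_mul, Matrix.det_mul, hD, hD, g.2, g'.2, mul_one, mul_one] at this
    exact Units.ext this
  subst h3
  have h4 : IsUnit (D c) := by rw [Matrix.isUnit_iff_isUnit_det, hD]; exact c.isUnit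
  have h5 := h4.mul_left_cancel h
  rw [Subtype.ext h5]

lemma top_of_card {n : ℕ} (hn : 2 ≤ n) {p : ℕ} [Fact p.Prime] (C : ℕ) (hC : 2 * C < p)
    (G : Subgroup (SpecialLinearGroup (Fin n) (ZMod p))) (h : p ^ (n^2 - 1) ≤ C * Nat.card G) : G = ⊤ := by
  have hp := (Fact.out : p.Prime)
  have h1 := card_SL_le (n := n) (by omega) (F := ZMod p)
  rw [ZMod.card] at h1
  have h2 := G.card_mul_index
  have hpow : p ^ (n^2) = p ^ (n^2-1) * p := by
    rw [← pow_succ]; congr 1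
    have : 0 < n^2 := by positivity
    omega
  have h3 : p ^ (n^2-1) * (G.index * (p-1)) ≤ p ^ (n^2-1) * (C * p) := by
    calc p ^ (n^2-1) * (G.index * (p-1)) ≤ (C * Nat.card G) * (G.index * (p-1)) := Nat.mul_le_mul_right _ h
      _ = C * (Nat.card (SpecialLinearGroup (Fin n) (ZMod p)) * (p-1)) := by rw [← h2]; ring
      _ ≤ C * p ^ (n^2) := Nat.mul_le_mul_left _ h1
      _ = _ := by rw [hpow]; ring
  have h4 := Nat.le_of_mul_le_mul_left h3 (pow_pos hp.pos _)
  have h5 : G.index ≤ 2 * C := by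
    have hp2 : p ≤ 2 * (p-1) := by have := hp.two_le; omega
    have : G.index * (p-1) ≤ (2 * C) * (p-1) := by
      calc _ ≤ C * p := h4
        _ ≤ C * (2 * (p-1)) := Nat.mul_le_mul_left _ hp2
        _ = _ := by ring
    exact Nat.le_of_mul_le_mul_right this (by have := hp.two_le; omega)
  refine closure_transv hn G fun i j hij a => ?_
  exact mem_of_index_lt G hp (by omega) _ (transv_pow hij a)

end PN

end

section
namespace PN
open MvPolynomial

lemma list_prod_sq_zero {T ι : Type*} [Ring T] (y : ι → T) (hy : ∀ i j, y i * y j = 0) (l : List ι) :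
    (l.map fun i => 1 + y i).prod = 1 + (l.map y).sum := by
  induction l with
  | nil => simp
  | cons a l ih =>
    rw [List.map_cons, List.prod_cons, ih, List.map_cons, List.sum_cons, add_mul, one_mul, mul_add, mul_one]
    have : y a * (l.map y).sum = 0 := by
      clear ih
      induction l with
      | nil => simp
      | cons b l ih => rw [List.map_cons, List.sum_cons, mul_add, hy, ih, add_zero]
    rw [this]; abel

lemma list_prod_deg {n d e : ℕ} {F : Type*} [Field F] {ι : Type*} (l : List ι)
    (M : ι → Mt(n) (MvPolynomial (Fin d) F))
    (hM : ∀ i a b, (M i a b).totalDegree ≤ e) (a b) : ((l.map M).prod a b).totalDegree ≤ l.length * e := by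
  induction l generalizing a b with
  | nil =>
    by_cases h : a = b
    · subst h; simp
    · simp [Matrix.one_apply_ne h]
  | cons i l ih =>
    rw [List.map_cons, List.prod_cons, Matrix.mul_apply]
    refine totalDegree_finsetSum_le fun c _ => ?_
    refine (totalDegree_mul _ _).trans ?_
    rw [List.length_cons, add_mul, one_mul, add_comm]
    exact Nat.add_le_add (ih _ _) (hM _ _ _)

/-- the polynomial matrix curve -/
noncomputable def curve {n d : ℕ} {F : Type*} [Field F] (A : Fin d → ℕ → Mt(n) F) (i : Fin d) :
    Mt(n) (MvPolynomial (Fin d) F) :=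
  Matrix.of fun a b => ∑ k ∈ Finset.range n, C (A i k a b) * X i ^ k

lemma curve_eval {n d : ℕ} {F : Type*} [Field F] (A : Fin d → ℕ → Mt(n) F) (i : Fin d) (t : Fin d → F) :
    (eval t).mapMatrix (curve A i) = ∑ k ∈ Finset.range n, t i ^ k • A i k := by
  ext a b
  simp [curve, Matrix.sum_apply, mul_comm]

lemma curve_deg {n d : ℕ} {F : Type*} [Field F] (A : Fin d → ℕ → Mt(n) F) (i : Fin d) (a b) :
    (curve A i a b).totalDegree ≤ n := by
  rw [curve, Matrix.of_apply]
  refine totalDegree_finsetSum_le fun k hk => ?_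
  refine (totalDegree_mul _ _).trans ?_
  rw [totalDegree_C, totalDegree_X_pow, zero_add]
  exact (Finset.mem_range.1 hk).le

lemma curve_quot {n d : ℕ} (hn : 2 ≤ n) {F : Type*} [Field F] (A : Fin d → ℕ → Mt(n) F)
    (hA0 : ∀ i, A i 0 = 1) (i : Fin d) :
    (Ideal.Quotient.mk (idealOfVars (Fin d) F ^ 2)).mapMatrix (curve A i) =
      1 + Matrix.of fun a b => Ideal.Quotient.mk (idealOfVars (Fin d) F ^ 2) (C (A i 1 a b) * X i) := by
  have hX : (X i : MvPolynomial (Fin d) F) ∈ idealOfVars (Fin d) F := Ideal.subset_span ⟨i, rfl⟩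
  ext a b
  simp only [curve, RingHom.mapMatrix_apply, Matrix.map_apply, Matrix.of_apply, Matrix.add_apply]
  obtain ⟨m, rfl⟩ : ∃ m, n = m + 2 := ⟨n - 2, by omega⟩
  rw [Finset.sum_range_succ', Finset.sum_range_succ', map_add, map_add, map_sum, Finset.sum_eq_zero]
  · rw [zero_add, add_comm]
    congr 1
    · rw [hA0]
      by_cases h : a = b
      · subst h; simp
      · simp [Matrix.one_apply_ne h]
    · simp
  · intro k _
    rw [Ideal.Quotient.eq_zero_iff_mem]
    refine Ideal.mul_mem_left _ _ ?_
    rw [add_assoc, pow_add]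
    exact Ideal.mul_mem_left _ _ (Ideal.pow_mem_pow hX _)

lemma nori_aux (n d : ℕ) (hn : 2 ≤ n) : ∃ C0 q0 : ℕ, ∀ (p : ℕ) [Fact p.Prime], q0 ≤ p →
    ∀ (G : Subgroup (SpecialLinearGroup (Fin n) (ZMod p)))
      (A : Fin d → ℕ → Mt(n) (ZMod p)), (∀ i, A i 0 = 1) →
      LinearIndependent (ZMod p) (fun i => A i 1) →
      (∀ i, ∀ t : ZMod p, ∃ g ∈ G, (g : Mt(n) (ZMod p)) = ∑ k ∈ Finset.range n, t ^ k • A i k) →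
      p ^ d ≤ C0 * Nat.card G := by
  classical
  obtain ⟨C0, q0, hCq⟩ := poly_image d (d * n)
  refine ⟨C0, q0, ?_⟩
  intro p _ hp G A hA0 hA hG
  have hq : q0 ≤ Fintype.card (ZMod p) := by rw [ZMod.card]; exact hp
  -- dual functionals
  obtain ⟨φ, hφ⟩ : ∃ φ : Fin d → (Mt(n) (ZMod p) →ₗ[ZMod p] ZMod p),
      ∀ i j, φ i (A j 1) = if i = j then 1 else 0 := by
    obtain ⟨T, hT⟩ := LinearMap.exists_leftInverse_of_injective
      (Fintype.linearCombination (ZMod p) (fun i => A i 1))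
      (LinearMap.ker_eq_bot.2 (linearIndependent_iff_injective_fintypeLinearCombination.1 hA))
    refine ⟨fun i => (LinearMap.proj i) ∘ₗ T, fun i j => ?_⟩
    have h := LinearMap.congr_fun hT (Pi.single j 1)
    rw [LinearMap.comp_apply, Fintype.linearCombination_apply_single, one_smul] at h
    rw [LinearMap.comp_apply, h]
    simp [Pi.single_apply]
  have hφs : ∀ i M, φ i M = ∑ a, ∑ b, φ i (Matrix.single a b 1) * M a b := by
    intro i M
    conv_lhs => rw [Matrix.matrix_eq_sum_single M]
    simp only [map_sum]
    refine Finset.sum_congr rfl fun a _ => Finset.sum_congr rfl fun b _ => ?_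
    have : Matrix.single a b (M a b) = M a b • Matrix.single a b (1 : ZMod p) := by simp
    rw [this, map_smul, smul_eq_mul, mul_comm]
  let P : Mt(n) (MvPolynomial (Fin d) (ZMod p)) := ((List.finRange d).map (curve A)).prod
  let f : Fin d → MvPolynomial (Fin d) (ZMod p) := fun i => ∑ a, ∑ b, C (φ i (Matrix.single a b 1)) * (P - 1) a b
  have hfeval : ∀ t i, eval t (f i) = φ i ((eval t).mapMatrix P - 1) := by
    intro t i
    rw [hφs]
    simp only [f, map_sum, map_mul, eval_C]
    refine Finset.sum_congr rfl fun a _ => Finset.sum_congr rfl fun b _ => ?_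
    congr 1
    have : (eval t).mapMatrix P - 1 = (eval t).mapMatrix (P - 1) := by rw [map_sub, map_one]
    rw [this]; rfl
  have hfdeg : ∀ i, (f i).totalDegree ≤ d * n := by
    intro i
    refine totalDegree_finsetSum_le fun a _ => totalDegree_finsetSum_le fun b _ => ?_
    refine (totalDegree_mul _ _).trans ?_
    rw [totalDegree_C, zero_add, Matrix.sub_apply]
    refine (totalDegree_sub _ _).trans (max_le ?_ ?_)
    · have := list_prod_deg (List.finRange d) (curve A) (curve_deg A) a b
      rwa [List.length_finRange] at this
    · by_cases h : a = b
      · subst h; simp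
      · simp [Matrix.one_apply_ne h]
  have hfI : ∀ i, f i - X i ∈ idealOfVars (Fin d) (ZMod p) ^ 2 := by
    intro i
    set π := Ideal.Quotient.mk (idealOfVars (Fin d) (ZMod p) ^ 2) with hπ
    have hX : ∀ i, (X i : MvPolynomial (Fin d) (ZMod p)) ∈ idealOfVars (Fin d) (ZMod p) := fun i => Ideal.subset_span ⟨i, rfl⟩
    have hP : π.mapMatrix P = 1 + ∑ j, Matrix.of fun a b => π (C (A j 1 a b) * X j) := by
      simp only [P, map_list_prod, List.map_map]
      have : (π.mapMatrix ∘ curve A) = fun j => 1 + Matrix.of fun a b => π (C (A j 1 a b) * X j) := by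
        funext j
        exact curve_quot hn A hA0 j
      rw [this, list_prod_sq_zero]
      · rw [← List.ofFn_eq_map, List.sum_ofFn]
      · intro j k
        ext a b
        rw [Matrix.mul_apply]
        refine Finset.sum_eq_zero fun c _ => ?_
        rw [Matrix.of_apply, Matrix.of_apply, ← map_mul, Ideal.Quotient.eq_zero_iff_mem, sq]
        exact Ideal.mul_mem_mul (Ideal.mul_mem_left _ _ (hX _)) (Ideal.mul_mem_left _ _ (hX _))
    rw [← Ideal.Quotient.eq_zero_iff_mem, ← hπ, map_sub, sub_eq_zero]
    have h1 : ∀ a b, π ((P - 1) a b) = ∑ j, π (C (A j 1 a b) * X j) := by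
      intro a b
      have : π.mapMatrix (P - 1) = ∑ j, Matrix.of fun a b => π (C (A j 1 a b) * X j) := by
        rw [map_sub, hP, map_one]; simp
      have := congrFun (congrFun this a) b
      rw [Matrix.sum_apply] at this
      exact this
    simp only [f, map_sum, map_mul, h1]
    have h2 : ∀ j, ∑ a, ∑ b, π (C (φ i (Matrix.single a b 1))) * (π (C (A j 1 a b)) * π (X j)) = π (C (φ i (A j 1))) * π (X j) := by
      intro j
      rw [hφs i (A j 1)]
      simp only [map_sum, map_mul, Finset.sum_mul, mul_assoc]
    have h3 : ∑ j, π (C (φ i (A j 1))) * π (X j) = π (X i) := by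
      rw [Finset.sum_eq_single i]
      · simp [hφ]
      · intro j _ hj
        simp [hφ, hj.symm]
      · simp
    rw [← h3]
    simp_rw [← h2, Finset.mul_sum]
    rw [Finset.sum_comm]
    simp_rw [Finset.sum_comm (s := Finset.univ (α := Fin d))]
    rw [Finset.sum_comm]
  have hmain := hCq (ZMod p) hq f hfdeg hfI
  rw [ZMod.card] at hmain
  refine hmain.trans (Nat.mul_le_mul_left _ ?_)
  have hsub : Set.range (fun (t : Fin d → ZMod p) i => eval t (f i)) ⊆
      Set.range (fun (g : G) i => φ i ((g.1 : Mt(n) (ZMod p)) - 1)) := by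
    rintro _ ⟨t, rfl⟩
    choose g hgG hg using fun i => hG i (t i)
    refine ⟨⟨((List.finRange d).map g).prod, Subgroup.list_prod_mem _ (by simp; exact hgG)⟩, ?_⟩
    funext i
    simp only [hfeval]
    congr 2
    simp only [P, map_list_prod, List.map_map]
    have h1 : ((eval t).mapMatrix ∘ curve A) = (fun g : SpecialLinearGroup (Fin n) (ZMod p) => (g : Mt(n) (ZMod p))) ∘ g := by
      funext j
      rw [Function.comp_apply, curve_eval, Function.comp_apply, hg]
    rw [h1, ← List.map_map]
    exact map_list_prod (SpecialLinearGroup.coeMonoidHom (ι := Fin n) (R := ZMod p)) _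
  rw [Nat.card_coe_set_eq]
  refine (Set.ncard_le_ncard hsub (Set.toFinite _)).trans ?_
  rw [← Set.image_univ]
  refine (Set.ncard_image_le (Set.toFinite _)).trans ?_
  rw [Set.ncard_univ]

theorem nori (n : ℕ) (hn : 2 ≤ n) : ∃ p0 : ℕ, ∀ (p : ℕ) [Fact p.Prime], p0 ≤ p →
    ∀ (G : Subgroup (SpecialLinearGroup (Fin n) (ZMod p)))
      (A : Fin (n^2-1) → ℕ → Mt(n) (ZMod p)), (∀ i, A i 0 = 1) →
      LinearIndependent (ZMod p) (fun i => A i 1) →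
      (∀ i, ∀ t : ZMod p, ∃ g ∈ G, (g : Mt(n) (ZMod p)) = ∑ k ∈ Finset.range n, t ^ k • A i k) →
      G = ⊤ := by
  obtain ⟨C0, q0, h⟩ := nori_aux n (n^2-1) hn
  refine ⟨max q0 (2 * C0 + 1), ?_⟩
  intro p _ hp G A hA0 hA hG
  refine top_of_card hn C0 (by have := le_max_right q0 (2*C0+1); omega) G ?_
  exact h p ((le_max_left _ _).trans hp) G A hA0 hA hG

end PN

end

section
namespace PJ

lemma ker_pow {n p k : ℕ} [Fact p.Prime] (x : SL n (ZMod (p^(k+1))))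
    (hx : SpecialLinearGroup.map (ZMod.castHom (dvd_pow_self p (Nat.succ_ne_zero k)) (ZMod p)) x = 1) :
    x ^ (p ^ k) = 1 := by
  have hp := (Fact.out : p.Prime)
  -- x = 1 + p Y
  have h1 : ∀ a b, ∃ y : ZMod (p^(k+1)), (x : Matrix _ _ _) a b - (1 : Mt(n) (ZMod (p^(k+1)))) a b = (p : ZMod (p^(k+1))) * y := by
    intro a b
    set c := (x : Matrix _ _ _) a b - (1 : Mt(n) (ZMod (p^(k+1)))) a b with hc
    have h2 : ZMod.castHom (dvd_pow_self p (Nat.succ_ne_zero k)) (ZMod p) c = 0 := by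
      have := congrArg (fun M : SL n (ZMod p) => (M : Mt(n) (ZMod p)) a b) hx
      simp only [SpecialLinearGroup.map_apply_coe, RingHom.mapMatrix_apply, Matrix.map_apply, SpecialLinearGroup.coe_one] at this
      rw [hc, map_sub, this]
      by_cases h : a = b
      · subst h; simp
      · simp [Matrix.one_apply_ne h]
    haveI : NeZero (p^(k+1)) := ⟨pow_ne_zero _ hp.ne_zero⟩
    have h3 : ((c.val : ℕ) : ZMod p) = 0 := by
      rw [← h2, ZMod.castHom_apply, ZMod.natCast_val]
    rw [ZMod.natCast_eq_zero_iff] at h3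
    obtain ⟨y, hy⟩ := h3
    refine ⟨(y : ZMod (p^(k+1))), ?_⟩
    rw [← ZMod.natCast_zmod_val c, hy]; push_cast; rfl
  choose Y hY using h1
  let Ym : Mt(n) (ZMod (p^(k+1))) := Matrix.of Y
  have hx1 : (x : Mt(n) (ZMod (p^(k+1)))) = 1 + (p : Mt(n) (ZMod (p^(k+1)))) * Ym := by
    ext a b
    have := hY a b
    rw [Matrix.add_apply, ← nsmul_eq_mul, Matrix.smul_apply, nsmul_eq_mul]
    change _ = _ + (p : ZMod (p^(k+1))) * Y a b
    rw [← this]; ring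
  obtain ⟨q, hq⟩ := dvd_sub_pow_of_dvd_sub (R := Polynomial ℤ) (p := p) (a := 1 + (p : Polynomial ℤ) * Polynomial.X) (b := 1) ⟨Polynomial.X, by ring⟩ k
  have h4 := congrArg (Polynomial.aeval (R := ℤ) Ym) hq
  simp only [map_sub, map_pow, map_add, map_mul, map_one, map_natCast, Polynomial.aeval_X, one_pow] at h4
  rw [← hx1] at h4
  have h5 : ((p : Mt(n) (ZMod (p^(k+1)))) ^ (k+1)) = 0 := by
    rw [← Nat.cast_pow, ← map_natCast (Matrix.scalar (Fin n)) , ZMod.natCast_self, map_zero]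
  rw [h5, zero_mul, sub_eq_zero] at h4
  apply Subtype.ext
  exact (Matrix.SpecialLinearGroup.coe_pow x (p^k)).trans h4

lemma lift_k (n p k : ℕ) [Fact p.Prime] (H : Subgroup (SL n ℤ)) (hcop : ¬ p ∣ Nat.card (H.map (redMod n p))) :
    ∃ s : (H.map (redMod n p)) →* SL n (ZMod (p^(k+1))),
      ∀ g, SpecialLinearGroup.map (ZMod.castHom (dvd_pow_self p (Nat.succ_ne_zero k)) (ZMod p)) (s g) = g.1 := by
  have hp := (Fact.out : p.Prime)
  haveI : NeZero (p^(k+1)) := ⟨pow_ne_zero _ hp.ne_zero⟩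
  set red := SpecialLinearGroup.map (n := Fin n) (ZMod.castHom (dvd_pow_self p (Nat.succ_ne_zero k)) (ZMod p)) with hred
  have hcomp : ∀ h : SL n ℤ, red (redMod n (p^(k+1)) h) = redMod n p h := by
    intro h
    apply Subtype.ext
    ext a b
    simp [hred, redMod]
  set E := H.map (redMod n (p^(k+1))) with hE
  set G := H.map (redMod n p) with hG
  have hEG : ∀ x : E, red x.1 ∈ G := by
    rintro ⟨x, h, hh, rfl⟩
    exact ⟨h, hh, (hcomp h).symm⟩
  let π : E →* G := (red.comp E.subtype).codRestrict G hEG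
  have hπ : Function.Surjective π := by
    rintro ⟨g, h, hh, rfl⟩
    exact ⟨⟨_, h, hh, rfl⟩, Subtype.ext (hcomp h)⟩
  have hidx : π.ker.index = Nat.card G := by
    rw [Subgroup.index_ker, MonoidHom.range_eq_top.2 hπ]
    exact Nat.card_congr Subgroup.topEquiv.toEquiv
  have hpg : IsPGroup p π.ker := by
    intro x
    refine ⟨k, ?_⟩
    apply Subtype.ext; apply Subtype.ext
    refine ker_pow x.1.1 ?_
    have := x.2
    rw [MonoidHom.mem_ker] at this
    exact congrArg Subtype.val this
  obtain ⟨m, hm⟩ := (IsPGroup.iff_card).1 hpg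
  obtain ⟨C, hC⟩ := Subgroup.exists_right_complement'_of_coprime (N := π.ker) (by
    rw [hm, hidx]
    exact Nat.Coprime.pow_left _ ((Nat.Prime.coprime_iff_not_dvd hp).2 hcop))
  have hbij : Function.Bijective (π.comp C.subtype) := by
    constructor
    · rw [injective_iff_map_eq_one]
      intro c hc
      have h1 : c.1 ∈ π.ker ⊓ C := ⟨hc, c.2⟩
      rw [hC.disjoint.eq_bot] at h1
      exact Subtype.ext (Subgroup.mem_bot.1 h1)
    · intro g
      obtain ⟨x, rfl⟩ := hπ g
      obtain ⟨⟨a, c⟩, hac⟩ := hC.2 x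
      refine ⟨c, ?_⟩
      rw [← hac]
      simp only [map_mul]
      have : π a.1 = 1 := a.2
      rw [this, one_mul]; rfl
  let e : C ≃* G := MulEquiv.ofBijective _ hbij
  refine ⟨E.subtype.comp (C.subtype.comp e.symm.toMonoidHom), fun g => ?_⟩
  have := e.apply_symm_apply g
  exact congrArg Subtype.val this

open Cardinal in
/-- a characteristic zero field of size at most the continuum embeds in `ℂ`. -/
lemma embed_complex (F : Type) [Field F] [CharZero F] (hF : #F ≤ 𝔠) : Nonempty (F →+* ℂ) := by
  let M := AlgebraicClosure (FractionRing (MvPolynomial ℝ F))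
  have h1 : #(FractionRing (MvPolynomial ℝ F)) = 𝔠 := by
    rw [FractionRing.cardinalMk, MvPolynomial.cardinalMk_eq_max]
    rw [Cardinal.mk_real, max_assoc, max_eq_left (Cardinal.aleph0_le_continuum), max_eq_right hF]
  have h2 : #M = 𝔠 := by
    apply le_antisymm
    · refine (Algebra.IsAlgebraic.cardinalMk_le_max (FractionRing (MvPolynomial ℝ F)) M).trans ?_
      rw [h1, max_eq_left Cardinal.aleph0_le_continuum]
    · rw [← h1]
      exact Cardinal.mk_le_of_injective (algebraMap (FractionRing (MvPolynomial ℝ F)) M).injective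
  haveI : CharZero (FractionRing (MvPolynomial ℝ F)) :=
    charZero_of_injective_algebraMap (R := MvPolynomial ℝ F) (IsFractionRing.injective _ _)
  haveI : CharZero M := charZero_of_injective_algebraMap (R := FractionRing (MvPolynomial ℝ F)) (algebraMap (FractionRing (MvPolynomial ℝ F)) M).injective
  obtain ⟨e⟩ := IsAlgClosed.ringEquiv_of_equiv_of_charZero (K := M) (L := ℂ) (by rw [h2]; exact Cardinal.aleph0_lt_continuum)
    (Cardinal.eq.1 (by rw [h2, Cardinal.mk_complex]))
  exact ⟨e.toRingHom.comp ((algebraMap (FractionRing (MvPolynomial ℝ F)) M).comp ((algebraMap (MvPolynomial ℝ F) _).comp MvPolynomial.C))⟩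

lemma unit_zmod {p k : ℕ} [Fact p.Prime] (x : ZMod (p^(k+1)))
    (hx : ZMod.castHom (dvd_pow_self p (Nat.succ_ne_zero k)) (ZMod p) x ≠ 0) : IsUnit x := by
  have hp := (Fact.out : p.Prime)
  haveI : NeZero (p^(k+1)) := ⟨pow_ne_zero _ hp.ne_zero⟩
  rw [← ZMod.natCast_zmod_val x, ZMod.isUnit_iff_coprime]
  refine Nat.Coprime.pow_right _ (Nat.Coprime.symm ((Nat.Prime.coprime_iff_not_dvd hp).2 ?_))
  intro h
  apply hx
  rw [ZMod.castHom_apply, ← ZMod.natCast_val]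
  exact (ZMod.natCast_eq_zero_iff _ _).2 h

open Cardinal in
/-- a `p'` congruence image embeds in `SL_n(ℂ)`. -/
theorem to_complex (n p : ℕ) [Fact p.Prime] (H : Subgroup (SL n ℤ)) (hcop : ¬ p ∣ Nat.card (H.map (redMod n p))) :
    ∃ s : (H.map (redMod n p)) →* SL n ℂ, Function.Injective s := by
  have hp := (Fact.out : p.Prime)
  choose s hs using fun k => lift_k n p k H hcop
  let R := ∀ k : ℕ, ZMod (p^(k+1))
  have hunit : ∀ x : R, (∀ k, ZMod.castHom (dvd_pow_self p (Nat.succ_ne_zero k)) (ZMod p) (x k) ≠ 0) → IsUnit x := by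
    intro x hx
    rw [Pi.isUnit_iff]
    exact fun k => unit_zmod _ (hx k)
  have hdisj : Disjoint ((⊥ : Ideal R) : Set R) (Submonoid.powers (p : R)) := by
    rw [Set.disjoint_left]
    rintro x hx ⟨j, rfl⟩
    have h0 : (p : R) ^ j = 0 := hx
    have h1 := congrFun h0 j
    rw [Pi.pow_apply, Pi.natCast_apply, Pi.zero_apply, ← Nat.cast_pow, ZMod.natCast_eq_zero_iff] at h1
    have := (Nat.pow_dvd_pow_iff_le_right hp.one_lt).1 h1
    omega
  obtain ⟨q, hq, -, hqd⟩ := Ideal.exists_le_prime_disjoint _ _ hdisj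
  let F := FractionRing (R ⧸ q)
  let ψ : R →+* F := (algebraMap (R ⧸ q) F).comp (Ideal.Quotient.mk q)
  have hψ : ∀ x : R, ψ x = 0 → x ∈ q := by
    intro x hx
    have : algebraMap (R ⧸ q) F (Ideal.Quotient.mk q x) = 0 := hx
    rw [IsFractionRing.to_map_eq_zero_iff] at this
    exact Ideal.Quotient.eq_zero_iff_mem.1 this
  haveI : CharZero F := by
    obtain ⟨r, hr⟩ := CharP.exists F
    rcases CharP.char_is_prime_or_zero F r with hrp | hr0
    · exfalso
      have h0 : (r : F) = 0 := CharP.cast_eq_zero F r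
      have h1 : (r : R) ∈ q := hψ _ (by rw [map_natCast, h0])
      by_cases hrpe : r = p
      · subst hrpe
        exact Set.disjoint_left.1 hqd h1 (Submonoid.mem_powers _)
      · have : IsUnit (r : R) := by
          apply hunit
          intro k
          rw [Pi.natCast_apply, map_natCast, Ne, ZMod.natCast_eq_zero_iff]
          intro h
          exact hrpe ((Nat.prime_dvd_prime_iff_eq hp hrp).1 h).symm
        exact hq.ne_top (Ideal.eq_top_of_isUnit_mem _ h1 this)
    · subst hr0
      exact CharP.charP_to_charZero F
  have hF : #F ≤ 𝔠 := by
    rw [show #F = #(R ⧸ q) from FractionRing.cardinalMk _]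
    refine (Cardinal.mk_le_of_surjective (Ideal.Quotient.mk_surjective (I := q))).trans ?_
    haveI : ∀ k, NeZero (p^(k+1)) := fun k => ⟨pow_ne_zero _ hp.ne_zero⟩
    have h1 : #R ≤ #(ℕ → ℕ) :=
      Cardinal.mk_le_of_injective (f := fun (x : R) (k : ℕ) => (x k).val) (fun x y h => by
        funext k; exact ZMod.val_injective _ (congrFun h k))
    refine h1.trans ?_
    simp
  obtain ⟨e⟩ := embed_complex F hF
  let sR : (H.map (redMod n p)) →* SL n R :=
    { toFun := fun g => ⟨Matrix.of fun a b => fun k => (s k g : Mt(n) (ZMod (p^(k+1)))) a b, by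
        funext k
        have h1 := RingHom.map_det (Pi.evalRingHom (fun k : ℕ => ZMod (p^(k+1))) k) (Matrix.of fun a b => fun k => (s k g : Mt(n) (ZMod (p^(k+1)))) a b)
        exact h1.trans (s k g).2⟩
      map_one' := by
        apply Subtype.ext
        ext a b k
        change (s k 1 : Mt(n) (ZMod (p^(k+1)))) a b = _
        rw [map_one]
        change (1 : Mt(n) (ZMod (p^(k+1)))) a b = ((1 : Mt(n) R) a b) k
        by_cases h : a = b
        · subst h; simp only [Matrix.one_apply_eq]; rfl
        · simp only [Matrix.one_apply_ne h]; rfl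
      map_mul' := by
        intro g h
        apply Subtype.ext
        ext a b k
        change (s k (g*h) : Mt(n) (ZMod (p^(k+1)))) a b = _
        rw [map_mul]
        change _ = Pi.evalRingHom (fun k : ℕ => ZMod (p^(k+1))) k (∑ c : Fin n, ((fun k => (s k g : Mt(n) (ZMod (p^(k+1)))) a c : R) * (fun k => (s k h : Mt(n) (ZMod (p^(k+1)))) c b : R)))
        rw [map_sum]
        rfl }
  refine ⟨(SpecialLinearGroup.map (e.comp ψ)).comp sR, ?_⟩
  rw [injective_iff_map_eq_one]
  intro g hg
  by_contra hne
  have hne2 : (g.1 : Mt(n) (ZMod p)) ≠ 1 := fun h => hne (Subtype.ext (Subtype.ext h))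
  obtain ⟨a, b, hab⟩ : ∃ a b, (g.1 : Mt(n) (ZMod p)) a b ≠ (1 : Mt(n) (ZMod p)) a b := by
    by_contra hcon
    push Not at hcon
    exact hne2 (Matrix.ext hcon)
  let x : R := (sR g : Mt(n) R) a b - (1 : Mt(n) R) a b
  have hxu : IsUnit x := by
    apply hunit
    intro k h0
    apply hab
    have h1 : x k = (s k g : Mt(n) (ZMod (p^(k+1)))) a b - (1 : Mt(n) (ZMod (p^(k+1)))) a b := by
      change _ - ((1 : Mt(n) R) a b) k = _
      congr 1
      by_cases h : a = b
      · subst h; simp only [Matrix.one_apply_eq]; rfl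
      · simp only [Matrix.one_apply_ne h]; rfl
    rw [h1, map_sub, sub_eq_zero] at h0
    rw [← hs k g]
    refine h0.trans ?_
    by_cases h : a = b
    · subst h; simp
    · simp [Matrix.one_apply_ne h]
  have hx0 : (e.comp ψ) x = 0 := by
    have h2 := congrArg (fun M : SL n ℂ => (M : Mt(n) ℂ) a b) hg
    have h3 : (e.comp ψ) ((sR g : Mt(n) R) a b) = (1 : Mt(n) ℂ) a b := h2
    rw [map_sub, h3]
    by_cases h : a = b
    · subst h; simp
    · simp [Matrix.one_apply_ne h]
  have := hxu.map (e.comp ψ)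
  rw [hx0] at this
  exact not_isUnit_zero this

open scoped MatrixOrder ComplexOrder in
/-- a finite complex linear group is unitarizable. -/
lemma unitarize {n : ℕ} {G : Type*} [Group G] [Fintype G] (ρ : G →* SL n ℂ) (hinj : Function.Injective ρ) :
    ∃ τ : G →* Matrix.unitaryGroup (Fin n) ℂ, Function.Injective τ := by
  classical
  let r : G → Mt(n) ℂ := fun g => (ρ g : Mt(n) ℂ)
  have hr1 : r 1 = 1 := by simp [r]
  have hrm : ∀ g h, r (g * h) = r g * r h := by intro g h; simp [r]
  have hdet : ∀ g, (r g).det = 1 := fun g => (ρ g).2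
  let S : Mt(n) ℂ := ∑ g, (r g)ᴴ * r g
  have hS : S.PosDef := by
    refine Matrix.posDef_sum Finset.univ_nonempty (fun g _ => ?_)
    refine (Matrix.posSemidef_conjTranspose_mul_self (r g)).posDef_iff_isUnit.2 ?_
    have : IsUnit (r g) := (Matrix.isUnit_iff_isUnit_det _).2 (by rw [hdet]; exact isUnit_one)
    exact (this.star).mul this
  have hSr : ∀ h, (r h)ᴴ * S * r h = S := by
    intro h
    simp only [S, Finset.mul_sum, Finset.sum_mul]
    rw [← Equiv.sum_comp (Equiv.mulRight h) (fun g => (r g)ᴴ * r g)]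
    refine Finset.sum_congr rfl (fun g _ => ?_)
    simp only [Equiv.coe_mulRight, hrm, Matrix.conjTranspose_mul, mul_assoc]
  obtain ⟨B, hB⟩ : ∃ B : Mt(n) ℂ, S = Bᴴ * B := by
    have h0 : (0 : Mt(n) ℂ) ≤ S := hS.posSemidef.nonneg
    obtain ⟨B, hB⟩ := CStarAlgebra.nonneg_iff_eq_star_mul_self.1 h0
    exact ⟨B, hB⟩
  have hBu : IsUnit B := by
    have h1 := hS.isUnit
    rw [Matrix.isUnit_iff_isUnit_det, hB, Matrix.det_mul] at h1
    exact (Matrix.isUnit_iff_isUnit_det _).2 (isUnit_of_mul_isUnit_right h1)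
  obtain ⟨b, rfl⟩ := hBu
  let c : Mt(n) ℂ := ((b⁻¹ : (Mt(n) ℂ)ˣ) : Mt(n) ℂ)
  have hcb : c * b = 1 := b.inv_mul
  have hbc : (b : Mt(n) ℂ) * c = 1 := b.mul_inv
  have hbc' : cᴴ * (b : Mt(n) ℂ)ᴴ = 1 := by
    rw [← Matrix.conjTranspose_mul, hbc, Matrix.conjTranspose_one]
  have hmem : ∀ g, (b : Mt(n) ℂ) * r g * c ∈ Matrix.unitaryGroup (Fin n) ℂ := by
    intro g
    rw [Matrix.mem_unitaryGroup_iff', Matrix.star_eq_conjTranspose, Matrix.conjTranspose_mul, Matrix.conjTranspose_mul]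
    have h1 := hSr g
    rw [hB] at h1
    calc cᴴ * ((r g)ᴴ * (b : Mt(n) ℂ)ᴴ) * (b * r g * c)
        = cᴴ * ((r g)ᴴ * ((b : Mt(n) ℂ)ᴴ * b) * r g) * c := by simp only [mul_assoc]
      _ = (cᴴ * (b : Mt(n) ℂ)ᴴ) * (b * c) := by rw [h1]; simp only [mul_assoc]
      _ = 1 := by rw [hbc, hbc', one_mul]
  refine ⟨{ toFun := fun g => ⟨_, hmem g⟩, map_one' := ?_, map_mul' := ?_ }, ?_⟩
  · apply Subtype.ext
    change (b : Mt(n) ℂ) * r 1 * c = 1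
    rw [hr1, mul_one, hbc]
  · intro g h
    apply Subtype.ext
    change (b : Mt(n) ℂ) * r (g * h) * c = (b * r g * c) * (b * r h * c)
    calc _ = (b : Mt(n) ℂ) * r g * (1 * (r h * c)) := by rw [hrm]; simp only [mul_assoc, one_mul]
      _ = _ := by rw [← hcb]; simp only [mul_assoc]
  · intro g h hgh
    have h1 : (b : Mt(n) ℂ) * r g * c = b * r h * c := congrArg Subtype.val hgh
    have h2 : c * ((b : Mt(n) ℂ) * r g * c) * b = c * (b * r h * c) * b := by rw [h1]
    have h3 : ∀ X : Mt(n) ℂ, c * ((b : Mt(n) ℂ) * X * c) * b = X := by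
      intro X
      calc _ = (c * b) * X * (c * b) := by simp only [mul_assoc]
        _ = X := by rw [hcb, one_mul, mul_one]
    rw [h3, h3] at h2
    exact hinj (Subtype.ext h2)

/-- Frobenius' lemma: elements of a finite unitary group close to `1` commute. -/
lemma small_commute {A : Type*} [NormedRing A] [NormedAlgebra ℝ A] [StarRing A] [CStarRing A]
    {G : Type*} [Group G] [Finite G] (τ : G →* unitary A) (hinj : Function.Injective τ)
    (x y : G) (hx : ‖(τ x : A) - 1‖ < 1/2) (hy : ‖(τ y : A) - 1‖ < 1/2) : x * y = y * x := by
  classical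
  by_contra hne
  let T : Set G := {a | ‖(τ a : A) - 1‖ < 1/2 ∧ ∃ b, ‖(τ b : A) - 1‖ < 1/2 ∧ a * b ≠ b * a}
  obtain ⟨a, ⟨ha, b, hb, hab⟩, hmin⟩ := Set.exists_min_image T (fun a => ‖(τ a : A) - 1‖) (Set.toFinite T) ⟨x, hx, y, hy, hne⟩
  clear hx hy hne x y
  let t : G → A := fun g => (τ g : A)
  have tm : ∀ g h, t (g * h) = t g * t h := by intro g h; simp [t]
  have t1 : t 1 = 1 := by simp [t]
  have tp : ∀ g (k : ℕ), t (g ^ k) = t g ^ k := by intro g k; simp [t]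
  have tinj : ∀ g h, t g = t h → g = h := fun g h e => hinj (Subtype.ext e)
  have tl : ∀ g (X : A), ‖t g * X‖ = ‖X‖ := fun g X => CStarRing.norm_coe_unitary_mul (τ g) X
  have tr : ∀ g (X : A), ‖X * t g‖ = ‖X‖ := fun g X => CStarRing.norm_mul_coe_unitary X (τ g)
  let z := a * b * a⁻¹ * b⁻¹
  have hzba : z * (b * a) = a * b := by simp only [z]; group
  have hapos : 0 < ‖t a - 1‖ := by
    rw [norm_pos_iff, sub_ne_zero]
    intro h
    have := tinj a 1 (h.trans t1.symm)
    apply hab; rw [this]; group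
  have hz : ‖t z - 1‖ < ‖t a - 1‖ := by
    have h1 : ‖t z - 1‖ = ‖t a * t b - t b * t a‖ := by
      rw [← tr (b * a) (t z - 1), sub_mul, ← tm, hzba, one_mul, tm, tm]
    have h2 : t a * t b - t b * t a = (t a - 1) * (t b - 1) - (t b - 1) * (t a - 1) := by noncomm_ring
    rw [h1, h2]
    have hb' : ‖t b - 1‖ < 1/2 := hb
    calc _ ≤ ‖(t a - 1) * (t b - 1)‖ + ‖(t b - 1) * (t a - 1)‖ := norm_sub_le _ _
      _ ≤ ‖t a - 1‖ * ‖t b - 1‖ + ‖t b - 1‖ * ‖t a - 1‖ := add_le_add (norm_mul_le _ _) (norm_mul_le _ _)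
      _ < ‖t a - 1‖ := by nlinarith
  have hzc : ∀ c, ‖t c - 1‖ < 1/2 → z * c = c * z := by
    intro c hc
    by_contra h
    exact absurd (hmin z ⟨hz.trans ha, c, hc, h⟩) (not_le.2 hz)
  have hza := hzc a ha
  have hzb := hzc b hb
  have haba : ∀ j : ℕ, a ^ j * b = z ^ j * b * a ^ j := by
    intro j
    induction j with
    | zero => simp
    | succ j ih =>
      have hzj : z ^ j * a = a * z ^ j := (Commute.pow_left hza j)
      have hazba : a * b = z * b * a := by rw [mul_assoc, hzba]
      calc a ^ (j+1) * b = a * (a ^ j * b) := by rw [pow_succ']; group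
        _ = (a * z ^ j) * b * a ^ j := by rw [ih]; group
        _ = z ^ j * (a * b) * a ^ j := by rw [← hzj]; group
        _ = z ^ (j+1) * b * a ^ (j+1) := by rw [hazba, pow_succ, pow_succ']; group
  let m := Nat.card G
  have hm : 0 < m := Nat.card_pos
  have hzm : z ^ m = 1 := pow_card_eq_one'
  let P : A := ∑ j ∈ Finset.range m, t z ^ j
  have hzP : t z * P = P := by
    have h1 : t z * P - P = (t z - 1) * P := by noncomm_ring
    have h2 := mul_geom_sum (t z) m
    rw [← tp, hzm, t1, sub_self] at h2
    rw [← sub_eq_zero, h1]; exact h2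
  have hzjP : ∀ j : ℕ, t z ^ j * P = P := by
    intro j
    induction j with
    | zero => simp
    | succ j ih => rw [pow_succ, mul_assoc, hzP, ih]
  have hPP : P * P = (m : A) * P := by
    conv_lhs => rw [show P * P = (∑ j ∈ Finset.range m, t z ^ j) * P from rfl, Finset.sum_mul]
    rw [Finset.sum_congr rfl (fun j _ => hzjP j)]
    simp
  have hPb : P * t b = t b * P := by
    simp only [P, Finset.sum_mul, Finset.mul_sum]
    refine Finset.sum_congr rfl (fun j _ => ?_)
    rw [← tp, ← tm, ← tm]
    congr 1
    exact Commute.pow_left hzb j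
  let Q : A := (m : A) - P
  have hPQ : P * Q = 0 := by
    simp only [Q, mul_sub, hPP, (Nat.cast_commute m P).eq, sub_self]
  have key : ∑ j ∈ Finset.range m, t (a^j) * (t b - 1) * t (a^j)⁻¹ * Q = - ((m : A) * Q) := by
    have h1 : ∀ j, t (a^j) * (t b - 1) * t (a^j)⁻¹ = t z ^ j * t b - 1 := by
      intro j
      rw [mul_sub, sub_mul, mul_one, ← tm, ← tm, ← tm, haba, mul_inv_cancel, mul_inv_cancel_right, tm, tp, t1]
    rw [← Finset.sum_mul, Finset.sum_congr rfl (fun j _ => h1 j), Finset.sum_sub_distrib, ← Finset.sum_mul, sub_mul]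
    change P * t b * Q - _ = _
    rw [hPb, mul_assoc, hPQ]
    simp
  have hQ : Q = 0 := by
    by_contra hQ
    have hQp : 0 < ‖Q‖ := norm_pos_iff.2 hQ
    have hmn : ‖(m : A) * Q‖ = m * ‖Q‖ := by
      rw [← nsmul_eq_mul, ← Nat.cast_smul_eq_nsmul ℝ, norm_smul]; simp
    have h2 : ‖(m : A) * Q‖ ≤ m * (‖t b - 1‖ * ‖Q‖) := by
      rw [← norm_neg, ← key]
      refine (norm_sum_le _ _).trans ?_
      refine (Finset.sum_le_sum (g := fun _ => ‖t b - 1‖ * ‖Q‖) (fun j _ => ?_)).trans (by simp)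
      rw [mul_assoc, mul_assoc, tl]
      refine (norm_mul_le _ _).trans ?_
      rw [tl]
    rw [hmn] at h2
    have hm' : (0 : ℝ) < m := by exact_mod_cast hm
    have h3 := le_of_mul_le_mul_left h2 hm'
    have hb' : ‖t b - 1‖ < 1/2 := hb
    nlinarith
  have hz1 : t z = 1 := by
    have h1 : P = (m : A) := (sub_eq_zero.1 hQ).symm
    rw [h1] at hzP
    have h2 : (m : ℝ) • (t z - 1) = 0 := by
      rw [Nat.cast_smul_eq_nsmul, nsmul_eq_mul, (Nat.cast_commute m (t z - 1)).eq, sub_mul, hzP, one_mul, sub_self]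
    rcases smul_eq_zero.1 h2 with h | h
    · exact absurd h (by exact_mod_cast hm.ne')
    · exact sub_eq_zero.1 h
  have hz1' := tinj z 1 (hz1.trans t1.symm)
  rw [hz1', one_mul] at hzba
  exact hab hzba.symm

open scoped Matrix.Norms.L2Operator in
/-- Jordan's theorem for finite unitary groups. -/
theorem jordan_unitary (n : ℕ) : ∃ K : ℕ, ∀ (G : Type) [Group G] [Finite G] (τ : G →* Matrix.unitaryGroup (Fin n) ℂ),
    Function.Injective τ → ∃ A : Subgroup G, (∀ x ∈ A, ∀ y ∈ A, x * y = y * x) ∧ A.index ≤ K := by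
  classical
  haveI : ProperSpace (Mt(n) ℂ) := FiniteDimensional.proper ℂ _
  have hcomp : IsCompact (Metric.closedBall (0 : Mt(n) ℂ) 1) := isCompact_closedBall _ _
  obtain ⟨t, -, htf, htc⟩ := finite_cover_balls_of_compact hcomp (show (0 : ℝ) < 1/4 by norm_num)
  haveI := htf.to_subtype
  refine ⟨Nat.card t, fun G _ _ τ hinj => ?_⟩
  have hsc := fun x y => small_commute τ hinj x y
  let S : Set G := {g | ‖(τ g : Mt(n) ℂ) - 1‖ < 1/2}
  refine ⟨Subgroup.closure S, ?_, ?_⟩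
  · intro x hx y hy
    have hc : ∀ x ∈ S, ∀ y ∈ S, x * y = y * x := fun x hx y hy => hsc x y hx hy
    letI := Subgroup.closureCommGroupOfComm hc
    exact congrArg Subtype.val (mul_comm (⟨x, hx⟩ : Subgroup.closure S) ⟨y, hy⟩)
  · have hb : ∀ g : G, ∃ c : t, (τ g : Mt(n) ℂ) ∈ Metric.ball c.1 (1/4) := by
      intro g
      have h1 : (τ g : Mt(n) ℂ) ∈ Metric.closedBall (0 : Mt(n) ℂ) 1 := by
        rw [mem_closedBall_zero_iff]
        rcases subsingleton_or_nontrivial (Mt(n) ℂ) with h | h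
        · rw [Subsingleton.elim (τ g : Mt(n) ℂ) 0]; simp
        · exact (CStarRing.norm_coe_unitary (τ g)).le
      have h2 := htc h1
      simp only [Set.mem_iUnion] at h2
      obtain ⟨c, hc, h3⟩ := h2
      exact ⟨⟨c, hc⟩, h3⟩
    choose f hf using hb
    refine Nat.card_le_card_of_injective (fun q : G ⧸ Subgroup.closure S => f q.out) ?_
    intro q r hqr
    have hqr' : f q.out = f r.out := hqr
    have h1 := hf q.out
    have h2 := hf r.out
    rw [← hqr'] at h2
    have h3 : dist (τ r.out : Mt(n) ℂ) (τ q.out) < 1/2 := by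
      have := dist_triangle_right (τ r.out : Mt(n) ℂ) (τ q.out) (f q.out).1
      rw [Metric.mem_ball] at h1 h2
      linarith
    have h4 : (q.out)⁻¹ * r.out ∈ S := by
      change ‖_‖ < _
      rw [← CStarRing.norm_coe_unitary_mul (τ q.out)]
      rw [dist_eq_norm] at h3
      have h5 : (τ q.out : Mt(n) ℂ) * ((τ (q.out⁻¹ * r.out) : Mt(n) ℂ) - 1) =
          (τ r.out : Mt(n) ℂ) - τ q.out := by
        rw [mul_sub, mul_one]
        congr 1
        have : τ q.out * τ (q.out⁻¹ * r.out) = τ r.out := by rw [← map_mul, mul_inv_cancel_left]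
        exact congrArg Subtype.val this
      rw [h5]
      exact h3
    rw [← QuotientGroup.out_eq' q, ← QuotientGroup.out_eq' r, QuotientGroup.eq]
    exact Subgroup.subset_closure h4

/-- in a finitely generated group, subgroups of bounded index contain a common finite index subgroup. -/
lemma common_finite_index {H : Type*} [Group H] [Group.FG H] (K : ℕ) :
    ∃ D : Subgroup H, D.FiniteIndex ∧ ∀ B : Subgroup H, B.FiniteIndex → B.index ≤ K → D ≤ B := by
  classical
  obtain ⟨S, hS⟩ := Group.fg_def.1 ‹Group.FG H›
  haveI : Finite (H →* Equiv.Perm (Fin K)) := by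
    refine Finite.of_injective (fun f : H →* Equiv.Perm (Fin K) => fun s : S => f s) ?_
    intro f g hfg
    apply MonoidHom.eq_of_eqOn_dense hS
    intro s hs
    exact congrFun hfg ⟨s, hs⟩
  refine ⟨⨅ f : H →* Equiv.Perm (Fin K), f.ker, ?_, ?_⟩
  · exact Subgroup.finiteIndex_iInf (fun f => inferInstance)
  · intro B hB hBK
    haveI := hB
    haveI : Fintype (H ⧸ B) := Fintype.ofFinite _
    have hc : Fintype.card (H ⧸ B) ≤ Fintype.card (Fin K) := by
      rw [Fintype.card_fin, ← Nat.card_eq_fintype_card]; exact hBK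
    obtain ⟨e⟩ := Function.Embedding.nonempty_of_card_le hc
    let f : H →* Equiv.Perm (Fin K) := (Equiv.Perm.viaEmbeddingHom e).comp (MulAction.toPermHom H (H ⧸ B))
    refine (iInf_le _ f).trans ?_
    refine le_trans ?_ (Subgroup.normalCore_le B)
    rw [Subgroup.normalCore_eq_ker]
    intro x hx
    rw [MonoidHom.mem_ker] at hx ⊢
    exact Equiv.Perm.viaEmbeddingHom_injective e (by rw [map_one]; exact hx)

lemma eq_of_inf_primes {n : ℕ} (P : Set ℕ) (hP : P.Infinite) (x y : SL n ℤ)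
    (h : ∀ p ∈ P, redMod n p x = redMod n p y) : x = y := by
  apply Subtype.ext
  ext a b
  by_contra hne
  have hne' : x.1 a b - y.1 a b ≠ 0 := sub_ne_zero.2 hne
  obtain ⟨p, hp, hlt⟩ := hP.exists_gt (x.1 a b - y.1 a b).natAbs
  have h1 := congrArg (fun M : SL n (ZMod p) => (M : Mt(n) (ZMod p)) a b) (h p hp)
  have h2 : ((x.1 a b : ℤ) : ZMod p) = ((y.1 a b : ℤ) : ZMod p) := h1
  rw [← sub_eq_zero, ← Int.cast_sub, ZMod.intCast_zmod_eq_zero_iff_dvd] at h2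
  have h3 := Int.natAbs_dvd_natAbs.2 h2
  have := Nat.le_of_dvd (Int.natAbs_pos.2 hne') h3
  rw [Int.natAbs_natCast] at this
  omega

/-- if infinitely many congruence images have order prime to `p`, then `H` is virtually abelian. -/
theorem solv_of_coprime {n : ℕ} (H : Subgroup (SL n ℤ)) (hfg : H.FG) (P : Set ℕ) (hP : P.Infinite)
    (hpr : ∀ p ∈ P, p.Prime) (hcop : ∀ p ∈ P, ¬ p ∣ Nat.card (H.map (redMod n p))) : SolvableByFinite H := by
  classical
  haveI : Group.FG H := (Group.fg_iff_subgroup_fg H).2 hfg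
  obtain ⟨K, hK⟩ := jordan_unitary n
  obtain ⟨D, hDf, hD⟩ := common_finite_index (H := H) K
  have hDc : ∀ x ∈ D, ∀ y ∈ D, x * y = y * x := by
    intro x hx y hy
    apply Subtype.ext
    refine eq_of_inf_primes P hP _ _ (fun p hp => ?_)
    haveI : Fact p.Prime := ⟨hpr p hp⟩
    obtain ⟨s, hs⟩ := to_complex n p H (hcop p hp)
    haveI : Finite (SL n (ZMod p)) := inferInstance
    haveI : Fintype (H.map (redMod n p)) := Fintype.ofFinite _
    obtain ⟨τ, hτ⟩ := unitarize s hs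
    obtain ⟨A, hA, hAi⟩ := hK _ τ hτ
    let f : H →* (H.map (redMod n p)) := (redMod n p).subgroupMap H
    have hf : Function.Surjective f := (redMod n p).subgroupMap_surjective H
    have hind : (A.comap f).index = A.index := Subgroup.index_comap_of_surjective A hf
    have hfi : (A.comap f).FiniteIndex := ⟨by rw [hind]; exact Subgroup.FiniteIndex.index_ne_zero⟩
    have hle := hD _ hfi (by rw [hind]; exact hAi)
    have := hA _ (hle hx) _ (hle hy)
    rw [← map_mul, ← map_mul] at this
    exact congrArg Subtype.val this
  refine ⟨D, ?_, hDf⟩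
  exact Group.isSolvable_of_comm (fun a b => Subtype.ext (hDc a.1 a.2 b.1 b.2))

end PJ

end

section
open Module

namespace PU

/-- the commutant of an irreducible non-solvable group of prime degree is trivial. -/
theorem commutant_scalar {n : ℕ} (hn : n.Prime) (H : Subgroup (SL n ℤ)) (hirr : IrreducibleQ H)
    (hns : ¬ Group.IsSolvable H) (D : Module.End ℚ (Fin n → ℚ)) (hD : ∀ h : H, D * rhoH H h = rhoH H h * D) :
    ∃ c : ℚ, D = algebraMap ℚ _ c := by
  classical
  have hirr' := (irrQ_iff H).1 hirr
  haveI : NeZero n := ⟨hn.ne_zero⟩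
  let C : Subalgebra ℚ (Module.End ℚ (Fin n → ℚ)) := Algebra.adjoin ℚ {D}
  have hCH : ∀ x ∈ C, ∀ h : H, x * rhoH H h = rhoH H h * x := by
    intro x hx h
    induction hx using Algebra.adjoin_induction with
    | mem x hx => rw [Set.mem_singleton_iff] at hx; subst hx; exact hD h
    | algebraMap r => exact Algebra.commutes r _
    | add x y _ _ hx hy => rw [add_mul, mul_add, hx, hy]
    | mul x y _ _ hx hy => rw [mul_assoc, hy, ← mul_assoc, hx, mul_assoc]
  have hCC : ∀ x ∈ C, ∀ y ∈ C, x * y = y * x := by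
    have h1 : ∀ x ∈ C, x * D = D * x := by
      intro x hx
      induction hx using Algebra.adjoin_induction with
      | mem x hx => rw [Set.mem_singleton_iff] at hx; subst hx; rfl
      | algebraMap r => exact Algebra.commutes r _
      | add x y _ _ hx hy => rw [add_mul, mul_add, hx, hy]
      | mul x y _ _ hx hy => rw [mul_assoc, hy, ← mul_assoc, hx, mul_assoc]
    intro x hx y hy
    induction hy using Algebra.adjoin_induction with
    | mem y hy => rw [Set.mem_singleton_iff] at hy; subst hy; exact h1 x hx
    | algebraMap r => exact (Algebra.commutes r x).symm
    | add y z _ _ hy hz => rw [add_mul, mul_add, hy, hz]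
    | mul y z _ _ hy hz => rw [← mul_assoc, hy, mul_assoc, hz, mul_assoc]
  have hinj : ∀ x ∈ C, x ≠ 0 → ∀ v, x v = 0 → v = 0 := by
    intro x hx hx0 v hv
    rcases hirr' (LinearMap.ker x) (fun h w hw => by
      rw [LinearMap.mem_ker] at hw ⊢
      have := congrArg (fun T : Module.End ℚ (Fin n → ℚ) => T w) (hCH x hx h)
      simp only [Module.End.mul_apply] at this
      rw [this, hw, map_zero]) with h | h
    · have : v ∈ LinearMap.ker x := hv
      rw [h] at this; exact this
    · exact absurd (LinearMap.ker_eq_top.1 h) hx0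
  haveI : NoZeroDivisors C := ⟨by
    intro a b hab
    by_contra hcon
    push Not at hcon
    apply hcon.2
    apply Subtype.ext
    apply LinearMap.ext
    intro v
    apply hinj a.1 a.2 (fun h => hcon.1 (Subtype.ext h))
    exact congrArg (fun T : C => T.1 v) hab⟩
  haveI : IsDomain C := NoZeroDivisors.to_isDomain C
  letI : DivisionRing C := divisionRingOfFiniteDimensional ℚ C
  have hmul : finrank ℚ C * finrank C (Fin n → ℚ) = finrank ℚ (Fin n → ℚ) := Module.finrank_mul_finrank ℚ C (Fin n → ℚ)
  rw [Module.finrank_fin_fun] at hmul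
  rcases (Nat.dvd_prime hn).1 (Dvd.intro _ hmul) with h1 | h1
  · have hbt : C = ⊥ := Subalgebra.finrank_eq_one_iff.1 h1
    have hDC : D ∈ C := Algebra.subset_adjoin rfl
    rw [hbt, Algebra.mem_bot] at hDC
    obtain ⟨c, hc⟩ := hDC
    exact ⟨c, hc.symm⟩
  · exfalso
    apply hns
    let v : Fin n → ℚ := fun _ => 1
    have hv : v ≠ 0 := fun h => one_ne_zero (congrFun h 0)
    let ev : C →ₗ[ℚ] (Fin n → ℚ) := (LinearMap.applyₗ v).comp C.val.toLinearMap
    have hevi : Function.Injective ev := by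
      rw [← LinearMap.ker_eq_bot, LinearMap.ker_eq_bot']
      intro x hx
      by_contra hx0
      exact hv (hinj x.1 x.2 (fun h => hx0 (Subtype.ext h)) v hx)
    have hevs : Function.Surjective ev :=
      (LinearMap.injective_iff_surjective_of_finrank_eq_finrank (by rw [h1, Module.finrank_fin_fun])).1 hevi
    have hHC : ∀ h : H, rhoH H h ∈ C := by
      intro h
      obtain ⟨c, hc⟩ := hevs (rhoH H h v)
      have : rhoH H h = c.1 := by
        apply LinearMap.ext
        intro w
        obtain ⟨d, rfl⟩ := hevs w
        have e1 := congrArg (fun T : Module.End ℚ (Fin n → ℚ) => T v) (hCH d.1 d.2 h)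
        have e2 := congrArg (fun T : Module.End ℚ (Fin n → ℚ) => T v) (hCC d.1 d.2 c.1 c.2)
        simp only [Module.End.mul_apply] at e1 e2
        have hc' : c.1 v = rhoH H h v := hc
        change rhoH H h (d.1 v) = c.1 (d.1 v)
        rw [← e1, ← e2, hc']
      rw [this]; exact c.2
    refine Group.isSolvable_of_comm (fun a b => rhoH_inj H ?_)
    rw [map_mul, map_mul]
    exact hCC _ (hHC a) _ (hHC b)

/-- Burnside type theorem: the enveloping algebra is the full endomorphism algebra. -/
theorem adjoin_top {n : ℕ} (hn : n.Prime) (H : Subgroup (SL n ℤ)) (hirr : IrreducibleQ H)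
    (hns : ¬ Group.IsSolvable H) : Algebra.adjoin ℚ (Set.range (rhoH H)) = ⊤ := by
  classical
  haveI : NeZero n := ⟨hn.ne_zero⟩
  have hirr' := (irrQ_iff H).1 hirr
  let A := Algebra.adjoin ℚ (Set.range (rhoH H))
  have hA : ∀ h, rhoH H h ∈ A := fun h => Algebra.subset_adjoin ⟨h, rfl⟩
  haveI : IsSimpleModule A (Fin n → ℚ) := by
    rw [isSimpleModule_iff]
    refine { exists_pair_ne := ⟨⊥, ⊤, bot_ne_top⟩, eq_bot_or_eq_top := ?_ }
    intro Y
    rcases hirr' (Y.restrictScalars ℚ) (fun h v hv => Y.smul_mem (⟨rhoH H h, hA h⟩ : A) hv) with h | h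
    · left
      rw [Submodule.restrictScalars_eq_bot_iff] at h; exact h
    · right
      rw [Submodule.restrictScalars_eq_top_iff] at h; exact h
  rw [eq_top_iff]
  intro T _
  have hsc : ∀ D : Module.End A (Fin n → ℚ), ∃ c : ℚ, ∀ v, D v = c • v := by
    intro D
    obtain ⟨c, hc⟩ := commutant_scalar hn H hirr hns (D.restrictScalars ℚ) (fun h => by
      apply LinearMap.ext
      intro v
      exact D.map_smul (⟨rhoH H h, hA h⟩ : A) v)
    exact ⟨c, fun v => congrArg (fun T : Module.End ℚ (Fin n → ℚ) => T v) hc⟩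
  let f : Module.End (Module.End A (Fin n → ℚ)) (Fin n → ℚ) :=
    { toFun := T, map_add' := T.map_add, map_smul' := by
        intro D v
        obtain ⟨c, hc⟩ := hsc D
        change T (D v) = D (T v)
        rw [hc, hc, T.map_smul] }
  obtain ⟨r, hr⟩ := jacobson_density (R := A) (M := Fin n → ℚ) f (Finset.univ.image (Pi.basisFun ℚ (Fin n)))
  have : T = r.1 := by
    apply (Pi.basisFun ℚ (Fin n)).ext
    intro i
    exact hr _ (Finset.mem_image_of_mem _ (Finset.mem_univ i))
  rw [this]; exact r.2

/-- the matrix of `g` over a commutative ring. -/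
def matF (K : Type*) [CommRing K] {n : ℕ} (g : SL n ℤ) : Mt(n) K :=
  (g : Mt(n) ℤ).map (Int.castRingHom K)

theorem matF_mul (K : Type*) [CommRing K] {n : ℕ} (g h : SL n ℤ) : matF K (g * h) = matF K g * matF K h := by
  simp only [matF, Matrix.SpecialLinearGroup.coe_mul]
  exact Matrix.map_mul (f := Int.castRingHom K)

theorem matF_one (K : Type*) [CommRing K] {n : ℕ} : matF K (1 : SL n ℤ) = 1 := by simp [matF]

theorem matF_det (K : Type*) [CommRing K] {n : ℕ} (g : SL n ℤ) : (matF K g).det = 1 := by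
  have := RingHom.map_det (Int.castRingHom K) (g : Mt(n) ℤ)
  rw [Matrix.SpecialLinearGroup.det_coe, map_one] at this
  exact this.symm

theorem matF_mul_inv (K : Type*) [CommRing K] {n : ℕ} (g : SL n ℤ) : matF K g * matF K g⁻¹ = 1 := by
  rw [← matF_mul, mul_inv_cancel, matF_one]

theorem matF_inv_mul (K : Type*) [CommRing K] {n : ℕ} (g : SL n ℤ) : matF K g⁻¹ * matF K g = 1 := by
  rw [← matF_mul, inv_mul_cancel, matF_one]

theorem matF_matQ (K : Type*) [Field K] [CharZero K] {n : ℕ} (g : SL n ℤ) :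
    matF K g = (matQ g).map (algebraMap ℚ K) := by
  ext i j
  simp [matF, matQ]

/-- the action on `K^n`. -/
def rhoF (K : Type*) [Field K] {n : ℕ} (H : Subgroup (SL n ℤ)) : H →* Module.End K (Fin n → K) where
  toFun h := Matrix.toLin' (matF K h.1)
  map_one' := by
    change Matrix.toLin' (matF K (1 : SL n ℤ)) = 1
    rw [matF_one]; exact Matrix.toLin'_one
  map_mul' a b := by
    change Matrix.toLin' (matF K (a.1 * b.1)) = _
    rw [matF_mul]; exact Matrix.toLin'_mul _ _

theorem abs_irr {n : ℕ} (hn : n.Prime) (H : Subgroup (SL n ℤ)) (hirr : IrreducibleQ H)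
    (hns : ¬ Group.IsSolvable H) (K : Type*) [Field K] [CharZero K] (Y : Submodule K (Fin n → K))
    (hY : ∀ h ∈ H, ∀ v ∈ Y, matF K h *ᵥ v ∈ Y) : Y = ⊥ ∨ Y = ⊤ := by
  classical
  have hall : ∀ T : Module.End ℚ (Fin n → ℚ), ∀ v ∈ Y, ((LinearMap.toMatrix' T).map (algebraMap ℚ K)) *ᵥ v ∈ Y := by
    intro T
    have hT : T ∈ Algebra.adjoin ℚ (Set.range (rhoH H)) := by rw [adjoin_top hn H hirr hns]; trivial
    induction hT using Algebra.adjoin_induction with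
    | mem x hx =>
      obtain ⟨h, rfl⟩ := hx
      intro v hv
      rw [rhoH_apply, LinearMap.toMatrix'_toLin', ← matF_matQ]
      exact hY h.1 h.2 v hv
    | algebraMap r =>
      intro v hv
      have : (LinearMap.toMatrix' (algebraMap ℚ (Module.End ℚ (Fin n → ℚ)) r)).map (algebraMap ℚ K) = algebraMap ℚ K r • (1 : Mt(n) K) := by
        rw [Module.algebraMap_end_eq_smul_id, map_smul, LinearMap.toMatrix'_id]
        ext i j
        by_cases h : i = j
        · subst h; simp
        · simp [Matrix.one_apply_ne h]
      rw [this, Matrix.smul_mulVec, Matrix.one_mulVec]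
      exact Y.smul_mem _ hv
    | add x y _ _ hx hy =>
      intro v hv
      rw [map_add, Matrix.map_add _ (fun a b => map_add _ a b), Matrix.add_mulVec]
      exact Y.add_mem (hx v hv) (hy v hv)
    | mul x y _ _ hx hy =>
      intro v hv
      rw [LinearMap.toMatrix'_mul, Matrix.map_mul, ← Matrix.mulVec_mulVec]
      exact hx _ (hy v hv)
  by_cases hb : Y = ⊥
  · exact Or.inl hb
  right
  obtain ⟨y, hy, hy0⟩ := Submodule.exists_mem_ne_zero_of_ne_bot hb
  obtain ⟨j, hj⟩ := Function.ne_iff.1 hy0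
  have he : ∀ i, Pi.single i (1 : K) ∈ Y := by
    intro i
    have h1 := hall (Matrix.toLin' (Matrix.single i j (1:ℚ))) y hy
    rw [LinearMap.toMatrix'_toLin', Matrix.map_single, map_one] at h1
    have h2 : Matrix.single i j (1:K) *ᵥ y = y j • Pi.single i (1:K) := by
      ext k
      by_cases hk : k = i
      · subst hk; simp [Matrix.mulVec, dotProduct, Matrix.single_apply]
      · simp [Matrix.mulVec, dotProduct, Matrix.single_apply, hk, Ne.symm hk]
    rw [h2] at h1
    have h3 := Y.smul_mem (y j)⁻¹ h1
    rwa [smul_smul, inv_mul_cancel₀ hj, one_smul] at h3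
  rw [eq_top_iff]
  intro v _
  rw [pi_eq_sum_univ v]
  refine Y.sum_mem (fun i _ => Y.smul_mem _ ?_)
  convert he i using 1
  ext k
  simp [Pi.single_apply, eq_comm]

lemma ns_of {n : ℕ} {H : Subgroup (SL n ℤ)} (hns : ¬ SolvableByFinite H) : ¬ Group.IsSolvable H := by
  intro h
  exact hns ⟨⊤, Group.isSolvable_of_surjective (f := (Subgroup.topEquiv (G := H)).symm.toMonoidHom) (Subgroup.topEquiv (G := H)).symm.surjective, inferInstance⟩

lemma schur {K : Type*} [Field K] [IsAlgClosed K] {n : ℕ} [NeZero n] (X : Set (Mt(n) K))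
    (hX : ∀ Y : Submodule K (Fin n → K), (∀ x ∈ X, ∀ v ∈ Y, x *ᵥ v ∈ Y) → Y = ⊥ ∨ Y = ⊤)
    (D : Mt(n) K) (hD : ∀ x ∈ X, D * x = x * D) : ∃ μ : K, D = μ • (1 : Mt(n) K) := by
  obtain ⟨μ, hμ⟩ := Module.End.exists_eigenvalue (Matrix.toLin' D)
  refine ⟨μ, ?_⟩
  rcases hX (Module.End.eigenspace (Matrix.toLin' D) μ) (fun x hx v hv => by
    rw [Module.End.mem_eigenspace_iff, Matrix.toLin'_apply] at hv ⊢
    rw [Matrix.mulVec_mulVec, hD x hx, ← Matrix.mulVec_mulVec, hv, Matrix.mulVec_smul]) with h | h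
  · exact absurd h hμ
  · apply Matrix.toLin'.injective
    apply LinearMap.ext
    intro v
    have : v ∈ Module.End.eigenspace (Matrix.toLin' D) μ := by rw [h]; trivial
    rw [Module.End.mem_eigenspace_iff] at this
    rw [this, map_smul, Matrix.toLin'_one]; rfl

/-- nonzero stable forms are invertible. -/
lemma form_unit {K : Type*} [Field K] {n : ℕ} (X : Set (Mt(n) K))
    (hX : ∀ Y : Submodule K (Fin n → K), (∀ x ∈ X, ∀ v ∈ Y, x *ᵥ v ∈ Y) → Y = ⊥ ∨ Y = ⊤)
    (B : Mt(n) K) (hB0 : B ≠ 0) (hB : ∀ x ∈ X, ∃ y, B * x = y * B) : IsUnit B.det := by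
  rcases hX (LinearMap.ker (Matrix.toLin' B)) (fun x hx v hv => by
    rw [LinearMap.mem_ker, Matrix.toLin'_apply] at hv ⊢
    obtain ⟨y, hy⟩ := hB x hx
    rw [Matrix.mulVec_mulVec, hy, ← Matrix.mulVec_mulVec, hv, Matrix.mulVec_zero]) with h | h
  · rw [isUnit_iff_ne_zero]
    intro h0
    obtain ⟨v, hv, hv0⟩ := Matrix.exists_mulVec_eq_zero_iff.2 h0
    have : v ∈ LinearMap.ker (Matrix.toLin' B) := by rw [LinearMap.mem_ker, Matrix.toLin'_apply, hv0]
    rw [h] at this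
    exact hv this
  · exfalso
    apply hB0
    apply Matrix.toLin'.injective
    rw [map_zero]; exact LinearMap.ker_eq_top.1 h

/-- uniqueness of forms. -/
lemma form_unique {K : Type*} [Field K] [IsAlgClosed K] {n : ℕ} [NeZero n] (X : Set (Mt(n) K))
    (hX : ∀ Y : Submodule K (Fin n → K), (∀ x ∈ X, ∀ v ∈ Y, x *ᵥ v ∈ Y) → Y = ⊥ ∨ Y = ⊤)
    (B C : Mt(n) K) (hBu : IsUnit B.det) (hBC : ∀ x ∈ X, ∃ y, B * x = y * B ∧ C * x = y * C) :
    ∃ μ : K, C = μ • B := by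
  have h1 : B⁻¹ * B = 1 := Matrix.nonsing_inv_mul _ hBu
  have h2 : B * B⁻¹ = 1 := Matrix.mul_nonsing_inv _ hBu
  obtain ⟨μ, hμ⟩ := schur X hX (B⁻¹ * C) (fun x hx => by
    obtain ⟨y, hy1, hy2⟩ := hBC x hx
    have h3 : B⁻¹ * y = x * B⁻¹ := by
      calc B⁻¹ * y = B⁻¹ * (y * B) * B⁻¹ := by rw [mul_assoc, mul_assoc, h2, mul_one]
        _ = x * B⁻¹ := by rw [← hy1, ← mul_assoc, h1, one_mul]
    rw [mul_assoc, hy2, ← mul_assoc, h3, mul_assoc])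
  refine ⟨μ, ?_⟩
  calc C = B * (B⁻¹ * C) := by rw [← mul_assoc, h2, one_mul]
    _ = μ • B := by rw [hμ, Matrix.mul_smul, mul_one]

lemma Hset_irr {n : ℕ} (hn : n.Prime) (H : Subgroup (SL n ℤ)) (hirr : IrreducibleQ H)
    (hns : ¬ SolvableByFinite H) (K : Type*) [Field K] [CharZero K] (H1 : Subgroup H) [hN : H1.Normal] [H1.FiniteIndex]
    (Y : Submodule K (Fin n → K)) (hY : ∀ x ∈ (fun h : H => matF K h.1) '' (H1 : Set H), ∀ v ∈ Y, x *ᵥ v ∈ Y) :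
    Y = ⊥ ∨ Y = ⊤ := by
  classical
  have habs := abs_irr hn H hirr (ns_of hns) K
  have hfr : (finrank K (Fin n → K)).Prime := by rw [Module.finrank_fin_fun]; exact hn
  have hconj : ∀ g : H, ∀ x ∈ H1, ∃ y ∈ H1, matF K x.1 * matF K g.1 = matF K g.1 * matF K y.1 := by
    intro g x hx
    refine ⟨g⁻¹ * x * g, by simpa using hN.conj_mem x hx g⁻¹, ?_⟩
    rw [← matF_mul, ← matF_mul]
    congr 1
    simp [mul_assoc]
  rcases clifford_prime (rhoF K H) ((fun h : H => rhoF K H h) '' (H1 : Set H)) (by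
      rintro g _ ⟨x, hx, rfl⟩
      obtain ⟨y, hy, hxy⟩ := hconj g x hx
      refine ⟨_, ⟨y, hy, rfl⟩, ?_⟩
      have := congrArg Matrix.toLin' hxy
      rw [Matrix.toLin'_mul, Matrix.toLin'_mul] at this
      exact this) (fun Z hZ => habs Z (fun h hh v hv => hZ ⟨h, hh⟩ v hv)) hfr with ⟨v, hv0, hv⟩ | h
  · exfalso
    apply hns
    refine ⟨H1, ?_, inferInstance⟩
    let Z : Submodule K (Fin n → K) :=
      { carrier := {w | ∀ x ∈ H1, ∀ y ∈ H1, matF K (x.1 * y.1) *ᵥ w = matF K (y.1 * x.1) *ᵥ w}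
        add_mem' := by
          intro a b ha hb x hx y hy
          rw [Matrix.mulVec_add, Matrix.mulVec_add, ha x hx y hy, hb x hx y hy]
        zero_mem' := by intro x hx y hy; simp
        smul_mem' := by
          intro c a ha x hx y hy
          rw [Matrix.mulVec_smul, Matrix.mulVec_smul, ha x hx y hy] }
    have hZv : v ∈ Z := by
      intro x hx y hy
      obtain ⟨c, hc⟩ := hv _ ⟨x, hx, rfl⟩
      obtain ⟨d, hd⟩ := hv _ ⟨y, hy, rfl⟩
      have hc' : matF K x.1 *ᵥ v = c • v := hc
      have hd' : matF K y.1 *ᵥ v = d • v := hd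
      rw [matF_mul, matF_mul, ← Matrix.mulVec_mulVec, ← Matrix.mulVec_mulVec, hc', hd', Matrix.mulVec_smul, Matrix.mulVec_smul, hc', hd', smul_smul, smul_smul, mul_comm]
    rcases habs Z (fun h hh w hw x hx y hy => by
      obtain ⟨x', hx', hxx⟩ := hconj ⟨h, hh⟩ x hx
      obtain ⟨y', hy', hyy⟩ := hconj ⟨h, hh⟩ y hy
      have hxx' : matF K x.1 * matF K h = matF K h * matF K x'.1 := hxx
      have hyy' : matF K y.1 * matF K h = matF K h * matF K y'.1 := hyy
      have k1 : matF K (x.1 * y.1) * matF K h = matF K h * matF K (x'.1 * y'.1) := by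
        rw [matF_mul, matF_mul, mul_assoc, hyy', ← mul_assoc, hxx', mul_assoc]
      have k2 : matF K (y.1 * x.1) * matF K h = matF K h * matF K (y'.1 * x'.1) := by
        rw [matF_mul, matF_mul, mul_assoc, hxx', ← mul_assoc, hyy', mul_assoc]
      rw [Matrix.mulVec_mulVec, Matrix.mulVec_mulVec, k1, k2,
        ← Matrix.mulVec_mulVec, ← Matrix.mulVec_mulVec, hw x' hx' y' hy']) with h | h
    · rw [h] at hZv; exact absurd hZv hv0
    · refine Group.isSolvable_of_comm (fun a b => ?_)
      apply Subtype.ext; apply Subtype.ext; apply Subtype.ext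
      have hab : matF K (a.1.1 * b.1.1) = matF K (b.1.1 * a.1.1) := by
        apply Matrix.toLin'.injective
        apply LinearMap.ext
        intro w
        have : w ∈ Z := by rw [h]; trivial
        exact this a.1 a.2 b.1 b.2
      ext i j
      have h3 := congrFun (congrFun hab i) j
      exact (Int.cast_injective (α := K)) h3
  · refine h Y ?_
    rintro _ ⟨x, hx, rfl⟩ v hv
    exact hY _ ⟨x, hx, rfl⟩ v hv

/-- rational descent of the invariant form. -/
theorem descent {n : ℕ} (hn : n.Prime) (hodd : Odd n) (H : Subgroup (SL n ℤ)) (hirr : IrreducibleQ H)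
    (hns : ¬ SolvableByFinite H) (K : Type*) [Field K] [CharZero K] [IsAlgClosed K]
    (B : Mt(n) K) (hBu : IsUnit B.det)
    (hB : ∀ h ∈ H, ∃ μ : K, (matF K h)ᵀ * B * matF K h = μ • B) : IsometryGroupQ H := by
  classical
  haveI : NeZero n := ⟨hn.ne_zero⟩
  have hB0 : B ≠ 0 := by
    rintro rfl
    rw [Matrix.det_zero] at hBu
    exact not_isUnit_zero hBu
  choose! μ hμ using hB
  have hinj : ∀ a b : K, a • B = b • B → a = b := fun a b h => smul_left_injective K hB0 h
  have hμn : ∀ h ∈ H, μ h ^ n = 1 := by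
    intro h hh
    have := congrArg Matrix.det (hμ h hh)
    rw [Matrix.det_mul, Matrix.det_mul, Matrix.det_transpose, matF_det, one_mul, mul_one, Matrix.det_smul, Fintype.card_fin] at this
    exact (mul_right_cancel₀ hBu.ne_zero ((one_mul _).trans this)).symm
  have hμ1 : μ 1 = 1 := by
    apply hinj
    rw [← hμ 1 H.one_mem, matF_one]; simp
  have hμm : ∀ g ∈ H, ∀ h ∈ H, μ (g * h) = μ g * μ h := by
    intro g hg h hh
    apply hinj
    rw [← hμ _ (H.mul_mem hg hh), matF_mul, Matrix.transpose_mul]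
    calc (matF K h)ᵀ * (matF K g)ᵀ * B * (matF K g * matF K h)
        = (matF K h)ᵀ * ((matF K g)ᵀ * B * matF K g) * matF K h := by simp only [mul_assoc]
      _ = _ := by rw [hμ g hg, Matrix.mul_smul, Matrix.smul_mul, hμ h hh, smul_smul]
  let χ : H →* rootsOfUnity n K :=
    { toFun := fun h => rootsOfUnity.mkOfPowEq (μ h.1) (hμn h.1 h.2)
      map_one' := by
        apply Subtype.ext; apply Units.ext
        exact hμ1
      map_mul' := by
        intro a b
        apply Subtype.ext; apply Units.ext
        exact hμm a.1 a.2 b.1 b.2 }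
  let H1 : Subgroup H := χ.ker
  haveI : Finite χ.range := inferInstance
  haveI : H1.FiniteIndex := Subgroup.finiteIndex_ker χ
  have hH1 : ∀ h ∈ H1, (matF K h.1)ᵀ * B * matF K h.1 = B := by
    intro h hh
    have h1 : χ h = 1 := hh
    have h2 : μ h.1 = 1 := congrArg (fun z : rootsOfUnity n K => ((z : Kˣ) : K)) h1
    rw [hμ h.1 h.2, h2, one_smul]
  obtain ⟨a, b, hab⟩ : ∃ a b, B a b ≠ 0 := by
    by_contra hcon
    push Not at hcon
    exact hB0 (Matrix.ext hcon)
  obtain ⟨l, hl⟩ : ∃ l : K →ₗ[ℚ] ℚ, l (B a b) ≠ 0 := by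
    by_contra hcon
    push Not at hcon
    exact hab ((Module.forall_dual_apply_eq_zero_iff ℚ _).1 hcon)
  let Ψ : Mt(n) ℚ := Matrix.of fun i j => l (B i j)
  have hlin : ∀ (M : Mt(n) K) (h : SL n ℤ),
      (Matrix.of fun i j => l (((matF K h)ᵀ * M * matF K h) i j)) = (matQ h)ᵀ * (Matrix.of fun i j => l (M i j)) * matQ h := by
    intro M h
    ext i j
    simp only [Matrix.of_apply, Matrix.mul_apply, Finset.sum_mul, map_sum, Matrix.transpose_apply]
    refine Finset.sum_congr rfl (fun c _ => Finset.sum_congr rfl (fun d _ => ?_))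
    have : matF K h d i * M d c * matF K h c j = (matQ h d i * matQ h c j) • M d c := by
      rw [matF_matQ, Algebra.smul_def, map_mul, Matrix.map_apply, Matrix.map_apply]; ring
    rw [this, map_smul, smul_eq_mul]; ring
  have hΨ1 : ∀ h ∈ H1, (matQ h.1)ᵀ * Ψ * matQ h.1 = Ψ := by
    intro h hh
    rw [← hlin B h.1, hH1 h hh]
  let ΨK := Ψ.map (algebraMap ℚ K)
  have hmapK : ∀ h : SL n ℤ, (matF K h)ᵀ * ΨK * matF K h = ((matQ h)ᵀ * Ψ * matQ h).map (algebraMap ℚ K) := by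
    intro h
    rw [Matrix.map_mul, Matrix.map_mul, Matrix.transpose_map, ← matF_matQ]
  obtain ⟨c, hc⟩ : ∃ c : K, ΨK = c • B := by
    refine form_unique ((fun h : H => matF K h.1) '' (H1 : Set H)) (fun Y hY => Hset_irr hn H hirr hns K H1 Y hY) B ΨK hBu ?_
    rintro _ ⟨h, hh, rfl⟩
    have hgen : ∀ M : Mt(n) K, (matF K h.1)ᵀ * M * matF K h.1 = M →
        M * matF K h.1 = (matF K (h.1)⁻¹)ᵀ * M := by
      intro M hM
      have h1 : (matF K (h.1)⁻¹)ᵀ * (matF K h.1)ᵀ = 1 := by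
        rw [← Matrix.transpose_mul, matF_mul_inv, Matrix.transpose_one]
      calc M * matF K h.1 = ((matF K (h.1)⁻¹)ᵀ * (matF K h.1)ᵀ) * (M * matF K h.1) := by rw [h1, one_mul]
        _ = (matF K (h.1)⁻¹)ᵀ * ((matF K h.1)ᵀ * M * matF K h.1) := by simp only [mul_assoc]
        _ = _ := by rw [hM]
    refine ⟨_, hgen B (hH1 h hh), hgen ΨK ?_⟩
    rw [hmapK, hΨ1 h hh]
  have hΨab : Ψ a b ≠ 0 := hl
  have hc0 : c ≠ 0 := by
    rintro rfl
    have h1 := congrFun (congrFun hc a) b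
    rw [zero_smul] at h1
    have h2 : algebraMap ℚ K (Ψ a b) = 0 := h1
    exact hΨab ((map_eq_zero _).1 h2)
  have hΨ : ∀ h ∈ H, (matQ h)ᵀ * Ψ * matQ h = Ψ := by
    intro h hh
    have h1 : ((matQ h)ᵀ * Ψ * matQ h).map (algebraMap ℚ K) = μ h • ΨK := by
      rw [← hmapK, hc, Matrix.mul_smul, Matrix.smul_mul, hμ h hh, smul_comm]
    have h2 : algebraMap ℚ K (((matQ h)ᵀ * Ψ * matQ h) a b) = μ h * algebraMap ℚ K (Ψ a b) := congrFun (congrFun h1 a) b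
    let r : ℚ := ((matQ h)ᵀ * Ψ * matQ h) a b / Ψ a b
    have hr : algebraMap ℚ K r = μ h := by
      have : algebraMap ℚ K (Ψ a b) ≠ 0 := by rw [Ne, map_eq_zero]; exact hΨab
      rw [map_div₀, h2, mul_div_cancel_right₀ _ this]
    have hrn : r ^ n = 1 := by
      apply (algebraMap ℚ K).injective
      rw [map_pow, hr, hμn h hh, map_one]
    have hr1 : r = 1 := hodd.pow_injective (by simpa using hrn)
    have hm1 : μ h = 1 := by rw [← hr, hr1, map_one]
    rw [hm1, one_smul] at h1
    exact Matrix.map_injective (algebraMap ℚ K).injective h1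
  have hΨu : IsUnit Ψ.det := by
    rw [isUnit_iff_ne_zero]
    intro h0
    have h1 := RingHom.map_det (algebraMap ℚ K) Ψ
    rw [h0, map_zero] at h1
    have h2 : ΨK.det = 0 := h1.symm
    rw [hc, Matrix.det_smul] at h2
    exact mul_ne_zero (pow_ne_zero _ hc0) hBu.ne_zero h2
  have e1 : Ψ * Ψ⁻¹ = 1 := Matrix.mul_nonsing_inv _ hΨu
  have e2 : Ψ⁻¹ * Ψ = 1 := Matrix.nonsing_inv_mul _ hΨu
  refine ⟨Ψ⁻¹, IsUnit.of_mul_eq_one _ e2, fun h hh => ?_⟩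
  have h1 : (matQ h * Ψ⁻¹ * (matQ h)ᵀ) * Ψ = 1 := by
    have h2 := hΨ h hh
    have h3 : Ψ⁻¹ * ((matQ h)ᵀ * Ψ) * matQ h = 1 := by rw [mul_assoc, h2, e2]
    have h4 := mul_eq_one_comm.1 h3
    rw [← h4]; simp only [mul_assoc]
  calc matQ h * Ψ⁻¹ * (matQ h)ᵀ = (matQ h * Ψ⁻¹ * (matQ h)ᵀ * Ψ) * Ψ⁻¹ := by rw [mul_assoc _ Ψ, e1, mul_one]
    _ = Ψ⁻¹ := by rw [h1, one_mul]

theorem traceless_finrank {n : ℕ} (hn : 1 ≤ n) {K : Type*} [Field K] (S : Submodule K (Mt(n) K))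
    (hS : ∀ M : Mt(n) K, M.trace = 0 → M ∈ S) : n ^ 2 - 1 ≤ finrank K S := by
  let t : Mt(n) K →ₗ[K] K := Matrix.traceLinearMap (Fin n) K K
  have h1 : finrank K (LinearMap.ker t) ≤ finrank K S := Submodule.finrank_mono (fun M hM => hS M hM)
  have h2 := LinearMap.finrank_range_add_finrank_ker t
  have h3 : finrank K (LinearMap.range t) ≤ 1 := by
    have := Submodule.finrank_le (LinearMap.range t)
    rwa [Module.finrank_self] at this
  rw [Module.finrank_matrix, Module.finrank_self, Fintype.card_fin, mul_one, ← sq] at h2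
  omega

theorem nil_family {n : ℕ} (hn : n.Prime) (hodd : Odd n) (H : Subgroup (SL n ℤ)) (hirr : IrreducibleQ H)
    (hns : ¬ SolvableByFinite H) (hiso : ¬ IsometryGroupQ H) (K : Type*) [Field K] [CharZero K] [IsAlgClosed K]
    (N : Set (Mt(n) K)) (hnil : ∀ X ∈ N, IsNilpotent X) (hnz : ∃ X ∈ N, X ≠ 0)
    (hconj : ∀ h ∈ H, ∀ X ∈ N, matF K h * X * matF K h⁻¹ ∈ N)
    (hbr : ∀ X ∈ N, ∀ Y ∈ N, X * Y - Y * X ∈ Submodule.span K N) :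
    ∃ X : Fin (n ^ 2 - 1) → Mt(n) K, (∀ i, X i ∈ N) ∧ LinearIndependent K X := by
  classical
  haveI : NeZero n := ⟨hn.ne_zero⟩
  have habs := abs_irr hn H hirr (ns_of hns) K
  have hfr : (finrank K (Fin n → K)).Prime := by rw [Module.finrank_fin_fun]; exact hn
  have hfr2 : finrank K (Fin n → K) ≠ 2 := by
    rw [Module.finrank_fin_fun]; rintro rfl; exact absurd hodd (by decide)
  have hconj' : ∀ h ∈ H, ∀ X ∈ N, ∃ Y ∈ N, X * matF K h = matF K h * Y := by
    intro h hh X hX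
    refine ⟨_, by simpa using hconj h⁻¹ (H.inv_mem hh) X hX, ?_⟩
    rw [← mul_assoc, ← mul_assoc, matF_mul_inv, one_mul]
  -- irreducibility of N
  have hNirr : ∀ Y : Submodule K (Fin n → K), (∀ x ∈ N, ∀ v ∈ Y, x *ᵥ v ∈ Y) → Y = ⊥ ∨ Y = ⊤ := by
    rcases clifford_prime (rhoF K H) (Matrix.toLin' '' N) (by
      rintro g _ ⟨x, hx, rfl⟩
      obtain ⟨y, hy, hxy⟩ := hconj' g.1 g.2 x hx
      refine ⟨_, ⟨y, hy, rfl⟩, ?_⟩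
      have := congrArg Matrix.toLin' hxy
      rw [Matrix.toLin'_mul, Matrix.toLin'_mul] at this
      exact this) (fun Z hZ => habs Z (fun h hh v hv => hZ ⟨h, hh⟩ v hv)) hfr with ⟨v, hv0, hv⟩ | h
    · exfalso
      let Z : Submodule K (Fin n → K) :=
        { carrier := {w | ∀ x ∈ N, x *ᵥ w = 0}
          add_mem' := by
            intro a b ha hb x hx
            rw [Matrix.mulVec_add, ha x hx, hb x hx, add_zero]
          zero_mem' := by intro x hx; simp
          smul_mem' := by
            intro c a ha x hx
            rw [Matrix.mulVec_smul, ha x hx, smul_zero] }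
      have hZv : v ∈ Z := by
        intro x hx
        obtain ⟨c, hc⟩ := hv _ ⟨x, hx, rfl⟩
        have hc' : x *ᵥ v = c • v := hc
        obtain ⟨k, hk⟩ := hnil x hx
        have hpow : ∀ k : ℕ, (x ^ k) *ᵥ v = c ^ k • v := by
          intro k
          induction k with
          | zero => simp
          | succ k ih => rw [pow_succ, ← Matrix.mulVec_mulVec, hc', Matrix.mulVec_smul, ih, smul_smul, pow_succ, mul_comm]
        have h1 := hpow k
        rw [hk, Matrix.zero_mulVec] at h1
        have h2 : c = 0 := by
          rcases smul_eq_zero.1 h1.symm with h | h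
          · exact eq_zero_of_pow_eq_zero h
          · exact absurd h hv0
        rw [hc', h2, zero_smul]
      rcases habs Z (fun h hh w hw x hx => by
        obtain ⟨y, hy, hxy⟩ := hconj' h hh x hx
        rw [Matrix.mulVec_mulVec, hxy, ← Matrix.mulVec_mulVec, hw y hy, Matrix.mulVec_zero]) with h | h
      · rw [h] at hZv; exact hv0 hZv
      · obtain ⟨X, hX, hX0⟩ := hnz
        apply hX0
        apply Matrix.toLin'.injective
        apply LinearMap.ext
        intro w
        have hw : w ∈ Z := by rw [h]; trivial
        rw [Matrix.toLin'_apply, hw X hX, map_zero]; rfl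
    · intro Y hY
      refine h Y ?_
      rintro _ ⟨x, hx, rfl⟩ v hv
      exact hY x hx v hv
  let S := Submodule.span K N
  have hbrS : ∀ X ∈ S, ∀ Y ∈ S, X * Y - Y * X ∈ S := by
    intro X hX Y hY
    induction hX, hY using Submodule.span_induction₂ with
    | mem_mem x y hx hy => exact hbr x hx y hy
    | zero_left y hy => simp
    | zero_right x hx => simp
    | add_left x y z _ _ _ h1 h2 =>
      have : (x + y) * z - z * (x + y) = (x * z - z * x) + (y * z - z * y) := by noncomm_ring
      rw [this]; exact S.add_mem h1 h2
    | add_right x y z _ _ _ h1 h2 =>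
      have : x * (y + z) - (y + z) * x = (x * y - y * x) + (x * z - z * x) := by noncomm_ring
      rw [this]; exact S.add_mem h1 h2
    | smul_left r x y _ _ h =>
      rw [Matrix.smul_mul, Matrix.mul_smul, ← smul_sub]; exact S.smul_mem r h
    | smul_right r x y _ _ h =>
      rw [Matrix.smul_mul, Matrix.mul_smul, ← smul_sub]; exact S.smul_mem r h
  have htrS : ∀ X ∈ S, X.trace = 0 := by
    intro X hX
    induction hX using Submodule.span_induction with
    | mem x hx => exact (Matrix.isNilpotent_trace_of_isNilpotent (hnil x hx)).eq_zero
    | zero => simp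
    | add x y _ _ h1 h2 => rw [Matrix.trace_add, h1, h2, add_zero]
    | smul r x _ h => rw [Matrix.trace_smul, h, smul_zero]
  have hmemS : ∀ M, Matrix.toLin' M ∈ S.map (Matrix.toLin' : Mt(n) K ≃ₗ[K] _).toLinearMap → M ∈ S := by
    rintro M ⟨M', hM', h⟩
    have : M' = M := Matrix.toLin'.injective h
    rw [← this]; exact hM'
  rcases theoremG (K := K) (V := Fin n → K) (S.map (Matrix.toLin' : Mt(n) K ≃ₗ[K] _).toLinearMap)
      (by
        rintro _ ⟨X, hX, rfl⟩ _ ⟨Y, hY, rfl⟩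
        refine ⟨_, hbrS X hX Y hY, ?_⟩
        simp only [LinearEquiv.coe_coe, map_sub, Matrix.toLin'_mul]; rfl)
      (by
        rintro _ ⟨X, hX, rfl⟩
        simp only [LinearEquiv.coe_coe]
        rw [Matrix.trace_toLin'_eq]; exact htrS X hX)
      (fun Y hY => hNirr Y (fun x hx v hv => hY _ ⟨x, Submodule.subset_span hx, rfl⟩ v hv)) hfr hfr2 with hall | ⟨Bf, hBf0, hBf⟩
  · have hge : n ^ 2 - 1 ≤ finrank K S := traceless_finrank hn.one_lt.le S (fun M hM => hmemS M (hall _ (by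
      rw [Matrix.trace_toLin'_eq]; exact hM)))
    obtain ⟨f, hf1, hf2, hf3⟩ := Submodule.exists_fun_fin_finrank_span_eq K N
    exact ⟨fun i => f (Fin.castLE hge i), fun i => hf1 _, hf3.comp _ (Fin.castLE_injective hge)⟩
  · exfalso
    apply hiso
    let B : Mt(n) K := Matrix.of fun i j => Bf (Pi.single i 1) (Pi.single j 1)
    have hBv : ∀ u v, Bf u v = u ⬝ᵥ (B *ᵥ v) := by
      intro u v
      have hB : LinearMap.toMatrix₂' K Bf = B := by
        ext i j
        rw [LinearMap.toMatrix₂'_apply]; rfl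
      rw [← hB, ← Matrix.toLinearMap₂'_apply', Matrix.toLinearMap₂'_toMatrix']
    have hB0 : B ≠ 0 := by
      intro h
      apply hBf0
      apply LinearMap.ext; intro u; apply LinearMap.ext; intro v
      rw [hBv, h]; simp
    have hBX : ∀ X ∈ N, B * X = -Xᵀ * B := by
      intro X hX
      have h1 : ∀ u v, u ⬝ᵥ ((Xᵀ * B + B * X) *ᵥ v) = 0 := by
        intro u v
        have h2 := hBf _ ⟨X, Submodule.subset_span hX, rfl⟩ u v
        simp only [LinearEquiv.coe_coe, Matrix.toLin'_apply] at h2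
        rw [hBv, hBv] at h2
        rw [Matrix.add_mulVec, dotProduct_add, ← Matrix.mulVec_mulVec, ← Matrix.mulVec_mulVec, ← h2]
        congr 1
        rw [Matrix.dotProduct_mulVec, Matrix.vecMul_transpose]
      have h3 : Xᵀ * B + B * X = 0 := by
        ext i j
        have := h1 (Pi.single i 1) (Pi.single j 1)
        simpa using this
      rw [neg_mul]
      exact eq_neg_of_add_eq_zero_right h3
    have hBu := form_unit N hNirr B hB0 (fun x hx => ⟨_, hBX x hx⟩)
    refine descent hn hodd H hirr hns K B hBu (fun h hh => ?_)
    refine form_unique N hNirr B _ hBu (fun x hx => ⟨_, hBX x hx, ?_⟩)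
    have hy := hconj h hh x hx
    set y := matF K h * x * matF K h⁻¹ with hydef
    have e1 : matF K h * x = y * matF K h := by
      rw [hydef, mul_assoc, matF_inv_mul, mul_one]
    calc (matF K h)ᵀ * B * matF K h * x = (matF K h)ᵀ * (B * y) * matF K h := by
          rw [mul_assoc _ _ x, e1]; simp only [mul_assoc]
      _ = -((y * matF K h)ᵀ * B * matF K h) := by
          rw [hBX y hy, Matrix.transpose_mul y (matF K h)]; simp only [mul_assoc, neg_mul, mul_neg]
      _ = _ := by
          rw [← e1, Matrix.transpose_mul (matF K h) x]; simp only [mul_assoc, neg_mul]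

/-- first order term of a polynomial curve in a subspace. -/
theorem curve2 {K : Type*} [Field K] [CharZero K] {V : Type*} [AddCommGroup V] [Module K V] (S : Submodule K V)
    (n : ℕ) (hn : 2 ≤ n) (B : ℕ → ℕ → V) (D : V)
    (h : ∀ t : ℕ, (∑ i ∈ Finset.range n, ∑ j ∈ Finset.range n, (t : K) ^ (i + j) • B i j) + D ∈ S) :
    B 0 1 + B 1 0 ∈ S := by
  by_contra hx
  obtain ⟨f, hf, hfS⟩ := Submodule.exists_le_ker_of_notMem hx
  let P : Polynomial K := (∑ i ∈ Finset.range n, ∑ j ∈ Finset.range n, Polynomial.monomial (i + j) (f (B i j))) + Polynomial.C (f D)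
  have hP : P = 0 := by
    refine Polynomial.eq_of_infinite_eval_eq _ _ (Set.Infinite.mono (s := Set.range (fun t : ℕ => (t : K))) ?_ (Set.infinite_range_of_injective Nat.cast_injective))
    rintro _ ⟨t, rfl⟩
    have h1 : f _ = 0 := hfS (h t)
    rw [map_add, map_sum] at h1
    simp only [map_sum, map_smul, smul_eq_mul] at h1
    simp only [Set.mem_setOf_eq, P, Polynomial.eval_add, Polynomial.eval_finset_sum, Polynomial.eval_monomial, Polynomial.eval_C, Polynomial.eval_zero]
    rw [← h1]
    congr 1
    refine Finset.sum_congr rfl (fun i _ => Finset.sum_congr rfl (fun j _ => mul_comm _ _))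
  apply hf
  have hc : P.coeff 1 = 0 := by rw [hP, Polynomial.coeff_zero]
  obtain ⟨m, rfl⟩ := Nat.exists_eq_add_of_le' hn
  rw [← hc, map_add]
  simp only [P, Polynomial.coeff_add, Polynomial.finset_sum_coeff, Polynomial.coeff_monomial, Polynomial.coeff_C]
  rw [Finset.sum_range_succ', Finset.sum_range_succ']
  have z : ∀ k ∈ Finset.range m, ∑ j ∈ Finset.range (m + 2), (if k + 1 + 1 + j = 1 then f (B (k + 1 + 1) j) else 0) = 0 := by
    intro k _
    apply Finset.sum_eq_zero
    intro j _
    rw [if_neg (by omega)]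
  rw [Finset.sum_eq_zero z]
  rw [Finset.sum_eq_single_of_mem 0 (by simp) (fun j _ hj => if_neg (by omega)),
    Finset.sum_eq_single_of_mem 1 (by simp) (fun j _ hj => if_neg (by omega))]
  simp [add_comm]

section cf
variable {F : Type*} [Field F] {A : Type*} [Ring A] [Algebra F A]

/-- coefficients of the polynomial curve `t ↦ (1 + ν)^t`. -/
noncomputable def cf (F : Type*) [Field F] {A : Type*} [Ring A] [Algebra F A] (n : ℕ) (ν : A) (k : ℕ) : A :=
  ∑ j ∈ Finset.range n, ((descPochhammer F j).coeff k / (j.factorial : F)) • ν ^ j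

theorem cf_pow (n : ℕ) (ν : A) (hν : ν ^ n = 0) (hF : ∀ j < n, (j.factorial : F) ≠ 0) (t : ℕ) :
    (1 + ν) ^ t = ∑ k ∈ Finset.range n, (t : F) ^ k • cf F n ν k := by
  have h1 : (1 + ν) ^ t = ∑ j ∈ Finset.range n, (t.choose j : F) • ν ^ j := by
    have e1 : (1 + ν) ^ t = ∑ j ∈ Finset.range (t + 1), (t.choose j : F) • ν ^ j := by
      rw [add_comm, (Commute.one_right ν).add_pow]
      refine Finset.sum_congr rfl (fun j _ => ?_)
      rw [one_pow, mul_one, Algebra.smul_def, map_natCast, Nat.cast_comm]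
    have e2 : ∑ j ∈ Finset.range (max n (t+1)), (t.choose j : F) • ν ^ j = ∑ j ∈ Finset.range (t + 1), (t.choose j : F) • ν ^ j := by
      symm
      apply Finset.sum_subset
      · intro x hx; rw [Finset.mem_range] at *; omega
      · intro x _ hx
        rw [Finset.mem_range] at hx
        rw [Nat.choose_eq_zero_of_lt (by omega)]; simp
    have e3 : ∑ j ∈ Finset.range (max n (t+1)), (t.choose j : F) • ν ^ j = ∑ j ∈ Finset.range n, (t.choose j : F) • ν ^ j := by
      symm
      apply Finset.sum_subset
      · intro x hx; rw [Finset.mem_range] at *; omega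
      · intro x _ hx
        rw [Finset.mem_range] at hx
        rw [pow_eq_zero_of_le (by omega) hν, smul_zero]
    rw [e1, ← e2, e3]
  rw [h1]
  simp only [cf, Finset.smul_sum]
  rw [Finset.sum_comm]
  refine Finset.sum_congr rfl (fun j hj => ?_)
  have hj' := Finset.mem_range.1 hj
  simp only [smul_smul]
  rw [← Finset.sum_smul]
  congr 1
  have h2 : (descPochhammer F j).eval (t : F) = ((j.factorial * t.choose j : ℕ) : F) := by
    rw [descPochhammer_eval_eq_descFactorial, Nat.descFactorial_eq_factorial_mul_choose]
  rw [Polynomial.eval_eq_sum_range' (n := n) (by rwa [descPochhammer_natDegree])] at h2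
  have h3 : (t.choose j : F) = (∑ i ∈ Finset.range n, (descPochhammer F j).coeff i * (t : F) ^ i) / (j.factorial : F) := by
    rw [h2, Nat.cast_mul, mul_div_cancel_left₀ _ (hF j hj')]
  rw [h3, Finset.sum_div]
  refine Finset.sum_congr rfl (fun i _ => ?_)
  ring

theorem cf_zero (n : ℕ) (hn : 2 ≤ n) (ν : A) : cf F n ν 0 = 1 := by
  rw [cf, Finset.sum_eq_single_of_mem 0 (by simp; omega)]
  · simp
  · intro j _ hj
    rw [Polynomial.coeff_zero_eq_eval_zero, descPochhammer_ne_zero_eval_zero F hj, zero_div, zero_smul]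

theorem cf_one (n : ℕ) (hn : 2 ≤ n) (ν : A) : ∃ w : A, Commute ν w ∧ cf F n ν 1 = ν * (1 + ν * w) := by
  obtain ⟨m, rfl⟩ := Nat.exists_eq_add_of_le' hn
  refine ⟨∑ j ∈ Finset.range m, ((descPochhammer F (j+2)).coeff 1 / ((j+2).factorial : F)) • ν ^ j, ?_, ?_⟩
  · apply Commute.sum_right
    intro j _
    exact ((Commute.refl ν).pow_right j).smul_right _
  · rw [cf, Finset.sum_range_succ', Finset.sum_range_succ', mul_add, Finset.mul_sum, Finset.mul_sum]
    simp only [descPochhammer_zero, zero_add, descPochhammer_one]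
    have e1 : (1 : Polynomial F).coeff 1 = 0 := by simp [Polynomial.coeff_one]
    rw [e1, zero_div, zero_smul, add_zero, Polynomial.coeff_X_one, add_comm, Nat.factorial_one, Nat.cast_one, div_one, one_smul, pow_one, mul_one]
    congr 1
    refine Finset.sum_congr rfl (fun j _ => ?_)
    rw [mul_smul_comm, mul_smul_comm, pow_succ', pow_succ']

theorem cf_one_nil (n : ℕ) (hn : 2 ≤ n) (ν : A) (hν : ν ^ n = 0) : (cf F n ν 1) ^ n = 0 := by
  obtain ⟨w, hw, h⟩ := cf_one (F := F) n hn ν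
  have hc : Commute ν (1 + ν * w) := (Commute.one_right ν).add_right ((Commute.refl ν).mul_right hw)
  rw [h, hc.mul_pow, hν, zero_mul]

theorem cf_one_ne (n : ℕ) (hn : 2 ≤ n) (ν : A) (hν : ν ^ n = 0) (h0 : ν ≠ 0) : cf F n ν 1 ≠ 0 := by
  obtain ⟨w, hw, h⟩ := cf_one (F := F) n hn ν
  have hnil : IsNilpotent (ν * w) := ⟨n, by rw [hw.mul_pow, hν, zero_mul]⟩
  have hu : IsUnit (1 + ν * w) := hnil.isUnit_one_add
  rw [h]
  intro h1
  exact h0 (hu.mul_left_eq_zero.1 h1)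

theorem cf_conj (n : ℕ) (ν u v : A) (huv : v * u = 1) (huv' : u * v = 1) (k : ℕ) : cf F n (u * ν * v) k = u * cf F n ν k * v := by
  rw [cf, cf, Finset.mul_sum, Finset.sum_mul]
  refine Finset.sum_congr rfl (fun j _ => ?_)
  rw [mul_smul_comm, smul_mul_assoc]
  congr 1
  clear * - huv huv'
  induction j with
  | zero => simp [huv']
  | succ j ih =>
    rw [pow_succ, ih, pow_succ]
    calc u * ν ^ j * v * (u * ν * v) = u * ν ^ j * (v * u) * ν * v := by simp only [mul_assoc]
      _ = _ := by rw [huv, mul_one]; simp only [mul_assoc]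

end cf

theorem exists_ultra {α : Type} (q : α → ℕ) [hqp : ∀ a, Fact (q a).Prime] (U : Ultrafilter α)
    (hq : ∀ N, ∀ᶠ a in (U : Filter α), N < q a) :
    ∃ (K : Type) (_ : Field K) (_ : CharZero K) (_ : IsAlgClosed K) (π : (∀ a, ZMod (q a)) →+* K),
      ∀ x, π x = 0 ↔ ∀ᶠ a in (U : Filter α), x a = 0 := by
  classical
  let m : Ideal (∀ a, ZMod (q a)) :=
    { carrier := {x | ∀ᶠ a in (U : Filter α), x a = 0}
      add_mem' := by
        intro x y hx hy
        filter_upwards [hx, hy] with a h1 h2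
        rw [Pi.add_apply, h1, h2, add_zero]
      zero_mem' := Filter.Eventually.of_forall (fun a => rfl)
      smul_mem' := by
        intro c x hx
        filter_upwards [hx] with a h1
        rw [smul_eq_mul, Pi.mul_apply, h1, mul_zero] }
  have hmem : ∀ x, x ∈ m ↔ ∀ᶠ a in (U : Filter α), x a = 0 := fun x => Iff.rfl
  haveI hmax : m.IsMaximal := by
    rw [Ideal.isMaximal_iff]
    constructor
    · rw [hmem]
      intro h
      obtain ⟨a, ha⟩ := h.exists
      exact one_ne_zero ha
    · intro J x hJ hx hxJ
      rw [hmem] at hx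
      have hx' : ∀ᶠ a in (U : Filter α), ¬ x a = 0 := Ultrafilter.eventually_not.2 hx
      let y : ∀ a, ZMod (q a) := fun a => (x a)⁻¹
      have h1 : y * x - 1 ∈ m := by
        rw [hmem]
        filter_upwards [hx'] with a ha
        change (x a)⁻¹ * x a - 1 = 0
        rw [inv_mul_cancel₀ ha, sub_self]
      have h2 := J.sub_mem (J.mul_mem_left y hxJ) (hJ h1)
      rwa [sub_sub_cancel] at h2
  letI : Field ((∀ a, ZMod (q a)) ⧸ m) := Ideal.Quotient.field m
  let K := AlgebraicClosure ((∀ a, ZMod (q a)) ⧸ m)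
  let π : (∀ a, ZMod (q a)) →+* K := (algebraMap ((∀ a, ZMod (q a)) ⧸ m) K).comp (Ideal.Quotient.mk m)
  have hπ : ∀ x, π x = 0 ↔ ∀ᶠ a in (U : Filter α), x a = 0 := by
    intro x
    change algebraMap ((∀ a, ZMod (q a)) ⧸ m) K (Ideal.Quotient.mk m x) = 0 ↔ _
    rw [map_eq_zero, Ideal.Quotient.eq_zero_iff_mem, hmem]
  have hK0 : CharZero K := by
    apply charZero_of_inj_zero
    intro k hk
    have h1 : π (k : ∀ a, ZMod (q a)) = 0 := by rw [map_natCast]; exact hk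
    rw [hπ] at h1
    obtain ⟨a, ha, hka⟩ := (h1.and (hq k)).exists
    have h2 : ((k : ℕ) : ZMod (q a)) = 0 := ha
    rw [ZMod.natCast_eq_zero_iff] at h2
    by_contra h0
    exact absurd (Nat.le_of_dvd (Nat.pos_of_ne_zero h0) h2) (by omega)
  exact ⟨K, inferInstance, hK0, inferInstance, π, hπ⟩

theorem exists_ultra_mat {α : Type} (n : ℕ) (q : α → ℕ) [hqp : ∀ a, Fact (q a).Prime] (U : Ultrafilter α)
    (hq : ∀ N, ∀ᶠ a in (U : Filter α), N < q a) :
    ∃ (K : Type) (_ : Field K) (_ : CharZero K) (_ : IsAlgClosed K) (π : (∀ a, ZMod (q a)) →+* K)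
      (Λ : (∀ a, Mt(n) (ZMod (q a))) →+* Mt(n) K),
      (∀ x, π x = 0 ↔ ∀ᶠ a in (U : Filter α), x a = 0) ∧
      (∀ M, Λ M = 0 ↔ ∀ᶠ a in (U : Filter α), M a = 0) ∧
      (∀ (c : ∀ a, ZMod (q a)) M, Λ (fun a => c a • M a) = π c • Λ M) ∧
      (∀ h : SL n ℤ, Λ (fun a => matF (ZMod (q a)) h) = matF K h) := by
  classical
  obtain ⟨K, i1, i2, i3, π, hπ⟩ := exists_ultra q U hq
  let Λ : (∀ a, Mt(n) (ZMod (q a))) →+* Mt(n) K :=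
    { toFun := fun M => Matrix.of fun i j => π (fun a => M a i j)
      map_one' := by
        ext i j
        rw [Matrix.of_apply]
        by_cases h : i = j
        · subst h
          rw [Matrix.one_apply_eq, ← map_one π]
          congr 1; ext a; exact Matrix.one_apply_eq i
        · rw [Matrix.one_apply_ne h, ← map_zero π]
          congr 1; ext a; exact Matrix.one_apply_ne h
      map_zero' := by
        ext i j
        rw [Matrix.of_apply, Matrix.zero_apply, ← map_zero π]; rfl
      map_add' := by
        intro M N
        ext i j
        rw [Matrix.add_apply, Matrix.of_apply, Matrix.of_apply, Matrix.of_apply, ← map_add]; rfl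
      map_mul' := by
        intro M N
        ext i j
        rw [Matrix.mul_apply, Matrix.of_apply]
        simp only [Matrix.of_apply, ← map_mul, ← map_sum]
        congr 1
        ext a
        rw [Finset.sum_apply]
        exact Matrix.mul_apply }
  have hΛ : ∀ M i j, Λ M i j = π (fun a => M a i j) := fun M i j => rfl
  refine ⟨K, i1, i2, i3, π, Λ, hπ, ?_, ?_, ?_⟩
  · intro M
    constructor
    · intro h
      have h1 : ∀ i j, ∀ᶠ a in (U : Filter α), M a i j = 0 := by
        intro i j
        rw [← hπ (fun a => M a i j), ← hΛ, h]; rfl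
      have h2 : ∀ᶠ a in (U : Filter α), ∀ i j, M a i j = 0 :=
        Filter.eventually_all.2 (fun i => Filter.eventually_all.2 (fun j => h1 i j))
      filter_upwards [h2] with a ha
      ext i j; exact ha i j
    · intro h
      ext i j
      rw [hΛ, Matrix.zero_apply, hπ]
      filter_upwards [h] with a ha
      rw [ha]; rfl
  · intro c M
    ext i j
    rw [Matrix.smul_apply, hΛ, hΛ, smul_eq_mul, ← map_mul]; rfl
  · intro h
    ext i j
    rw [hΛ]
    have : (fun a => matF (ZMod (q a)) h i j) = ((((h : Mt(n) ℤ) i j : ℤ)) : ∀ a, ZMod (q a)) := by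
      ext a; rfl
    rw [this, map_intCast]; rfl

theorem matrix_nil_pow {n : ℕ} {F : Type*} [Field F] (M : Mt(n) F) (h : IsNilpotent M) : M ^ n = 0 := by
  have h1 := (Matrix.isNilpotent_charpoly_sub_pow_of_isNilpotent h).eq_zero
  have h2 := Matrix.aeval_self_charpoly M
  rw [sub_eq_zero.1 h1, map_pow, Polynomial.aeval_X, Fintype.card_fin] at h2
  exact h2

theorem exists_unip {n p : ℕ} [Fact p.Prime] (G : Subgroup (SL n (ZMod p))) (h : p ∣ Nat.card G) :
    ∃ g ∈ G, (g.1 - 1) ^ n = 0 ∧ g.1 - 1 ≠ 0 := by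
  obtain ⟨x, hx⟩ := exists_prime_orderOf_dvd_card' p h
  have hxp : (x.1 : Mt(n) (ZMod p)) ^ p = 1 := by
    have h1 : x.1 ^ p = 1 := by
      have : x ^ p = 1 := orderOf_dvd_iff_pow_eq_one.1 (dvd_of_eq hx)
      exact congrArg Subtype.val this
    rw [← Matrix.SpecialLinearGroup.coe_pow, h1, Matrix.SpecialLinearGroup.coe_one]
  refine ⟨x.1, x.2, ?_, ?_⟩
  · by_cases hn0 : n = 0
    · subst hn0; exact Subsingleton.elim _ _
    haveI : NeZero n := ⟨hn0⟩
    apply matrix_nil_pow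
    refine ⟨p, ?_⟩
    haveI : CharP (Mt(n) (ZMod p)) p := inferInstance
    rw [sub_pow_char_of_commute p (Commute.one_right _), hxp, one_pow, sub_self]
  · intro h0
    have h1 : x = 1 := Subtype.ext (Subtype.ext (sub_eq_zero.1 h0))
    rw [h1, orderOf_one] at hx
    exact (Fact.out : p.Prime).one_lt.ne hx

section
variable {n p : ℕ}

theorem coe_inv_mul (g : SL n (ZMod p)) : (g⁻¹).1 * g = 1 := by
  rw [← Matrix.SpecialLinearGroup.coe_mul, inv_mul_cancel, Matrix.SpecialLinearGroup.coe_one]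

theorem coe_mul_inv (g : SL n (ZMod p)) : g.1 * (g⁻¹ : SL n (ZMod p)) = 1 := by
  rw [← Matrix.SpecialLinearGroup.coe_mul, mul_inv_cancel, Matrix.SpecialLinearGroup.coe_one]

theorem conj_sub_one (k g : SL n (ZMod p)) : ((k * g * k⁻¹ : SL n (ZMod p)) : Mt(n) (ZMod p)) - 1 =
    k.1 * (g.1 - 1) * (k⁻¹ : SL n (ZMod p)) := by
  rw [mul_sub, mul_one, sub_mul, coe_mul_inv, Matrix.SpecialLinearGroup.coe_mul, Matrix.SpecialLinearGroup.coe_mul]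

theorem inv_unip (g : SL n (ZMod p)) (h : (g.1 - 1) ^ n = 0) :
    ((g⁻¹).1 - 1) ^ n = 0 := by
  have h1 : (g⁻¹).1 - 1 =
      (g.1 - 1) * (-(g⁻¹ : SL n (ZMod p))) := by
    rw [sub_mul, mul_neg, coe_mul_inv, one_mul]; abel
  have hc : Commute (g.1 - 1) (-(g⁻¹ : SL n (ZMod p))) := by
    refine Commute.neg_right (Commute.sub_left ?_ (Commute.one_left _))
    exact (coe_mul_inv g).trans (coe_inv_mul g).symm
  rw [h1, hc.mul_pow, h, zero_mul]

theorem conj_unip (k g : SL n (ZMod p)) (h : (g.1 - 1) ^ n = 0) :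
    (((k * g * k⁻¹ : SL n (ZMod p)) : Mt(n) (ZMod p)) - 1) ^ n = 0 := by
  rw [conj_sub_one]
  have h1 : ∀ j : ℕ, (k.1 * (g.1 - 1) * (k⁻¹ : SL n (ZMod p))) ^ j =
      k.1 * (g.1 - 1) ^ j * (k⁻¹ : SL n (ZMod p)) := by
    intro j
    induction j with
    | zero => rw [pow_zero, pow_zero, mul_one, coe_mul_inv]
    | succ j ih =>
      rw [pow_succ, ih, pow_succ]
      generalize (g.1 - 1) = z
      calc _ = k.1 * z ^ j * ((k⁻¹).1 * k) * z * (k⁻¹ : SL n (ZMod p)) := by simp only [mul_assoc]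
        _ = _ := by rw [coe_inv_mul, mul_one]; simp only [mul_assoc]
  rw [h1, h, mul_zero, zero_mul]

theorem unip_pow [Fact p.Prime] (hnp : n < p) (g : SL n (ZMod p)) (h : (g.1 - 1) ^ n = 0) (t : ℕ) :
    ((g ^ t : SL n (ZMod p)) : Mt(n) (ZMod p)) =
      ∑ k ∈ Finset.range n, (t : ZMod p) ^ k • cf (ZMod p) n (g.1 - 1) k := by
  rw [← cf_pow n _ h, add_sub_cancel, Matrix.SpecialLinearGroup.coe_pow]
  intro j hj h0
  rw [ZMod.natCast_eq_zero_iff, (Fact.out : p.Prime).dvd_factorial] at h0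
  omega

end

theorem ultra_main {n : ℕ} (hn : n.Prime) (hodd : Odd n) (H : Subgroup (SL n ℤ)) (hirr : IrreducibleQ H)
    (hns : ¬ SolvableByFinite H) (hiso : ¬ IsometryGroupQ H) {α : Type} [Nonempty α] (q : α → ℕ) [hqp : ∀ a, Fact (q a).Prime]
    (U : Ultrafilter α) (hq : ∀ N, ∀ᶠ a in (U : Filter α), N < q a) (hnq : ∀ a, n < q a)
    (hdiv : ∀ a, q a ∣ Nat.card (H.map (redMod n (q a)))) :
    ∃ a, ∃ g : Fin (n ^ 2 - 1) → SL n (ZMod (q a)), (∀ i, g i ∈ H.map (redMod n (q a))) ∧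
      (∀ i, ((g i : Mt(n) (ZMod (q a))) - 1) ^ n = 0) ∧
      LinearIndependent (ZMod (q a)) (fun i => cf (ZMod (q a)) n ((g i : Mt(n) (ZMod (q a))) - 1) 1) := by
  classical
  obtain ⟨K, i1, i2, i3, π, Λ, hπ, hΛ0, hΛs, hΛh⟩ := exists_ultra_mat n q U hq
  have hn2 : 2 ≤ n := hn.two_le
  let G : ∀ a, Subgroup (SL n (ZMod (q a))) := fun a => H.map (redMod n (q a))
  let E : (∀ a, SL n (ZMod (q a))) → ℕ → Mt(n) K := fun g k =>
    Λ (fun a => cf (ZMod (q a)) n ((g a : Mt(n) (ZMod (q a))) - 1) k)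
  let good : (∀ a, SL n (ZMod (q a))) → Prop := fun g =>
    ∀ a, g a ∈ G a ∧ ((g a : Mt(n) (ZMod (q a))) - 1) ^ n = 0
  let L : (∀ a, SL n (ZMod (q a))) → Mt(n) K := fun g => Λ (fun a => (g a : Mt(n) (ZMod (q a))))
  let N : Set (Mt(n) K) := {X | ∃ g, good g ∧ X = E g 1}
  have hLmul : ∀ g g', L (g * g') = L g * L g' := by
    intro g g'
    change Λ _ = Λ _ * Λ _
    rw [← map_mul]
    congr 1
  have hL1 : L 1 = 1 := by
    change Λ _ = 1
    exact map_one Λ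
  have hE0 : ∀ g, E g 0 = 1 := by
    intro g
    rw [← map_one Λ]
    change Λ _ = Λ _
    congr 1
    ext1 a
    exact cf_zero n hn2 _
  have hLpow : ∀ g, good g → ∀ t : ℕ, L (g ^ t) = ∑ k ∈ Finset.range n, (t : K) ^ k • E g k := by
    intro g hg t
    have h1 : (fun a => ((g ^ t) a : Mt(n) (ZMod (q a)))) =
        ∑ k ∈ Finset.range n, (fun a => ((t : ∀ a, ZMod (q a)) ^ k) a • cf (ZMod (q a)) n ((g a : Mt(n) (ZMod (q a))) - 1) k) := by
      ext1 a
      rw [Finset.sum_apply]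
      exact unip_pow (hnq a) (g a) (hg a).2 t
    change Λ (fun a => ((g ^ t) a : Mt(n) (ZMod (q a)))) = _
    rw [h1, map_sum]
    refine Finset.sum_congr rfl (fun k _ => ?_)
    rw [hΛs, map_pow, map_natCast]
  have hconjG : ∀ k : ∀ a, SL n (ZMod (q a)), (∀ a, k a ∈ G a) → ∀ X ∈ N, L k * X * L k⁻¹ ∈ N := by
    rintro k hk _ ⟨g, hg, rfl⟩
    refine ⟨k * g * k⁻¹, fun a => ⟨(G a).mul_mem ((G a).mul_mem (hk a) (hg a).1) ((G a).inv_mem (hk a)), conj_unip (k a) (g a) (hg a).2⟩, ?_⟩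
    change Λ _ * Λ _ * Λ _ = Λ _
    rw [← map_mul, ← map_mul]
    congr 1
    ext1 a
    change _ = cf (ZMod (q a)) n (((k a * g a * (k a)⁻¹ : SL n (ZMod (q a))) : Mt(n) (ZMod (q a))) - 1) 1
    rw [conj_sub_one, cf_conj n _ _ _ (coe_inv_mul (k a)) (coe_mul_inv (k a))]
    rfl
  have hLh : ∀ h : SL n ℤ, L (fun a => redMod n (q a) h) = matF K h := by
    intro h
    rw [← hΛh]; rfl
  obtain ⟨X, hXN, hXli⟩ := nil_family hn hodd H hirr hns hiso K N
    (by
      rintro _ ⟨g, hg, rfl⟩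
      refine ⟨n, ?_⟩
      change (Λ _) ^ n = 0
      rw [← map_pow, ← map_zero Λ]
      congr 1
      ext1 a
      exact cf_one_nil n hn2 _ (hg a).2)
    (by
      choose g hg1 hg2 hg3 using fun a => exists_unip (G a) (hdiv a)
      refine ⟨E g 1, ⟨g, fun a => ⟨hg1 a, hg2 a⟩, rfl⟩, ?_⟩
      intro h0
      have h1 := (hΛ0 _).1 h0
      obtain ⟨a, ha⟩ := h1.exists
      exact cf_one_ne n hn2 _ (hg2 a) (hg3 a) ha)
    (by
      intro h hh X hX
      have h1 := hconjG (fun a => redMod n (q a) h) (fun a => Subgroup.mem_map_of_mem _ hh) X hX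
      have h2 : (fun a => redMod n (q a) h)⁻¹ = (fun a => redMod n (q a) h⁻¹) := by
        ext1 a
        exact (map_inv _ _).symm
      rwa [h2, hLh, hLh] at h1)
    (by
      rintro _ ⟨g, hg, rfl⟩ Y hY
      have hgi : good g⁻¹ := fun a => ⟨(G a).inv_mem (hg a).1, inv_unip (g a) (hg a).2⟩
      have hneg : E g⁻¹ 1 + E g 1 = 0 := by
        have h1 := curve2 (K := K) (⊥ : Submodule K (Mt(n) K)) n hn2 (fun i j => E g i * E g⁻¹ j) (-1) (fun t => by
          rw [Submodule.mem_bot, ← sub_eq_add_neg, sub_eq_zero]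
          have h2 : L (g ^ t) * L (g⁻¹ ^ t) = 1 := by
            rw [← hLmul, inv_pow, mul_inv_cancel, hL1]
          rw [hLpow g hg, hLpow _ hgi, Finset.sum_mul_sum] at h2
          rw [← h2]
          refine Finset.sum_congr rfl (fun i _ => Finset.sum_congr rfl (fun j _ => ?_))
          rw [smul_mul_smul_comm, pow_add])
        rw [Submodule.mem_bot] at h1
        simpa only [hE0, one_mul, mul_one] using h1
      have h3 := curve2 (K := K) (Submodule.span K N) n hn2 (fun i j => E g i * Y * E g⁻¹ j) 0 (fun t => by
        have h2 := Submodule.subset_span (R := K) (hconjG (g ^ t) (fun a => (G a).pow_mem (hg a).1 t) Y hY)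
        rw [← inv_pow, hLpow g hg, hLpow _ hgi, Finset.sum_mul, Finset.sum_mul_sum] at h2
        rw [add_zero]
        rw [SetLike.mem_coe] at h2
        refine (congrArg (fun z => z ∈ Submodule.span K N) ?_).mpr h2
        refine Finset.sum_congr rfl (fun i _ => Finset.sum_congr rfl (fun j _ => ?_))
        rw [smul_mul_assoc, smul_mul_smul_comm, pow_add])
      simp only [hE0, one_mul, mul_one] at h3
      rw [eq_neg_of_add_eq_zero_left hneg] at h3
      convert h3 using 1
      rw [mul_neg]; abel)
  choose g hg hXg using hXN
  by_contra hcon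
  push Not at hcon
  have hdep : ∀ a, ∃ c : Fin (n ^ 2 - 1) → ZMod (q a),
      ∑ i, c i • cf (ZMod (q a)) n ((g i a : Mt(n) (ZMod (q a))) - 1) 1 = 0 ∧ ∃ i, c i ≠ 0 := by
    intro a
    exact Fintype.not_linearIndependent_iff.1 (hcon a (fun i => g i a) (fun i => (hg i a).1) (fun i => (hg i a).2))
  choose c hc1 hc2 using hdep
  have hsum : ∑ i, π (fun a => c a i) • X i = 0 := by
    have h1 : ∀ i, π (fun a => c a i) • X i = Λ (fun a => c a i • cf (ZMod (q a)) n ((g i a : Mt(n) (ZMod (q a))) - 1) 1) := by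
      intro i
      rw [hΛs (fun a => c a i), hXg i]
    simp only [h1]
    rw [← map_sum, ← map_zero Λ]
    congr 1
    ext1 a
    rw [Finset.sum_apply]
    exact hc1 a
  have hz := Fintype.linearIndependent_iff.1 hXli _ hsum
  have hev : ∀ᶠ a in (U : Filter α), ∀ i, c a i = 0 :=
    Filter.eventually_all.2 (fun i => (hπ _).1 (hz i))
  obtain ⟨a, ha⟩ := hev.exists
  obtain ⟨i, hi⟩ := hc2 a
  exact hi (ha i)

theorem d_imp_b {n : ℕ} (hn : n.Prime) (hodd : Odd n) (H : Subgroup (SL n ℤ)) (hfg : H.FG) (hirr : IrreducibleQ H)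
    (hns : ¬ SolvableByFinite H) (hiso : ¬ IsometryGroupQ H) :
    {p : ℕ | p.Prime ∧ H.map (redMod n p) ≠ ⊤}.Finite := by
  classical
  by_contra hinf
  obtain ⟨p0, hp0⟩ := PN.nori n hn.two_le
  let B : Set ℕ := {p : ℕ | p.Prime ∧ H.map (redMod n p) ≠ ⊤}
  have hB1 : {p ∈ B | ¬ p ∣ Nat.card (H.map (redMod n p))}.Finite := by
    by_contra h
    exact hns (PJ.solv_of_coprime H hfg _ h (fun p hp => hp.1.1) (fun p hp => hp.2))
  let P : Set ℕ := (B \ {p ∈ B | ¬ p ∣ Nat.card (H.map (redMod n p))}) \ Set.Iic (max n p0)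
  have hP : P.Infinite := (Set.Infinite.diff hinf hB1).diff (Set.finite_Iic _)
  haveI : Infinite P := hP.to_subtype
  haveI : ∀ a : P, Fact (a.1).Prime := fun a => ⟨a.2.1.1.1⟩
  have hbig : ∀ a : P, n < a.1 ∧ p0 ≤ a.1 := by
    intro a
    have h : ¬ a.1 ≤ max n p0 := a.2.2
    rw [not_le, max_lt_iff] at h
    exact ⟨h.1, h.2.le⟩
  have hdiv : ∀ a : P, a.1 ∣ Nat.card (H.map (redMod n a.1)) := by
    intro a
    by_contra h
    exact a.2.1.2 ⟨a.2.1.1, h⟩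
  obtain ⟨a, g, hg1, hg2, hg3⟩ := ultra_main hn hodd H hirr hns hiso (fun a : P => a.1) (Filter.hyperfilter P) (by
      intro k
      have hfin : {a : P | ¬ k < a.1}.Finite := by
        apply Set.Finite.of_finite_image _ Subtype.val_injective.injOn
        refine (Set.finite_Iic k).subset ?_
        rintro _ ⟨a, ha, rfl⟩
        exact not_lt.1 ha
      exact Filter.hyperfilter_le_cofinite hfin) (fun a => (hbig a).1) hdiv
  refine a.2.1.1.2 (hp0 a.1 (hbig a).2 _ (fun i k => cf (ZMod a.1) n ((g i : Mt(n) (ZMod a.1)) - 1) k)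
    (fun i => cf_zero n hn.two_le _) hg3 (fun i t => ⟨g i ^ t.val, Subgroup.pow_mem _ (hg1 i) _, ?_⟩))
  rw [unip_pow (hbig a).1 (g i) (hg2 i), ZMod.natCast_zmod_val]

end PU

end

/-- For odd prime `n` and finitely generated `H ≤ SL(n,ℤ)`, the following
are equivalent: (a) `φ_p(H) = SL(n,ℤ/pℤ)` for some prime `p`; (b) `φ_p(H) = SL(n,ℤ/pℤ)`
for all but finitely many primes `p`; (c) `H` is infinite, non-solvable, primitive, and
not an isometry group; (d) `H` is irreducible, not solvable-by-finite, and not an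
isometry group. -/
theorem density_characterizations (n : ℕ) (hn : n.Prime) (hodd : Odd n)
    (H : Subgroup (SL n ℤ)) (hFG : H.FG) :
    ((∃ p : ℕ, p.Prime ∧ H.map (redMod n p) = ⊤) ↔
        {p : ℕ | p.Prime ∧ H.map (redMod n p) ≠ ⊤}.Finite) ∧
    ({p : ℕ | p.Prime ∧ H.map (redMod n p) ≠ ⊤}.Finite ↔
        (Infinite H ∧ ¬ IsSolvable H ∧ PrimitiveQ H ∧ ¬ IsometryGroupQ H)) ∧
    ((Infinite H ∧ ¬ IsSolvable H ∧ PrimitiveQ H ∧ ¬ IsometryGroupQ H) ↔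
        (IrreducibleQ H ∧ ¬ SolvableByFinite H ∧ ¬ IsometryGroupQ H)) := by
  have hdc := d_iff_c hn hodd H
  have had : (∃ p : ℕ, p.Prime ∧ H.map (redMod n p) = ⊤) →
      (IrreducibleQ H ∧ ¬ SolvableByFinite H ∧ ¬ IsometryGroupQ H) := by
    rintro ⟨p, hp, h⟩
    exact a_imp_d hn hodd hp H h
  have hdb : (IrreducibleQ H ∧ ¬ SolvableByFinite H ∧ ¬ IsometryGroupQ H) →
      {p : ℕ | p.Prime ∧ H.map (redMod n p) ≠ ⊤}.Finite := by
    rintro ⟨h1, h2, h3⟩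
    exact PU.d_imp_b hn hodd H hFG h1 h2 h3
  have hba : {p : ℕ | p.Prime ∧ H.map (redMod n p) ≠ ⊤}.Finite →
      ∃ p : ℕ, p.Prime ∧ H.map (redMod n p) = ⊤ := by
    intro hfin
    obtain ⟨p, hp, hpn⟩ := (Nat.infinite_setOf_prime.diff hfin).nonempty
    refine ⟨p, hp, ?_⟩
    by_contra h
    exact hpn ⟨hp, h⟩
  exact ⟨⟨fun h => hdb (had h), hba⟩, ⟨fun h => hdc.2 (had (hba h)), fun h => hdb (hdc.1 h)⟩, hdc⟩
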